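/- For every real number n ≥ 106 and every real number x ≥ 1, the interval [x, x + x^(1 - 1/n)] contains at least one prime. In particular, taking n = 250 and n = 33000 makes the Heilbronn and Hoheisel short-interval results fully effective for all x ≥ 1. -/

import Mathlib

section
open Complex Filter Topology Set

/-- The error made on `[n, n + 1]` when comparing `∑ n^{-s}` with `∫ t^{-s}`, times `s - 1`. -/
noncomputable def zetaGap (n : ℕ) (s : ℂ) : ℂ :=
  (s - 1) * ((n : ℂ) + 1) ^ (-s) + (((n : ℂ) + 1) ^ (1 - s) - (n : ℂ) ^ (1 - s))

lemma norm_natCast_cpow_sub_le {n : ℕ} (hn : 1 ≤ n) {s : ℂ} (hs : 0 < s.re) {t : ℝ}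
    (ht : t ∈ Icc (n : ℝ) (n + 1)) :
    ‖(t : ℂ) ^ (-s) - ((n : ℂ) + 1) ^ (-s)‖ ≤ ‖s‖ * (n : ℝ) ^ (-s.re - 1) := by
  have hn0 : (0 : ℝ) < n := by exact_mod_cast hn
  have hd : ∀ u ∈ Icc (n : ℝ) (n + 1), HasDerivWithinAt (fun u : ℝ => (u : ℂ) ^ (-s))
      ((-s) * (u : ℂ) ^ (-s - 1)) (Icc (n : ℝ) (n + 1)) u := by
    intro u hu
    have hu0 : (0 : ℝ) < u := lt_of_lt_of_le hn0 hu.1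
    have := (hasDerivAt_id (u : ℂ)).cpow_const (c := -s) (Or.inl (by simpa using hu0))
    simpa using (this.comp_ofReal).hasDerivWithinAt
  have hb : ∀ u ∈ Icc (n : ℝ) (n + 1), ‖(-s) * (u : ℂ) ^ (-s - 1)‖ ≤
      ‖s‖ * (n : ℝ) ^ (-s.re - 1) := by
    intro u hu
    have hu0 : (0 : ℝ) < u := lt_of_lt_of_le hn0 hu.1
    rw [norm_mul, norm_neg, norm_cpow_eq_rpow_re_of_pos hu0]
    gcongr
    simp only [sub_re, neg_re, one_re]
    exact Real.rpow_le_rpow_of_nonpos hn0 hu.1 (by linarith)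
  have := (convex_Icc (n : ℝ) (n + 1)).norm_image_sub_le_of_norm_hasDerivWithin_le hd hb
    (right_mem_Icc.2 (by linarith)) ht
  have h1 : ‖t - (n + 1)‖ ≤ 1 := by
    rw [Real.norm_eq_abs, abs_le]; constructor <;> linarith [ht.1, ht.2]
  calc _ ≤ _ := by simpa using this
    _ ≤ ‖s‖ * (n : ℝ) ^ (-s.re - 1) * 1 := by gcongr; simpa using h1
    _ = _ := mul_one _

lemma norm_zetaGap_le {n : ℕ} (hn : 1 ≤ n) {s : ℂ} (hs : 0 < s.re) :
    ‖zetaGap n s‖ ≤ ‖s - 1‖ * ‖s‖ * (n : ℝ) ^ (-s.re - 1) := by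
  have hn0 : (0 : ℝ) < n := by exact_mod_cast hn
  have hd : ∀ u ∈ Icc (n : ℝ) (n + 1), HasDerivWithinAt
      (fun u : ℝ => (s - 1) * u * ((n : ℂ) + 1) ^ (-s) + (u : ℂ) ^ (1 - s))
      ((1 - s) * ((u : ℂ) ^ (-s) - ((n : ℂ) + 1) ^ (-s))) (Icc (n : ℝ) (n + 1)) u := by
    intro u hu
    have hu0 : (0 : ℝ) < u := lt_of_lt_of_le hn0 hu.1
    have h1 := (hasDerivAt_id (u : ℂ)).cpow_const (c := 1 - s) (Or.inl (by simpa using hu0))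
    have h2 := ((hasDerivAt_id (u : ℂ)).const_mul (s - 1)).mul_const (((n : ℂ) + 1) ^ (-s))
    have h3 := (h2.add h1).comp_ofReal
    have e : (s - 1) * 1 * ((n : ℂ) + 1) ^ (-s) + (1 - s) * id (u : ℂ) ^ (1 - s - 1) * 1 =
        (1 - s) * ((u : ℂ) ^ (-s) - ((n : ℂ) + 1) ^ (-s)) := by
      rw [show (1 - s - 1 : ℂ) = -s by ring]; simp only [id]; ring
    rw [e] at h3
    exact h3.hasDerivWithinAt
  have hb : ∀ u ∈ Icc (n : ℝ) (n + 1),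
      ‖(1 - s) * ((u : ℂ) ^ (-s) - ((n : ℂ) + 1) ^ (-s))‖ ≤
      ‖s - 1‖ * ‖s‖ * (n : ℝ) ^ (-s.re - 1) := by
    intro u hu
    rw [norm_mul, norm_sub_rev, mul_assoc]
    gcongr
    exact norm_natCast_cpow_sub_le hn hs hu
  have := (convex_Icc (n : ℝ) (n + 1)).norm_image_sub_le_of_norm_hasDerivWithin_le hd hb
    (left_mem_Icc.2 (by linarith)) (right_mem_Icc.2 (by linarith))
  have h1 : ‖(n : ℝ) + 1 - n‖ = 1 := by simp
  rw [h1, mul_one] at this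
  refine le_trans (le_of_eq ?_) this
  rw [zetaGap]; congr 1; push_cast; ring

lemma rpow_neg_sub_one_le {n : ℕ} (hn : 1 ≤ n) {σ : ℝ} (hσ : 0 < σ) :
    ((n : ℝ) + 1) ^ (-σ - 1) ≤ ((n : ℝ) ^ (-σ) - ((n : ℝ) + 1) ^ (-σ)) / σ := by
  have hn0 : (0 : ℝ) < n := by exact_mod_cast hn
  rw [le_div_iff₀ hσ]
  have hd : ∀ u ∈ interior (Icc (n : ℝ) (n + 1)), deriv (fun u : ℝ => -u ^ (-σ)) u ≥
      ((n : ℝ) + 1) ^ (-σ - 1) * σ := by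
    intro u hu
    rw [interior_Icc] at hu
    have hu0 : (0 : ℝ) < u := lt_trans hn0 hu.1
    have h := ((Real.hasDerivAt_rpow_const (p := -σ) (Or.inl hu0.ne')).neg).deriv
    have h' : deriv (fun u : ℝ => -u ^ (-σ)) u = -(-σ * u ^ (-σ - 1)) := h
    rw [h']
    have := Real.rpow_le_rpow_of_nonpos hu0 hu.2.le (by linarith : -σ - 1 ≤ 0)
    nlinarith
  have hcont : ContinuousOn (fun u : ℝ => -u ^ (-σ)) (Icc (n : ℝ) (n + 1)) := by
    apply ContinuousOn.neg
    exact continuousOn_id.rpow_const (fun x hx => Or.inl (lt_of_lt_of_le hn0 hx.1).ne')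
  have hdiff : DifferentiableOn ℝ (fun u : ℝ => -u ^ (-σ)) (interior (Icc (n : ℝ) (n + 1))) := by
    intro u hu
    rw [interior_Icc] at hu
    have hu0 : (0 : ℝ) < u := lt_trans hn0 hu.1
    exact ((Real.hasDerivAt_rpow_const (p := -σ)
      (Or.inl hu0.ne')).neg).differentiableAt.differentiableWithinAt
  have := (convex_Icc (n : ℝ) (n + 1)).mul_sub_le_image_sub_of_le_deriv hcont hdiff hd
    n (left_mem_Icc.2 (by linarith)) (n + 1) (right_mem_Icc.2 (by linarith)) (by linarith)
  simp only [add_sub_cancel_left, mul_one] at this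
  linarith

lemma summable_nat_add_rpow (N : ℕ) {σ : ℝ} (hσ : 0 < σ) :
    Summable (fun k : ℕ => ((N + k : ℕ) : ℝ) ^ (-σ - 1)) := by
  have := (Real.summable_nat_rpow (p := -σ - 1)).2 (by linarith)
  simpa [add_comm] using (summable_nat_add_iff N).2 this

lemma tsum_nat_add_rpow_le {N : ℕ} (hN : 1 ≤ N) {σ : ℝ} (hσ : 0 < σ) :
    ∑' k : ℕ, ((N + k : ℕ) : ℝ) ^ (-σ - 1) ≤ (1 + 1 / σ) * (N : ℝ) ^ (-σ) := by
  have hN1 : (1 : ℝ) ≤ N := by exact_mod_cast hN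
  have key : ∀ K : ℕ, ∑ k ∈ Finset.range K, ((N + k : ℕ) : ℝ) ^ (-σ - 1) ≤
      (1 + 1 / σ) * (N : ℝ) ^ (-σ) := by
    have aux : ∀ K : ℕ, ∑ k ∈ Finset.range (K + 1), ((N + k : ℕ) : ℝ) ^ (-σ - 1) ≤
      (N : ℝ) ^ (-σ - 1) + ((N : ℝ) ^ (-σ) - ((N + K : ℕ) : ℝ) ^ (-σ)) / σ := by
      intro K
      induction K with
      | zero => simp
      | succ K ih =>
        rw [Finset.sum_range_succ]
        have := rpow_neg_sub_one_le (n := N + K) (by omega) hσ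
        push_cast at this ih ⊢
        rw [← add_assoc (N : ℝ) K 1]
        have e : ((N : ℝ) ^ (-σ) - ((N : ℝ) + K + 1) ^ (-σ)) / σ =
          ((N : ℝ) ^ (-σ) - ((N : ℝ) + K) ^ (-σ)) / σ +
          (((N : ℝ) + K) ^ (-σ) - ((N : ℝ) + K + 1) ^ (-σ)) / σ := by ring
        rw [e]; linarith
    intro K
    have h1 : (N : ℝ) ^ (-σ - 1) ≤ (N : ℝ) ^ (-σ) :=
      Real.rpow_le_rpow_of_exponent_le hN1 (by linarith)
    have h2 : ∀ K : ℕ, 0 ≤ ((N + K : ℕ) : ℝ) ^ (-σ) := fun K => by positivity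
    calc _ ≤ ∑ k ∈ Finset.range (K + 1), ((N + k : ℕ) : ℝ) ^ (-σ - 1) := by
            rw [Finset.sum_range_succ]; have : 0 ≤ ((N + K : ℕ) : ℝ) ^ (-σ - 1) := by positivity
            linarith
      _ ≤ _ := aux K
      _ ≤ (N : ℝ) ^ (-σ) + (N : ℝ) ^ (-σ) / σ := by
            gcongr; linarith [h2 K]
      _ = _ := by ring
  exact (summable_nat_add_rpow N hσ).tsum_le_of_sum_range_le key

lemma riemannZeta₁_eq_of_one_lt_re {N : ℕ} (hN : 1 ≤ N) {s : ℂ} (hs : 1 < s.re) :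
    riemannZeta₁ s = (s - 1) * ∑ n ∈ Finset.Icc 1 N, (n : ℂ) ^ (-s) + (N : ℂ) ^ (1 - s) +
      ∑' k : ℕ, zetaGap (N + k) s := by
  have hs1 : s ≠ 1 := by rintro rfl; simp at hs
  have hsum : HasSum (fun k : ℕ => zetaGap (N + k) s)
      ((s - 1) * (∑' k : ℕ, ((N + k : ℕ) + 1 : ℂ) ^ (-s)) + (0 - (N : ℂ) ^ (1 - s))) := by
    have hS : Summable (fun k : ℕ => ((N + k : ℕ) + 1 : ℂ) ^ (-s)) := by
      have := (summable_nat_add_iff (N + 1)).2 (Complex.summable_one_div_nat_cpow.2 hs)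
      refine this.congr fun k => ?_
      rw [one_div, ← cpow_neg]; congr 1; push_cast; ring
    refine HasSum.add (hS.hasSum.mul_left _) ?_
    have hnorm : Tendsto (fun k : ℕ => ((N + k : ℕ) : ℂ) ^ (1 - s)) atTop (𝓝 0) := by
      rw [tendsto_zero_iff_norm_tendsto_zero]
      have : Tendsto (fun k : ℕ => ((N + k : ℕ) : ℝ) ^ (-(s.re - 1))) atTop (𝓝 0) := by
        refine (tendsto_rpow_neg_atTop (by linarith)).comp ?_
        exact tendsto_natCast_atTop_atTop.comp (tendsto_add_atTop_nat N |>.congr (by intro k; ring))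
      refine this.congr fun k => ?_
      rw [norm_natCast_cpow_of_pos (by omega)]
      simp
    have hbound : Summable (fun k : ℕ => ((N + k : ℕ) : ℝ) ^ (-s.re)) := by
      have := summable_nat_add_rpow N (σ := s.re - 1) (by linarith)
      simpa using this
    have hsm : Summable (fun k : ℕ =>
        (((N + k : ℕ) : ℂ) + 1) ^ (1 - s) - ((N + k : ℕ) : ℂ) ^ (1 - s)) := by
      have h1 : Summable (fun k : ℕ => zetaGap (N + k) s) := by
        refine Summable.of_norm_bounded (g := fun k : ℕ =>
          ‖s - 1‖ * ‖s‖ * ((N + k : ℕ) : ℝ) ^ (-s.re - 1)) ?_ ?_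
        · exact (summable_nat_add_rpow N (by linarith)).mul_left _
        · intro k; exact norm_zetaGap_le (by omega) (by linarith)
      refine (h1.sub (hS.mul_left (s - 1))).congr fun k => ?_
      simp [zetaGap]
    rw [hsm.hasSum_iff_tendsto_nat]
    have : ∀ K : ℕ, ∑ k ∈ Finset.range K, ((((N + k : ℕ) : ℂ) + 1) ^ (1 - s) -
        ((N + k : ℕ) : ℂ) ^ (1 - s)) = ((N + K : ℕ) : ℂ) ^ (1 - s) - (N : ℂ) ^ (1 - s) := by
      intro K
      have := Finset.sum_range_sub (fun k : ℕ => ((N + k : ℕ) : ℂ) ^ (1 - s)) K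
      rw [← show ((N + 0 : ℕ) : ℂ) ^ (1 - s) = (N : ℂ) ^ (1 - s) by simp, ← this]
      refine Finset.sum_congr rfl fun k _ => ?_
      push_cast; ring_nf
    simp_rw [this]
    exact hnorm.sub_const _
  rw [hsum.tsum_eq]
  have hz := zeta_eq_tsum_one_div_nat_add_one_cpow hs
  have hS0 : Summable (fun k : ℕ => 1 / ((k : ℂ) + 1) ^ s) := by
    have := (summable_nat_add_iff 1).2 (Complex.summable_one_div_nat_cpow.2 hs)
    simpa using this
  rw [← hS0.sum_add_tsum_nat_add N] at hz
  have e1 : ∑ n ∈ Finset.Icc 1 N, (n : ℂ) ^ (-s) = ∑ i ∈ Finset.range N, 1 / ((i : ℂ) + 1) ^ s := by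
    have := Finset.sum_Ico_add' (fun i : ℕ => 1 / ((i : ℂ)) ^ s) 0 N 1
    rw [Finset.range_eq_Ico]
    push_cast at this
    rw [this]
    exact Finset.sum_congr rfl fun n _ => by rw [cpow_neg, one_div]
  have e2 : ∑' k : ℕ, ((N + k : ℕ) + 1 : ℂ) ^ (-s) = ∑' i : ℕ, 1 / (((i + N : ℕ) : ℂ) + 1) ^ s := by
    refine tsum_congr fun k => ?_
    rw [cpow_neg, one_div, add_comm N k]
  rw [e1, e2]
  have := riemannZeta_eq_inv_sub_mul hs1
  have h0 : s - 1 ≠ 0 := sub_ne_zero.2 hs1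
  have h3 : riemannZeta₁ s = (s - 1) * riemannZeta s := by rw [this]; field_simp
  rw [h3, hz]; ring

/-- First-order Euler-Maclaurin approximation of `(s - 1) ζ(s)` in the right half plane. -/
lemma riemannZeta₁_eq {N : ℕ} (hN : 1 ≤ N) {s : ℂ} (hs : 0 < s.re) :
    riemannZeta₁ s = (s - 1) * ∑ n ∈ Finset.Icc 1 N, (n : ℂ) ^ (-s) + (N : ℂ) ^ (1 - s) +
      ∑' k : ℕ, zetaGap (N + k) s := by
  have hU : IsOpen {s : ℂ | 0 < s.re} := isOpen_lt continuous_const continuous_re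
  have hconv : Convex ℝ {s : ℂ | 0 < s.re} := convex_halfSpace_re_gt 0
  have hgapd : ∀ n : ℕ, 1 ≤ n → Differentiable ℂ (zetaGap n) := by
    intro n hn
    have h1 : (n : ℂ) ≠ 0 := by exact_mod_cast (by omega : n ≠ 0)
    have h2 : (n : ℂ) + 1 ≠ 0 := by exact_mod_cast (by omega : n + 1 ≠ 0)
    unfold zetaGap
    refine Differentiable.add (Differentiable.mul (by fun_prop) ?_) (Differentiable.sub ?_ ?_) <;>
    · refine Differentiable.const_cpow (by fun_prop) (Or.inl ?_)
      assumption
  have hF : DifferentiableOn ℂ (fun s => ∑' k : ℕ, zetaGap (N + k) s) {s : ℂ | 0 < s.re} := by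
    intro w hw
    set δ := w.re / 2
    have hδ : 0 < δ := by simp only [δ]; have : 0 < w.re := hw; linarith
    have hV : IsOpen ({s : ℂ | δ < s.re} ∩ Metric.ball w 1) :=
      (isOpen_lt continuous_const continuous_re).inter Metric.isOpen_ball
    have hwV : w ∈ ({s : ℂ | δ < s.re} ∩ Metric.ball w 1) :=
      ⟨by simp only [mem_ofPred_eq, δ]; have : 0 < w.re := hw; linarith, by simp⟩
    refine DifferentiableAt.differentiableWithinAt ?_
    refine DifferentiableOn.differentiableAt (s := {s : ℂ | δ < s.re} ∩ Metric.ball w 1) ?_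
      (hV.mem_nhds hwV)
    refine differentiableOn_tsum_of_summable_norm
      (u := fun k : ℕ => (‖w‖ + 2) * (‖w‖ + 2) * ((N + k : ℕ) : ℝ) ^ (-δ - 1))
      ((summable_nat_add_rpow N hδ).mul_left _) (fun k => (hgapd _ (by omega)).differentiableOn)
      hV ?_
    intro k v hv
    have hv1 : δ < v.re := hv.1
    have hv2 : ‖v - w‖ < 1 := by simpa [dist_eq] using hv.2
    have hvn : ‖v‖ ≤ ‖w‖ + 1 := by
      have := norm_add_le (v - w) w; simp at this; linarith
    refine (norm_zetaGap_le (by omega) (by linarith)).trans ?_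
    have h1 : (1 : ℝ) ≤ ((N + k : ℕ) : ℝ) := by exact_mod_cast (by omega)
    have hv3 : ‖v - 1‖ ≤ ‖w‖ + 2 := by
      have := norm_sub_le v 1; simp at this; linarith
    gcongr
    linarith
  have hR : DifferentiableOn ℂ (fun s => (s - 1) * ∑ n ∈ Finset.Icc 1 N, (n : ℂ) ^ (-s) +
      (N : ℂ) ^ (1 - s) + ∑' k : ℕ, zetaGap (N + k) s) {s : ℂ | 0 < s.re} := by
    refine DifferentiableOn.add (Differentiable.differentiableOn ?_) hF
    refine Differentiable.add (Differentiable.mul (by fun_prop) ?_) ?_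
    · refine Differentiable.fun_sum fun n hn => ?_
      refine Differentiable.const_cpow (by fun_prop) (Or.inl ?_)
      have := (Finset.mem_Icc.1 hn).1
      exact_mod_cast (by omega : n ≠ 0)
    · refine Differentiable.const_cpow (by fun_prop) (Or.inl ?_)
      exact_mod_cast (by omega : N ≠ 0)
  have hE := (differentiable_riemannZeta₁.differentiableOn.analyticOnNhd hU).eqOn_of_preconnected_of_eventuallyEq
    (hR.analyticOnNhd hU) hconv.isPreconnected (z₀ := 2) (by simp) ?_
  · exact hE hs
  · have : {s : ℂ | 1 < s.re} ∈ 𝓝 (2 : ℂ) :=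
      (isOpen_lt continuous_const continuous_re).mem_nhds (by simp)
    filter_upwards [this] with s hs
    exact riemannZeta₁_eq_of_one_lt_re hN hs

lemma norm_tsum_zetaGap_le {N : ℕ} (hN : 1 ≤ N) {s : ℂ} (hs : 0 < s.re) :
    ‖∑' k : ℕ, zetaGap (N + k) s‖ ≤ ‖s - 1‖ * ‖s‖ * ((1 + 1 / s.re) * (N : ℝ) ^ (-s.re)) := by
  refine (tsum_of_norm_bounded ((summable_nat_add_rpow N hs).mul_left (‖s - 1‖ * ‖s‖)).hasSum
    fun k => norm_zetaGap_le (by omega) hs).trans ?_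
  rw [tsum_mul_left]
  gcongr
  exact tsum_nat_add_rpow_le hN hs

lemma Complex.norm_Gamma_le {s : ℂ} (hs : 0 < s.re) : ‖Gamma s‖ ≤ Real.Gamma s.re := by
  rw [Gamma_eq_integral hs, Real.Gamma_eq_integral hs, GammaIntegral]
  refine (MeasureTheory.norm_integral_le_integral_norm _).trans (le_of_eq ?_)
  refine MeasureTheory.setIntegral_congr_fun measurableSet_Ioi fun x hx => ?_
  have hx0 : (0 : ℝ) < x := hx
  simp only [norm_mul, norm_cpow_eq_rpow_re_of_pos hx0, sub_re, one_re]
  rw [Complex.norm_real, Real.norm_of_nonneg (Real.exp_pos _).le]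

lemma Real.Gamma_add_two_le {x : ℝ} (hx : 0 < x) :
    Real.Gamma (x + 2) ≤ Real.exp (2 * (x + 2) ^ (3 / 2 : ℝ)) := by
  set n := ⌈x⌉₊
  have hn : x ≤ n := Nat.le_ceil x
  have hn2 : (n : ℝ) + 1 ≤ x + 2 := by linarith [Nat.ceil_lt_add_one hx.le]
  have h1 : Real.Gamma (x + 2) ≤ Real.Gamma ((n : ℝ) + 2) :=
    Real.Gamma_strictMonoOn_Ici.monotoneOn (by simp; linarith) (by simp) (by linarith)
  have h2 : Real.Gamma ((n : ℝ) + 2) = ((n + 1).factorial : ℝ) := by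
    rw [← Real.Gamma_nat_eq_factorial]; push_cast; ring_nf
  have h3 : (((n + 1).factorial : ℕ) : ℝ) ≤ ((n : ℝ) + 1) ^ (n + 1) := by
    exact_mod_cast Nat.factorial_le_pow (n + 1)
  have h4 : ((n : ℝ) + 1) ^ (n + 1) ≤ (x + 2) ^ (x + 2) := by
    rw [← Real.rpow_natCast]
    push_cast
    exact (Real.rpow_le_rpow (by positivity) hn2 (by positivity)).trans
      (Real.rpow_le_rpow_of_exponent_le (by linarith) hn2)
  have h5 : (x + 2) ^ (x + 2) ≤ Real.exp (2 * (x + 2) ^ (3 / 2 : ℝ)) := by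
    rw [Real.rpow_def_of_pos (by linarith), Real.exp_le_exp]
    have := Real.log_le_rpow_div (x := x + 2) (by linarith) (ε := 1 / 2) (by norm_num)
    calc Real.log (x + 2) * (x + 2) ≤ ((x + 2) ^ (1 / 2 : ℝ) / (1 / 2)) * (x + 2) := by gcongr
      _ = 2 * ((x + 2) ^ (1 / 2 : ℝ) * (x + 2) ^ (1 : ℝ)) := by rw [Real.rpow_one]; ring
      _ = _ := by rw [← Real.rpow_add (by linarith)]; norm_num
  rw [h2] at h1
  linarith

/-- The entire function `s (s - 1) π^{-s/2} Γ(s/2) ζ(s)`. -/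
noncomputable def riemannXi (s : ℂ) : ℂ := s * (s - 1) * completedRiemannZeta₀ s + 1

lemma differentiable_riemannXi : Differentiable ℂ riemannXi := by
  unfold riemannXi
  exact ((differentiable_id.mul (differentiable_id.sub_const 1)).mul
    differentiable_completedZeta₀).add_const 1

lemma riemannXi_one_sub (s : ℂ) : riemannXi (1 - s) = riemannXi s := by
  unfold riemannXi; rw [completedRiemannZeta₀_one_sub]; ring

lemma riemannXi_eq {s : ℂ} (hs : 0 < s.re) :
    riemannXi s = s * Gammaℝ s * riemannZeta₁ s := by
  have hs0 : s ≠ 0 := by rintro rfl; simp at hs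
  rcases eq_or_ne s 1 with rfl | hs1
  · simp [riemannXi]
  · have h0 : s - 1 ≠ 0 := sub_ne_zero.2 hs1
    have h0' : 1 - s ≠ 0 := sub_ne_zero.2 hs1.symm
    have hG := Gammaℝ_ne_zero_of_re_pos hs
    have h1 := riemannZeta_eq_inv_sub_mul hs1
    rw [riemannZeta_def_of_ne_zero hs0, completedRiemannZeta_eq] at h1
    have h2 : riemannZeta₁ s = (s - 1) * ((completedRiemannZeta₀ s - 1 / s - 1 / (1 - s)) / Gammaℝ s) := by
      rw [h1]; field_simp
    rw [h2, riemannXi]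
    field_simp
    ring

lemma norm_riemannZeta₁_le {s : ℂ} (hs : 1 / 2 ≤ s.re) :
    ‖riemannZeta₁ s‖ ≤ 5 * (1 + ‖s‖) ^ 2 := by
  rw [riemannZeta₁_eq le_rfl (by linarith : 0 < s.re)]
  have h1 := norm_tsum_zetaGap_le le_rfl (by linarith : 0 < s.re)
  have h2 : ‖s - 1‖ ≤ ‖s‖ + 1 := by have := norm_sub_le s 1; simpa using this
  have h3 : 1 / s.re ≤ 2 := by rw [div_le_iff₀ (by linarith)]; linarith
  have h4 : ‖∑' k : ℕ, zetaGap (1 + k) s‖ ≤ (‖s‖ + 1) * ‖s‖ * 3 := by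
    refine h1.trans ?_
    simp only [Nat.cast_one, Real.one_rpow, mul_one]
    gcongr; linarith
  simp only [Finset.Icc_self, Finset.sum_singleton, Nat.cast_one, one_cpow, mul_one]
  have := norm_add_le (s - 1 + 1) (∑' k : ℕ, zetaGap (1 + k) s)
  have h5 : ‖s - 1 + 1‖ = ‖s‖ := by simp
  rw [h5] at this
  nlinarith [norm_nonneg s]

lemma norm_Gammaℝ_le {s : ℂ} (hs : 1 / 2 ≤ s.re) :
    ‖Gammaℝ s‖ ≤ 4 * Real.exp (2 * (‖s‖ + 2) ^ (3 / 2 : ℝ)) * 4 := by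
  have hre : (s / 2).re = s.re / 2 := by simp
  have hle := re_le_norm s
  rw [Gammaℝ_def, norm_mul]
  have h1 : ‖(Real.pi : ℂ) ^ (-s / 2)‖ ≤ 1 := by
    rw [norm_cpow_eq_rpow_re_of_pos Real.pi_pos]
    apply Real.rpow_le_one_of_one_le_of_nonpos (by linarith [Real.pi_gt_three])
    simp; linarith
  have h2 : ‖Gamma (s / 2)‖ ≤ Real.Gamma (s.re / 2) := by
    rw [← hre]; exact norm_Gamma_le (by rw [hre]; linarith)
  have h3 := Real.Gamma_add_two_le (x := s.re / 2) (by linarith)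
  have h4 : Real.Gamma (s.re / 2 + 2) = (s.re / 2 + 1) * ((s.re / 2) * Real.Gamma (s.re / 2)) := by
    rw [← Real.Gamma_add_one (by linarith), ← Real.Gamma_add_one (by linarith)]; ring_nf
  have hG : 0 < Real.Gamma (s.re / 2) := Real.Gamma_pos_of_pos (by linarith)
  have h5 : Real.exp (2 * (s.re / 2 + 2) ^ (3 / 2 : ℝ)) ≤ Real.exp (2 * (‖s‖ + 2) ^ (3 / 2 : ℝ)) := by
    gcongr; linarith
  have h6 : Real.Gamma (s.re / 2) ≤ 4 * Real.exp (2 * (‖s‖ + 2) ^ (3 / 2 : ℝ)) := by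
    have : 1 / 4 * Real.Gamma (s.re / 2) ≤ Real.Gamma (s.re / 2 + 2) := by
      rw [h4, ← mul_assoc]; gcongr; nlinarith
    linarith
  have he := Real.exp_pos (2 * (‖s‖ + 2) ^ (3 / 2 : ℝ))
  calc _ ≤ 1 * (4 * Real.exp (2 * (‖s‖ + 2) ^ (3 / 2 : ℝ))) := by gcongr; exact h2.trans h6
    _ ≤ _ := by linarith

lemma exists_norm_riemannXi_le :
    ∃ C : ℝ, 0 < C ∧ ∀ s : ℂ, ‖riemannXi s‖ ≤ Real.exp (C * (1 + ‖s‖) ^ (3 / 2 : ℝ)) := by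
  have main : ∀ s : ℂ, 1 / 2 ≤ s.re → ‖riemannXi s‖ ≤ Real.exp (91 * (1 + ‖s‖) ^ (3 / 2 : ℝ)) := by
    intro s hs
    rw [riemannXi_eq (by linarith), norm_mul, norm_mul]
    have h1 := norm_riemannZeta₁_le hs
    have h2 := norm_Gammaℝ_le hs
    set x := 1 + ‖s‖
    have hx : 1 ≤ x := by simp only [x]; linarith [norm_nonneg s]
    have hxx : x ≤ x ^ (3 / 2 : ℝ) := by
      conv_lhs => rw [← Real.rpow_one x]
      exact Real.rpow_le_rpow_of_exponent_le hx (by norm_num)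
    have h3 : (‖s‖ + 2) ^ (3 / 2 : ℝ) ≤ 4 * x ^ (3 / 2 : ℝ) := by
      calc _ ≤ (2 * x) ^ (3 / 2 : ℝ) := by
            have h : ‖s‖ + 2 ≤ 2 * x := by simp only [x]; linarith [norm_nonneg s]
            gcongr
        _ = 2 ^ (3 / 2 : ℝ) * x ^ (3 / 2 : ℝ) := Real.mul_rpow (by norm_num) (by linarith)
        _ ≤ 2 ^ (2 : ℝ) * x ^ (3 / 2 : ℝ) := by
            gcongr <;> norm_num
        _ = _ := by norm_num
    have h4 : x ^ 3 ≤ Real.exp (3 * x) := by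
      have := Real.add_one_le_exp x
      calc x ^ 3 ≤ (Real.exp x) ^ 3 := by gcongr; linarith
        _ = _ := by rw [← Real.exp_nat_mul]; norm_num
    have h80 : (80 : ℝ) ≤ Real.exp 80 := by linarith [Real.add_one_le_exp 80]
    calc ‖s‖ * ‖Gammaℝ s‖ * ‖riemannZeta₁ s‖
        ≤ x * (4 * Real.exp (2 * (‖s‖ + 2) ^ (3 / 2 : ℝ)) * 4) * (5 * x ^ 2) := by
          gcongr; linarith [norm_nonneg s]
      _ = 80 * (x ^ 3 * Real.exp (2 * (‖s‖ + 2) ^ (3 / 2 : ℝ))) := by ring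
      _ ≤ Real.exp 80 * (Real.exp (3 * x) * Real.exp (2 * (4 * x ^ (3 / 2 : ℝ)))) := by
          gcongr
      _ = Real.exp (80 + (3 * x + 2 * (4 * x ^ (3 / 2 : ℝ)))) := by
          rw [Real.exp_add, Real.exp_add]
      _ ≤ _ := by
          gcongr; linarith
  refine ⟨91 * 3, by norm_num, fun s => ?_⟩
  have hp : 0 < (1 + ‖s‖) ^ (3 / 2 : ℝ) := by positivity
  by_cases hs : 1 / 2 ≤ s.re
  · refine (main s hs).trans ?_
    gcongr; norm_num
  · rw [← riemannXi_one_sub]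
    refine (main (1 - s) (by simp; linarith)).trans ?_
    have h1 : ‖1 - s‖ ≤ 1 + ‖s‖ := by have := norm_sub_le 1 s; simpa using this
    rw [Real.exp_le_exp, mul_assoc]
    gcongr
    calc (1 + ‖1 - s‖) ^ (3 / 2 : ℝ) ≤ (2 * (1 + ‖s‖)) ^ (3 / 2 : ℝ) := by
          gcongr; linarith [norm_nonneg s]
      _ = 2 ^ (3 / 2 : ℝ) * (1 + ‖s‖) ^ (3 / 2 : ℝ) := Real.mul_rpow (by norm_num) (by positivity)
      _ ≤ _ := by
          gcongr
          rw [show (3 / 2 : ℝ) = 1 + 1 / 2 by norm_num, Real.rpow_add (by norm_num), Real.rpow_one,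
            ← Real.sqrt_eq_rpow]
          have : √2 ≤ 1.5 := by rw [Real.sqrt_le_left (by norm_num)]; norm_num
          linarith

/-- An entire function which is not identically zero can be divided by the full power of
`z - ρ` that divides it. -/
theorem exists_entire_eq_pow_mul {f : ℂ → ℂ} (hf : Differentiable ℂ f) {z₀ : ℂ} (h₀ : f z₀ ≠ 0)
    (ρ : ℂ) : ∃ (n : ℕ) (g : ℂ → ℂ), Differentiable ℂ g ∧ g ρ ≠ 0 ∧
      ∀ z, f z = (z - ρ) ^ n * g z := by
  have hfa : AnalyticOnNhd ℂ f univ := fun z _ ↦ hf.analyticAt z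
  have hord : analyticOrderAt f ρ ≠ ⊤ :=
    hfa.analyticOrderAt_ne_top_of_isPreconnected isPreconnected_univ (mem_univ z₀) (mem_univ ρ)
      (by simp [(hf.analyticAt z₀).analyticOrderAt_eq_zero.2 h₀])
  obtain ⟨g₀, hg₀, hg₀ρ, hfg⟩ := (hf.analyticAt ρ).analyticOrderAt_ne_top.1 hord
  set n := analyticOrderNatAt f ρ
  have hg : ∀ z, z ≠ ρ →
      Function.update (fun z ↦ f z / (z - ρ) ^ n) ρ (g₀ ρ) =ᶠ[𝓝 z] fun z ↦ f z / (z - ρ) ^ n := by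
    intro z hz
    filter_upwards [isOpen_ne.mem_nhds hz] with w hw
    exact Function.update_of_ne hw _ _
  have hgρ : Function.update (fun z ↦ f z / (z - ρ) ^ n) ρ (g₀ ρ) =ᶠ[𝓝 ρ] g₀ := by
    filter_upwards [hfg] with w hw
    rcases eq_or_ne w ρ with rfl | hne
    · simp
    · rw [Function.update_of_ne hne, hw, smul_eq_mul,
        mul_div_cancel_left₀ _ (pow_ne_zero _ (sub_ne_zero.2 hne))]
  refine ⟨n, Function.update (fun z ↦ f z / (z - ρ) ^ n) ρ (g₀ ρ), fun z ↦ ?_, by simpa, fun z ↦ ?_⟩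
  · rcases eq_or_ne z ρ with rfl | hz
    · exact (hg₀.differentiableAt.congr_of_eventuallyEq hgρ)
    · refine DifferentiableAt.congr_of_eventuallyEq ?_ (hg z hz)
      exact (hf z).div (by fun_prop) (pow_ne_zero _ (sub_ne_zero.2 hz))
  · rcases eq_or_ne z ρ with rfl | hz
    · have := hfg.self_of_nhds
      simpa using this
    · rw [Function.update_of_ne hz, mul_div_cancel₀ _ (pow_ne_zero _ (sub_ne_zero.2 hz))]

/-- Dividing out all roots lying in a finite set. -/
theorem exists_entire_eq_prod_mul {f : ℂ → ℂ} (hf : Differentiable ℂ f) {z₀ : ℂ} (h₀ : f z₀ ≠ 0)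
    (S : Finset ℂ) : ∃ (ι : Type) (_ : Fintype ι) (a : ι → ℂ) (g : ℂ → ℂ), (∀ i, a i ∈ S) ∧
      Differentiable ℂ g ∧ (∀ ρ ∈ S, g ρ ≠ 0) ∧ ∀ z, f z = (∏ i, (z - a i)) * g z := by
  classical
  induction S using Finset.induction_on with
  | empty => exact ⟨Empty, inferInstance, Empty.elim, f, fun i ↦ i.elim, hf, by simp, by simp⟩
  | insert ρ S _ ih =>
    obtain ⟨ι, _, a, g, ha, hg, hgS, hfg⟩ := ih
    have hg₀ : g z₀ ≠ 0 := fun h ↦ h₀ (by rw [hfg, h, mul_zero])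
    obtain ⟨n, g', hg', hg'ρ, hgg'⟩ := exists_entire_eq_pow_mul hg hg₀ ρ
    refine ⟨ι ⊕ Fin n, inferInstance, Sum.elim a fun _ ↦ ρ, g', ?_, hg', ?_, fun z ↦ ?_⟩
    · rintro (i | i) <;> simp [ha]
    · intro σ hσ
      rcases Finset.mem_insert.1 hσ with rfl | hσ
      · exact hg'ρ
      · exact fun h ↦ hgS σ hσ (by rw [hgg', h, mul_zero])
    · rw [hfg, hgg']
      simp [Fintype.prod_sum_type, mul_assoc]

theorem finite_zeros_closedBall {f : ℂ → ℂ} (hf : Differentiable ℂ f) {z₀ : ℂ} (h₀ : f z₀ ≠ 0)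
    (R : ℝ) : (Metric.closedBall 0 R ∩ f ⁻¹' {0}).Finite := by
  have h : f ⁻¹' {0}ᶜ ∈ codiscrete ℂ :=
    AnalyticOnNhd.preimage_zero_mem_codiscrete (fun z _ ↦ hf.analyticAt z) h₀
  have hd := (mem_codiscrete'.mp h).2
  rw [preimage_compl, compl_compl] at hd
  refine ((isCompact_closedBall (0:ℂ) R).inter_right
    ((isClosed_singleton (x := (0:ℂ))).preimage hf.continuous)).finite ?_
  exact hd.mono inter_subset_right

theorem logDeriv_prod_sub_mul {ι : Type} [Fintype ι] {a : ι → ℂ} {f g : ℂ → ℂ}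
    (hg : Differentiable ℂ g) (hfg : ∀ z, f z = (∏ i, (z - a i)) * g z) {w : ℂ} (hw : f w ≠ 0) :
    logDeriv f w = ∑ i, 1 / (w - a i) + logDeriv g w := by
  have hw' := hw
  rw [hfg] at hw'
  have h1 := left_ne_zero_of_mul hw'
  have h2 := right_ne_zero_of_mul hw'
  rw [show f = fun z ↦ (∏ i, (z - a i)) * g z from funext hfg,
    logDeriv_mul w h1 h2 (by fun_prop) (hg w),
    logDeriv_prod (f := fun i z ↦ z - a i) (fun i _ ↦ (Finset.prod_ne_zero_iff.1 h1) i (Finset.mem_univ i))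
      (fun i _ ↦ by fun_prop)]
  simp [logDeriv_apply]

/-- The logarithm of a zero-free function on a disc, bounded through its modulus. -/
theorem norm_logDeriv_le_of_ne_zero {g : ℂ → ℂ} (hg : Differentiable ℂ g) {R B : ℝ} (hR : 0 < R)
    (hB : 0 < B) (hne : ∀ z ∈ Metric.ball 0 R, g z ≠ 0)
    (hle : ∀ z ∈ Metric.ball 0 R, ‖g z‖ ≤ ‖g 0‖ * Real.exp B) {w : ℂ} (hw : ‖w‖ < R / 4) :
    ‖logDeriv g w‖ ≤ 8 * B / R := by
  have h0 : (0:ℂ) ∈ Metric.ball (0:ℂ) R := by simpa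
  have hd : DifferentiableOn ℂ (logDeriv g) (Metric.ball 0 R) := fun z hz ↦
    (((hg.analyticAt z).deriv.differentiableAt).div (hg z) (hne z hz)).differentiableWithinAt
  obtain ⟨h, hh0, hh⟩ := (hd.isExactOn_ball).with_val_at 0 0
  have hexp : ∀ z ∈ Metric.ball (0:ℂ) R, g z = g 0 * exp (h z) := by
    have hconst : ∀ z ∈ Metric.ball (0:ℂ) R, HasDerivAt (fun z ↦ g z * exp (-h z)) 0 z := by
      intro z hz
      have := (hg z).hasDerivAt.mul ((hh z hz).neg.cexp)
      refine this.congr_deriv ?_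
      rw [logDeriv_apply]
      have := hne z hz
      simp only [Pi.neg_apply]
      field_simp
      ring
    intro z hz
    have hcon := (convex_ball (0:ℂ) R).is_const_of_fderivWithin_eq_zero (𝕜 := ℂ)
      (f := fun z ↦ g z * exp (-h z))
      (fun z hz ↦ (hconst z hz).differentiableAt.differentiableWithinAt) (fun z hz ↦ by
        rw [fderivWithin_of_isOpen Metric.isOpen_ball hz]
        ext
        simp [(hconst z hz).deriv]) hz h0
    simp only [hh0, neg_zero, exp_zero, mul_one] at hcon
    rw [← hcon, mul_assoc, ← exp_add]
    simp
  have hg0 : 0 < ‖g 0‖ := norm_pos_iff.2 (hne 0 h0)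
  have hre : MapsTo h (Metric.ball 0 R) {z | z.re ≤ B} := by
    intro z hz
    have := hle z hz
    rw [hexp z hz, norm_mul, norm_exp] at this
    exact Real.exp_le_exp.1 (le_of_mul_le_mul_left this hg0)
  have hhd : DifferentiableOn ℂ h (Metric.ball 0 R) :=
    fun z hz ↦ (hh z hz).differentiableAt.differentiableWithinAt
  have hw' : w ∈ Metric.ball (0:ℂ) R := by simp; linarith
  rw [← (hh w hw').deriv]
  have hsub : Metric.closedBall w (R / 4) ⊆ Metric.ball 0 R := by
    intro z hz
    rw [mem_closedBall_iff_norm] at hz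
    rw [mem_ball_zero_iff]
    linarith [norm_sub_norm_le z w]
  have := Complex.norm_deriv_le_of_forall_mem_sphere_norm_le (c := w) (R := R / 4) (C := 2 * B)
    (f := h) (by positivity) ((hhd.mono (by simpa [closure_ball _ (show R/4 ≠ 0 by positivity)] using hsub)).diffContOnCl) (by
      intro z hz
      have hzR := hsub (Metric.sphere_subset_closedBall hz)
      have hz2 : ‖z‖ ≤ R / 2 := by
        rw [mem_sphere_iff_norm] at hz
        linarith [norm_sub_norm_le z w]
      refine (borelCaratheodory_zero hB hhd hre hR hzR hh0).trans ?_
      rw [div_le_iff₀ (by linarith)]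
      nlinarith)
  refine this.trans (le_of_eq ?_)
  field_simp
  ring

/-- Partial fractions for the logarithmic derivative of an entire function of order below one,
nonzero at the origin. -/
theorem exists_partialFraction_of_zero_ne {F : ℂ → ℂ} (hF : Differentiable ℂ F) (h₀ : F 0 ≠ 0)
    {C : ℝ} (hC : 0 < C) (hbd : ∀ w, ‖F w‖ ≤ Real.exp (C * (1 + ‖w‖) ^ (3 / 4 : ℝ))) {ε K : ℝ}
    (hε : 0 < ε) : ∃ (ι : Type) (_ : Fintype ι) (a : ι → ℂ) (E : ℂ → ℂ),
      (∀ i, F (a i) = 0) ∧ DifferentiableOn ℂ E (Metric.ball 0 K) ∧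
      (∀ w ∈ Metric.ball 0 K, ‖E w‖ ≤ ε) ∧
      ∀ w ∈ Metric.ball 0 K, F w ≠ 0 → logDeriv F w = ∑ i, 1 / (w - a i) + E w := by
  set c : ℝ := |Real.log ‖F 0‖|
  have hlim : Tendsto (fun R : ℝ ↦ 8 * (C * (3 * R) ^ (3 / 4 : ℝ) + c) / R) atTop (𝓝 0) := by
    have h1 : Tendsto (fun R : ℝ ↦ 8 * (C * 3 ^ (3 / 4 : ℝ)) * R ^ (-(1 / 4 : ℝ)) + 8 * c * R⁻¹)
        atTop (𝓝 (8 * (C * 3 ^ (3 / 4 : ℝ)) * 0 + 8 * c * 0)) :=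
      ((tendsto_rpow_neg_atTop (by norm_num)).const_mul _).add (tendsto_inv_atTop_zero.const_mul _)
    rw [mul_zero, mul_zero, add_zero] at h1
    refine h1.congr' ?_
    filter_upwards [eventually_gt_atTop 0] with R hR
    rw [Real.mul_rpow (by norm_num) hR.le, show (-(1/4:ℝ)) = 3 / 4 - 1 by norm_num,
      Real.rpow_sub hR, Real.rpow_one]
    field_simp
  obtain ⟨R, hRε, hR⟩ := ((hlim.eventually (gt_mem_nhds hε)).and
    (eventually_ge_atTop (max 1 (4 * K)))).exists
  have hR1 : 1 ≤ R := (le_max_left _ _).trans hR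
  have hRK : 4 * K ≤ R := (le_max_right _ _).trans hR
  have hfin := finite_zeros_closedBall hF h₀ R
  obtain ⟨ι, _, a, g, ha, hg, hgS, hfg⟩ := exists_entire_eq_prod_mul hF h₀ hfin.toFinset
  simp only [Finite.mem_toFinset, mem_inter_iff, mem_closedBall_zero_iff, mem_preimage,
    mem_singleton_iff] at ha hgS
  have hne : ∀ z ∈ Metric.ball (0:ℂ) R, g z ≠ 0 := by
    intro z hz hgz
    exact hgS z ⟨(mem_ball_zero_iff.1 hz).le, by rw [hfg, hgz, mul_zero]⟩ hgz
  have hB : 0 < C * (3 * R) ^ (3 / 4 : ℝ) + c := by positivity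
  have hle : ∀ z ∈ Metric.ball (0:ℂ) R, ‖g z‖ ≤ ‖g 0‖ * Real.exp (C * (3 * R) ^ (3 / 4 : ℝ) + c) := by
    intro z hz
    refine Complex.norm_le_of_forall_mem_frontier_norm_le (U := Metric.ball 0 (2 * R))
      Metric.isBounded_ball hg.diffContOnCl (fun w hw ↦ ?_)
      (subset_closure (Metric.ball_subset_ball (by linarith) hz))
    rw [frontier_ball _ (by positivity), mem_sphere_zero_iff_norm] at hw
    have hP : ∏ i, ‖a i‖ ≤ ∏ i, ‖w - a i‖ := by
      refine Finset.prod_le_prod (fun _ _ ↦ norm_nonneg _) fun i _ ↦ ?_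
      linarith [norm_sub_norm_le w (a i), (ha i).1]
    have h0P : 0 < ∏ i, ‖a i‖ := Finset.prod_pos fun i _ ↦ norm_pos_iff.2 fun h ↦ h₀ (h ▸ (ha i).2)
    have hF0 : ‖F 0‖ = (∏ i, ‖a i‖) * ‖g 0‖ := by rw [hfg]; simp
    have hFw : ‖F w‖ = (∏ i, ‖w - a i‖) * ‖g w‖ := by rw [hfg]; simp
    have hexp : ‖F w‖ ≤ ‖F 0‖ * Real.exp (C * (3 * R) ^ (3 / 4 : ℝ) + c) := by
      have hlog : 1 ≤ ‖F 0‖ * Real.exp c := by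
        have h1 : 0 < ‖F 0‖ := norm_pos_iff.2 h₀
        conv_rhs => rw [← Real.exp_log h1, ← Real.exp_add]
        exact Real.one_le_exp (by linarith [neg_abs_le (Real.log ‖F 0‖)])
      refine (hbd w).trans ?_
      rw [Real.exp_add, mul_left_comm]
      have : Real.exp (C * (1 + ‖w‖) ^ (3 / 4 : ℝ)) ≤ Real.exp (C * (3 * R) ^ (3 / 4 : ℝ)) := by
        gcongr
        linarith
      nlinarith [Real.exp_pos (C * (3 * R) ^ (3 / 4 : ℝ))]
    have h3 : (∏ i, ‖a i‖) * ‖g w‖ ≤ (∏ i, ‖a i‖) * (‖g 0‖ * Real.exp (C * (3 * R) ^ (3 / 4 : ℝ) + c)) := by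
      calc _ ≤ (∏ i, ‖w - a i‖) * ‖g w‖ := by gcongr
        _ = ‖F w‖ := hFw.symm
        _ ≤ _ := hexp
        _ = _ := by rw [hF0]; ring
    exact le_of_mul_le_mul_left h3 h0P
  refine ⟨ι, inferInstance, a, logDeriv g, fun i ↦ (ha i).2, fun z hz ↦ ?_, fun w hw ↦ ?_, fun w _ hFw ↦ logDeriv_prod_sub_mul hg hfg hFw⟩
  · have : z ∈ Metric.ball (0:ℂ) R := by
      rw [mem_ball_zero_iff] at hz ⊢
      linarith
    exact (((hg.analyticAt z).deriv.differentiableAt).div (hg z) (hne z this)).differentiableWithinAt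
  · refine (norm_logDeriv_le_of_ne_zero hg (by positivity) hB hne hle ?_).trans hRε.le
    rw [mem_ball_zero_iff] at hw
    linarith

/-- Partial fractions for the logarithmic derivative of an entire function of order below one. -/
theorem exists_partialFraction {F : ℂ → ℂ} (hF : Differentiable ℂ F) {w₀ : ℂ} (h₀ : F w₀ ≠ 0)
    {C : ℝ} (hC : 0 < C) (hbd : ∀ w, ‖F w‖ ≤ Real.exp (C * (1 + ‖w‖) ^ (3 / 4 : ℝ))) {ε K : ℝ}
    (hε : 0 < ε) : ∃ (ι : Type) (_ : Fintype ι) (a : ι → ℂ) (E : ℂ → ℂ),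
      (∀ i, F (a i) = 0) ∧ DifferentiableOn ℂ E (Metric.ball 0 K) ∧
      (∀ w ∈ Metric.ball 0 K, ‖E w‖ ≤ ε) ∧
      ∀ w ∈ Metric.ball 0 K, F w ≠ 0 → logDeriv F w = ∑ i, 1 / (w - a i) + E w := by
  have hbd' : ∀ w, ‖F (w + w₀)‖ ≤
      Real.exp ((C * (1 + ‖w₀‖) ^ (3 / 4 : ℝ)) * (1 + ‖w‖) ^ (3 / 4 : ℝ)) := by
    intro w
    refine (hbd _).trans (Real.exp_le_exp.2 ?_)
    rw [mul_assoc, ← Real.mul_rpow (by positivity) (by positivity)]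
    gcongr
    nlinarith [norm_add_le w w₀, norm_nonneg w, norm_nonneg w₀, mul_nonneg (norm_nonneg w) (norm_nonneg w₀)]
  obtain ⟨ι, _, a, E, ha, hE, hEε, h⟩ := exists_partialFraction_of_zero_ne
    (F := fun w ↦ F (w + w₀)) (by fun_prop) (by simpa) (by positivity) hbd' (K := K + ‖w₀‖) hε
  have hmem : ∀ w ∈ Metric.ball (0:ℂ) K, w - w₀ ∈ Metric.ball (0:ℂ) (K + ‖w₀‖) := by
    intro w hw
    rw [mem_ball_zero_iff] at hw ⊢
    linarith [norm_sub_le w w₀]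
  refine ⟨ι, inferInstance, fun i ↦ a i + w₀, fun w ↦ E (w - w₀), ha, ?_, fun w hw ↦ hEε _ (hmem w hw), ?_⟩
  · exact hE.comp (by fun_prop) hmem
  · intro w hw hFw
    have := h (w - w₀) (hmem w hw) (by simpa)
    simp only [logDeriv_apply, deriv_comp_add_const, sub_add_cancel] at this
    rw [logDeriv_apply, this]
    simp [sub_sub, add_comm]

/-- An even entire function is an entire function of the square. -/
theorem exists_entire_comp_sq {f : ℂ → ℂ} (hf : Differentiable ℂ f) (heven : ∀ z, f (-z) = f z) :
    ∃ F : ℂ → ℂ, Differentiable ℂ F ∧ ∀ z, F (z ^ 2) = f z := by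
  have hsq : ∀ w : ℂ, (w ^ (2⁻¹ : ℂ)) ^ 2 = w := fun w ↦ by
    simp
  have hf2 : ∀ {a b : ℂ}, a ^ 2 = b ^ 2 → f a = f b := by
    intro a b h
    rcases sq_eq_sq_iff_eq_or_eq_neg.1 h with rfl | rfl
    · rfl
    · exact heven _
  refine ⟨fun w ↦ f (w ^ (2⁻¹ : ℂ)), ?_, fun z ↦ hf2 (hsq _)⟩
  have hne : ∀ w₀ : ℂ, w₀ ≠ 0 → DifferentiableAt ℂ (fun w ↦ f (w ^ (2⁻¹ : ℂ))) w₀ := by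
    intro w₀ hw₀
    have heq : (fun w ↦ f (w ^ (2⁻¹ : ℂ))) =
        fun w ↦ f (w₀ ^ (2⁻¹ : ℂ) * (w / w₀) ^ (2⁻¹ : ℂ)) := by
      funext w
      refine hf2 ?_
      rw [mul_pow, hsq, hsq, hsq]
      field_simp
    rw [heq]
    refine (hf _).comp w₀ (DifferentiableAt.const_mul (DifferentiableAt.cpow (by fun_prop) (by fun_prop) ?_) _)
    simp [hw₀]
  have hcont : ContinuousAt (fun w ↦ f (w ^ (2⁻¹ : ℂ))) 0 := by
    refine ContinuousAt.comp (g := f) hf.continuous.continuousAt ?_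
    exact Complex.continuousAt_cpow_const_of_re_pos (by simp) (by norm_num)
  rw [← differentiableOn_univ]
  refine (Complex.differentiableOn_compl_singleton_and_continuousAt_iff (c := 0) univ_mem).1 ⟨?_, hcont⟩
  exact fun w hw ↦ (hne w (by simpa using hw)).differentiableWithinAt

lemma riemannXi_eq_zero_imp {s : ℂ} (h : riemannXi s = 0) :
    0 < s.re ∧ s.re < 1 ∧ riemannZeta s = 0 := by
  have key : ∀ s : ℂ, 0 < s.re → riemannXi s = 0 → s.re < 1 ∧ riemannZeta s = 0 := by
    intro s hs h
    have hs0 : s ≠ 0 := by rintro rfl; simp at hs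
    rw [riemannXi_eq hs] at h
    have h1 : riemannZeta₁ s = 0 :=
      (mul_eq_zero.1 h).resolve_left (mul_ne_zero hs0 (Gammaℝ_ne_zero_of_re_pos hs))
    have hs1 : s ≠ 1 := by rintro rfl; simp at h1
    have h2 : riemannZeta s = 0 := by rw [riemannZeta_eq_inv_sub_mul hs1, h1, mul_zero]
    exact ⟨lt_of_not_ge fun h ↦ riemannZeta_ne_zero_of_one_le_re h h2, h2⟩
  rcases lt_or_ge 0 s.re with hs | hs
  · exact ⟨hs, key s hs h⟩
  · rw [← riemannXi_one_sub] at h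
    have := key (1 - s) (by simp; linarith) h
    simp at this
    linarith

/-- Partial fractions for the logarithmic derivative of `riemannXi`, up to an arbitrarily small
error in an arbitrarily large disc. -/
theorem exists_logDeriv_riemannXi_eq {ε K : ℝ} (hε : 0 < ε) (hK : 1 ≤ K) :
    ∃ (ι : Type) (_ : Fintype ι) (ρ : ι → ℂ) (E : ℂ → ℂ), (∀ i, riemannXi (ρ i) = 0) ∧
      DifferentiableOn ℂ E (Metric.ball 0 K) ∧ (∀ s ∈ Metric.ball 0 K, ‖E s‖ ≤ ε) ∧
      ∀ s ∈ Metric.ball 0 K, riemannXi s ≠ 0 →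
        logDeriv riemannXi s = ∑ i, 1 / (s - ρ i) + E s := by
  obtain ⟨C, hC, hbd⟩ := exists_norm_riemannXi_le
  obtain ⟨F, hF, hFf⟩ := exists_entire_comp_sq (f := fun z ↦ riemannXi (1 / 2 + z))
    (differentiable_riemannXi.comp (by fun_prop)) (fun z ↦ by
      rw [← riemannXi_one_sub]; ring_nf)
  have hsq : ∀ w : ℂ, (w ^ (2⁻¹ : ℂ)) ^ 2 = w := fun w ↦ by
    simp
  have hF0 : F ((3 / 2) ^ 2) ≠ 0 := by
    rw [hFf]
    intro h
    have := riemannXi_eq_zero_imp h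
    norm_num at this
  have hFbd : ∀ w, ‖F w‖ ≤ Real.exp ((C * 4 ^ (3 / 4 : ℝ)) * (1 + ‖w‖) ^ (3 / 4 : ℝ)) := by
    intro w
    set z := w ^ (2⁻¹ : ℂ)
    have hz : z ^ 2 = w := hsq w
    rw [← hz, hFf]
    refine (hbd _).trans (Real.exp_le_exp.2 ?_)
    rw [mul_assoc, ← Real.mul_rpow (by norm_num) (by positivity), norm_pow,
      show (3 / 2 : ℝ) = (2:ℕ) * (3 / 4) by norm_num, Real.rpow_mul (by positivity),
      Real.rpow_natCast]
    gcongr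
    have h1 : ‖1 / 2 + z‖ ≤ 1 / 2 + ‖z‖ := (norm_add_le _ _).trans (by norm_num)
    nlinarith [norm_nonneg z, norm_nonneg (1 / 2 + z), sq_nonneg (‖z‖ - 1 / 2)]
  obtain ⟨ι, _, a, E, ha, hE, hEε, h⟩ := exists_partialFraction hF hF0 (by positivity) hFbd
    (ε := ε / (4 * K)) (K := (2 * K) ^ 2) (by positivity)
  have hmem : ∀ s ∈ Metric.ball (0:ℂ) K, (s - 1 / 2) ^ 2 ∈ Metric.ball (0:ℂ) ((2 * K) ^ 2) ∧
      ‖s - 1 / 2‖ ≤ 2 * K := by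
    intro s hs
    rw [mem_ball_zero_iff] at hs ⊢
    have : ‖s - 1 / 2‖ < 2 * K := (norm_sub_le _ _).trans_lt (by norm_num; linarith)
    rw [norm_pow]
    exact ⟨by gcongr, this.le⟩
  refine ⟨ι ⊕ ι, inferInstance,
    Sum.elim (fun i ↦ 1 / 2 + a i ^ (2⁻¹ : ℂ)) (fun i ↦ 1 / 2 - a i ^ (2⁻¹ : ℂ)),
    fun s ↦ 2 * (s - 1 / 2) * E ((s - 1 / 2) ^ 2), ?_, ?_, ?_, ?_⟩
  · have h1 : ∀ i, riemannXi (1 / 2 + a i ^ (2⁻¹ : ℂ)) = 0 := by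
      intro i
      have := hFf (a i ^ (2⁻¹ : ℂ))
      rwa [hsq, ha, eq_comm] at this
    rintro (i | i)
    · exact h1 i
    · simp only [Sum.elim_inr]
      rw [← riemannXi_one_sub, ← h1 i]
      ring_nf
  · exact DifferentiableOn.mul (by fun_prop)
      (hE.comp (g := E) (f := fun s : ℂ ↦ (s - 1 / 2) ^ 2) (by fun_prop) fun s hs ↦ (hmem s hs).1)
  · intro s hs
    have h1 := hEε _ (hmem s hs).1
    rw [norm_mul, norm_mul, Complex.norm_ofNat]
    calc 2 * ‖s - 1 / 2‖ * ‖E ((s - 1 / 2) ^ 2)‖ ≤ 2 * (2 * K) * (ε / (4 * K)) := by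
          gcongr
          exact (hmem s hs).2
      _ = ε := by field_simp; ring
  · intro s hs hxs
    have hcomp : riemannXi = F ∘ fun s ↦ (s - 1 / 2) ^ 2 := by
      funext s
      simp [hFf]
    have hFs : F ((s - 1 / 2) ^ 2) ≠ 0 := by rwa [hFf, add_sub_cancel]
    have hder : deriv (fun s : ℂ ↦ (s - 1 / 2) ^ 2) s = 2 * (s - 1 / 2) := by simp
    rw [hcomp, logDeriv_comp (hF _) (by fun_prop), h _ (hmem s hs).1 hFs, hder, add_mul,
      Fintype.sum_sum_type, ← Finset.sum_add_distrib, Finset.sum_mul, mul_comm (E _)]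
    congr 1
    refine Finset.sum_congr rfl fun i _ ↦ ?_
    have hi : a i = (a i ^ (2⁻¹ : ℂ)) ^ 2 := (hsq _).symm
    simp only [Sum.elim_inl, Sum.elim_inr]
    have hxi : F (a i) = 0 := ha i
    set b := a i ^ (2⁻¹ : ℂ)
    rw [hi]
    have h1 : (s - 1 / 2) ^ 2 - b ^ 2 ≠ 0 := by
      intro h
      rw [sub_eq_zero.1 h, ← hi] at hFs
      exact hFs hxi
    rw [sq_sub_sq] at h1 ⊢
    have h2 : s - (1 / 2 + b) ≠ 0 := by convert right_ne_zero_of_mul h1 using 1; ring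
    have h3 : s - (1 / 2 - b) ≠ 0 := by convert left_ne_zero_of_mul h1 using 1; ring
    rw [show (s - 1 / 2 + b) * (s - 1 / 2 - b) = (s - (1 / 2 + b)) * (s - (1 / 2 - b)) by ring]
    rw [div_add_div _ _ h2 h3, div_mul_eq_mul_div]
    congr 1
    ring

open ArithmeticFunction in
/-- The explicit formula in partial-fraction form, up to an arbitrarily small error in an
arbitrarily large disc. -/
theorem exists_LSeries_vonMangoldt_eq {ε K : ℝ} (hε : 0 < ε) (hK : 1 ≤ K) :
    ∃ (ι : Type) (_ : Fintype ι) (ρ : ι → ℂ) (E : ℂ → ℂ),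
      (∀ i, 0 < (ρ i).re ∧ (ρ i).re < 1 ∧ riemannZeta (ρ i) = 0) ∧
      DifferentiableOn ℂ E (Metric.ball 0 K) ∧ (∀ s ∈ Metric.ball 0 K, ‖E s‖ ≤ ε) ∧
      ∀ s : ℂ, 1 < s.re → ‖s‖ < K → LSeries (fun n ↦ (Λ n : ℂ)) s =
        1 / (s - 1) + (digamma (s / 2 + 1) - Real.log Real.pi) / 2 - ∑ i, 1 / (s - ρ i) - E s := by
  obtain ⟨ι, _, ρ, E, hρ, hE, hEε, h⟩ := exists_logDeriv_riemannXi_eq hε hK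
  refine ⟨ι, inferInstance, ρ, E, fun i ↦ riemannXi_eq_zero_imp (hρ i), hE, hEε, fun s hs hsK ↦ ?_⟩
  have hxi : riemannXi s ≠ 0 := fun h ↦ by linarith [(riemannXi_eq_zero_imp h).2.1]
  have hlog := h s (by simpa) hxi
  have hs0 : s ≠ 0 := by rintro rfl; norm_num at hs
  have hs1 : s ≠ 1 := by rintro rfl; norm_num at hs
  have hΓ : Gamma (s / 2) ≠ 0 := Complex.Gamma_ne_zero_of_re_pos (by simp; linarith)
  have hζ : riemannZeta s ≠ 0 := riemannZeta_ne_zero_of_one_le_re hs.le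
  have hev : riemannXi =ᶠ[𝓝 s] fun s ↦ (s * (s - 1)) * (((Real.pi : ℂ) ^ (-s / 2) * Gamma (s / 2)) * riemannZeta s) := by
    have h1 : {s : ℂ | 1 < s.re} ∈ 𝓝 s := (isOpen_lt continuous_const continuous_re).mem_nhds hs
    filter_upwards [h1] with w hw
    have hw' : (1:ℝ) < w.re := hw
    have hw1 : w ≠ 1 := by rintro rfl; norm_num at hw'
    rw [riemannXi_eq (by linarith), riemannZeta_eq_inv_sub_mul hw1, Gammaℝ_def]
    have := sub_ne_zero.2 hw1
    field_simp
  have hπ : (Real.pi : ℂ) ≠ 0 := by exact_mod_cast Real.pi_ne_zero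
  have hdΓ : DifferentiableAt ℂ Gamma (s / 2) := Complex.differentiableAt_Gamma _ fun m h ↦ by
    have := congrArg re h
    simp at this
    have : (0:ℝ) ≤ m := by positivity
    linarith
  have hdΓ' : DifferentiableAt ℂ (fun s ↦ Gamma (s / 2)) s :=
    DifferentiableAt.comp (g := Gamma) s hdΓ (by fun_prop)
  have hdπ : HasDerivAt (fun s : ℂ ↦ (Real.pi : ℂ) ^ (-s / 2)) ((Real.pi : ℂ) ^ (-s / 2) * Complex.log Real.pi * (-1 / 2)) s :=
    HasDerivAt.const_cpow (((hasDerivAt_id s).neg).div_const 2) (Or.inl hπ)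
  have hdζ := differentiableAt_riemannZeta hs1
  have hπs : (Real.pi : ℂ) ^ (-s / 2) ≠ 0 := by simp [Complex.cpow_eq_zero_iff, hπ]
  have hl1 : logDeriv (fun s : ℂ ↦ s * (s - 1)) s = 1 / s + 1 / (s - 1) := by
    rw [logDeriv_mul s (f := fun s ↦ s) (g := fun s ↦ s - 1) hs0 (sub_ne_zero.2 hs1) (by fun_prop) (by fun_prop)]
    simp [logDeriv_apply]
  have hl2 : logDeriv (fun s ↦ Gamma (s / 2)) s = digamma (s / 2) / 2 := by
    have := logDeriv_comp (f := Gamma) (g := fun s : ℂ ↦ s / 2) (x := s) hdΓ (by fun_prop)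
    rw [Function.comp_def] at this
    rw [this, digamma_def]
    simp
    ring
  have hl3 : logDeriv (fun s : ℂ ↦ (Real.pi : ℂ) ^ (-s / 2)) s = - Real.log Real.pi / 2 := by
    rw [logDeriv_apply, hdπ.deriv, Complex.ofReal_log Real.pi_pos.le]
    field_simp
  rw [(logDeriv_congr_nhds hev).self_of_nhds, logDeriv_mul s (f := fun s ↦ s * (s - 1))
    (g := fun s ↦ (Real.pi : ℂ) ^ (-s / 2) * Gamma (s / 2) * riemannZeta s)
    (mul_ne_zero hs0 (sub_ne_zero.2 hs1)) (mul_ne_zero (mul_ne_zero hπs hΓ) hζ) (by fun_prop)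
    ((hdπ.differentiableAt.mul hdΓ').mul hdζ),
    logDeriv_mul s (f := fun s ↦ (Real.pi : ℂ) ^ (-s / 2) * Gamma (s / 2)) (mul_ne_zero hπs hΓ) hζ (hdπ.differentiableAt.mul hdΓ') hdζ,
    logDeriv_mul s (f := fun s : ℂ ↦ (Real.pi : ℂ) ^ (-s / 2)) hπs hΓ hdπ.differentiableAt hdΓ',
    hl1, hl2, hl3] at hlog
  have hΛ := LSeries_vonMangoldt_eq_deriv_riemannZeta_div hs
  rw [logDeriv_apply] at hlog
  have hdig := digamma_apply_add_one (s / 2) (fun m h ↦ by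
    have := congrArg re h
    simp at this
    have : (0:ℝ) ≤ m := by positivity
    linarith)
  rw [hdig]
  have h4 : (s / 2)⁻¹ = 2 * (1 / s) := by field_simp
  rw [h4]
  have : deriv riemannZeta s / riemannZeta s = ∑ i, 1 / (s - ρ i) + E s - (1 / s + 1 / (s - 1)) - (-(Real.log Real.pi : ℂ) / 2 + digamma (s / 2) / 2) := by
    rw [← hlog]; ring
  refine hΛ.trans ?_
  rw [neg_div, this]
  ring

open MeasureTheory in
theorem Complex.norm_GammaSeq_le {s : ℂ} (hs : 0 < s.re) {n : ℕ} (hn : n ≠ 0) :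
    ‖GammaSeq s n‖ ≤ Real.Gamma s.re := by
  rw [GammaSeq_eq_approx_Gamma_integral hs hn, Real.Gamma_eq_integral hs]
  have hint := Real.GammaIntegral_convergent hs
  have hsub : Ioc (0:ℝ) n ⊆ Ioi 0 := Ioc_subset_Ioi_self
  refine (intervalIntegral.norm_integral_le_of_norm_le (g := fun x : ℝ ↦ Real.exp (-x) * x ^ (s.re - 1))
    (by positivity) (ae_of_all _ fun x hx ↦ ?_) ?_).trans ?_
  · rw [norm_mul, Complex.norm_of_nonneg
      (pow_nonneg (sub_nonneg.mpr <| div_le_one_of_le₀ hx.2 <| by positivity) _),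
      norm_cpow_eq_rpow_re_of_pos hx.1, sub_re, one_re]
    have := hx.1
    gcongr
    exact Real.one_sub_div_pow_le_exp_neg hx.2
  · rw [intervalIntegrable_iff_integrableOn_Ioc_of_le (by positivity)]
    exact hint.mono_set hsub
  · rw [intervalIntegral.integral_of_le (by positivity)]
    refine setIntegral_mono_set hint ?_ hsub.eventuallyLE
    filter_upwards [ae_restrict_mem measurableSet_Ioi] with x hx
    have : (0:ℝ) < x := hx
    simp only [Pi.zero_apply]
    positivity

theorem Complex.hasDerivAt_GammaSeq {s : ℂ} (hs : 0 < s.re) {n : ℕ} (hn : n ≠ 0) :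
    HasDerivAt (fun s ↦ GammaSeq s n)
      (GammaSeq s n * (Real.log n - ∑ j ∈ Finset.range (n + 1), 1 / (s + j))) s := by
  have hne : ∀ j : ℕ, s + j ≠ 0 := fun j h ↦ by
    have := congrArg re h
    simp at this
    have : (0:ℝ) ≤ j := by positivity
    linarith
  have hprod : HasDerivAt (fun s : ℂ ↦ ∏ j ∈ Finset.range (n + 1), (s + (j:ℂ)))
      ((∏ j ∈ Finset.range (n + 1), (s + (j:ℂ))) * ∑ j ∈ Finset.range (n + 1), 1 / (s + j)) s := by
    have hd : DifferentiableAt ℂ (fun s : ℂ ↦ ∏ j ∈ Finset.range (n + 1), (s + (j:ℂ))) s := by fun_prop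
    have hP : ∏ j ∈ Finset.range (n + 1), (s + (j:ℂ)) ≠ 0 := Finset.prod_ne_zero_iff.2 fun j _ ↦ hne j
    have := logDeriv_prod (s := Finset.range (n + 1)) (f := fun (j : ℕ) (s : ℂ) ↦ s + (j:ℂ)) (x := s)
      (fun j _ ↦ hne j) (fun j _ ↦ by fun_prop)
    refine hd.hasDerivAt.congr_deriv ?_
    rw [logDeriv_apply, div_eq_iff hP] at this
    rw [this, mul_comm]
    congr 1
    refine Finset.sum_congr rfl fun j _ ↦ ?_
    simp [logDeriv_apply]
  have hP : ∏ j ∈ Finset.range (n + 1), (s + (j:ℂ)) ≠ 0 := Finset.prod_ne_zero_iff.2 fun j _ ↦ hne j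
  have hpow : HasDerivAt (fun s : ℂ ↦ (n:ℂ) ^ s * n.factorial) ((n:ℂ) ^ s * Complex.log n * 1 * n.factorial) s :=
    (HasDerivAt.const_cpow (hasDerivAt_id s) (Or.inl (by exact_mod_cast hn))).mul_const _
  refine (hpow.div hprod hP).congr_deriv ?_
  rw [GammaSeq, Complex.ofReal_log (by positivity), Complex.ofReal_natCast]
  field_simp

theorem Complex.tendsto_deriv_GammaSeq {s : ℂ} (hs : 0 < s.re) :
    Tendsto (fun n ↦ deriv (fun s ↦ GammaSeq s n) s) atTop (𝓝 (deriv Gamma s)) := by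
  set r := s.re / 2 with hr
  have hr0 : 0 < r := by positivity
  have hU : IsOpen {z : ℂ | 0 < z.re} := isOpen_lt continuous_const continuous_re
  have hsub : Metric.closedBall s r ⊆ {z : ℂ | 0 < z.re} := by
    intro z hz
    rw [mem_closedBall_iff_norm] at hz
    have := (abs_re_le_norm (z - s)).trans hz
    rw [sub_re, abs_le] at this
    simp only [mem_ofPred_eq]
    linarith
  have hsph : ∀ θ : ℝ, 0 < (circleMap s r θ).re := fun θ ↦
    hsub (Metric.sphere_subset_closedBall (circleMap_mem_sphere s hr0.le θ))
  have hdΓ : DifferentiableOn ℂ Gamma {z : ℂ | 0 < z.re} := fun z hz ↦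
    (differentiableAt_Gamma z fun m h ↦ by
      have h0 : 0 < z.re := hz
      have := congrArg re h
      simp at this
      have : (0:ℝ) ≤ m := by positivity
      linarith).differentiableWithinAt
  have hdS : ∀ n : ℕ, n ≠ 0 → DifferentiableOn ℂ (fun s ↦ GammaSeq s n) {z : ℂ | 0 < z.re} :=
    fun n hn z hz ↦ (hasDerivAt_GammaSeq hz hn).differentiableAt.differentiableWithinAt
  obtain ⟨M, hM⟩ : ∃ M, ∀ θ : ℝ, Real.Gamma (circleMap s r θ).re ≤ M := by
    have hc : ContinuousOn (fun z : ℂ ↦ Real.Gamma z.re) (Metric.sphere s r) := by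
      intro z hz
      have h0 : 0 < z.re := hsub (Metric.sphere_subset_closedBall hz)
      exact (ContinuousAt.comp (g := Real.Gamma) (Real.differentiableAt_Gamma fun m h ↦ by
        have : (0:ℝ) ≤ m := by positivity
        linarith).continuousAt continuous_re.continuousAt).continuousWithinAt
    obtain ⟨M, hM⟩ := (isCompact_sphere s r).bddAbove_image hc
    exact ⟨M, fun θ ↦ hM ⟨_, circleMap_mem_sphere s hr0.le θ, rfl⟩⟩
  rw [← cderiv_eq_deriv hU hdΓ hr0 hsub]
  have hev : (fun n ↦ cderiv r (fun s ↦ GammaSeq s n) s) =ᶠ[atTop]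
      fun n ↦ deriv (fun s ↦ GammaSeq s n) s := by
    filter_upwards [eventually_ne_atTop 0] with n hn
    exact cderiv_eq_deriv hU (hdS n hn) hr0 hsub
  refine Tendsto.congr' hev ?_
  unfold cderiv
  refine Tendsto.const_smul ?_ _
  unfold circleIntegral
  refine intervalIntegral.tendsto_integral_filter_of_dominated_convergence
    (fun _ ↦ r * ((r ^ 2)⁻¹ * M)) ?_ ?_ (by simp) ?_
  · filter_upwards [eventually_ne_atTop 0] with n hn
    have : Continuous fun θ : ℝ ↦ GammaSeq (circleMap s r θ) n :=
      continuous_iff_continuousAt.2 fun θ ↦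
        ContinuousAt.comp (g := fun s ↦ GammaSeq s n) (hasDerivAt_GammaSeq (hsph θ) hn).continuousAt (continuous_circleMap s r).continuousAt
    refine Continuous.aestronglyMeasurable ?_
    have h2 : Continuous fun θ : ℝ ↦ ((circleMap s r θ - s) ^ 2)⁻¹ := by
      refine Continuous.inv₀ (by fun_prop) fun θ ↦ ?_
      simp [circleMap, hr0.ne']
    simp only [deriv_circleMap]
    fun_prop
  · filter_upwards [eventually_ne_atTop 0] with n hn
    refine MeasureTheory.ae_of_all _ fun θ _ ↦ ?_
    simp only [deriv_circleMap, norm_smul, norm_mul, norm_inv, norm_pow, norm_I, mul_one,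
      circleMap_sub_center, norm_circleMap_zero, abs_of_pos hr0]
    gcongr
    exact (norm_GammaSeq_le (hsph θ) hn).trans (hM θ)
  · refine MeasureTheory.ae_of_all _ fun θ _ ↦ ?_
    exact ((GammaSeq_tendsto_Gamma _).const_smul _).const_smul _

theorem Complex.tendsto_log_sub_sum_digamma {s : ℂ} (hs : 0 < s.re) :
    Tendsto (fun n : ℕ ↦ (Real.log n : ℂ) - ∑ j ∈ Finset.range (n + 1), 1 / (s + j)) atTop
      (𝓝 (digamma s)) := by
  have hΓ := Gamma_ne_zero_of_re_pos hs
  have h := (tendsto_deriv_GammaSeq hs).div (GammaSeq_tendsto_Gamma s) hΓ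
  refine h.congr' ?_
  filter_upwards [eventually_ne_atTop 0, (GammaSeq_tendsto_Gamma s).eventually_ne hΓ] with n hn hne
  simp only [Pi.div_apply]
  rw [(hasDerivAt_GammaSeq hs hn).deriv, mul_div_cancel_left₀ _ hne]

theorem Complex.re_digamma_le {w : ℂ} (hw : 1 < w.re) :
    (digamma w).re ≤ Real.log ‖w‖ + 1 / (|w.im| + w.re - 1) := by
  set Φ : ℕ → ℝ := fun j ↦ Real.log ‖w + j‖ + 1 / (|w.im| + (w.re + j) - 1) with hΦ
  have hy : ∀ j : ℕ, 0 < |w.im| + (w.re + j) - 1 := fun j ↦ by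
    have := abs_nonneg w.im
    have : (0:ℝ) ≤ j := by positivity
    linarith
  have hpos : ∀ j : ℕ, 0 < ‖w + j‖ := fun j ↦ by
    refine norm_pos_iff.2 fun h ↦ ?_
    have := congrArg re h
    simp at this
    have : (0:ℝ) ≤ j := by positivity
    linarith
  have step : ∀ j : ℕ, Φ (j + 1) - Φ j ≤ (1 / (w + j)).re := by
    intro j
    set x := w.re + j with hx
    have hx1 : 1 < x := by
      have : (0:ℝ) ≤ j := by positivity
      linarith
    set t := |w.im|
    have ht : 0 ≤ t := abs_nonneg _
    have hn1 : ‖w + j‖ ^ 2 = x ^ 2 + t ^ 2 := by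
      rw [← Complex.normSq_eq_norm_sq, normSq_apply, sq_abs]; simp [hx]; ring
    have hn2 : ‖w + (j + 1 : ℕ)‖ ^ 2 = (x + 1) ^ 2 + t ^ 2 := by
      rw [← Complex.normSq_eq_norm_sq, normSq_apply, sq_abs]; simp [hx]; ring
    have hre : (1 / (w + j)).re = x / (x ^ 2 + t ^ 2) := by
      rw [← hn1, ← Complex.normSq_eq_norm_sq, one_div, inv_re]; simp [hx]
    have hlog : Real.log ‖w + (j + 1 : ℕ)‖ - Real.log ‖w + j‖ ≤ (2 * x + 1) / (2 * (x ^ 2 + t ^ 2)) := by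
      have h1 : Real.log (‖w + (j + 1 : ℕ)‖ ^ 2 / ‖w + j‖ ^ 2) ≤ ‖w + (j + 1 : ℕ)‖ ^ 2 / ‖w + j‖ ^ 2 - 1 :=
        Real.log_le_sub_one_of_pos (div_pos (pow_pos (hpos _) 2) (pow_pos (hpos _) 2))
      rw [Real.log_div (pow_pos (hpos _) 2).ne' (pow_pos (hpos _) 2).ne', Real.log_pow, Real.log_pow,
        hn1, hn2, Nat.cast_ofNat] at h1
      have h2 : ((x + 1) ^ 2 + t ^ 2) / (x ^ 2 + t ^ 2) - 1 = 2 * ((2 * x + 1) / (2 * (x ^ 2 + t ^ 2))) := by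
        have : x ^ 2 + t ^ 2 ≠ 0 := by positivity
        field_simp
        ring
      linarith
    have hyj := hy j
    have e1 : Φ (j + 1) - Φ j = (Real.log ‖w + (j + 1 : ℕ)‖ - Real.log ‖w + j‖) +
        (1 / (t + x) - 1 / (t + x - 1)) := by
      simp only [hΦ]
      push_cast
      rw [show t + (w.re + (j + 1)) - 1 = t + x by simp [hx]; ring]
      ring
    have h3 : 1 / (t + x - 1) - 1 / (t + x) ≥ 1 / (2 * (x ^ 2 + t ^ 2)) := by
      rw [div_sub_div _ _ (by linarith) (by linarith), ge_iff_le, div_le_div_iff₀ (by positivity) (mul_pos (by linarith) (by linarith))]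
      nlinarith [sq_nonneg (x - t)]
    have h4 : (2 * x + 1) / (2 * (x ^ 2 + t ^ 2)) - 1 / (2 * (x ^ 2 + t ^ 2)) = x / (x ^ 2 + t ^ 2) := by
      have : x ^ 2 + t ^ 2 ≠ 0 := by positivity
      field_simp
      ring
    rw [e1, hre]
    linarith
  have hsum : ∀ n : ℕ, Φ (n + 1) - Φ 0 ≤ (∑ j ∈ Finset.range (n + 1), 1 / (w + j)).re := by
    intro n
    rw [re_sum, ← Finset.sum_range_sub]
    exact Finset.sum_le_sum fun j _ ↦ step j
  have hlim := (continuous_re.tendsto _).comp (tendsto_log_sub_sum_digamma (by linarith : 0 < w.re))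
  have hΦ0 : Φ 0 = Real.log ‖w‖ + 1 / (|w.im| + w.re - 1) := by simp [hΦ]
  rw [← hΦ0]
  refine le_of_tendsto hlim ?_
  filter_upwards [eventually_gt_atTop 0] with n hn
  have h1 := hsum n
  have h2 : Real.log n ≤ Φ (n + 1) := by
    have h3 : Real.log n ≤ Real.log ‖w + (n + 1 : ℕ)‖ := by
      refine Real.log_le_log (by exact_mod_cast hn) ?_
      have := (le_abs_self _).trans (abs_re_le_norm (w + (n + 1 : ℕ)))
      simp at this ⊢
      linarith
    have : 0 ≤ 1 / (|w.im| + (w.re + (n + 1 : ℕ)) - 1) := (div_pos one_pos (hy _)).le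
    simp only [hΦ]
    linarith
  simp only [Function.comp_apply, sub_re, ofReal_re]
  linarith

theorem Complex.norm_digamma_le {w : ℂ} (hw : 1 / 2 ≤ w.re) : ‖digamma w‖ ≤ 4 + 2 * ‖w‖ := by
  have hlim := (tendsto_log_sub_sum_digamma (by linarith : 0 < w.re)).norm
  refine le_of_tendsto hlim ?_
  filter_upwards [eventually_gt_atTop 0] with n hn
  have hre : ∀ j : ℕ, 1 / 2 + (j:ℝ) ≤ ‖w + j‖ := fun j ↦ by
    have := (le_abs_self _).trans (abs_re_le_norm (w + j))
    simp at this
    linarith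
  have hpos : ∀ j : ℕ, 0 < ‖w + j‖ := fun j ↦ by
    have := hre j
    have : (0:ℝ) ≤ j := by positivity
    linarith
  have h1 : |Real.log n - ∑ j ∈ Finset.range n, 1 / ((j:ℝ) + 1)| ≤ 1 := by
    have ha := log_add_one_le_harmonic n
    have hb := harmonic_le_one_add_log n
    have hc : (harmonic n : ℝ) = ∑ j ∈ Finset.range n, 1 / ((j:ℝ) + 1) := by
      simp [harmonic]
    have hd : Real.log n ≤ Real.log (n + 1 : ℕ) := Real.log_le_log (by exact_mod_cast hn) (by push_cast; linarith)
    rw [← hc, abs_le]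
    constructor <;> linarith
  have hsq : ∀ m : ℕ, ∑ j ∈ Finset.range (m + 1), 1 / ((j:ℝ) + 1) ^ 2 ≤ 2 - 1 / ((m:ℝ) + 1) := by
    intro m
    induction m with
    | zero => norm_num
    | succ m ih =>
      rw [Finset.sum_range_succ]
      push_cast
      have : 1 / ((m:ℝ) + 1 + 1) ^ 2 ≤ 1 / (m + 1) - 1 / (m + 1 + 1) := by
        rw [div_sub_div _ _ (by positivity) (by positivity), div_le_div_iff₀ (by positivity) (by positivity)]
        nlinarith [(Nat.cast_nonneg m : (0:ℝ) ≤ m)]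
      linarith
  have h2 : ‖∑ j ∈ Finset.range n, (1 / ((j:ℂ) + 1) - 1 / (w + (j + 1 : ℕ)))‖ ≤ 2 * ‖w‖ := by
    refine (norm_sum_le _ _).trans ?_
    calc _ ≤ ∑ j ∈ Finset.range n, ‖w‖ * (1 / ((j:ℝ) + 1) ^ 2) := by
          refine Finset.sum_le_sum fun j _ ↦ ?_
          have hj : (j:ℂ) + 1 ≠ 0 := by exact_mod_cast j.succ_ne_zero
          have hwj : w + (j + 1 : ℕ) ≠ 0 := norm_pos_iff.1 (hpos _)
          rw [div_sub_div _ _ hj hwj, norm_div, norm_mul]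
          have e : ‖(1:ℂ) * (w + (j + 1 : ℕ)) - (j + 1) * 1‖ = ‖w‖ := by push_cast; ring_nf
          have e2 : ‖(j:ℂ) + 1‖ = (j:ℝ) + 1 := by exact_mod_cast Complex.norm_natCast (j + 1)
          rw [e, e2, mul_one_div]
          have := hre (j + 1)
          push_cast at this ⊢
          gcongr
          nlinarith
      _ = ‖w‖ * ∑ j ∈ Finset.range n, 1 / ((j:ℝ) + 1) ^ 2 := by rw [Finset.mul_sum]
      _ ≤ ‖w‖ * 2 := by
          gcongr
          refine (Finset.sum_le_sum_of_subset_of_nonneg (Finset.range_subset_range.2 n.le_succ)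
            fun j _ _ ↦ by positivity).trans ((hsq n).trans ?_)
          have : (0:ℝ) ≤ 1 / ((n:ℝ) + 1) := by positivity
          linarith
      _ = _ := mul_comm _ _
  have h3 : ‖1 / w‖ ≤ 2 := by
    have h := hre 0
    simp only [Nat.cast_zero, add_zero] at h
    rw [norm_div, norm_one, div_le_iff₀ (by linarith)]
    linarith
  have e : (Real.log n : ℂ) - ∑ j ∈ Finset.range (n + 1), 1 / (w + j) =
      ((Real.log n - ∑ j ∈ Finset.range n, 1 / ((j:ℝ) + 1) : ℝ) : ℂ) +
      ∑ j ∈ Finset.range n, (1 / ((j:ℂ) + 1) - 1 / (w + (j + 1 : ℕ))) - 1 / w := by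
    rw [Finset.sum_range_succ', Finset.sum_sub_distrib]
    push_cast
    simp
    ring
  rw [e]
  refine (norm_sub_le _ _).trans ?_
  have := norm_add_le ((Real.log n - ∑ j ∈ Finset.range n, 1 / ((j:ℝ) + 1) : ℝ) : ℂ) (∑ j ∈ Finset.range n, (1 / ((j:ℂ) + 1) - 1 / (w + (j + 1 : ℕ))))
  rw [Complex.norm_real, Real.norm_eq_abs] at this
  linarith

end

section
open Complex Filter Topology Set
open ArithmeticFunction

theorem hasSum_re_LSeries_vonMangoldt {σ : ℝ} (hσ : 1 < σ) (t : ℝ) :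
    HasSum (fun n : ℕ ↦ Λ n * (n : ℝ) ^ (-σ) * Real.cos (t * Real.log n))
      (LSeries (fun n ↦ (Λ n : ℂ)) (σ + t * I)).re := by
  have hs : 1 < ((σ : ℂ) + t * I).re := by simpa
  have h := hasSum_re (LSeriesSummable_vonMangoldt hs).LSeriesHasSum
  refine h.congr_fun fun n ↦ ?_
  rcases Nat.eq_zero_or_pos n with rfl | hn
  · simp
  have hn0 : (n : ℂ) ≠ 0 := by exact_mod_cast hn.ne'
  have hnr : (0:ℝ) < n := by exact_mod_cast hn
  rw [LSeries.term_of_ne_zero hn.ne', div_eq_mul_inv, ← cpow_neg, re_ofReal_mul, neg_add, cpow_add _ _ hn0]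
  rw [show -(σ:ℂ) = ((-σ : ℝ) : ℂ) by simp, ← ofReal_natCast, ← ofReal_cpow hnr.le, re_ofReal_mul,
    cpow_def_of_ne_zero (by exact_mod_cast hn.ne'), ← ofReal_log hnr.le,
    show (Real.log n : ℂ) * -(t * I) = ((-(t * Real.log n) : ℝ) : ℂ) * I by push_cast; ring,
    exp_ofReal_mul_I_re, Real.cos_neg, mul_assoc]

/-- A finite family of zeros of `ζ` in the critical strip together with the error function of the
corresponding truncated partial fraction expansion of `ζ'/ζ`. -/
structure ZetaZeros (K ε : ℝ) where
  ι : Type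
  fintype : Fintype ι
  ρ : ι → ℂ
  E : ℂ → ℂ
  re_pos : ∀ i, 0 < (ρ i).re
  re_lt_one : ∀ i, (ρ i).re < 1
  zeta_eq_zero : ∀ i, riemannZeta (ρ i) = 0
  differentiableOn : DifferentiableOn ℂ E (Metric.ball 0 K)
  norm_le : ∀ s ∈ Metric.ball 0 K, ‖E s‖ ≤ ε
  LSeries_eq : ∀ s : ℂ, 1 < s.re → ‖s‖ < K →
    LSeries (fun n ↦ (Λ n : ℂ)) s =
      1 / (s - 1) + (digamma (s / 2 + 1) - Real.log Real.pi) / 2 - ∑ i, 1 / (s - ρ i) - E s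

namespace ZetaZeros

theorem nonempty {ε K : ℝ} (hε : 0 < ε) (hK : 1 ≤ K) : Nonempty (ZetaZeros K ε) := by
  obtain ⟨ι, h, ρ, E, h1, h2, h3, h4⟩ := exists_LSeries_vonMangoldt_eq hε hK
  exact ⟨⟨ι, h, ρ, E, fun i ↦ (h1 i).1, fun i ↦ (h1 i).2.1, fun i ↦ (h1 i).2.2, h2, h3, h4⟩⟩

variable {K ε : ℝ} (Z : ZetaZeros K ε)

instance : Fintype Z.ι := Z.fintype

theorem re_one_div_sub (z : ℂ) (i : Z.ι) :
    (1 / (z - Z.ρ i)).re = (z.re - (Z.ρ i).re) / ((z.re - (Z.ρ i).re) ^ 2 + (z.im - (Z.ρ i).im) ^ 2) := by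
  rw [one_div, inv_re, normSq_apply, sub_re, sub_im]
  ring

theorem re_one_div_sub_nonneg {z : ℂ} (hz : 1 ≤ z.re) (i : Z.ι) : 0 ≤ (1 / (z - Z.ρ i)).re := by
  rw [re_one_div_sub]
  have := Z.re_lt_one i
  exact div_nonneg (by linarith) (by positivity)

theorem re_one_div {η t : ℝ} : (1 / (((1 + η : ℝ) : ℂ) + t * I - 1)).re = η / (η ^ 2 + t ^ 2) := by
  rw [one_div, inv_re, normSq_apply]
  simp [pow_two]

/-- `Re (Σ 1/(s - ρ) + L(Λ, s))`, bounded above through the partial fraction expansion. -/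
theorem sum_add_re_LSeries_le {s : ℂ} (hs : 1 < s.re) (hsK : ‖s‖ < K) :
    (∑ i, (1 / (s - Z.ρ i)).re) + (LSeries (fun n ↦ (Λ n : ℂ)) s).re ≤
      (1 / (s - 1)).re + ((digamma (s / 2 + 1)).re - Real.log Real.pi) / 2 + ε := by
  have h := congrArg re (Z.LSeries_eq s hs hsK)
  have hE := (neg_le_of_abs_le ((abs_re_le_norm (Z.E s)).trans (Z.norm_le s (by simpa using hsK))))
  have e : ((digamma (s / 2 + 1) - Real.log Real.pi) / 2).re = ((digamma (s / 2 + 1)).re - Real.log Real.pi) / 2 := by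
    rw [show (2:ℂ) = ((2:ℝ):ℂ) by simp, div_ofReal_re, sub_re, ofReal_re]
  rw [sub_re, sub_re, add_re, e, re_sum] at h
  linarith

theorem re_digamma_half_le {s : ℂ} (hs : 1 < s.re) :
    ((digamma (s / 2 + 1)).re - Real.log Real.pi) / 2 ≤
      Real.log (‖s + 2‖ / (2 * Real.pi)) / 2 + 1 / (|s.im| + s.re) := by
  have hw : (s / 2 + 1).re = s.re / 2 + 1 := by simp
  have hwi : (s / 2 + 1).im = s.im / 2 := by simp
  have h := re_digamma_le (w := s / 2 + 1) (by rw [hw]; linarith)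
  have hn : ‖s / 2 + 1‖ = ‖s + 2‖ / 2 := by
    rw [show s / 2 + 1 = (s + 2) / 2 by ring, norm_div]; simp
  have hpos : 0 < ‖s + 2‖ := norm_pos_iff.2 fun h ↦ by
    have := congrArg re h
    simp at this
    linarith
  rw [hn, hw, hwi, abs_div, abs_two] at h
  have e : 1 / (|s.im| / 2 + (s.re / 2 + 1) - 1) = 2 * (1 / (|s.im| + s.re)) := by
    have : |s.im| + s.re ≠ 0 := by positivity
    rw [show |s.im| / 2 + (s.re / 2 + 1) - 1 = (|s.im| + s.re) / 2 by ring]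
    field_simp
  have e2 : Real.log (‖s + 2‖ / (2 * Real.pi)) = Real.log (‖s + 2‖ / 2) - Real.log Real.pi := by
    rw [← Real.log_div (by positivity) (by positivity)]; congr 1; field_simp
  rw [e] at h
  linarith

theorem digamma_half_le_of_abs_le {η t : ℝ} (hη : 0 < η) (hη1 : η ≤ 1) :
    ((digamma ((((1 + η : ℝ) : ℂ) + t * I) / 2 + 1)).re - Real.log Real.pi) / 2 ≤
      Real.log ((|t| + 30) / 6) / 2 - 1 / 100 := by
  set s : ℂ := ((1 + η : ℝ) : ℂ) + t * I with hs
  have hre : s.re = 1 + η := by simp [hs]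
  have him : s.im = t := by simp [hs]
  refine (re_digamma_half_le (s := s) (by rw [hre]; linarith)).trans ?_
  have ht : 0 ≤ |t| := abs_nonneg t
  have hn : ‖s + 2‖ ≤ |t| + 4 := by
    refine (norm_le_abs_re_add_abs_im _).trans ?_
    simp only [add_re, add_im, hre, him]
    norm_num
    rw [abs_of_pos (by linarith)]
    linarith
  have hpos : 0 < ‖s + 2‖ := norm_pos_iff.2 fun h ↦ by
    have := congrArg re h
    simp [hre] at this
    linarith
  rw [hre, him]
  have h1 : 1 / (|t| + (1 + η)) ≤ 1 / (|t| + 1) := by gcongr; linarith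
  set y := 1 / (|t| + 1) with hy
  have hy1 : y ≤ 1 := by rw [hy, div_le_one (by positivity)]; linarith
  have hy0 : 0 < y := by positivity
  have h2 : Real.exp (2 * y) ≤ 1 + 6.4 * y := by
    have := convexOn_exp.2 (mem_univ 0) (mem_univ 2) (sub_nonneg.2 hy1) hy0.le (by ring)
    simp only [smul_eq_mul, Real.exp_zero] at this
    have e2 : Real.exp 2 ≤ 7.4 := by
      have := Real.exp_one_lt_d9
      rw [show (2:ℝ) = 1 + 1 by norm_num, Real.exp_add]
      nlinarith [Real.exp_pos 1]
    rw [show (1 - y) * 0 + y * 2 = 2 * y by ring] at this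
    nlinarith
  have h3 : ‖s + 2‖ / (2 * Real.pi) * Real.exp (2 * y) * Real.exp (1 / 50) ≤ (|t| + 30) / 6 := by
    have e3 : Real.exp (1 / 50) ≤ 1.0205 := by
      have := Real.exp_bound_div_one_sub_of_interval (x := 1 / 50) (by norm_num) (by norm_num)
      refine this.trans ?_
      norm_num
    have hpi := Real.pi_gt_d2
    have a1 : ‖s + 2‖ / (2 * Real.pi) ≤ (|t| + 4) / 6.28 := by
      gcongr; linarith
    have a2 : (|t| + 4) * (1 + 6.4 * y) ≤ |t| + 29.6 := by
      have : (|t| + 1) * y = 1 := by rw [hy]; field_simp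
      nlinarith
    calc _ ≤ (|t| + 4) / 6.28 * (1 + 6.4 * y) * 1.0205 := by gcongr
      _ = ((|t| + 4) * (1 + 6.4 * y)) / 6.28 * 1.0205 := by ring
      _ ≤ (|t| + 29.6) / 6.28 * 1.0205 := by gcongr
      _ ≤ _ := by
        rw [div_mul_eq_mul_div, div_le_div_iff₀ (by norm_num) (by norm_num)]
        norm_num
        linarith
  have h4 := Real.log_le_log (by positivity) h3
  rw [Real.log_mul (by positivity) (by positivity), Real.log_mul (by positivity) (by positivity),
    Real.log_exp, Real.log_exp] at h4
  linarith

theorem digamma_half_nonpos {η : ℝ} (hη : 0 < η) (hη1 : η ≤ 1) :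
    ((digamma (((1 + η : ℝ) : ℂ) / 2 + 1)).re - Real.log Real.pi) / 2 ≤ - 1 / 100 := by
  set w : ℂ := ((1 + η : ℝ) : ℂ) / 2 + 1 with hw
  set v : ℝ := (1 + η) / 2 + 1 with hv
  have hwv : w = (v : ℂ) := by simp [hw, hv]
  have hadd := digamma_apply_add_one w fun m h ↦ by
    rw [hwv] at h
    have := congrArg re h
    simp at this
    have : (0:ℝ) ≤ m := by positivity
    simp only [hv] at *
    linarith
  have h1 := re_digamma_le (w := w + 1) (by rw [hwv]; simp; linarith)
  rw [hadd, hwv] at h1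
  have e1 : ((v:ℂ) + 1) = ((v + 1 : ℝ) : ℂ) := by simp
  have hv1 : 0 < v := by positivity
  rw [e1, Complex.norm_real, ofReal_re, ofReal_im, add_re, Real.norm_of_nonneg (by positivity), ← ofReal_inv, ofReal_re] at h1
  rw [hwv]
  have e2 : 1 / (|0| + (v + 1) - 1) = v⁻¹ := by simp
  rw [e2] at h1
  have h3 : Real.log (v + 1) ≤ Real.log 3 := Real.log_le_log (by linarith) (by simp only [hv]; linarith)
  have h4 : Real.log 3 + 1 / 50 ≤ Real.log Real.pi := by
    have hpi := Real.pi_gt_d2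
    have e3 : Real.exp (1 / 50) ≤ 1.0205 := by
      have := Real.exp_bound_div_one_sub_of_interval (x := 1 / 50) (by norm_num) (by norm_num)
      refine this.trans ?_
      norm_num
    have := Real.log_le_log (by positivity) (show 3 * Real.exp (1 / 50) ≤ Real.pi by linarith)
    rwa [Real.log_mul (by norm_num) (by positivity), Real.log_exp] at this
  linarith

end ZetaZeros

/-- The real part of `-ζ'/ζ` at `σ + it`, as a Dirichlet series. -/
noncomputable def reLSeriesVonMangoldt (σ t : ℝ) : ℝ :=
  (LSeries (fun n ↦ (Λ n : ℂ)) (σ + t * I)).re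

theorem hasSum_reLSeriesVonMangoldt {σ : ℝ} (hσ : 1 < σ) (t : ℝ) :
    HasSum (fun n : ℕ ↦ Λ n * (n : ℝ) ^ (-σ) * Real.cos (t * Real.log n)) (reLSeriesVonMangoldt σ t) :=
  hasSum_re_LSeries_vonMangoldt hσ t

theorem reLSeriesVonMangoldt_quadratic_nonneg {α : Type*} (J : Finset α) (t : α → ℝ) (r : ℝ) {σ : ℝ}
    (hσ : 1 < σ) :
    0 ≤ r ^ 2 * reLSeriesVonMangoldt σ 0 + 2 * r * ∑ j ∈ J, reLSeriesVonMangoldt σ (t j) +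
      ∑ j ∈ J, ∑ k ∈ J, reLSeriesVonMangoldt σ (t j - t k) := by
  have h := (((hasSum_reLSeriesVonMangoldt hσ 0).mul_left (r ^ 2)).add
    ((hasSum_sum fun j (_ : j ∈ J) ↦ hasSum_reLSeriesVonMangoldt hσ (t j)).mul_left (2 * r))).add
    (hasSum_sum fun j (_ : j ∈ J) ↦ hasSum_sum fun k (_ : k ∈ J) ↦
      hasSum_reLSeriesVonMangoldt hσ (t j - t k))
  refine h.nonneg fun n ↦ ?_
  set u := Real.log n
  have e : r ^ 2 * (Λ n * (n : ℝ) ^ (-σ) * Real.cos (0 * u)) +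
      2 * r * ∑ j ∈ J, Λ n * (n : ℝ) ^ (-σ) * Real.cos (t j * u) +
      ∑ j ∈ J, ∑ k ∈ J, Λ n * (n : ℝ) ^ (-σ) * Real.cos ((t j - t k) * u) =
      Λ n * (n : ℝ) ^ (-σ) * ((r + ∑ j ∈ J, Real.cos (t j * u)) ^ 2 + (∑ j ∈ J, Real.sin (t j * u)) ^ 2) := by
    simp_rw [← Finset.mul_sum, sub_mul, Real.cos_sub, Finset.sum_add_distrib, ← Finset.mul_sum,
      ← Finset.sum_mul]
    simp
    ring
  rw [e]
  have : 0 ≤ Λ n := vonMangoldt_nonneg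
  positivity

theorem reLSeriesVonMangoldt_trig_nonneg {σ : ℝ} (hσ : 1 < σ) (t : ℝ) :
    0 ≤ 5 * reLSeriesVonMangoldt σ 0 + 8 * reLSeriesVonMangoldt σ t + 4 * reLSeriesVonMangoldt σ (2 * t) +
      reLSeriesVonMangoldt σ (3 * t) := by
  have h := ((((hasSum_reLSeriesVonMangoldt hσ 0).mul_left 5).add
    ((hasSum_reLSeriesVonMangoldt hσ t).mul_left 8)).add
    ((hasSum_reLSeriesVonMangoldt hσ (2 * t)).mul_left 4)).add (hasSum_reLSeriesVonMangoldt hσ (3 * t))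
  refine h.nonneg fun n ↦ ?_
  set u := Real.log n
  have e : 5 * (Λ n * (n : ℝ) ^ (-σ) * Real.cos (0 * u)) + 8 * (Λ n * (n : ℝ) ^ (-σ) * Real.cos (t * u)) +
      4 * (Λ n * (n : ℝ) ^ (-σ) * Real.cos (2 * t * u)) + Λ n * (n : ℝ) ^ (-σ) * Real.cos (3 * t * u) =
      Λ n * (n : ℝ) ^ (-σ) * ((1 + Real.cos (t * u)) * (1 + 2 * Real.cos (t * u)) ^ 2) := by
    rw [mul_assoc 2, mul_assoc 3, Real.cos_two_mul, Real.cos_three_mul, zero_mul, Real.cos_zero]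
    ring
  rw [e]
  have : 0 ≤ Λ n := vonMangoldt_nonneg
  have : 0 ≤ 1 + Real.cos (t * u) := by linarith [Real.neg_one_le_cos (t * u)]
  positivity

theorem le_reLSeriesVonMangoldt_two : 1 / 4 + 1 / 30 ≤ reLSeriesVonMangoldt 2 0 := by
  have h := hasSum_reLSeriesVonMangoldt (σ := 2) (by norm_num) 0
  have h2 := sum_le_hasSum {2, 3} (fun n _ ↦ by
    have : 0 ≤ Λ n := vonMangoldt_nonneg
    rw [zero_mul, Real.cos_zero]
    positivity) h
  refine le_trans ?_ h2
  rw [Finset.sum_pair (by norm_num), vonMangoldt_apply_prime Nat.prime_two, vonMangoldt_apply_prime Nat.prime_three]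
  rw [Real.rpow_neg (by positivity), Real.rpow_neg (by positivity)]
  norm_num
  have h3 : Real.log 2 < Real.log 3 := Real.log_lt_log (by norm_num) (by norm_num)
  have h4 := Real.log_two_gt_d9
  have h5 : 3 * Real.log 2 ≤ 2 * Real.log 3 := by
    have := Real.log_le_log (by norm_num) (show (2:ℝ) ^ 3 ≤ 3 ^ 2 by norm_num)
    rw [Real.log_pow, Real.log_pow] at this
    exact_mod_cast this
  linarith

namespace ZetaZeros
variable {K ε : ℝ} (Z : ZetaZeros K ε)

/-- `Σ Re 1/(σ + it - ρ)` over the zeros of the family. -/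
noncomputable def sumRe (σ t : ℝ) : ℝ := ∑ i, (1 / ((σ : ℂ) + t * I - Z.ρ i)).re

theorem sumRe_nonneg {σ : ℝ} (hσ : 1 ≤ σ) (t : ℝ) : 0 ≤ Z.sumRe σ t :=
  Finset.sum_nonneg fun i _ ↦ Z.re_one_div_sub_nonneg (by simpa) i

theorem sum_le_sumRe {σ : ℝ} (hσ : 1 ≤ σ) (t : ℝ) (J : Finset Z.ι) :
    ∑ i ∈ J, (σ - (Z.ρ i).re) / ((σ - (Z.ρ i).re) ^ 2 + (t - (Z.ρ i).im) ^ 2) ≤ Z.sumRe σ t := by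
  refine le_trans (le_of_eq (Finset.sum_congr rfl fun i _ ↦ ?_))
    (Finset.sum_le_sum_of_subset_of_nonneg (Finset.subset_univ J) fun i _ _ ↦ Z.re_one_div_sub_nonneg (z := (σ : ℂ) + t * I) (by simpa) i)
  rw [re_one_div_sub]
  simp

theorem sumRe_add_le (hε : ε ≤ 1 / 100) {η t : ℝ} (hη : 0 < η) (hη1 : η ≤ 1) (ht : |t| + 2 < K) :
    Z.sumRe (1 + η) t + reLSeriesVonMangoldt (1 + η) t ≤
      η / (η ^ 2 + t ^ 2) + Real.log ((|t| + 30) / 6) / 2 := by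
  have hK : ‖((1 + η : ℝ) : ℂ) + t * I‖ < K := by
    refine (norm_le_abs_re_add_abs_im _).trans_lt ?_
    simp only [add_re, ofReal_re, mul_re, I_re, mul_zero, ofReal_im, I_im, sub_self, add_zero, add_im,
      mul_im, zero_add, mul_one]
    rw [abs_of_pos (by linarith)]
    linarith
  have h := Z.sum_add_re_LSeries_le (s := ((1 + η : ℝ) : ℂ) + t * I) (by simpa) hK
  rw [re_one_div] at h
  have h2 := digamma_half_le_of_abs_le (t := t) hη hη1
  unfold sumRe reLSeriesVonMangoldt
  linarith

theorem sumRe_add_le_zero (hε : ε ≤ 1 / 100) {η : ℝ} (hη : 0 < η) (hη1 : η ≤ 1) (hK2 : 2 < K) :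
    Z.sumRe (1 + η) 0 + reLSeriesVonMangoldt (1 + η) 0 ≤ 1 / η := by
  have hK : ‖((1 + η : ℝ) : ℂ) + (0 : ℝ) * I‖ < K := by
    simp only [ofReal_zero, zero_mul, add_zero, norm_real, Real.norm_eq_abs]
    rw [abs_of_pos (by linarith)]
    linarith
  have h := Z.sum_add_re_LSeries_le (s := ((1 + η : ℝ) : ℂ) + (0:ℝ) * I) (by simpa) hK
  rw [re_one_div] at h
  have h2 := digamma_half_nonpos hη hη1
  have e : η / (η ^ 2 + 0 ^ 2) = 1 / η := by field_simp; ring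
  unfold sumRe reLSeriesVonMangoldt
  rw [e, show ((1 + η : ℝ) : ℂ) + (0:ℝ) * I = ((1 + η : ℝ) : ℂ) by simp] at h
  rw [show ((1 + η : ℝ) : ℂ) + (0:ℝ) * I = ((1 + η : ℝ) : ℂ) by simp]
  linarith

theorem half_le_abs_im (hε : ε ≤ 1 / 100) (hK : 3 < K) (i : Z.ι) (hi : 9 / 10 ≤ (Z.ρ i).re) :
    1 / 2 ≤ |(Z.ρ i).im| := by
  by_contra! h
  have h1 := Z.sumRe_add_le_zero hε one_pos le_rfl (by linarith)
  have h2 := Z.sum_le_sumRe (σ := 1 + 1) (by norm_num) 0 {i}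
  have h3 := le_reLSeriesVonMangoldt_two
  rw [Finset.sum_singleton] at h2
  rw [show (2:ℝ) = 1 + 1 by norm_num] at h3
  have h4 := Z.re_lt_one i
  have h5 : (Z.ρ i).im ^ 2 < 1 / 4 := by
    rw [← sq_abs]
    nlinarith [abs_nonneg (Z.ρ i).im]
  have h6 : 3 / 4 ≤ (1 + 1 - (Z.ρ i).re) / ((1 + 1 - (Z.ρ i).re) ^ 2 + (0 - (Z.ρ i).im) ^ 2) := by
    rw [le_div_iff₀ (by nlinarith [sq_nonneg (0 - (Z.ρ i).im)])]
    nlinarith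
  linarith

theorem pole_le {η t : ℝ} (hη : 0 < η) (ht : 1 / 2 ≤ |t|) : η / (η ^ 2 + t ^ 2) ≤ 4 * η := by
  rw [div_le_iff₀ (by positivity)]
  have : 1 / 4 ≤ t ^ 2 := by rw [← sq_abs]; nlinarith
  have := sq_nonneg η
  nlinarith

theorem le_height {H : ℝ} (hH : 0 ≤ H) (h : 4 ≤ Real.log ((2 * H + 30) / 6)) : 100 ≤ H := by
  have h7 := (Real.le_log_iff_exp_le (by positivity)).1 h
  have h8 : (50 : ℝ) ≤ Real.exp 4 := by
    have := Real.exp_one_gt_d9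
    rw [show (4:ℝ) = 1 + 1 + 1 + 1 by norm_num, Real.exp_add, Real.exp_add, Real.exp_add]
    have h2 : 7.2 ≤ Real.exp 1 * Real.exp 1 := by nlinarith
    nlinarith
  linarith

theorem log_height_le {H x : ℝ} (hH : 100 ≤ H) (hx : |x| ≤ H) :
    Real.log ((|x| + 30) / 6) ≤ Real.log ((2 * H + 30) / 6) - 1 / 2 := by
  have h1 : Real.exp (1 / 2) ≤ 1.65 := by
    have := Real.exp_one_lt_d9
    have h2 : Real.exp (1 / 2) * Real.exp (1 / 2) = Real.exp 1 := by rw [← Real.exp_add]; norm_num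
    nlinarith [Real.exp_pos (1 / 2)]
  have h10 : (|x| + 30) / 6 * Real.exp (1 / 2) ≤ (2 * H + 30) / 6 := by
    have : (|x| + 30) / 6 * Real.exp (1 / 2) ≤ (|x| + 30) / 6 * 1.65 := by gcongr
    linarith
  have h11 := Real.log_le_log (by positivity) h10
  rw [Real.log_mul (by positivity) (by positivity), Real.log_exp] at h11
  linarith

theorem log_three_mul_height_le {H y : ℝ} (hH : 100 ≤ H) (hy0 : 0 ≤ y) (hy : y ≤ H) :
    Real.log ((3 * y + 30) / 6) ≤ Real.log ((2 * H + 30) / 6) + 1 / 2 := by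
  have h9 : 1.5 ≤ Real.exp (1 / 2) := by have := Real.add_one_le_exp (1 / 2 : ℝ); linarith
  have h10 : (3 * y + 30) / 6 ≤ (2 * H + 30) / 6 * Real.exp (1 / 2) := by
    have : (2 * H + 30) / 6 * 1.5 ≤ (2 * H + 30) / 6 * Real.exp (1 / 2) := by gcongr
    linarith
  have h11 := Real.log_le_log (by positivity) h10
  rwa [Real.log_mul (by positivity) (by positivity), Real.log_exp] at h11

/-- Explicit classical zero-free region. -/
theorem zero_free (hε : ε ≤ 1 / 100) {H l : ℝ} (hl : l = Real.log ((2 * H + 30) / 6)) (hl4 : 4 ≤ l)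
    (hK : 3 * H + 3 < K) (i : Z.ι) (hi : |(Z.ρ i).im| ≤ H) : 1 / (20 * l) ≤ 1 - (Z.ρ i).re := by
  by_contra! hb
  set γ := (Z.ρ i).im with hγ
  set b := 1 - (Z.ρ i).re with hbdef
  have hH : 0 ≤ H := (abs_nonneg _).trans hi
  have hb0 : 0 < b := by have := Z.re_lt_one i; simp only [hbdef]; linarith
  have hl0 : 0 < l := by linarith
  set η := 1 / (5 * l) with hη
  have hη0 : 0 < η := by positivity
  have hηl : η * l = 1 / 5 := by rw [hη]; field_simp
  have hη1 : η ≤ 1 / 20 := by nlinarith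
  have hbl : b * l < 1 / 20 := by
    calc b * l < 1 / (20 * l) * l := by gcongr
      _ = _ := by field_simp
  have hγ1 : 1 / 2 ≤ |γ| := Z.half_le_abs_im hε (by linarith) i (by
    have : b < 1 / 10 := by nlinarith
    simp only [hbdef] at this
    linarith)
  have h0 := Z.sumRe_add_le_zero hε hη0 (by linarith) (by linarith)
  have h1 := Z.sumRe_add_le hε (t := γ) hη0 (by linarith) (by linarith)
  have h2 := Z.sumRe_add_le hε (t := 2 * γ) hη0 (by linarith) (by rw [abs_mul, abs_two]; linarith)
  have h3 := Z.sumRe_add_le hε (t := 3 * γ) hη0 (by linarith) (by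
    rw [abs_mul, abs_of_pos (by norm_num : (0:ℝ) < 3)]; linarith)
  have hpos := reLSeriesVonMangoldt_trig_nonneg (σ := 1 + η) (by linarith) γ
  have p1 := pole_le (t := γ) hη0 hγ1
  have p2 := pole_le (t := 2 * γ) hη0 (by rw [abs_mul, abs_two]; linarith)
  have p3 := pole_le (t := 3 * γ) hη0 (by rw [abs_mul, abs_of_pos (by norm_num : (0:ℝ) < 3)]; linarith)
  have d0 := Z.sumRe_nonneg (σ := 1 + η) (by linarith) 0
  have d2 := Z.sumRe_nonneg (σ := 1 + η) (by linarith) (2 * γ)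
  have d3 := Z.sumRe_nonneg (σ := 1 + η) (by linarith) (3 * γ)
  have d1 := Z.sum_le_sumRe (σ := 1 + η) (by linarith) γ {i}
  rw [Finset.sum_singleton, ← hγ, sub_self, show 1 + η - (Z.ρ i).re = η + b by simp only [hbdef]; ring] at d1
  have hH50 : 100 ≤ H := le_height hH (hl ▸ hl4)
  have l1 : Real.log ((|γ| + 30) / 6) ≤ l - 1 / 2 := hl ▸ log_height_le hH50 hi
  have l2 : Real.log ((|2 * γ| + 30) / 6) ≤ l := by
    rw [hl, abs_mul, abs_two]
    exact Real.log_le_log (by positivity) (by linarith)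
  have l3 : Real.log ((|3 * γ| + 30) / 6) ≤ l + 1 / 2 := by
    rw [hl, abs_mul, abs_of_pos (by norm_num : (0:ℝ) < 3)]
    exact log_three_mul_height_le hH50 (abs_nonneg γ) hi
  have key : 8 * ((η + b) / ((η + b) ^ 2 + 0 ^ 2)) ≤ 5 * (1 / η) + 6.5 * l - 1.75 + 52 * η := by
    clear_value η b γ
    clear hη hγ hbdef hbl hηl hl4 hK hi hl hγ1
    linarith
  have e1 : (η + b) / ((η + b) ^ 2 + 0 ^ 2) = 1 / (η + b) := by
    have : η + b ≠ 0 := by positivity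
    field_simp; ring
  have e2 : 1 / η = 5 * l := by rw [hη]; field_simp
  have e3 : 4 * l ≤ 1 / (η + b) := by
    rw [le_div_iff₀ (by positivity)]
    nlinarith
  rw [e1, e2] at key
  linarith

end ZetaZeros

theorem poisson_scale {η b B τ : ℝ} (hη : 0 < η) (hb : 0 ≤ b) (hbB : b ≤ B) :
    η / (η + B) * (η / (η ^ 2 + τ ^ 2)) ≤ (η + b) / ((η + b) ^ 2 + τ ^ 2) := by
  have h1 : η / (η + B) ≤ η / (η + b) := by gcongr
  have h2 : η / (η + b) * (η / (η ^ 2 + τ ^ 2)) ≤ (η + b) / ((η + b) ^ 2 + τ ^ 2) := by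
    rw [div_mul_div_comm, div_le_div_iff₀ (by positivity) (by positivity)]
    have : η * η ≤ (η + b) ^ 2 := by nlinarith
    nlinarith [mul_nonneg (sub_nonneg.2 this) (sq_nonneg τ)]
  refine le_trans ?_ h2
  gcongr

theorem card_bound_of_quadratic {N X l a p : ℝ} (hN : 0 < N) (hl : 0 < l) (ha : 0 < a)
    (hp : a / 2 ≤ p) (hX : N * (l / a) ≤ X)
    (hq : 0 < X * p - N * l / 2 → (X * p - N * l / 2) ^ 2 ≤ l / a * (X + N ^ 2 * l / 2))
    (hpos : 0 < (p - a / 2) ^ 2 - a / 2) :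
    N * ((p - a / 2) ^ 2 - a / 2) ≤ 1 := by
  obtain ⟨x, rfl⟩ : ∃ x, X = N * (l / a) * x := ⟨X / (N * (l / a)), by field_simp⟩
  have hx : 1 ≤ x := by
    have : 0 < N * (l / a) := by positivity
    nlinarith
  have hpa : a / 2 < p := lt_of_le_of_ne hp fun h ↦ by
    rw [← h] at hpos
    linarith
  have e1 : N * (l / a) * x * p - N * l / 2 = N * l / a * (x * p - a / 2) := by field_simp
  have h0 : 0 < x * p - a / 2 := by nlinarith
  have h1 := hq (by rw [e1]; positivity)
  rw [e1] at h1
  have e2 : l / a * (N * (l / a) * x + N ^ 2 * l / 2) = N * (l / a) ^ 2 * (x + N * (a / 2)) := by field_simp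
  have e3 : (N * l / a * (x * p - a / 2)) ^ 2 = N * (l / a) ^ 2 * (N * (x * p - a / 2) ^ 2) := by ring
  rw [e2, e3] at h1
  have h2 := le_of_mul_le_mul_left h1 (by positivity)
  have h3 : x * (p - a / 2) ^ 2 ≤ (x * p - a / 2) ^ 2 := by
    have : 0 ≤ (x - 1) * (x * p ^ 2 - (a / 2) ^ 2) := by
      refine mul_nonneg (by linarith) ?_
      nlinarith
    nlinarith
  have h4 : N * (a / 2) ≤ N * (a / 2) * x := by
    have : 0 < N * (a / 2) := by positivity
    nlinarith
  have h5 : x * (N * ((p - a / 2) ^ 2 - a / 2)) ≤ x * 1 := by nlinarith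
  exact le_of_mul_le_mul_left h5 (by linarith)

namespace ZetaZeros
variable {K ε : ℝ} (Z : ZetaZeros K ε)

/-- Few zeros lie close to the line `Re s = 1`. -/
theorem card_near_one_le (hε : ε ≤ 1 / 100) {H l : ℝ} (hl : l = Real.log ((2 * H + 30) / 6)) (hl4 : 4 ≤ l)
    (hK : 3 * H + 3 < K) {a lam : ℝ} (ha : 0 < a) (ha4 : a ≤ 1 / 4) (hlam : 0 ≤ lam) (hlam4 : lam ≤ 2 / 5)
    (hp : a / 2 ≤ a / (a + lam)) (hpos : 0 < (a / (a + lam) - a / 2) ^ 2 - a / 2) (J : Finset Z.ι)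
    (hJ : ∀ i ∈ J, |(Z.ρ i).im| ≤ H ∧ 1 - (Z.ρ i).re ≤ lam / l) :
    (J.card : ℝ) * ((a / (a + lam) - a / 2) ^ 2 - a / 2) ≤ 1 := by
  rcases J.eq_empty_or_nonempty with rfl | ⟨i0, hi0⟩
  · simp
  have hH : 0 ≤ H := (abs_nonneg _).trans (hJ i0 hi0).1
  have hH100 : 100 ≤ H := le_height hH (hl ▸ hl4)
  have hl0 : 0 < l := by linarith
  set η := a / l with hη
  have hη0 : 0 < η := by positivity
  have hη1 : η ≤ 1 / 16 := by
    rw [hη, div_le_iff₀ hl0]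
    linarith
  set γ : Z.ι → ℝ := fun i ↦ (Z.ρ i).im with hγ
  set P : ℝ → ℝ := fun τ ↦ η / (η ^ 2 + τ ^ 2) with hP
  have hN : (0:ℝ) < J.card := by exact_mod_cast Finset.card_pos.2 ⟨i0, hi0⟩
  have ep : η / (η + lam / l) = a / (a + lam) := by rw [hη]; field_simp
  set X := ∑ j ∈ J, ∑ k ∈ J, P (γ j - γ k) with hXdef
  have hX : (J.card : ℝ) * (l / a) ≤ X := by
    rw [← nsmul_eq_mul]
    refine Finset.card_nsmul_le_sum _ _ _ fun j hj ↦ ?_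
    have h := Finset.single_le_sum (f := fun k ↦ P (γ j - γ k))
      (fun k _ ↦ by simp only [hP]; positivity) hj
    refine le_trans (le_of_eq ?_) h
    simp only [hP, sub_self, hη]
    field_simp
    ring
  have hL : ∀ j ∈ J, (∑ k ∈ J, a / (a + lam) * P (γ j - γ k)) + reLSeriesVonMangoldt (1 + η) (γ j) ≤ l / 2 := by
    intro j hj
    obtain ⟨hj1, hj2⟩ := hJ j hj
    have h1 := Z.sumRe_add_le hε (t := γ j) hη0 (by linarith) (by simp only [hγ]; linarith)
    have h2 := Z.sum_le_sumRe (σ := 1 + η) (by linarith) (γ j) J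
    have h3 : ∑ k ∈ J, a / (a + lam) * P (γ j - γ k) ≤
        ∑ i ∈ J, (1 + η - (Z.ρ i).re) / ((1 + η - (Z.ρ i).re) ^ 2 + (γ j - (Z.ρ i).im) ^ 2) := by
      refine Finset.sum_le_sum fun k hk ↦ ?_
      have := poisson_scale (τ := γ j - γ k) hη0 (sub_nonneg.2 (Z.re_lt_one k).le) (hJ k hk).2
      rw [ep] at this
      rw [show 1 + η - (Z.ρ k).re = η + (1 - (Z.ρ k).re) by ring]
      exact this
    have h4 := pole_le (t := γ j) hη0 (Z.half_le_abs_im hε (by linarith) j (by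
      have : lam / l ≤ 1 / 10 := by rw [div_le_iff₀ hl0]; linarith
      linarith))
    have h5 : Real.log ((|γ j| + 30) / 6) ≤ l - 1 / 2 := hl ▸ log_height_le hH100 hj1
    linarith
  have hpair : ∑ j ∈ J, ∑ k ∈ J, reLSeriesVonMangoldt (1 + η) (γ j - γ k) ≤ X + (J.card : ℝ) ^ 2 * l / 2 := by
    have : X + (J.card : ℝ) ^ 2 * l / 2 = ∑ j ∈ J, ∑ k ∈ J, (P (γ j - γ k) + l / 2) := by
      simp only [Finset.sum_add_distrib, hXdef, Finset.sum_const, nsmul_eq_mul]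
      ring
    rw [this]
    refine Finset.sum_le_sum fun j hj ↦ Finset.sum_le_sum fun k hk ↦ ?_
    have h6 : |γ j - γ k| ≤ 2 * H := (abs_sub _ _).trans (by linarith [(hJ j hj).1, (hJ k hk).1])
    have h1 := Z.sumRe_add_le hε (t := γ j - γ k) hη0 (by linarith) (by linarith)
    have h2 := Z.sumRe_nonneg (σ := 1 + η) (by linarith) (γ j - γ k)
    have h3 : Real.log ((|γ j - γ k| + 30) / 6) ≤ l := by
      rw [hl]
      exact Real.log_le_log (by positivity) (by linarith)
    simp only [hP]
    linarith
  have h0 := Z.sumRe_add_le_zero hε hη0 (by linarith) (by linarith)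
  have d0 := Z.sumRe_nonneg (σ := 1 + η) (by linarith) 0
  have e1 : 1 / η = l / a := by rw [hη]; field_simp
  refine card_bound_of_quadratic (X := X) hN hl0 ha hp hX (fun hY ↦ ?_) hpos
  set Y := X * (a / (a + lam)) - J.card * l / 2 with hYdef
  have hS : ∑ j ∈ J, reLSeriesVonMangoldt (1 + η) (γ j) ≤ - Y := by
    have := Finset.sum_le_sum hL
    simp only [Finset.sum_add_distrib, Finset.sum_const, nsmul_eq_mul, ← Finset.mul_sum] at this
    rw [← hXdef] at this
    linarith
  have hq := reLSeriesVonMangoldt_quadratic_nonneg J γ (η * Y) (σ := 1 + η) (by linarith)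
  rw [← e1]
  have e2 : (η * Y) ^ 2 * reLSeriesVonMangoldt (1 + η) 0 ≤ (η * Y) ^ 2 * (1 / η) := by
    gcongr
    linarith
  have e3 : 2 * (η * Y) * ∑ j ∈ J, reLSeriesVonMangoldt (1 + η) (γ j) ≤ 2 * (η * Y) * (- Y) := by
    gcongr
  have e4 : (η * Y) ^ 2 * (1 / η) = η * Y ^ 2 := by field_simp
  have e5 : η * Y ^ 2 ≤ X + (J.card : ℝ) ^ 2 * l / 2 := by nlinarith
  rw [one_div, inv_mul_eq_div, le_div_iff₀ hη0]
  linarith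

end ZetaZeros

theorem Complex.differentiableAt_digamma {s : ℂ} (hs : 0 < s.re) : DifferentiableAt ℂ digamma s := by
  have hopen : IsOpen {z : ℂ | 0 < z.re} := isOpen_lt continuous_const continuous_re
  have hG : DifferentiableOn ℂ Gamma {z : ℂ | 0 < z.re} := fun z hz ↦
    (differentiableAt_Gamma z fun m h ↦ by
      have h0 : 0 < z.re := hz
      have : (0 : ℝ) ≤ m := m.cast_nonneg
      rw [h] at h0
      simp at h0
      linarith).differentiableWithinAt
  have h1 := (hG.deriv hopen).differentiableAt (hopen.mem_nhds hs)
  have h2 := hG.differentiableAt (hopen.mem_nhds hs)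
  exact h1.div h2 (Gamma_ne_zero_of_re_pos hs)

/-- The combination of derivatives of `f` at `1 + M` which turns `n ^ (-s)` into
`n ^ (-1 - M) * u ^ k` times a parabola in `u = log n` centred at `(k + 1) / M`. -/
noncomputable def windowFunctional (M : ℝ) (k : ℕ) (f : ℂ → ℂ) : ℂ :=
  (1 - ((k : ℂ) + 1) / 4) * ((-1) ^ k * iteratedDeriv k f (1 + M)) +
    M / 2 * ((-1) ^ (k + 1) * iteratedDeriv (k + 1) f (1 + M)) -
    M ^ 2 / (4 * ((k : ℂ) + 1)) * ((-1) ^ (k + 2) * iteratedDeriv (k + 2) f (1 + M))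

section windowFunctional

variable {M : ℝ} {k : ℕ} {f g : ℂ → ℂ}

theorem windowFunctional_congr (h : f =ᶠ[𝓝 (1 + (M : ℂ))] g) :
    windowFunctional M k f = windowFunctional M k g := by
  simp only [windowFunctional, h.iteratedDeriv_eq]

theorem windowFunctional_add (hf : AnalyticAt ℂ f (1 + M)) (hg : AnalyticAt ℂ g (1 + M)) :
    windowFunctional M k (fun s ↦ f s + g s) = windowFunctional M k f + windowFunctional M k g := by
  simp only [windowFunctional]
  rw [iteratedDeriv_fun_add hf.contDiffAt hg.contDiffAt, iteratedDeriv_fun_add hf.contDiffAt hg.contDiffAt,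
    iteratedDeriv_fun_add hf.contDiffAt hg.contDiffAt]
  ring

theorem windowFunctional_sub (hf : AnalyticAt ℂ f (1 + M)) (hg : AnalyticAt ℂ g (1 + M)) :
    windowFunctional M k (fun s ↦ f s - g s) = windowFunctional M k f - windowFunctional M k g := by
  simp only [windowFunctional]
  rw [iteratedDeriv_fun_sub hf.contDiffAt hg.contDiffAt, iteratedDeriv_fun_sub hf.contDiffAt hg.contDiffAt,
    iteratedDeriv_fun_sub hf.contDiffAt hg.contDiffAt]
  ring

theorem windowFunctional_sum {ι : Type*} (I : Finset ι) {F : ι → ℂ → ℂ}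
    (hF : ∀ i ∈ I, AnalyticAt ℂ (F i) (1 + M)) :
    windowFunctional M k (fun s ↦ ∑ i ∈ I, F i s) = ∑ i ∈ I, windowFunctional M k (F i) := by
  simp only [windowFunctional]
  rw [iteratedDeriv_fun_sum fun i hi ↦ (hF i hi).contDiffAt,
    iteratedDeriv_fun_sum fun i hi ↦ (hF i hi).contDiffAt,
    iteratedDeriv_fun_sum fun i hi ↦ (hF i hi).contDiffAt]
  simp only [Finset.mul_sum, ← Finset.sum_add_distrib, ← Finset.sum_sub_distrib]

theorem neg_one_pow_mul_iteratedDeriv_one_div_sub (j : ℕ) {s w : ℂ} (_ : s - w ≠ 0) :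
    (-1) ^ j * iteratedDeriv j (fun s ↦ 1 / (s - w)) s = j.factorial / (s - w) ^ (j + 1) := by
  have h1 := congrFun (iter_deriv_inv_linear_sub j (1 : ℂ) w) s
  simp only [one_mul, one_pow, mul_one] at h1
  simp only [one_div]
  rw [iteratedDeriv_eq_iterate, h1, ← mul_assoc, ← mul_assoc, ← mul_pow, neg_one_mul, neg_neg, one_pow,
    one_mul, div_eq_mul_inv, ← zpow_natCast, ← zpow_neg]
  congr 2
  push_cast
  ring

theorem windowFunctional_one_div_sub {w : ℂ} (h : (1 + M : ℂ) - w ≠ 0) :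
    windowFunctional M k (fun s ↦ 1 / (s - w)) = k.factorial / ((1 + M : ℂ) - w) ^ (k + 1) *
      (1 - ((k : ℂ) + 1) / 4 * ((1 - w) / ((1 + M : ℂ) - w)) ^ 2 - (M / ((1 + M : ℂ) - w)) ^ 2 / 4) := by
  have hk : ((k : ℂ) + 1) ≠ 0 := by exact_mod_cast k.succ_ne_zero
  simp only [windowFunctional, neg_one_pow_mul_iteratedDeriv_one_div_sub _ h]
  rw [show (1 - w : ℂ) = (1 + M) - w - M by ring]
  generalize (1 + M : ℂ) - w = z at *
  simp only [Nat.factorial_succ]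
  push_cast
  field_simp
  ring

theorem norm_windowFunctional_one_div_sub_le (hM : 0 < M) {w : ℂ} (h : w.re ≤ 1) :
    ‖windowFunctional M k (fun s ↦ 1 / (s - w))‖ ≤ k.factorial / M ^ (k + 1) *
      ((M / ‖(1 + M : ℂ) - w‖) ^ (k + 1) *
        (5 / 4 + ((k : ℝ) + 1) / 4 * (‖1 - w‖ / ‖(1 + M : ℂ) - w‖) ^ 2)) := by
  have hz : M ≤ ‖(1 + M : ℂ) - w‖ := by
    refine le_trans ?_ (re_le_norm _)
    simp; linarith
  have hz0 : (1 + M : ℂ) - w ≠ 0 := by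
    rw [← norm_pos_iff]; linarith
  rw [windowFunctional_one_div_sub hz0, norm_mul, norm_div, norm_pow, norm_natCast]
  have h1 : ‖(1 : ℂ) - ((k : ℂ) + 1) / 4 * ((1 - w) / ((1 + M : ℂ) - w)) ^ 2 -
      (M / ((1 + M : ℂ) - w)) ^ 2 / 4‖ ≤
      5 / 4 + ((k : ℝ) + 1) / 4 * (‖1 - w‖ / ‖(1 + M : ℂ) - w‖) ^ 2 := by
    refine (norm_sub_le _ _).trans ?_
    have h2 : ‖(M / ((1 + M : ℂ) - w)) ^ 2 / 4‖ ≤ 1 / 4 := by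
      rw [norm_div, norm_pow, norm_div, norm_real, Real.norm_of_nonneg hM.le]
      have : M / ‖(1 + M : ℂ) - w‖ ≤ 1 := (div_le_one (by linarith)).2 hz
      have h0 : 0 ≤ M / ‖(1 + M : ℂ) - w‖ := by positivity
      norm_num
      nlinarith
    have h3 := norm_sub_le (1 : ℂ) (((k : ℂ) + 1) / 4 * ((1 - w) / ((1 + M : ℂ) - w)) ^ 2)
    have h4 : ‖((k : ℂ) + 1) / 4 * ((1 - w) / ((1 + M : ℂ) - w)) ^ 2‖ =
        ((k : ℝ) + 1) / 4 * (‖1 - w‖ / ‖(1 + M : ℂ) - w‖) ^ 2 := by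
      rw [norm_mul, norm_pow, norm_div, norm_div]
      congr 2
      · exact_mod_cast Complex.norm_natCast (k + 1)
      · norm_num
    rw [h4, norm_one] at h3
    linarith
  have hzp : 0 < ‖(1 + M : ℂ) - w‖ := by linarith
  calc _ ≤ k.factorial / ‖(1 + M : ℂ) - w‖ ^ (k + 1) *
        (5 / 4 + ((k : ℝ) + 1) / 4 * (‖1 - w‖ / ‖(1 + M : ℂ) - w‖) ^ 2) := by gcongr
    _ = _ := by
      rw [div_pow M]
      generalize ‖(1 + M : ℂ) - w‖ = Y at *
      generalize (5 / 4 + ((k : ℝ) + 1) / 4 * (‖1 - w‖ / Y) ^ 2) = B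
      field_simp

theorem norm_windowFunctional_le (hM : 0 < M) {C R : ℝ} (hR : M ≤ R) 
    (hf : DiffContOnCl ℂ f (Metric.ball (1 + (M : ℂ)) R))
    (hC : ∀ z ∈ Metric.sphere (1 + (M : ℂ)) R, ‖f z‖ ≤ C) :
    ‖windowFunctional M k f‖ ≤ k.factorial * C / R ^ k * ((k : ℝ) + 3) := by
  have hR0 : 0 < R := hM.trans_le hR
  have hC0 : 0 ≤ C := (norm_nonneg _).trans (hC (1 + M + R) (by simp [abs_of_pos hR0]))
  have hd (j : ℕ) : ‖(-1) ^ j * iteratedDeriv j f (1 + M)‖ ≤ j.factorial * C / R ^ j := by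
    rw [norm_mul, norm_pow, norm_neg, norm_one, one_pow, one_mul]
    exact norm_iteratedDeriv_le_of_forall_mem_sphere_norm_le j hR0 hf hC
  have hk : ‖(k : ℂ) + 1‖ = (k : ℝ) + 1 := by exact_mod_cast Complex.norm_natCast (k + 1)
  have n1 : ‖(1 - ((k : ℂ) + 1) / 4)‖ ≤ 1 + ((k : ℝ) + 1) / 4 := by
    refine (norm_sub_le _ _).trans ?_
    rw [norm_div, hk]
    norm_num
  have n2 : ‖(M : ℂ) / 2‖ = M / 2 := by
    rw [norm_div, norm_real, Real.norm_of_nonneg hM.le]; norm_num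
  have n3 : ‖(M : ℂ) ^ 2 / (4 * ((k : ℂ) + 1))‖ = M ^ 2 / (4 * ((k : ℝ) + 1)) := by
    rw [norm_div, norm_pow, norm_real, Real.norm_of_nonneg hM.le, norm_mul, hk]; norm_num
  have e1 : ((k + 1).factorial : ℝ) * C / R ^ (k + 1) = k.factorial * C / R ^ k * (((k : ℝ) + 1) / R) := by
    rw [Nat.factorial_succ]; push_cast; rw [pow_succ]; field_simp
  have e2 : ((k + 2).factorial : ℝ) * C / R ^ (k + 2) =
      k.factorial * C / R ^ k * (((k : ℝ) + 2) * ((k : ℝ) + 1) / R ^ 2) := by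
    rw [Nat.factorial_succ, Nat.factorial_succ]; push_cast; rw [pow_add]; field_simp; ring
  set A := k.factorial * C / R ^ k with hA
  have hA0 : 0 ≤ A := by positivity
  calc _ ≤ (1 + ((k : ℝ) + 1) / 4) * A + M / 2 * (A * (((k : ℝ) + 1) / R)) +
        M ^ 2 / (4 * ((k : ℝ) + 1)) * (A * (((k : ℝ) + 2) * ((k : ℝ) + 1) / R ^ 2)) := by
        rw [windowFunctional]
        refine (norm_sub_le _ _).trans (add_le_add ((norm_add_le _ _).trans (add_le_add ?_ ?_)) ?_)
        · rw [norm_mul]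
          exact mul_le_mul n1 (hd k) (norm_nonneg _) (by positivity)
        · rw [norm_mul, n2, ← e1]
          exact mul_le_mul_of_nonneg_left (hd (k + 1)) (by positivity)
        · rw [norm_mul, n3, ← e2]
          exact mul_le_mul_of_nonneg_left (hd (k + 2)) (by positivity)
    _ = A * ((1 + ((k : ℝ) + 1) / 4) + ((k : ℝ) + 1) / 2 * (M / R) + ((k : ℝ) + 2) / 4 * (M / R) ^ 2) := by
        field_simp
    _ ≤ A * ((1 + ((k : ℝ) + 1) / 4) + ((k : ℝ) + 1) / 2 * 1 + ((k : ℝ) + 2) / 4 * 1 ^ 2) := by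
        have : M / R ≤ 1 := (div_le_one hR0).2 hR
        gcongr
    _ ≤ _ := by
        refine mul_le_mul_of_nonneg_left ?_ hA0
        linarith [k.cast_nonneg (α := ℝ)]

theorem LSeries.logMul_iterate (f : ℕ → ℂ) (m n : ℕ) :
    logMul^[m] f n = (Real.log n : ℂ) ^ m * f n := by
  induction m with
  | zero => simp
  | succ m ih =>
    rw [Function.iterate_succ_apply', LSeries.logMul, ih, Complex.natCast_log]
    ring

theorem hasSum_windowFunctional_LSeries (hM : 0 < M) :
    HasSum (fun n : ℕ ↦ Λ n * (n : ℝ) ^ (-(1 + M)) * Real.log n ^ k *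
      (1 - (M * Real.log n - (k + 1)) ^ 2 / (4 * (k + 1))))
      (windowFunctional M k (LSeries fun n ↦ (Λ n : ℂ))).re := by
  set f : ℕ → ℂ := fun n ↦ (Λ n : ℂ)
  have ha : LSeries.abscissaOfAbsConv f < ((1 + M : ℂ)).re := by
    refine lt_of_le_of_lt ?_ (b := ((1 : ℝ) : EReal)) ?_ 
    · refine LSeries.abscissaOfAbsConv_le_of_forall_lt_LSeriesSummable fun y hy ↦ ?_
      exact LSeriesSummable_vonMangoldt (by simpa using hy)
    · exact_mod_cast show (1 : ℝ) < (1 + M : ℂ).re by simpa using hM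
  have hs (j : ℕ) : HasSum (fun n ↦ LSeries.term (LSeries.logMul^[j] f) (1 + M) n)
      ((-1) ^ j * iteratedDeriv j (LSeries f) (1 + M)) := by
    rw [LSeries_iteratedDeriv j ha, ← mul_assoc, ← mul_pow, neg_one_mul, neg_neg, one_pow, one_mul]
    refine (LSeriesSummable_of_abscissaOfAbsConv_lt_re ?_).LSeriesHasSum
    rwa [LSeries.absicssaOfAbsConv_logPowMul]
  have h := hasSum_re ((((hs k).mul_left (1 - ((k : ℂ) + 1) / 4)).add
    ((hs (k + 1)).mul_left ((M : ℂ) / 2))).sub ((hs (k + 2)).mul_left (M ^ 2 / (4 * ((k : ℂ) + 1)))))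
  refine h.congr_fun fun n ↦ ?_
  rcases eq_or_ne n 0 with rfl | hn
  · simp
  have hk : ((k : ℝ) + 1) ≠ 0 := by exact_mod_cast k.succ_ne_zero
  rw [show (1 - ((k : ℂ) + 1) / 4) * LSeries.term (LSeries.logMul^[k] f) (1 + M) n +
      (M : ℂ) / 2 * LSeries.term (LSeries.logMul^[k + 1] f) (1 + M) n -
      (M : ℂ) ^ 2 / (4 * ((k : ℂ) + 1)) * LSeries.term (LSeries.logMul^[k + 2] f) (1 + M) n =
      ((Λ n * (n : ℝ) ^ (-(1 + M)) * Real.log n ^ k *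
      (1 - (M * Real.log n - (k + 1)) ^ 2 / (4 * (k + 1))) : ℝ) : ℂ) from ?_, ofReal_re]
  have hk' : ((k : ℂ) + 1) ≠ 0 := by exact_mod_cast k.succ_ne_zero
  simp only [LSeries.term_of_ne_zero hn, LSeries.logMul_iterate]
  push_cast
  rw [ofReal_cpow n.cast_nonneg]
  push_cast
  rw [cpow_neg]
  simp only [div_eq_mul_inv _ ((n : ℂ) ^ (1 + (M : ℂ)))]
  generalize ((n : ℂ) ^ (1 + (M : ℂ)))⁻¹ = P
  simp only [f]
  field_simp
  ring

end windowFunctional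

theorem vonMangoldt_mul_rpow_mul_log_pow_le {M : ℝ} (hM : 0 < M) (k : ℕ) {x : ℝ} (hx : 0 < x) {n : ℕ}
    (hn : x ≤ n) (hn1 : 1 ≤ n) :
    Λ n * (n : ℝ) ^ (-(1 + M)) * Real.log n ^ k ≤ k.factorial / M ^ k / x * Λ n := by
  have hn0 : (0 : ℝ) < n := by exact_mod_cast hn1
  have hlog : 0 ≤ Real.log n := Real.log_natCast_nonneg n
  have h1 := Real.pow_div_factorial_le_exp (M * Real.log n) (by positivity) k
  rw [div_le_iff₀ (by positivity), mul_pow] at h1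
  have h2 : (n : ℝ) ^ (-(1 + M)) = (n : ℝ)⁻¹ * Real.exp (-(M * Real.log n)) := by
    rw [neg_add, Real.rpow_add hn0, Real.rpow_neg_one, Real.rpow_def_of_pos hn0]
    ring_nf
  have h3 : Real.exp (-(M * Real.log n)) * Real.log n ^ k ≤ k.factorial / M ^ k := by
    rw [le_div_iff₀ (by positivity), Real.exp_neg, inv_mul_eq_div, div_mul_eq_mul_div,
      div_le_iff₀ (Real.exp_pos _)]
    linarith
  have h4 : (n : ℝ)⁻¹ ≤ x⁻¹ := inv_anti₀ hx hn
  have h5 : 0 ≤ Λ n := vonMangoldt_nonneg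
  calc _ = Λ n * ((n : ℝ)⁻¹ * (Real.exp (-(M * Real.log n)) * Real.log n ^ k)) := by rw [h2]; ring
    _ ≤ Λ n * (x⁻¹ * (k.factorial / M ^ k)) := by gcongr
    _ = _ := by ring

theorem re_windowFunctional_LSeries_le {M : ℝ} (hM : 0 < M) (k : ℕ) {x y : ℝ} (hx : 1 ≤ x) (hxy : x ≤ y)
    (hMx : M * Real.log x ≤ (k + 1) - 2 * √(k + 1)) (hMy : (k + 1) + 2 * √(k + 1) ≤ M * Real.log y)
    (hprime : ∀ p : ℕ, p.Prime → x ≤ p → ¬ (p : ℝ) ≤ y) :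
    (windowFunctional M k (LSeries fun n ↦ (Λ n : ℂ))).re ≤
      k.factorial / M ^ k / x * (2 * √y * Real.log y) := by
  have hx0 : 0 < x := by linarith
  have hy0 : 0 < y := by linarith
  refine le_trans ?_ (mul_le_mul_of_nonneg_left (Chebyshev.psi_sub_theta_le (hx.trans hxy)) (by positivity))
  rw [Chebyshev.psi_sub_theta_eq_sum_not_prime, Finset.mul_sum]
  set I := Finset.filter (fun n ↦ ¬ Nat.Prime n) (Finset.Ioc 0 ⌊y⌋₊) with hI
  have hsum : HasSum (fun n ↦ if n ∈ I then k.factorial / M ^ k / x * Λ n else 0) _ :=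
    hasSum_sum_of_ne_finset_zero (s := I) (fun b hb ↦ if_neg hb)
  rw [Finset.sum_congr rfl fun n hn ↦ if_pos hn] at hsum
  refine hasSum_le (fun n ↦ ?_) (hasSum_windowFunctional_LSeries (k := k) hM) hsum
  have hΛ : 0 ≤ Λ n := vonMangoldt_nonneg
  have hk : (0 : ℝ) < (k : ℝ) + 1 := by positivity
  rcases Nat.eq_zero_or_pos n with rfl | hn1
  · simp [hI]
  have hn0 : (0 : ℝ) < n := by exact_mod_cast hn1
  have hlog : 0 ≤ Real.log n := Real.log_natCast_nonneg n
  have hA : 0 ≤ Λ n * (n : ℝ) ^ (-(1 + M)) * Real.log n ^ k := by positivity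
  have hB : 0 ≤ (if n ∈ I then k.factorial / M ^ k / x * Λ n else 0) := by split_ifs <;> positivity
  rcases le_or_gt (4 * ((k : ℝ) + 1)) ((M * Real.log n - (k + 1)) ^ 2) with h | h
  · refine le_trans (mul_nonpos_of_nonneg_of_nonpos hA ?_) hB
    rw [sub_nonpos, one_le_div (by positivity)]
    exact h
  · have hsq : √((k : ℝ) + 1) ^ 2 = k + 1 := Real.sq_sqrt hk.le
    have habs := abs_lt_of_sq_lt_sq (a := M * Real.log n - (k + 1)) (b := 2 * √(k + 1))
      (by rw [mul_pow, hsq]; linarith) (by positivity)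
    rw [abs_lt] at habs
    have h1 : x ≤ n := by
      rw [← Real.log_le_log_iff hx0 hn0]
      exact le_of_mul_le_mul_left (by linarith) hM
    have h2 : (n : ℝ) ≤ y := by
      rw [← Real.log_le_log_iff hn0 hy0]
      exact le_of_mul_le_mul_left (by linarith) hM
    have h3 := vonMangoldt_mul_rpow_mul_log_pow_le hM k hx0 h1 hn1
    have h4 : 1 - (M * Real.log n - (k + 1)) ^ 2 / (4 * (k + 1)) ≤ 1 := by
      rw [sub_le_self_iff]; positivity
    refine (mul_le_of_le_one_right hA h4).trans (h3.trans (le_of_eq ?_))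
    rw [if_pos]
    simp only [hI, Finset.mem_filter, Finset.mem_Ioc]
    exact ⟨⟨hn1, Nat.le_floor h2⟩, fun hp ↦ hprime n hp h1 h2⟩

namespace ZetaZeros

variable {K ε : ℝ} (Z : ZetaZeros K ε)

theorem three_quarters_le (hε : ε ≤ 1 / 100) {M : ℝ} (hM : 0 < M) (hK : 2 * M + 3 < K) (k : ℕ) {x y : ℝ}
    (hx : 1 ≤ x) (hxy : x ≤ y)
    (hMx : M * Real.log x ≤ (k + 1) - 2 * √(k + 1)) (hMy : (k + 1) + 2 * √(k + 1) ≤ M * Real.log y)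
    (hprime : ∀ p : ℕ, p.Prime → x ≤ p → ¬ (p : ℝ) ≤ y) :
    3 / 4 ≤ ∑ i, (M / ‖(1 + M : ℂ) - Z.ρ i‖) ^ (k + 1) *
        (5 / 4 + ((k : ℝ) + 1) / 4 * (‖1 - Z.ρ i‖ / ‖(1 + M : ℂ) - Z.ρ i‖) ^ 2) +
      M * (M + 6) * (k + 3) * (M / (M + 2)) ^ k + M / x * (2 * √y * Real.log y) := by
  set R : ℂ → ℂ := fun s ↦ (digamma (s / 2 + 1) - Real.log Real.pi) / 2 - Z.E s with hR
  have hre : ∀ z ∈ Metric.closedBall (1 + (M : ℂ)) (M + 2), ‖z‖ ≤ 2 * M + 3 ∧ 1 / 2 ≤ (z / 2 + 1).re := by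
    intro z hz
    rw [mem_closedBall_iff_norm] at hz
    have h1 : ‖(1 + M : ℂ)‖ = 1 + M := by
      rw [← ofReal_one, ← ofReal_add, norm_real, Real.norm_of_nonneg (by linarith)]
    have h2 := norm_sub_norm_le z (1 + M : ℂ)
    have h3 := (abs_re_le_norm _).trans hz
    rw [abs_le] at h3
    simp at h3
    refine ⟨by linarith, ?_⟩
    have : (z / 2 + 1).re = z.re / 2 + 1 := by simp
    rw [this]
    linarith [h3.1]
  have hdiff : ∀ z ∈ Metric.closedBall (1 + (M : ℂ)) (M + 2), DifferentiableAt ℂ R z := by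
    intro z hz
    obtain ⟨h1, h2⟩ := hre z hz
    have hzK : z ∈ Metric.ball (0 : ℂ) K := by rw [mem_ball_zero_iff]; linarith
    have hE := Z.differentiableOn.differentiableAt (Metric.isOpen_ball.mem_nhds hzK)
    have hd : DifferentiableAt ℂ (fun s : ℂ ↦ digamma (s / 2 + 1)) z :=
      (Complex.differentiableAt_digamma (s := z / 2 + 1) (by linarith)).comp z
        (by fun_prop : DifferentiableAt ℂ (fun s : ℂ ↦ s / 2 + 1) z)
    exact ((hd.sub_const _).div_const _).sub hE
  have hDC : DiffContOnCl ℂ R (Metric.ball (1 + (M : ℂ)) (M + 2)) := by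
    refine DifferentiableOn.diffContOnCl fun z hz ↦ ?_
    rw [closure_ball _ (by linarith : M + 2 ≠ 0)] at hz
    exact (hdiff z hz).differentiableWithinAt
  have hnorm : ∀ z ∈ Metric.sphere (1 + (M : ℂ)) (M + 2), ‖R z‖ ≤ M + 6 := by
    intro z hz
    obtain ⟨h1, h2⟩ := hre z (Metric.sphere_subset_closedBall hz)
    have h3 := Complex.norm_digamma_le h2
    have h4 : ‖z / 2 + 1‖ ≤ M + 5 / 2 := by
      refine (norm_add_le _ _).trans ?_
      rw [norm_div, norm_one, Complex.norm_ofNat]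
      linarith
    have h5 := Z.norm_le z (by rw [mem_ball_zero_iff]; linarith)
    have h6 : ‖((Real.log Real.pi : ℝ) : ℂ)‖ ≤ 2 := by
      rw [norm_real, Real.norm_of_nonneg (Real.log_nonneg (by linarith [Real.pi_gt_three])),
        Real.log_le_iff_le_exp Real.pi_pos]
      have := Real.add_one_le_exp (1 : ℝ)
      have h7 : Real.exp 2 = Real.exp 1 * Real.exp 1 := by rw [← Real.exp_add]; norm_num
      nlinarith [Real.pi_lt_four]
    have h7 := norm_sub_le (digamma (z / 2 + 1)) ((Real.log Real.pi : ℝ) : ℂ)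
    refine (norm_sub_le _ _).trans ?_
    rw [norm_div, Complex.norm_ofNat]
    linarith
  have hRle := norm_windowFunctional_le (k := k) hM (by linarith) hDC hnorm
  have hz0 (w : ℂ) (hw : w.re ≤ 1) : (1 + M : ℂ) - w ≠ 0 := by
    refine fun h ↦ ?_
    have := congrArg re h
    simp at this
    linarith
  have hpole : AnalyticAt ℂ (fun s : ℂ ↦ 1 / (s - 1)) (1 + M) := by
    have := hz0 1 (by simp)
    fun_prop (disch := assumption)
  have hzero (i : Z.ι) : AnalyticAt ℂ (fun s : ℂ ↦ 1 / (s - Z.ρ i)) (1 + M) := by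
    have := hz0 (Z.ρ i) (Z.re_lt_one i).le
    fun_prop (disch := assumption)
  have hRan : AnalyticAt ℂ R (1 + M) :=
    hDC.differentiableOn.analyticAt (Metric.isOpen_ball.mem_nhds (Metric.mem_ball_self (by linarith)))
  have hsum : AnalyticAt ℂ (fun s ↦ ∑ i, 1 / (s - Z.ρ i)) (1 + (M : ℂ)) :=
    Finset.analyticAt_fun_sum _ fun i _ ↦ hzero i
  have heq : LSeries (fun n ↦ (Λ n : ℂ)) =ᶠ[𝓝 (1 + (M : ℂ))]
      fun s ↦ (1 / (s - 1) - ∑ i, 1 / (s - Z.ρ i)) + R s := by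
    have ho : IsOpen {s : ℂ | 1 < s.re ∧ ‖s‖ < K} :=
      (isOpen_lt continuous_const continuous_re).inter (isOpen_lt continuous_norm continuous_const)
    have hmem : (1 + M : ℂ) ∈ {s : ℂ | 1 < s.re ∧ ‖s‖ < K} := by
      refine ⟨by simpa using hM, ?_⟩
      rw [← ofReal_one, ← ofReal_add, norm_real, Real.norm_of_nonneg (by linarith)]
      linarith
    filter_upwards [ho.mem_nhds hmem] with s hs
    rw [Z.LSeries_eq s hs.1 hs.2]
    simp only [hR]
    ring
  have hwf := windowFunctional_congr (k := k) heq
  rw [windowFunctional_add (f := fun s ↦ 1 / (s - 1) - ∑ i, 1 / (s - Z.ρ i)) (hpole.sub hsum) hRan,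
    windowFunctional_sub hpole hsum, windowFunctional_sum _ fun i _ ↦ hzero i] at hwf
  have hre := re_windowFunctional_LSeries_le hM k hx hxy hMx hMy hprime
  have hS : ‖∑ i, windowFunctional M k (fun s ↦ 1 / (s - Z.ρ i))‖ ≤
      k.factorial / M ^ (k + 1) * ∑ i, (M / ‖(1 + M : ℂ) - Z.ρ i‖) ^ (k + 1) *
        (5 / 4 + ((k : ℝ) + 1) / 4 * (‖1 - Z.ρ i‖ / ‖(1 + M : ℂ) - Z.ρ i‖) ^ 2) := by
    refine (norm_sum_le _ _).trans ?_
    rw [Finset.mul_sum]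
    exact Finset.sum_le_sum fun i _ ↦ norm_windowFunctional_one_div_sub_le hM (Z.re_lt_one i).le
  have hP : windowFunctional M k (fun s ↦ 1 / (s - 1)) = ((k.factorial / M ^ (k + 1) * (3 / 4) : ℝ) : ℂ) := by
    rw [windowFunctional_one_div_sub (hz0 1 (by simp))]
    have : (M : ℂ) ≠ 0 := by exact_mod_cast hM.ne'
    push_cast
    rw [add_sub_cancel_left, sub_self, zero_div, div_self this]
    norm_num
  have hre2 := congrArg re hwf
  rw [hP, add_re, sub_re, ofReal_re] at hre2
  have h1 := (le_abs_self _).trans ((abs_re_le_norm _).trans hS)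
  have h2 := (neg_abs_le _).trans' (neg_le_neg ((abs_re_le_norm _).trans hRle))
  set S := ∑ i, (M / ‖(1 + M : ℂ) - Z.ρ i‖) ^ (k + 1) *
        (5 / 4 + ((k : ℝ) + 1) / 4 * (‖1 - Z.ρ i‖ / ‖(1 + M : ℂ) - Z.ρ i‖) ^ 2)
  have hF : (0 : ℝ) < k.factorial / M ^ (k + 1) := by positivity
  refine le_of_mul_le_mul_left ?_ hF
  have e1 : k.factorial / M ^ (k + 1) * (M * (M + 6) * (k + 3) * (M / (M + 2)) ^ k) =
      k.factorial * (M + 6) / (M + 2) ^ k * ((k : ℝ) + 3) := by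
    rw [div_pow, pow_succ]; field_simp
  have e2 : k.factorial / M ^ (k + 1) * (M / x * (2 * √y * Real.log y)) =
      k.factorial / M ^ k / x * (2 * √y * Real.log y) := by
    rw [pow_succ]; field_simp
  rw [mul_add, mul_add, e1, e2]
  linarith

end ZetaZeros

end

section
open Complex Filter Topology Set
open ArithmeticFunction
open scoped ArithmeticFunction.Moebius ArithmeticFunction.zeta

/-- The Möbius function restricted to integers coprime to `k`. -/
noncomputable def moebiusCoprime (k : ℕ) : ArithmeticFunction ℝ :=
  ⟨fun m ↦ if m.Coprime k then ((μ m : ℤ) : ℝ) else 0, by simp⟩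

theorem moebiusCoprime_apply (k m : ℕ) :
    moebiusCoprime k m = if m.Coprime k then ((μ m : ℤ) : ℝ) else 0 := rfl

theorem abs_moebiusCoprime_le (k m : ℕ) : |moebiusCoprime k m| ≤ 1 := by
  rw [moebiusCoprime_apply]
  split_ifs
  · exact_mod_cast abs_moebius_le_one
  · simp

theorem isMultiplicative_moebiusCoprime (k : ℕ) : (moebiusCoprime k).IsMultiplicative := by
  refine ⟨by simp [moebiusCoprime_apply], fun {m n} h ↦ ?_⟩
  simp only [moebiusCoprime_apply, Nat.coprime_mul_iff_left, isMultiplicative_moebius.map_mul_of_coprime h]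
  split_ifs <;> simp_all

theorem moebiusCoprime_mul_zeta_apply (k : ℕ) {n : ℕ} (hn : n ≠ 0) :
    (moebiusCoprime k * (ζ : ArithmeticFunction ℝ)) n = if n.primeFactors ⊆ k.primeFactors ∨ k = 0 then 1 else 0 := by
  set F : ArithmeticFunction ℝ := prodPrimeFactors fun p ↦ if p ∣ k then 1 else 0 with hF
  have hmul : moebiusCoprime k * (ζ : ArithmeticFunction ℝ) = F := by
    rw [((isMultiplicative_moebiusCoprime k).mul (isMultiplicative_zeta.natCast)).eq_iff_eq_on_prime_powers
      _ _ (IsMultiplicative.prodPrimeFactors _)]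
    intro p a hp
    rw [mul_comm, coe_zeta_mul_apply]
    rcases Nat.eq_zero_or_pos a with rfl | ha
    · simp [moebiusCoprime_apply]
    have h1 : F (p ^ a) = if p ∣ k then 1 else 0 := by
      rw [hF, prodPrimeFactors_apply (pow_ne_zero _ hp.ne_zero), Nat.primeFactors_prime_pow ha.ne' hp]
      simp
    obtain ⟨b, rfl⟩ := Nat.exists_eq_succ_of_ne_zero ha.ne'
    rw [h1, Nat.sum_divisors_prime_pow hp, Finset.sum_range_succ', Finset.sum_range_succ']
    have h2 : ∀ j ∈ Finset.range b, moebiusCoprime k (p ^ (j + 1 + 1)) = 0 := by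
      intro j _
      rw [moebiusCoprime_apply, moebius_apply_prime_pow hp (by omega)]
      simp
    rw [Finset.sum_eq_zero h2]
    simp only [moebiusCoprime_apply, zero_add, pow_one, pow_zero, Nat.coprime_one_left_eq_true, if_true,
      moebius_apply_prime hp, moebius_apply_one, hp.coprime_iff_not_dvd]
    split_ifs <;> simp_all
  rw [hmul, hF, prodPrimeFactors_apply hn]
  split_ifs with h
  · refine Finset.prod_eq_one fun p hp ↦ if_pos ?_
    rcases h with h | h
    · exact Nat.dvd_of_mem_primeFactors (h hp)
    · simp [h]
  · push Not at h
    obtain ⟨p, hp, hpk⟩ := Finset.not_subset.1 h.1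
    refine Finset.prod_eq_zero hp (if_neg fun hd ↦ hpk ?_)
    exact Nat.mem_primeFactors.2 ⟨Nat.prime_of_mem_primeFactors hp, hd, h.2⟩

theorem abs_sum_moebiusCoprime_div_le {k : ℕ} (hk : k ≠ 0) (N : ℕ) :
    |∑ m ∈ Finset.Ioc 0 N, moebiusCoprime k m / m| ≤ 1 := by
  rcases Nat.eq_zero_or_pos N with rfl | hN
  · simp
  have hN0 : (0 : ℝ) < N := by exact_mod_cast hN
  have h1 := sum_Ioc_mul_zeta_eq_sum (moebiusCoprime k) N
  have h2 : ∀ m ∈ Finset.Ioc 0 N, |(N : ℝ) * (moebiusCoprime k m / m) - moebiusCoprime k m * ((N / m : ℕ) : ℝ)| ≤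
      if m ≠ 1 ∧ m.Coprime k then 1 else 0 := by
    intro m hm
    have hm0 : (0 : ℝ) < m := by exact_mod_cast (Finset.mem_Ioc.1 hm).1
    have e : (N : ℝ) * (moebiusCoprime k m / m) - moebiusCoprime k m * ((N / m : ℕ) : ℝ) =
      moebiusCoprime k m * ((N : ℝ) / m - ((N / m : ℕ) : ℝ)) := by ring
    rw [e]
    split_ifs with h
    · have h3 := Nat.floor_div_eq_div (K := ℝ) N m
      have h4 := Nat.floor_le (show (0 : ℝ) ≤ (N : ℝ) / m by positivity)
      have h5 := Nat.lt_floor_add_one ((N : ℝ) / m)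
      rw [h3] at h4 h5
      rw [abs_mul, abs_of_nonneg (sub_nonneg.2 h4)]
      exact mul_le_one₀ (abs_moebiusCoprime_le k m) (sub_nonneg.2 h4) (by linarith)
    · rcases eq_or_ne m 1 with rfl | hm1
      · simp
      · rw [moebiusCoprime_apply, if_neg (fun h' ↦ h ⟨hm1, h'⟩)]
        simp
  have h3 : ∀ n ∈ Finset.Ioc 0 N, (moebiusCoprime k * (ζ : ArithmeticFunction ℝ)) n ≤
      1 - if n ≠ 1 ∧ n.Coprime k then 1 else 0 := by
    intro n hn
    have hn0 := (Finset.mem_Ioc.1 hn).1.ne'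
    rw [moebiusCoprime_mul_zeta_apply k hn0]
    split_ifs with h h' h'
    · exfalso
      obtain ⟨p, hp⟩ := Nat.nonempty_primeFactors.2 (show 1 < n by omega)
      have hpk := (h.resolve_right hk) hp
      exact Nat.not_coprime_of_dvd_of_dvd (Nat.prime_of_mem_primeFactors hp).one_lt
        (Nat.dvd_of_mem_primeFactors hp) (Nat.dvd_of_mem_primeFactors hpk) h'.2
    all_goals norm_num
  have h30 : ∀ n ∈ Finset.Ioc 0 N, 0 ≤ (moebiusCoprime k * (ζ : ArithmeticFunction ℝ)) n := by
    intro n hn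
    rw [moebiusCoprime_mul_zeta_apply k (Finset.mem_Ioc.1 hn).1.ne']
    split_ifs <;> norm_num
  have h4 := (Finset.abs_sum_le_sum_abs _ _).trans (Finset.sum_le_sum h2)
  rw [Finset.sum_sub_distrib, ← Finset.mul_sum, ← h1] at h4
  have h5 := Finset.sum_le_sum h3
  have h6 := Finset.sum_nonneg h30
  rw [Finset.sum_sub_distrib] at h5
  simp only [Finset.sum_const, Nat.card_Ioc, tsub_zero, nsmul_eq_mul, mul_one] at h5
  have h7 : |(N : ℝ) * ∑ m ∈ Finset.Ioc 0 N, moebiusCoprime k m / m| ≤ N := by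
    have := abs_sub_abs_le_abs_sub ((N : ℝ) * ∑ m ∈ Finset.Ioc 0 N, moebiusCoprime k m / m)
      (∑ n ∈ Finset.Ioc 0 N, (moebiusCoprime k * (ζ : ArithmeticFunction ℝ)) n)
    rw [abs_of_nonneg h6] at this
    linarith
  rw [abs_mul, abs_of_pos hN0] at h7
  exact (mul_le_iff_le_one_right hN0).1 h7

theorem abs_harmonic_sub_log_sub_le {t : ℝ} (ht : 1 ≤ t) :
    |(harmonic ⌊t⌋₊ : ℝ) - Real.log t - Real.eulerMascheroniConstant| ≤ 1 / t := by
  have ht0 : 0 < t := by linarith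
  set n := ⌊t⌋₊ with hn
  have hn1 : 1 ≤ n := Nat.le_floor (by simpa using ht)
  have hn0 : (0 : ℝ) < n := by exact_mod_cast hn1
  have h1 := Nat.floor_le ht0.le
  have h2 := Nat.lt_floor_add_one t
  rw [← hn] at h1 h2
  have g1 := Real.eulerMascheroniSeq_lt_eulerMascheroniConstant n
  have g2 := Real.eulerMascheroniConstant_lt_eulerMascheroniSeq' (n + 1)
  rw [Real.eulerMascheroniSeq] at g1
  rw [Real.eulerMascheroniSeq', if_neg (by omega), harmonic_succ] at g2
  push_cast at g2
  have h3 : Real.log ((n : ℝ) + 1) - Real.log t ≤ 1 / t := by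
    rw [← Real.log_div (by positivity) ht0.ne']
    refine (Real.log_le_sub_one_of_pos (by positivity)).trans ?_
    rw [div_sub_one ht0.ne']
    gcongr
    linarith
  have h4 : Real.log t ≤ Real.log ((n : ℝ) + 1) := Real.log_le_log ht0 h2.le
  have h5 : ((n : ℝ) + 1)⁻¹ ≤ 1 / t := by
    rw [one_div]
    exact inv_anti₀ ht0 h2.le
  rw [abs_le]
  constructor <;> linarith

theorem sum_inv_le_prod_primeFactors (k N : ℕ) :
    ∑ n ∈ Finset.Ioc 0 N with n.primeFactors ⊆ k.primeFactors, (n : ℝ)⁻¹ ≤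
      ∏ p ∈ k.primeFactors, (1 - (p : ℝ)⁻¹)⁻¹ := by
  set f : ℕ →* ℝ := ⟨⟨fun n ↦ (n : ℝ)⁻¹, by simp⟩, fun m n ↦ by simp [mul_comm]⟩ with hf
  have h := (EulerProduct.summable_and_hasSum_factoredNumbers_prod_filter_prime_geometric (f := f)
    (fun {p} hp ↦ by
      simp only [hf, MonoidHom.coe_mk, OneHom.coe_mk, norm_inv, RCLike.norm_natCast]
      exact inv_lt_one_of_one_lt₀ (by exact_mod_cast hp.one_lt)) k.primeFactors).2
  rw [Finset.filter_true_of_mem fun p hp ↦ Nat.prime_of_mem_primeFactors hp] at h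
  have h2 := (hasSum_subtype_iff_indicator (f := fun n ↦ f n)).1 h
  refine le_trans (le_of_eq ?_) (sum_le_hasSum ((Finset.Ioc 0 N).filter
    fun n ↦ n.primeFactors ⊆ k.primeFactors) (fun i _ ↦ ?_) h2)
  · refine Finset.sum_congr rfl fun n hn ↦ ?_
    rw [Finset.mem_filter, Finset.mem_Ioc] at hn
    rw [Set.indicator_of_mem]
    · rfl
    · exact Nat.mem_factoredNumbers_of_primeFactors_subset hn.1.1.ne' hn.2
  · refine Set.indicator_nonneg (fun n _ ↦ ?_) i
    simp [hf]

/-- The size of `∑ μ(m) log (y / m) / m` over `m` coprime to `k`. -/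
noncomputable def sieveBound (k : ℕ) : ℝ := ∏ p ∈ k.primeFactors, (1 - (p : ℝ)⁻¹)⁻¹ + 5 / 3

theorem abs_sum_moebiusCoprime_div_mul_log_le {k : ℕ} (hk : k ≠ 0) {y : ℝ} (hy : 1 ≤ y) :
    |∑ m ∈ Finset.Ioc 0 ⌊y⌋₊, moebiusCoprime k m / m * Real.log (y / m)| ≤ sieveBound k := by
  have hy0 : 0 < y := by linarith
  set γ := Real.eulerMascheroniConstant
  have hγ1 : 0 ≤ γ := by linarith [Real.one_half_lt_eulerMascheroniConstant]
  have hγ2 : γ ≤ 2 / 3 := Real.eulerMascheroniConstant_lt_two_thirds.le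
  set I := Finset.Ioc 0 ⌊y⌋₊
  have hI : ∀ m ∈ I, (0 : ℝ) < m ∧ (m : ℝ) ≤ y := fun m hm ↦ by
    have := Finset.mem_Ioc.1 hm
    exact ⟨by exact_mod_cast this.1, (Nat.cast_le.2 this.2).trans (Nat.floor_le hy0.le)⟩
  set f : ArithmeticFunction ℝ := ⟨fun m ↦ moebiusCoprime k m / m, by simp⟩ with hf
  set g : ArithmeticFunction ℝ := ⟨fun m ↦ (m : ℝ)⁻¹, by simp⟩ with hg
  have hfg (n : ℕ) : (f * g) n = (moebiusCoprime k * (ζ : ArithmeticFunction ℝ)) n * (n : ℝ)⁻¹ := by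
    rw [mul_apply, mul_apply, Finset.sum_mul]
    refine Finset.sum_congr rfl fun x hx ↦ ?_
    obtain ⟨h1, h2⟩ := Nat.mem_divisorsAntidiagonal.1 hx
    have h3 : x.2 ≠ 0 := by rintro h; simp [h] at h1; exact h2 h1.symm
    rw [natCoe_apply, zeta_apply_ne h3, ← h1]
    simp only [hf, hg, coe_mk]
    push_cast
    rw [mul_inv]
    ring
  have hconv := sum_Ioc_mul_eq_sum_sum f g ⌊y⌋₊
  have hharm : ∀ m ∈ I, ∑ j ∈ Finset.Ioc 0 (⌊y⌋₊ / m), g j = (harmonic ⌊y / m⌋₊ : ℝ) := by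
    intro m hm
    rw [← Nat.floor_div_natCast, harmonic_eq_sum_Icc]
    push_cast
    rfl
  replace hconv : ∑ n ∈ I, (f * g) n = ∑ m ∈ I, f m * (harmonic ⌊y / m⌋₊ : ℝ) :=
    hconv.trans (Finset.sum_congr rfl fun m hm ↦ by rw [hharm m hm])
  have hL : 0 ≤ ∑ n ∈ I, (f * g) n ∧ ∑ n ∈ I, (f * g) n ≤ ∏ p ∈ k.primeFactors, (1 - (p : ℝ)⁻¹)⁻¹ := by
    have e : ∑ n ∈ I, (f * g) n = ∑ n ∈ I with n.primeFactors ⊆ k.primeFactors, (n : ℝ)⁻¹ := by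
      rw [Finset.sum_filter]
      refine Finset.sum_congr rfl fun n hn ↦ ?_
      rw [hfg, moebiusCoprime_mul_zeta_apply k (Finset.mem_Ioc.1 hn).1.ne']
      simp [hk]
    rw [e]
    exact ⟨Finset.sum_nonneg fun n _ ↦ by positivity, sum_inv_le_prod_primeFactors k _⟩
  have hE : |∑ m ∈ I, moebiusCoprime k m / m * ((harmonic ⌊y / m⌋₊ : ℝ) - Real.log (y / m) - γ)| ≤ 1 := by
    calc _ ≤ ∑ m ∈ I, 1 / y := by
          refine (Finset.abs_sum_le_sum_abs _ _).trans (Finset.sum_le_sum fun m hm ↦ ?_)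
          obtain ⟨h1, h2⟩ := hI m hm
          have h3 := abs_harmonic_sub_log_sub_le (t := y / m) (by rwa [one_le_div h1])
          have h4 : |moebiusCoprime k m / m| ≤ 1 / m := by
            rw [abs_div, abs_of_pos h1]
            gcongr
            exact abs_moebiusCoprime_le k m
          rw [abs_mul]
          refine (mul_le_mul h4 h3 (abs_nonneg _) (by positivity)).trans (le_of_eq ?_)
          field_simp
      _ ≤ 1 := by
          simp only [I, Finset.sum_const, Nat.card_Ioc, tsub_zero, nsmul_eq_mul]
          rw [mul_one_div, div_le_one hy0]
          exact Nat.floor_le hy0.le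
  have hm := abs_sum_moebiusCoprime_div_le hk ⌊y⌋₊
  have e : ∑ m ∈ I, moebiusCoprime k m / m * ((harmonic ⌊y / m⌋₊ : ℝ) - Real.log (y / m) - γ) =
      ∑ n ∈ I, (f * g) n - ∑ m ∈ I, moebiusCoprime k m / m * Real.log (y / m) -
        γ * ∑ m ∈ I, moebiusCoprime k m / m := by
    rw [hconv, Finset.mul_sum, ← Finset.sum_sub_distrib, ← Finset.sum_sub_distrib]
    refine Finset.sum_congr rfl fun m _ ↦ ?_
    simp only [hf, coe_mk]
    ring
  rw [e] at hE
  have hγm : |γ * ∑ m ∈ I, moebiusCoprime k m / m| ≤ 2 / 3 := by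
    rw [abs_mul, abs_of_nonneg hγ1]
    nlinarith [abs_nonneg (∑ m ∈ I, moebiusCoprime k m / m)]
  have hP : (0 : ℝ) ≤ ∏ p ∈ k.primeFactors, (1 - (p : ℝ)⁻¹)⁻¹ := hL.1.trans hL.2
  rw [sieveBound]
  rw [abs_le] at *
  constructor <;> linarith [hL.1, hL.2, hE.1, hE.2, hγm.1, hγm.2]

theorem exp_neg_mul_max_eq {ε Y v : ℝ} (hv : 0 ≤ v) :
    Real.exp (-ε * v) * max (Y - v) 0 = Real.exp (-ε * Y) * max (Y - v) 0 +
      ∫ w in (0 : ℝ)..max Y 0, max (w - v) 0 * (Real.exp (-ε * w) * (ε ^ 2 * (Y - w) + 2 * ε)) := by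
  have hcont : Continuous fun w : ℝ ↦ max (w - v) 0 * (Real.exp (-ε * w) * (ε ^ 2 * (Y - w) + 2 * ε)) := by
    fun_prop
  rcases le_or_gt Y v with h | h
  · rw [max_eq_right (by linarith : Y - v ≤ 0)]
    rw [intervalIntegral.integral_congr (g := fun _ ↦ 0)]
    · simp
    · intro w hw
      rw [uIcc_of_le (le_max_right _ _)] at hw
      have : w ≤ v := hw.2.trans (max_le h hv)
      simp [max_eq_right (by linarith : w - v ≤ 0)]
  have hY : 0 ≤ Y := hv.trans h.le
  rw [max_eq_left (by linarith : 0 ≤ Y - v), max_eq_left hY,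
    ← intervalIntegral.integral_add_adjacent_intervals (hcont.intervalIntegrable 0 v)
      (hcont.intervalIntegrable v Y)]
  have h1 : ∫ w in (0 : ℝ)..v, max (w - v) 0 * (Real.exp (-ε * w) * (ε ^ 2 * (Y - w) + 2 * ε)) = 0 := by
    rw [intervalIntegral.integral_congr (g := fun _ ↦ 0)]
    · simp
    · intro w hw
      rw [uIcc_of_le hv] at hw
      simp [max_eq_right (by linarith [hw.2] : w - v ≤ 0)]
  have h2 : ∫ w in v..Y, max (w - v) 0 * (Real.exp (-ε * w) * (ε ^ 2 * (Y - w) + 2 * ε)) =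
      (Y - v) * (-Real.exp (-ε * Y)) + Real.exp (-ε * v) * (Y - v) := by
    rw [intervalIntegral.integral_congr
      (g := fun w ↦ (w - v) * (Real.exp (-ε * w) * (ε ^ 2 * (Y - w) + 2 * ε)))]
    · rw [intervalIntegral.integral_eq_sub_of_hasDerivAt (f := fun w ↦
        (w - v) * (Real.exp (-ε * w) * (-ε * (Y - w) - 1)) - Real.exp (-ε * w) * (Y - w))]
      · simp
      · intro w _
        have e : HasDerivAt (fun w : ℝ ↦ Real.exp (-ε * w)) (Real.exp (-ε * w) * (-ε)) w := by
          simpa using ((hasDerivAt_id w).const_mul (-ε)).exp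
        have e1 : HasDerivAt (fun w : ℝ ↦ Y - w) (-1) w := by simpa using (hasDerivAt_id w).const_sub Y
        have e2 : HasDerivAt (fun w : ℝ ↦ w - v) 1 w := (hasDerivAt_id w).sub_const v
        refine ((e2.mul (e.mul ((e1.const_mul (-ε)).sub_const 1))).sub (e.mul e1)).congr_deriv ?_
        simp only [Pi.mul_apply]
        ring
      · exact (by fun_prop : Continuous fun w : ℝ ↦
          (w - v) * (Real.exp (-ε * w) * (ε ^ 2 * (Y - w) + 2 * ε))).intervalIntegrable _ _
    · intro w hw
      rw [uIcc_of_le h.le] at hw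
      simp [max_eq_left (by linarith [hw.1] : 0 ≤ w - v)]
  rw [h1, h2]
  ring

theorem one_le_sieveBound (k : ℕ) : 1 ≤ sieveBound k := by
  rw [sieveBound]
  have : (0 : ℝ) ≤ ∏ p ∈ k.primeFactors, (1 - (p : ℝ)⁻¹)⁻¹ :=
    Finset.prod_nonneg fun p hp ↦ inv_nonneg.2 (sub_nonneg.2 (inv_le_one_of_one_le₀
      (by exact_mod_cast (Nat.prime_of_mem_primeFactors hp).one_le)))
  linarith

theorem abs_sum_moebiusCoprime_div_mul_max_le {k : ℕ} (hk : k ≠ 0) {N : ℕ} {w : ℝ}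
    (hw : Real.exp w < N + 1) :
    |∑ m ∈ Finset.Ioc 0 N, moebiusCoprime k m / m * max (w - Real.log m) 0| ≤ sieveBound k := by
  rcases lt_or_ge w 0 with h | h
  · rw [Finset.sum_eq_zero]
    · simpa using zero_le_one.trans (one_le_sieveBound k)
    · intro m _
      rw [max_eq_right (by linarith [Real.log_natCast_nonneg m]), mul_zero]
  have h1 := abs_sum_moebiusCoprime_div_mul_log_le hk (Real.one_le_exp h)
  refine (congrArg _ ?_).trans_le h1
  symm
  have hN : ⌊Real.exp w⌋₊ ≤ N := Nat.lt_succ_iff.1 ((Nat.floor_lt (Real.exp_nonneg w)).2 (by exact_mod_cast hw))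
  refine Finset.sum_subset_zero_on_sdiff (Finset.Ioc_subset_Ioc_right hN) (fun m hm ↦ ?_) (fun m hm ↦ ?_)
  · rw [Finset.mem_sdiff, Finset.mem_Ioc, Finset.mem_Ioc] at hm
    have h2 : ⌊Real.exp w⌋₊ < m := by
      by_contra! h3
      exact hm.2 ⟨hm.1.1, h3⟩
    rw [Nat.floor_lt (Real.exp_nonneg w)] at h2
    have := Real.log_le_log (Real.exp_pos w) h2.le
    rw [Real.log_exp] at this
    rw [max_eq_right (by linarith), mul_zero]
  · rw [Finset.mem_Ioc] at hm
    have h2 := Nat.le_floor_iff (Real.exp_nonneg w) |>.1 hm.2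
    have hm0 : (0 : ℝ) < m := by exact_mod_cast hm.1
    have := Real.log_le_log hm0 h2
    rw [Real.log_exp] at this
    rw [max_eq_left (by linarith), Real.log_div (Real.exp_pos w).ne' hm0.ne', Real.log_exp]

theorem abs_sum_moebiusCoprime_mul_rpow_mul_max_le {k : ℕ} (hk : k ≠ 0) {N : ℕ} {ε Y : ℝ} (hε : 0 ≤ ε)
    (hY : Real.exp Y < N + 1) :
    |∑ m ∈ Finset.Ioc 0 N, moebiusCoprime k m * (m : ℝ) ^ (-(1 + ε)) * max (Y - Real.log m) 0| ≤
      sieveBound k * (1 + ε * max Y 0) := by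
  set B := sieveBound k
  have hB : 0 ≤ B := zero_le_one.trans (one_le_sieveBound k)
  have hsplit : ∀ m ∈ Finset.Ioc 0 N, moebiusCoprime k m * (m : ℝ) ^ (-(1 + ε)) * max (Y - Real.log m) 0 =
      Real.exp (-ε * Y) * (moebiusCoprime k m / m * max (Y - Real.log m) 0) +
      ∫ w in (0 : ℝ)..max Y 0, moebiusCoprime k m / m * max (w - Real.log m) 0 *
        (Real.exp (-ε * w) * (ε ^ 2 * (Y - w) + 2 * ε)) := by
    intro m hm
    have hm0 : (0 : ℝ) < m := by exact_mod_cast (Finset.mem_Ioc.1 hm).1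
    have e : (m : ℝ) ^ (-(1 + ε)) = (m : ℝ)⁻¹ * Real.exp (-ε * Real.log m) := by
      rw [Real.rpow_def_of_pos hm0, ← Real.exp_log (inv_pos.2 hm0), Real.log_inv, ← Real.exp_add]
      congr 1
      ring
    have h := exp_neg_mul_max_eq (ε := ε) (Y := Y) (Real.log_natCast_nonneg m)
    simp_rw [mul_assoc (moebiusCoprime k m / m)]
    rw [intervalIntegral.integral_const_mul, e]
    calc _ = moebiusCoprime k m / m * (Real.exp (-ε * Real.log m) * max (Y - Real.log m) 0) := by ring
      _ = _ := by rw [h]; ring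
  rw [Finset.sum_congr rfl hsplit, Finset.sum_add_distrib, ← Finset.mul_sum,
    ← intervalIntegral.integral_finsetSum fun m _ ↦ Continuous.intervalIntegrable (by fun_prop) _ _]
  simp_rw [← Finset.sum_mul]
  rcases lt_or_ge Y 0 with h | h
  · rw [max_eq_right h.le, intervalIntegral.integral_same, Finset.sum_eq_zero]
    · simpa using hB
    · intro m _
      rw [max_eq_right (by linarith [Real.log_natCast_nonneg m]), mul_zero]
  rw [max_eq_left h]
  have hI : |∫ w in (0 : ℝ)..Y, (∑ m ∈ Finset.Ioc 0 N, moebiusCoprime k m / m * max (w - Real.log m) 0) *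
        (Real.exp (-ε * w) * (ε ^ 2 * (Y - w) + 2 * ε))| ≤
      ∫ w in (0 : ℝ)..Y, B * (Real.exp (-ε * w) * (ε ^ 2 * (Y - w) + 2 * ε)) := by
    rw [← Real.norm_eq_abs]
    refine intervalIntegral.norm_integral_le_of_norm_le h (Eventually.of_forall fun w hw ↦ ?_)
      (Continuous.intervalIntegrable (by fun_prop) _ _)
    have h1 := abs_sum_moebiusCoprime_div_mul_max_le hk (N := N) (w := w)
      ((Real.exp_le_exp.2 hw.2).trans_lt hY)
    have h2 : 0 ≤ Real.exp (-ε * w) * (ε ^ 2 * (Y - w) + 2 * ε) := by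
      have := sub_nonneg.2 hw.2
      positivity
    rw [norm_mul, Real.norm_eq_abs, Real.norm_of_nonneg h2]
    gcongr
  have hJ : ∫ w in (0 : ℝ)..Y, B * (Real.exp (-ε * w) * (ε ^ 2 * (Y - w) + 2 * ε)) =
      B * (1 + ε * Y - Real.exp (-ε * Y)) := by
    rw [intervalIntegral.integral_const_mul, intervalIntegral.integral_eq_sub_of_hasDerivAt (f := fun w ↦
        Real.exp (-ε * w) * (-ε * (Y - w) - 1))]
    · simp
      ring_nf
      simp
    · intro w _
      have e : HasDerivAt (fun w : ℝ ↦ Real.exp (-ε * w)) (Real.exp (-ε * w) * (-ε)) w := by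
        simpa using ((hasDerivAt_id w).const_mul (-ε)).exp
      have e1 : HasDerivAt (fun w : ℝ ↦ Y - w) (-1) w := by simpa using (hasDerivAt_id w).const_sub Y
      refine (e.mul ((e1.const_mul (-ε)).sub_const 1)).congr_deriv ?_
      ring
    · exact Continuous.intervalIntegrable (by fun_prop) _ _
  have hF := abs_sum_moebiusCoprime_div_mul_max_le hk hY
  refine (abs_add_le _ _).trans ?_
  rw [abs_mul, abs_of_pos (Real.exp_pos _)]
  have := mul_le_mul_of_nonneg_left hF (Real.exp_pos (-ε * Y)).le
  rw [hJ] at hI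
  linarith

theorem sum_Ioc_one_inv_mul_sub_one_le (N : ℕ) :
    ∑ n ∈ Finset.Ioc 1 N, ((n : ℝ) * (n - 1))⁻¹ ≤ 1 := by
  rcases Nat.eq_zero_or_pos N with rfl | hN
  · simp
  suffices h : ∑ n ∈ Finset.Ioc 1 N, ((n : ℝ) * (n - 1))⁻¹ = 1 - (N : ℝ)⁻¹ by
    rw [h]
    linarith [show (0 : ℝ) ≤ (N : ℝ)⁻¹ by positivity]
  induction N, hN using Nat.le_induction with
  | base => simp
  | succ n hn ih =>
    have hn0 : (0 : ℝ) < n := by exact_mod_cast hn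
    rw [Finset.sum_Ioc_succ_top (by omega), ih]
    push_cast
    rw [add_sub_cancel_right, mul_inv]
    have h1 : (n : ℝ) * (n : ℝ)⁻¹ = 1 := mul_inv_cancel₀ hn0.ne'
    have h2 : ((n : ℝ) + 1) * ((n : ℝ) + 1)⁻¹ = 1 := mul_inv_cancel₀ (by positivity)
    linear_combination (n : ℝ)⁻¹ * h2 - ((n : ℝ) + 1)⁻¹ * h1

theorem sum_squarefree_prod_inv_le (N : ℕ) :
    ∑ d ∈ Finset.Ioc 0 N with Squarefree d, ∏ p ∈ d.primeFactors, ((p : ℝ) * (p - 1))⁻¹ ≤ Real.exp 1 := by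
  set S := (Finset.Ioc 1 N).filter Nat.Prime
  have hpos : ∀ p : ℕ, p.Prime → (0 : ℝ) ≤ ((p : ℝ) * (p - 1))⁻¹ := fun p hp ↦ by
    have : (1 : ℝ) ≤ p := by exact_mod_cast hp.one_le
    exact inv_nonneg.2 (mul_nonneg (by linarith) (by linarith))
  have hinj : Set.InjOn Nat.primeFactors ((Finset.Ioc 0 N).filter Squarefree : Finset ℕ) := by
    intro a ha b hb hab
    simp only [Finset.coe_filter, Set.mem_ofPred_eq] at ha hb
    rw [← Nat.prod_primeFactors_of_squarefree ha.2, ← Nat.prod_primeFactors_of_squarefree hb.2, hab]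
  calc ∑ d ∈ Finset.Ioc 0 N with Squarefree d, ∏ p ∈ d.primeFactors, ((p : ℝ) * (p - 1))⁻¹ =
        ∑ t ∈ ((Finset.Ioc 0 N).filter Squarefree).image Nat.primeFactors, ∏ p ∈ t, ((p : ℝ) * (p - 1))⁻¹ :=
        (Finset.sum_image (f := fun t : Finset ℕ ↦ ∏ p ∈ t, ((p : ℝ) * (p - 1))⁻¹) hinj).symm
    _ ≤ ∑ t ∈ S.powerset, ∏ p ∈ t, ((p : ℝ) * (p - 1))⁻¹ := by
        refine Finset.sum_le_sum_of_subset_of_nonneg (fun t ht ↦ ?_) (fun t ht _ ↦ ?_)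
        · obtain ⟨d, hd, rfl⟩ := Finset.mem_image.1 ht
          rw [Finset.mem_filter, Finset.mem_Ioc] at hd
          rw [Finset.mem_powerset]
          intro p hp
          have hpp := Nat.prime_of_mem_primeFactors hp
          rw [Finset.mem_filter, Finset.mem_Ioc]
          exact ⟨⟨hpp.one_lt, (Nat.le_of_dvd hd.1.1 (Nat.dvd_of_mem_primeFactors hp)).trans hd.1.2⟩, hpp⟩
        · exact Finset.prod_nonneg fun p hp ↦ hpos p
            (Finset.mem_filter.1 (Finset.mem_powerset.1 ht hp)).2
    _ = ∏ p ∈ S, (1 + ((p : ℝ) * (p - 1))⁻¹) := (Finset.prod_one_add S).symm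
    _ ≤ ∏ p ∈ S, Real.exp (((p : ℝ) * (p - 1))⁻¹) := by
        refine Finset.prod_le_prod (fun p hp ↦ ?_) (fun p hp ↦ ?_)
        · linarith [hpos p (Finset.mem_filter.1 hp).2]
        · rw [add_comm]
          exact Real.add_one_le_exp _
    _ = Real.exp (∑ p ∈ S, ((p : ℝ) * (p - 1))⁻¹) := (Real.exp_sum _ _).symm
    _ ≤ Real.exp 1 := by
        refine Real.exp_le_exp.2 (le_trans ?_ (sum_Ioc_one_inv_mul_sub_one_le N))
        refine Finset.sum_le_sum_of_subset_of_nonneg (Finset.filter_subset _ _) fun n hn _ ↦ ?_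
        have : (1 : ℝ) ≤ n := by exact_mod_cast (Finset.mem_Ioc.1 hn).1.le
        exact inv_nonneg.2 (mul_nonneg (by linarith) (by linarith))

theorem sum_Ioc_inv_le (N : ℕ) : ∑ n ∈ Finset.Ioc 0 N, (n : ℝ)⁻¹ ≤ 1 + Real.log N := by
  have := harmonic_le_one_add_log N
  rw [harmonic_eq_sum_Icc] at this
  push_cast at this
  exact this

theorem sum_squarefree_inv_mul_prod_le (N : ℕ) :
    ∑ k ∈ Finset.Ioc 0 N with Squarefree k, (k : ℝ)⁻¹ * ∏ p ∈ k.primeFactors, (1 - (p : ℝ)⁻¹)⁻¹ ≤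
      Real.exp 1 * (1 + Real.log N) := by
  set h : ArithmeticFunction ℝ := ⟨fun d ↦ if Squarefree d then
    ∏ p ∈ d.primeFactors, ((p : ℝ) * (p - 1))⁻¹ else 0, by simp⟩ with hh
  set g : ArithmeticFunction ℝ := ⟨fun m ↦ (m : ℝ)⁻¹, by simp⟩ with hg
  have hh0 (d : ℕ) : 0 ≤ h d := by
    simp only [hh, coe_mk]
    split_ifs
    · refine Finset.prod_nonneg fun p hp ↦ ?_
      have : (1 : ℝ) ≤ p := by exact_mod_cast (Nat.prime_of_mem_primeFactors hp).one_le
      exact inv_nonneg.2 (mul_nonneg (by linarith) (by linarith))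
    · rfl
  have hg0 (d : ℕ) : 0 ≤ g d := by simp [hg]
  have hconv := sum_Ioc_mul_eq_sum_sum h g N
  have e : ∀ k : ℕ, Squarefree k → (k : ℝ)⁻¹ * ∏ p ∈ k.primeFactors, (1 - (p : ℝ)⁻¹)⁻¹ = (h * g) k := by
    intro k hk
    have h1 : ∏ p ∈ k.primeFactors, (1 - (p : ℝ)⁻¹)⁻¹ = ∏ p ∈ k.primeFactors, (1 + ((p : ℝ) - 1)⁻¹) := by
      refine Finset.prod_congr rfl fun p hp ↦ ?_
      have : (1 : ℝ) < p := by exact_mod_cast (Nat.prime_of_mem_primeFactors hp).one_lt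
      have h2 : (p : ℝ) - 1 ≠ 0 := by linarith
      have h3 : (p : ℝ) ≠ 0 := by linarith
      field_simp
      ring
    rw [h1]
    have h2 := IsMultiplicative.prodPrimeFactors_one_add_of_squarefree
      (IsMultiplicative.prodPrimeFactors (R := ℝ) fun p ↦ ((p : ℝ) - 1)⁻¹) hk
    have h3 : ∏ p ∈ k.primeFactors, (1 + ((p : ℝ) - 1)⁻¹) =
        ∏ p ∈ k.primeFactors, (1 + (prodPrimeFactors (R := ℝ) fun p ↦ ((p : ℝ) - 1)⁻¹) p) := by
      refine Finset.prod_congr rfl fun p hp ↦ ?_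
      have hp' := Nat.prime_of_mem_primeFactors hp
      rw [prodPrimeFactors_apply hp'.ne_zero, hp'.primeFactors, Finset.prod_singleton]
    rw [h3, h2, mul_apply, Nat.sum_divisorsAntidiagonal (f := fun a b ↦ h a * g b), Finset.mul_sum]
    refine Finset.sum_congr rfl fun d hd ↦ ?_
    obtain ⟨m, rfl⟩ := Nat.dvd_of_mem_divisors hd
    have hd0 : d ≠ 0 := by rintro rfl; simp at hk
    have hds : Squarefree d := hk.of_mul_left
    rw [Nat.mul_div_cancel_left _ (Nat.pos_of_ne_zero hd0), prodPrimeFactors_apply hd0]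
    simp only [hh, hg, coe_mk, if_pos hds]
    simp_rw [mul_inv]
    rw [Finset.prod_mul_distrib]
    have h4 : ∏ p ∈ d.primeFactors, (p : ℝ)⁻¹ = (d : ℝ)⁻¹ := by
      rw [Finset.prod_inv_distrib]
      rw [← Nat.cast_prod, Nat.prod_primeFactors_of_squarefree hds]
    rw [h4]
    push_cast
    rw [mul_inv]
    ring
  calc _ = ∑ k ∈ Finset.Ioc 0 N with Squarefree k, (h * g) k :=
        Finset.sum_congr rfl fun k hk ↦ e k (Finset.mem_filter.1 hk).2
    _ ≤ ∑ k ∈ Finset.Ioc 0 N, (h * g) k := by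
        refine Finset.sum_le_sum_of_subset_of_nonneg (Finset.filter_subset _ _) fun k _ _ ↦ ?_
        rw [mul_apply]
        exact Finset.sum_nonneg fun x _ ↦ mul_nonneg (hh0 _) (hg0 _)
    _ = ∑ n ∈ Finset.Ioc 0 N, h n * ∑ m ∈ Finset.Ioc 0 (N / n), g m := hconv
    _ ≤ ∑ n ∈ Finset.Ioc 0 N, h n * (1 + Real.log N) := by
        refine Finset.sum_le_sum fun n _ ↦ mul_le_mul_of_nonneg_left (le_trans ?_ (sum_Ioc_inv_le N)) (hh0 n)
        exact Finset.sum_le_sum_of_subset_of_nonneg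
          (Finset.Ioc_subset_Ioc_right (Nat.div_le_self N n)) fun m _ _ ↦ hg0 m
    _ ≤ _ := by
        rw [← Finset.sum_mul]
        have hlog : 0 ≤ 1 + Real.log N := by linarith [Real.log_natCast_nonneg N]
        refine mul_le_mul_of_nonneg_right ?_ hlog
        refine le_of_eq_of_le ?_ (sum_squarefree_prod_inv_le N)
        rw [Finset.sum_filter]
        rfl

theorem sum_squarefree_sieveBound_sq_le (N : ℕ) :
    ∑ k ∈ Finset.Ioc 0 N with Squarefree k,
      (k : ℝ)⁻¹ * (∏ p ∈ k.primeFactors, (1 - (p : ℝ)⁻¹)) * sieveBound k ^ 2 ≤ 9 * (1 + Real.log N) := by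
  have h1 : ∀ k ∈ (Finset.Ioc 0 N).filter Squarefree,
      (k : ℝ)⁻¹ * (∏ p ∈ k.primeFactors, (1 - (p : ℝ)⁻¹)) * sieveBound k ^ 2 ≤
      (k : ℝ)⁻¹ * ∏ p ∈ k.primeFactors, (1 - (p : ℝ)⁻¹)⁻¹ + 55 / 9 * (k : ℝ)⁻¹ := by
    intro k hk
    have hp : ∀ p ∈ k.primeFactors, 0 < 1 - (p : ℝ)⁻¹ ∧ 1 - (p : ℝ)⁻¹ ≤ 1 := fun p hp ↦ by
      have h1 := (Nat.prime_of_mem_primeFactors hp).one_lt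
      have h2 : ((p : ℝ))⁻¹ < 1 := inv_lt_one_of_one_lt₀ (by exact_mod_cast h1)
      have h3 : (0 : ℝ) ≤ (p : ℝ)⁻¹ := by positivity
      constructor <;> linarith
    rw [sieveBound, Finset.prod_inv_distrib]
    set P := ∏ p ∈ k.primeFactors, (1 - (p : ℝ)⁻¹)
    have hP0 : 0 < P := Finset.prod_pos fun p h ↦ (hp p h).1
    have hP1 : P ≤ 1 := Finset.prod_le_one (fun p h ↦ (hp p h).1.le) fun p h ↦ (hp p h).2
    have e : (k : ℝ)⁻¹ * P * (P⁻¹ + 5 / 3) ^ 2 = (k : ℝ)⁻¹ * P⁻¹ + (k : ℝ)⁻¹ * (10 / 3 + 25 / 9 * P) := by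
      field_simp
      ring
    rw [e]
    have : (k : ℝ)⁻¹ * (10 / 3 + 25 / 9 * P) ≤ (k : ℝ)⁻¹ * (55 / 9) := by
      gcongr
      linarith
    linarith
  refine (Finset.sum_le_sum h1).trans ?_
  rw [Finset.sum_add_distrib, ← Finset.mul_sum]
  have h2 := sum_squarefree_inv_mul_prod_le N
  have h3 : ∑ k ∈ Finset.Ioc 0 N with Squarefree k, (k : ℝ)⁻¹ ≤ 1 + Real.log N :=
    (Finset.sum_le_sum_of_subset_of_nonneg (Finset.filter_subset _ _) fun k _ _ ↦ by positivity).trans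
      (sum_Ioc_inv_le N)
  have h4 := Real.exp_one_lt_d9
  have h5 := Real.log_natCast_nonneg N
  nlinarith

/-- Jordan's totient on squarefree integers, with a real exponent. -/
noncomputable def jordanTotient (s : ℝ) (k : ℕ) : ℝ := ∏ p ∈ k.primeFactors, ((p : ℝ) ^ s - 1)

theorem sum_divisors_jordanTotient {s : ℝ} {n : ℕ} (hn : Squarefree n) :
    ∑ k ∈ n.divisors, jordanTotient s k = (n : ℝ) ^ s := by
  set F : ArithmeticFunction ℝ := prodPrimeFactors fun p ↦ (p : ℝ) ^ s - 1 with hF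
  have h := IsMultiplicative.prodPrimeFactors_one_add_of_squarefree
      (IsMultiplicative.prodPrimeFactors (R := ℝ) fun p ↦ (p : ℝ) ^ s - 1) hn
  rw [← hF] at h
  have h2 : ∑ k ∈ n.divisors, jordanTotient s k = ∑ k ∈ n.divisors, F k :=
    Finset.sum_congr rfl fun k hk ↦ by
      rw [hF, prodPrimeFactors_apply (Nat.pos_of_mem_divisors hk).ne', jordanTotient]
  rw [h2, ← h]
  calc _ = ∏ p ∈ n.primeFactors, (p : ℝ) ^ s := by
        refine Finset.prod_congr rfl fun p hp ↦ ?_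
        have hp' := Nat.prime_of_mem_primeFactors hp
        rw [hF, prodPrimeFactors_apply hp'.ne_zero, hp'.primeFactors, Finset.prod_singleton]
        ring
    _ = (n : ℝ) ^ s := by
        rw [Real.finsetProd_rpow _ _ fun i _ ↦ Nat.cast_nonneg i]
        rw [← Nat.cast_prod, Nat.prod_primeFactors_of_squarefree hn]

theorem sum_mul_lcm_rpow_eq {c c' : ℕ → ℝ} (N : ℕ) (s : ℝ) (hc : ∀ d, ¬ Squarefree d → c d = 0)
    (hc' : ∀ d, ¬ Squarefree d → c' d = 0) :
    ∑ d ∈ Finset.Ioc 0 N, ∑ e ∈ Finset.Ioc 0 N, c d * c' e * (d.lcm e : ℝ) ^ (-s) =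
      ∑ k ∈ Finset.Ioc 0 N with Squarefree k, jordanTotient s k *
        ((∑ d ∈ Finset.Ioc 0 N with k ∣ d, c d * (d : ℝ) ^ (-s)) *
          ∑ e ∈ Finset.Ioc 0 N with k ∣ e, c' e * (e : ℝ) ^ (-s)) := by
  have h1 : ∀ d ∈ Finset.Ioc 0 N, ∀ e ∈ Finset.Ioc 0 N, c d * c' e * (d.lcm e : ℝ) ^ (-s) =
      ∑ k ∈ Finset.Ioc 0 N with Squarefree k, jordanTotient s k *
        ((if k ∣ d then c d * (d : ℝ) ^ (-s) else 0) * if k ∣ e then c' e * (e : ℝ) ^ (-s) else 0) := by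
    intro d hd e he
    by_cases hds : Squarefree d
    swap
    · simp [hc d hds]
    by_cases hes : Squarefree e
    swap
    · simp [hc' e hes]
    rw [Finset.mem_Ioc] at hd he
    have hd0 : (0 : ℝ) < d := by exact_mod_cast hd.1
    have he0 : (0 : ℝ) < e := by exact_mod_cast he.1
    have hgs : Squarefree (d.gcd e) := hds.squarefree_of_dvd (Nat.gcd_dvd_left d e)
    have hg0 : (0 : ℝ) < d.gcd e := by exact_mod_cast Nat.pos_of_ne_zero hgs.ne_zero
    have hl : (d.lcm e : ℝ) = d * e / d.gcd e := by
      rw [eq_div_iff hg0.ne', mul_comm]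
      exact_mod_cast Nat.gcd_mul_lcm d e
    have h2 : (d.lcm e : ℝ) ^ (-s) = (d : ℝ) ^ (-s) * (e : ℝ) ^ (-s) * ∑ k ∈ (d.gcd e).divisors, jordanTotient s k := by
      rw [sum_divisors_jordanTotient hgs, hl, Real.div_rpow (by positivity) hg0.le,
        Real.mul_rpow hd0.le he0.le, Real.rpow_neg hg0.le, div_inv_eq_mul]
    have h3 : (d.gcd e).divisors = ((Finset.Ioc 0 N).filter Squarefree).filter fun k ↦ k ∣ d ∧ k ∣ e := by
      ext k
      simp only [Nat.mem_divisors, Finset.mem_filter, Finset.mem_Ioc, Nat.dvd_gcd_iff]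
      constructor
      · rintro ⟨⟨h4, h5⟩, -⟩
        exact ⟨⟨⟨Nat.pos_of_dvd_of_pos h4 hd.1, (Nat.le_of_dvd hd.1 h4).trans hd.2⟩,
          hds.squarefree_of_dvd h4⟩, h4, h5⟩
      · rintro ⟨-, h⟩
        exact ⟨h, hgs.ne_zero⟩
    rw [h2, h3, Finset.sum_filter, Finset.mul_sum, Finset.mul_sum]
    refine Finset.sum_congr rfl fun k _ ↦ ?_
    by_cases h4 : k ∣ d <;> by_cases h5 : k ∣ e <;> simp [h4, h5]
    ring
  rw [Finset.sum_congr rfl fun d hd ↦ Finset.sum_congr rfl (h1 d hd)]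
  simp_rw [Finset.sum_filter (p := fun d ↦ _ ∣ d), Finset.sum_mul_sum, Finset.mul_sum]
  rw [Finset.sum_congr rfl fun d _ ↦ Finset.sum_comm, Finset.sum_comm]

theorem jordanTotient_mul_rpow_le {s : ℝ} (hs : 1 ≤ s) {k : ℕ} (hk : Squarefree k) :
    0 ≤ jordanTotient s k ∧ jordanTotient s k * ((k : ℝ) ^ (-s) * (k : ℝ) ^ (-s)) ≤
      (k : ℝ)⁻¹ * ∏ p ∈ k.primeFactors, (1 - (p : ℝ)⁻¹) := by
  have hp : ∀ p ∈ k.primeFactors, (2 : ℝ) ≤ p ∧ (p : ℝ) ≤ (p : ℝ) ^ s := fun p hp ↦ by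
    have h1 : (2 : ℝ) ≤ p := by exact_mod_cast (Nat.prime_of_mem_primeFactors hp).two_le
    exact ⟨h1, Real.self_le_rpow_of_one_le (by linarith) hs⟩
  refine ⟨Finset.prod_nonneg fun p h ↦ by linarith [(hp p h).1, (hp p h).2], ?_⟩
  have e1 : ∀ t : ℝ, (k : ℝ) ^ t = ∏ p ∈ k.primeFactors, (p : ℝ) ^ t := fun t ↦ by
    rw [Real.finsetProd_rpow _ _ fun i _ ↦ Nat.cast_nonneg i]
    rw [← Nat.cast_prod, Nat.prod_primeFactors_of_squarefree hk]
  have e2 : (k : ℝ)⁻¹ = ∏ p ∈ k.primeFactors, (p : ℝ)⁻¹ := by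
    simpa [Real.rpow_neg_one] using e1 (-1)
  rw [e1, e2, jordanTotient, ← Finset.prod_mul_distrib, ← Finset.prod_mul_distrib,
    ← Finset.prod_mul_distrib]
  refine Finset.prod_le_prod (fun p h ↦ ?_) (fun p h ↦ ?_)
  · obtain ⟨h1, h2⟩ := hp p h
    have : 0 ≤ (p : ℝ) ^ s - 1 := by linarith
    positivity
  · obtain ⟨h1, h2⟩ := hp p h
    rw [Real.rpow_neg (by linarith)]
    set q : ℝ := (p : ℝ) ^ s
    have hq : 0 < q := by linarith
    have hx : q⁻¹ ≤ (p : ℝ)⁻¹ := inv_anti₀ (by linarith) h2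
    have hy : (p : ℝ)⁻¹ ≤ 2⁻¹ := inv_anti₀ (by norm_num) h1
    have e : (q - 1) * (q⁻¹ * q⁻¹) = q⁻¹ * (1 - q⁻¹) := by field_simp
    rw [e]
    nlinarith

theorem abs_sum_mul_lcm_rpow_le {c c' : ℕ → ℝ} {N : ℕ} {s A A' Z : ℝ} (hs : 1 ≤ s)
    (hc : ∀ d, ¬ Squarefree d → c d = 0) (hc' : ∀ d, ¬ Squarefree d → c' d = 0)
    (hcA : ∀ k ∈ Finset.Ioc 0 N, Squarefree k →
      |∑ d ∈ Finset.Ioc 0 N with k ∣ d, c d * (d : ℝ) ^ (-s)| ≤ A * ((k : ℝ) ^ (-s) * sieveBound k))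
    (hcA' : ∀ k ∈ Finset.Ioc 0 N, Squarefree k →
      |∑ d ∈ Finset.Ioc 0 N with k ∣ d, c' d * (d : ℝ) ^ (-s)| ≤ A' * ((k : ℝ) ^ (-s) * sieveBound k))
    (hA : 0 ≤ A) (hA' : 0 ≤ A') (hZ : 0 ≤ Z) (hsupp : ∀ d : ℕ, Real.exp Z < d → c d = 0) :
    |∑ d ∈ Finset.Ioc 0 N, ∑ e ∈ Finset.Ioc 0 N, c d * c' e * (d.lcm e : ℝ) ^ (-s)| ≤
      9 * (A * A') * (1 + Z) := by
  set n := ⌊Real.exp Z⌋₊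
  have hn1 : 1 ≤ n := Nat.le_floor (by simpa using hZ)
  rw [sum_mul_lcm_rpow_eq N s hc hc']
  set t : ℕ → ℝ := fun k ↦ (k : ℝ)⁻¹ * (∏ p ∈ k.primeFactors, (1 - (p : ℝ)⁻¹)) * sieveBound k ^ 2
  have ht : ∀ k, Squarefree k → 0 ≤ t k := fun k hk ↦
    mul_nonneg (((mul_nonneg (jordanTotient_mul_rpow_le le_rfl hk).1 (by positivity))).trans
      (jordanTotient_mul_rpow_le le_rfl hk).2) (sq_nonneg _)
  have h1 : ∀ k ∈ (Finset.Ioc 0 N).filter Squarefree, |jordanTotient s k *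
        ((∑ d ∈ Finset.Ioc 0 N with k ∣ d, c d * (d : ℝ) ^ (-s)) *
          ∑ e ∈ Finset.Ioc 0 N with k ∣ e, c' e * (e : ℝ) ^ (-s))| ≤
        if k ∈ (Finset.Ioc 0 n).filter Squarefree then A * A' * t k else 0 := by
    intro k hk
    rw [Finset.mem_filter] at hk
    split_ifs with h
    · obtain ⟨h2, h3⟩ := jordanTotient_mul_rpow_le hs hk.2
      rw [abs_mul, abs_mul, abs_of_nonneg h2]
      have hB := zero_le_one.trans (one_le_sieveBound k)
      have h4 := mul_le_mul (hcA k hk.1 hk.2) (hcA' k hk.1 hk.2) (abs_nonneg _) (by positivity)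
      calc _ ≤ jordanTotient s k * _ := mul_le_mul_of_nonneg_left h4 h2
        _ = A * A' * (jordanTotient s k * ((k : ℝ) ^ (-s) * (k : ℝ) ^ (-s)) * sieveBound k ^ 2) := by ring
        _ ≤ _ := by
          refine mul_le_mul_of_nonneg_left ?_ (by positivity)
          exact mul_le_mul_of_nonneg_right h3 (by positivity)
    · have hkn : n < k := by
        by_contra! h2
        exact h (Finset.mem_filter.2 ⟨Finset.mem_Ioc.2 ⟨(Finset.mem_Ioc.1 hk.1).1, h2⟩, hk.2⟩)
      rw [Nat.floor_lt (Real.exp_nonneg Z)] at hkn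
      rw [Finset.sum_eq_zero]
      · simp
      · intro d hd
        rw [Finset.mem_filter, Finset.mem_Ioc] at hd
        have : k ≤ d := Nat.le_of_dvd hd.1.1 hd.2
        rw [hsupp d (hkn.trans_le (by exact_mod_cast this)), zero_mul]
  refine (Finset.abs_sum_le_sum_abs _ _).trans ((Finset.sum_le_sum h1).trans ?_)
  rw [← Finset.sum_filter]
  have h2 : ∑ k ∈ ((Finset.Ioc 0 N).filter Squarefree).filter
      (fun k ↦ k ∈ (Finset.Ioc 0 n).filter Squarefree), A * A' * t k ≤
      ∑ k ∈ (Finset.Ioc 0 n).filter Squarefree, A * A' * t k := by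
    refine Finset.sum_le_sum_of_subset_of_nonneg (fun k hk ↦ (Finset.mem_filter.1 hk).2) fun k hk _ ↦ ?_
    exact mul_nonneg (mul_nonneg hA hA') (ht k (Finset.mem_filter.1 hk).2)
  refine h2.trans ?_
  rw [← Finset.mul_sum]
  have h3 := sum_squarefree_sieveBound_sq_le n
  have h4 : Real.log n ≤ Z := by
    rw [← Real.log_exp Z]
    exact Real.log_le_log (by exact_mod_cast hn1) (Nat.floor_le (Real.exp_nonneg Z))
  calc _ ≤ A * A' * (9 * (1 + Real.log n)) := mul_le_mul_of_nonneg_left h3 (mul_nonneg hA hA')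
    _ ≤ A * A' * (9 * (1 + Z)) := by gcongr
    _ = _ := by ring

/-- The coefficients `μ(d) log⁺ (e ^ Y / d)`. -/
noncomputable def selbergCoeff (Y : ℝ) (d : ℕ) : ℝ := (μ d : ℤ) * max (Y - Real.log d) 0

theorem selbergCoeff_of_not_squarefree (Y : ℝ) {d : ℕ} (hd : ¬ Squarefree d) : selbergCoeff Y d = 0 := by
  simp [selbergCoeff, moebius_eq_zero_of_not_squarefree hd]

theorem selbergCoeff_of_exp_le {Y : ℝ} {d : ℕ} (hd : Real.exp Y ≤ d) : selbergCoeff Y d = 0 := by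
  have := Real.log_le_log (Real.exp_pos Y) hd
  rw [Real.log_exp] at this
  rw [selbergCoeff, max_eq_right (by linarith), mul_zero]

theorem abs_selbergCoeff_le {Y : ℝ} (hY : 0 ≤ Y) (d : ℕ) : |selbergCoeff Y d| ≤ Y := by
  rw [selbergCoeff, abs_mul, abs_of_nonneg (le_max_right (Y - Real.log d) 0)]
  have h1 : |((μ d : ℤ) : ℝ)| ≤ 1 := by exact_mod_cast abs_moebius_le_one
  have h2 : max (Y - Real.log d) 0 ≤ Y := max_le (by linarith [Real.log_natCast_nonneg d]) hY
  nlinarith [le_max_right (Y - Real.log d) 0]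

theorem abs_sum_selbergCoeff_mul_rpow_le {N k : ℕ} {ε Y : ℝ} (hε : 0 ≤ ε) (hY : 0 ≤ Y)
    (hYN : Real.exp Y < N + 1) (hk : k ∈ Finset.Ioc 0 N) :
    |∑ d ∈ Finset.Ioc 0 N with k ∣ d, selbergCoeff Y d * (d : ℝ) ^ (-(1 + ε))| ≤
      (1 + ε * Y) * ((k : ℝ) ^ (-(1 + ε)) * sieveBound k) := by
  have hk0 := (Finset.mem_Ioc.1 hk).1
  have hk0' : (0 : ℝ) < k := by exact_mod_cast hk0
  have hB := zero_le_one.trans (one_le_sieveBound k)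
  have e : ∑ d ∈ Finset.Ioc 0 N with k ∣ d, selbergCoeff Y d * (d : ℝ) ^ (-(1 + ε)) =
      (μ k : ℤ) * (k : ℝ) ^ (-(1 + ε)) * ∑ m ∈ Finset.Ioc 0 (N / k),
        moebiusCoprime k m * (m : ℝ) ^ (-(1 + ε)) * max (Y - Real.log k - Real.log m) 0 := by
    rw [Finset.mul_sum]
    symm
    refine Finset.sum_bij (fun m _ ↦ k * m) ?_ ?_ ?_ ?_
    · intro m hm
      rw [Finset.mem_Ioc] at hm
      rw [Finset.mem_filter, Finset.mem_Ioc]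
      exact ⟨⟨Nat.mul_pos hk0 hm.1, by rw [mul_comm]; exact (Nat.le_div_iff_mul_le hk0).1 hm.2⟩, dvd_mul_right _ _⟩
    · intro a _ b _ hab
      exact Nat.eq_of_mul_eq_mul_left hk0 hab
    · intro d hd
      rw [Finset.mem_filter, Finset.mem_Ioc] at hd
      obtain ⟨⟨h1, h2⟩, m, rfl⟩ := hd
      exact ⟨m, Finset.mem_Ioc.2 ⟨Nat.pos_of_mul_pos_left h1, (Nat.le_div_iff_mul_le hk0).2 (by rwa [mul_comm])⟩, rfl⟩
    · intro m hm
      have hm0 : (0 : ℝ) < m := by exact_mod_cast (Finset.mem_Ioc.1 hm).1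
      have h1 : ((μ (k * m) : ℤ) : ℝ) = (μ k : ℤ) * moebiusCoprime k m := by
        rw [moebiusCoprime_apply]
        split_ifs with h
        · rw [isMultiplicative_moebius.map_mul_of_coprime h.symm]
          push_cast
          rfl
        · rw [moebius_eq_zero_of_not_squarefree fun h' ↦ h (Nat.coprime_of_squarefree_mul h').symm]
          simp
      rw [selbergCoeff, h1]
      push_cast
      rw [Real.log_mul hk0'.ne' hm0.ne', Real.mul_rpow hk0'.le hm0.le, sub_sub]
      ring
  have hlt : Real.exp (Y - Real.log k) < ((N / k : ℕ) : ℝ) + 1 := by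
    rw [Real.exp_sub, Real.exp_log hk0', div_lt_iff₀ hk0']
    refine hYN.trans_le ?_
    have : N + 1 ≤ (N / k + 1) * k := by
      rw [mul_comm]
      exact Nat.lt_mul_div_succ N hk0
    exact_mod_cast this
  have h1 := abs_sum_moebiusCoprime_mul_rpow_mul_max_le hk0.ne' hε hlt
  have h2 : max (Y - Real.log k) 0 ≤ Y := max_le (by linarith [Real.log_natCast_nonneg k]) hY
  have h3 : |((μ k : ℤ) : ℝ)| ≤ 1 := by exact_mod_cast abs_moebius_le_one
  rw [e, abs_mul, abs_mul, abs_of_nonneg (by positivity : (0 : ℝ) ≤ (k : ℝ) ^ (-(1 + ε)))]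
  calc _ ≤ 1 * (k : ℝ) ^ (-(1 + ε)) * (sieveBound k * (1 + ε * max (Y - Real.log k) 0)) := by gcongr
    _ ≤ 1 * (k : ℝ) ^ (-(1 + ε)) * (sieveBound k * (1 + ε * Y)) := by gcongr
    _ = _ := by ring

theorem mul_rpow_neg_le {ε : ℝ} (hε : 0 ≤ ε) {x : ℝ} (hx : 0 < x) :
    ε * (x + 1) ^ (-(1 + ε)) ≤ x ^ (-ε) - (x + 1) ^ (-ε) := by
  have h1 : (x + 1) ^ (-(1 + ε)) = (x + 1) ^ (-ε) * (x + 1)⁻¹ := by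
    rw [neg_add, Real.rpow_add (by positivity), Real.rpow_neg_one, mul_comm]
  have h2 : x ^ (-ε) = (x + 1) ^ (-ε) * Real.exp (ε * (Real.log (x + 1) - Real.log x)) := by
    rw [Real.rpow_def_of_pos hx, Real.rpow_def_of_pos (by positivity), ← Real.exp_add]
    congr 1
    ring
  have h3 : (x + 1)⁻¹ ≤ Real.log (x + 1) - Real.log x := by
    have := Real.log_le_sub_one_of_pos (show 0 < x / (x + 1) by positivity)
    rw [Real.log_div hx.ne' (by positivity)] at this
    have e : x / (x + 1) - 1 = -(x + 1)⁻¹ := by field_simp; ring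
    linarith
  have h4 := Real.add_one_le_exp (ε * (Real.log (x + 1) - Real.log x))
  rw [h1, h2]
  have h5 : 0 < (x + 1) ^ (-ε) := by positivity
  have h6 := mul_le_mul_of_nonneg_left h3 hε
  nlinarith

theorem tsum_rpow_le {ε : ℝ} (hε : 0 < ε) :
    Summable (fun n : ℕ ↦ (n : ℝ) ^ (-(1 + ε))) ∧ ∑' n : ℕ, (n : ℝ) ^ (-(1 + ε)) ≤ 1 + 1 / ε := by
  have hs : Summable (fun n : ℕ ↦ (n : ℝ) ^ (-(1 + ε))) := Real.summable_nat_rpow.2 (by linarith)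
  refine ⟨hs, hs.tsum_le_of_sum_range_le fun N ↦ ?_⟩
  have h : ∀ N : ℕ, ∑ n ∈ Finset.range (N + 2), (n : ℝ) ^ (-(1 + ε)) ≤
      1 + 1 / ε * (1 - ((N : ℝ) + 1) ^ (-ε)) := by
    intro N
    induction N with
    | zero =>
      simp only [zero_add, Finset.sum_range_succ, Finset.sum_range_zero, Nat.cast_zero, Nat.cast_one,
        Real.one_rpow, sub_self, mul_zero]
      rw [Real.zero_rpow (by linarith)]
      norm_num
    | succ N ih =>
      rw [Finset.sum_range_succ]
      have := mul_rpow_neg_le hε.le (show (0 : ℝ) < N + 1 by positivity)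
      push_cast
      have e : (N : ℝ) + 2 = N + 1 + 1 := by ring
      rw [e]
      have h2 : ((N : ℝ) + 1 + 1) ^ (-(1 + ε)) ≤
          1 / ε * (((N : ℝ) + 1) ^ (-ε) - ((N : ℝ) + 1 + 1) ^ (-ε)) := by
        rw [one_div, ← div_eq_inv_mul, le_div_iff₀ hε, mul_comm]
        exact this
      linarith
  calc _ ≤ ∑ n ∈ Finset.range (N + 2), (n : ℝ) ^ (-(1 + ε)) :=
        Finset.sum_le_sum_of_subset_of_nonneg (Finset.range_mono (by omega)) fun _ _ _ ↦ by positivity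
    _ ≤ _ := h N
    _ ≤ _ := by
        have : 0 < ((N : ℝ) + 1) ^ (-ε) := by positivity
        have h2 : 0 < 1 / ε := by positivity
        nlinarith

/-- The divisor sum `∑_{d ∣ n} c d`. -/
noncomputable def divisorSum (c : ℕ → ℝ) (n : ℕ) : ℝ := ∑ d ∈ n.divisors, c d

theorem divisorSum_eq {c : ℕ → ℝ} {D n : ℕ} (hD : ∀ d, D < d → c d = 0) (hn : n ≠ 0) :
    divisorSum c n = ∑ d ∈ Finset.Ioc 0 D, if d ∣ n then c d else 0 := by
  rw [divisorSum, ← Finset.sum_filter]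
  symm
  refine Finset.sum_subset (fun d hd ↦ ?_) (fun d hd hd' ↦ ?_)
  · exact Nat.mem_divisors.2 ⟨(Finset.mem_filter.1 hd).2, hn⟩
  · refine hD d ?_
    by_contra! h
    exact hd' (Finset.mem_filter.2 ⟨Finset.mem_Ioc.2 ⟨Nat.pos_of_mem_divisors hd, h⟩,
      Nat.dvd_of_mem_divisors hd⟩)

theorem divisorSum_mul_divisorSum {c c' : ℕ → ℝ} {D n : ℕ} (hD : ∀ d, D < d → c d = 0)
    (hD' : ∀ d, D < d → c' d = 0) (hn : n ≠ 0) :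
    divisorSum c n * divisorSum c' n =
      ∑ d ∈ Finset.Ioc 0 D, ∑ e ∈ Finset.Ioc 0 D, c d * c' e * if d.lcm e ∣ n then 1 else 0 := by
  rw [divisorSum_eq hD hn, divisorSum_eq hD' hn, Finset.sum_mul_sum]
  refine Finset.sum_congr rfl fun d _ ↦ Finset.sum_congr rfl fun e _ ↦ ?_
  simp only [Nat.lcm_dvd_iff]
  by_cases h1 : d ∣ n <;> by_cases h2 : e ∣ n <;> simp [h1, h2]

theorem hasSum_ite_dvd_rpow {ε : ℝ} (hε : 0 < ε) {D : ℕ} (hD : 0 < D) :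
    HasSum (fun n : ℕ ↦ if D ∣ n then (n : ℝ) ^ (-(1 + ε)) else 0)
      ((D : ℝ) ^ (-(1 + ε)) * ∑' n : ℕ, (n : ℝ) ^ (-(1 + ε))) := by
  have h := (tsum_rpow_le hε).1.hasSum.mul_left ((D : ℝ) ^ (-(1 + ε)))
  have hinj : Function.Injective (fun n : ℕ ↦ D * n) := fun a b h ↦ Nat.eq_of_mul_eq_mul_left hD h
  refine (hinj.hasSum_iff fun n hn ↦ if_neg fun ⟨m, hm⟩ ↦ hn ⟨m, hm.symm⟩).1 ?_
  refine h.congr_fun fun n ↦ ?_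
  simp only [Function.comp, dvd_mul_right, if_true]
  push_cast
  rw [Real.mul_rpow (by positivity) (by positivity)]

theorem sum_divisorSum_sq_div_le {c : ℕ → ℝ} {D N : ℕ} (hD : ∀ d, D < d → c d = 0) {L V : ℝ}
    (hL : 0 < L) (hN : (N : ℝ) ≤ Real.exp L)
    (hV : |∑ d ∈ Finset.Ioc 0 D, ∑ e ∈ Finset.Ioc 0 D, c d * c e * (d.lcm e : ℝ) ^ (-(1 + 1 / L))| ≤ V) :
    ∑ n ∈ Finset.Ioc 0 N, divisorSum c n ^ 2 / n ≤ Real.exp 1 * ((1 + L) * V) := by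
  have hε : 0 < 1 / L := by positivity
  have hV0 := (abs_nonneg _).trans hV
  set ε := 1 / L with hε'
  have h1 : HasSum (fun n : ℕ ↦ ∑ d ∈ Finset.Ioc 0 D, ∑ e ∈ Finset.Ioc 0 D,
      c d * c e * if d.lcm e ∣ n then (n : ℝ) ^ (-(1 + ε)) else 0)
      (∑ d ∈ Finset.Ioc 0 D, ∑ e ∈ Finset.Ioc 0 D, c d * c e *
        ((d.lcm e : ℝ) ^ (-(1 + ε)) * ∑' n : ℕ, (n : ℝ) ^ (-(1 + ε)))) :=
    hasSum_sum fun d hd ↦ hasSum_sum fun e he ↦ (hasSum_ite_dvd_rpow hε (Nat.lcm_pos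
      (Finset.mem_Ioc.1 hd).1 (Finset.mem_Ioc.1 he).1)).mul_left _
  have e1 : ∀ n : ℕ, ∑ d ∈ Finset.Ioc 0 D, ∑ e ∈ Finset.Ioc 0 D,
      c d * c e * (if d.lcm e ∣ n then (n : ℝ) ^ (-(1 + ε)) else 0) =
      if n = 0 then 0 else divisorSum c n ^ 2 * (n : ℝ) ^ (-(1 + ε)) := by
    intro n
    split_ifs with hn
    · subst hn
      refine Finset.sum_eq_zero fun d _ ↦ Finset.sum_eq_zero fun e _ ↦ ?_
      rw [Nat.cast_zero, Real.zero_rpow (by linarith)]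
      simp
    · rw [sq, divisorSum_mul_divisorSum hD hD hn, Finset.sum_mul]
      refine Finset.sum_congr rfl fun d _ ↦ ?_
      rw [Finset.sum_mul]
      refine Finset.sum_congr rfl fun e _ ↦ ?_
      split_ifs <;> simp
  have e2 : ∑ d ∈ Finset.Ioc 0 D, ∑ e ∈ Finset.Ioc 0 D, c d * c e *
        ((d.lcm e : ℝ) ^ (-(1 + ε)) * ∑' n : ℕ, (n : ℝ) ^ (-(1 + ε))) =
      (∑ d ∈ Finset.Ioc 0 D, ∑ e ∈ Finset.Ioc 0 D, c d * c e * (d.lcm e : ℝ) ^ (-(1 + ε))) *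
        ∑' n : ℕ, (n : ℝ) ^ (-(1 + ε)) := by
    simp_rw [Finset.sum_mul, mul_assoc]
  rw [e2] at h1
  simp_rw [e1] at h1
  have h2 := sum_le_hasSum (Finset.Ioc 0 N) (fun n _ ↦ by split_ifs <;> positivity) h1
  obtain ⟨-, h3⟩ := tsum_rpow_le hε
  have h30 : 0 ≤ ∑' n : ℕ, (n : ℝ) ^ (-(1 + ε)) := tsum_nonneg fun n ↦ by positivity
  have h4 : ∀ n ∈ Finset.Ioc 0 N, divisorSum c n ^ 2 / n ≤
      Real.exp 1 * if n = 0 then 0 else divisorSum c n ^ 2 * (n : ℝ) ^ (-(1 + ε)) := by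
    intro n hn
    rw [Finset.mem_Ioc] at hn
    have hn0 : (0 : ℝ) < n := by exact_mod_cast hn.1
    have hlog : Real.log n ≤ L := by
      rw [← Real.log_exp L]
      exact Real.log_le_log hn0 ((Nat.cast_le.2 hn.2).trans hN)
    rw [if_neg hn.1.ne', neg_add, add_comm, Real.rpow_add hn0, Real.rpow_neg_one]
    have h5 : Real.exp (-1) ≤ (n : ℝ) ^ (-ε) := by
      rw [Real.rpow_def_of_pos hn0]
      refine Real.exp_le_exp.2 ?_
      rw [hε', mul_neg, mul_one_div, neg_le_neg_iff]
      exact (div_le_one hL).2 hlog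
    have h6 : 1 ≤ Real.exp 1 * (n : ℝ) ^ (-ε) := by
      calc (1 : ℝ) = Real.exp 1 * Real.exp (-1) := by rw [← Real.exp_add]; simp
        _ ≤ _ := by gcongr
    rw [div_eq_mul_inv]
    have : 0 ≤ divisorSum c n ^ 2 * (n : ℝ)⁻¹ := by positivity
    nlinarith
  refine (Finset.sum_le_sum h4).trans ?_
  rw [← Finset.mul_sum]
  gcongr
  refine h2.trans ?_
  have h7 : 1 / ε = L := by rw [hε', one_div_one_div]
  rw [h7] at h3
  calc _ ≤ |∑ d ∈ Finset.Ioc 0 D, ∑ e ∈ Finset.Ioc 0 D, c d * c e * (d.lcm e : ℝ) ^ (-(1 + ε))| *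
        ∑' n : ℕ, (n : ℝ) ^ (-(1 + ε)) := mul_le_mul_of_nonneg_right (le_abs_self _) h30
    _ ≤ V * (1 + L) := by gcongr
    _ = _ := mul_comm _ _

/-- Coefficients of Selberg's `Λ²` majorant at level `e ^ (l / 2)`. -/
noncomputable def thetaCoeff (l : ℝ) (d : ℕ) : ℝ := 2 / l * selbergCoeff (l / 2) d

/-- Coefficients of the mollifier, with transition range `[e ^ (7 l / 2), e ^ (5 l)]`. -/
noncomputable def psiCoeff (l : ℝ) (d : ℕ) : ℝ :=
  2 / (3 * l) * (selbergCoeff (5 * l) d - selbergCoeff (7 / 2 * l) d)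

section Coefficients

variable {l : ℝ}

theorem thetaCoeff_of_not_squarefree {d : ℕ} (hd : ¬ Squarefree d) : thetaCoeff l d = 0 := by
  simp [thetaCoeff, selbergCoeff_of_not_squarefree _ hd]

theorem psiCoeff_of_not_squarefree {d : ℕ} (hd : ¬ Squarefree d) : psiCoeff l d = 0 := by
  simp [psiCoeff, selbergCoeff_of_not_squarefree _ hd]

theorem thetaCoeff_of_exp_lt {d : ℕ} (hd : Real.exp (l / 2) < d) : thetaCoeff l d = 0 := by
  simp [thetaCoeff, selbergCoeff_of_exp_le hd.le]

theorem psiCoeff_of_exp_lt (hl : 0 < l) {d : ℕ} (hd : Real.exp (5 * l) < d) : psiCoeff l d = 0 := by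
  have : Real.exp (7 / 2 * l) ≤ d := (Real.exp_le_exp.2 (by linarith)).trans hd.le
  simp [psiCoeff, selbergCoeff_of_exp_le hd.le, selbergCoeff_of_exp_le this]

theorem abs_thetaCoeff_le (hl : 0 < l) (d : ℕ) : |thetaCoeff l d| ≤ 1 := by
  rw [thetaCoeff, abs_mul, abs_of_pos (by positivity)]
  calc _ ≤ 2 / l * (l / 2) := by
        gcongr
        exact abs_selbergCoeff_le (by positivity) d
    _ = 1 := by field_simp

theorem abs_psiCoeff_le (hl : 0 < l) (d : ℕ) : |psiCoeff l d| ≤ 1 := by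
  have h1 : |((μ d : ℤ) : ℝ)| ≤ 1 := by exact_mod_cast abs_moebius_le_one
  have h2 : |max (5 * l - Real.log d) 0 - max (7 / 2 * l - Real.log d) 0| ≤ 3 / 2 * l := by
    rw [abs_le]
    constructor
    · linarith [max_le_max (show 7 / 2 * l - Real.log d ≤ 5 * l - Real.log d by linarith) (le_refl (0 : ℝ))]
    · rcases max_cases (5 * l - Real.log d) 0 with h | h <;>
      rcases max_cases (7 / 2 * l - Real.log d) 0 with h' | h' <;> linarith
  rw [psiCoeff, selbergCoeff, selbergCoeff, ← mul_sub, abs_mul, abs_mul, abs_of_pos (by positivity)]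
  calc _ ≤ 2 / (3 * l) * (1 * (3 / 2 * l)) := by gcongr
    _ = 1 := by field_simp

theorem divisorSum_thetaCoeff_one (hl : 0 < l) : divisorSum (thetaCoeff l) 1 = 1 := by
  simp only [divisorSum, Nat.divisors_one, Finset.sum_singleton, thetaCoeff, selbergCoeff,
    moebius_apply_one, Nat.cast_one, Real.log_one, sub_zero]
  rw [max_eq_left (by positivity)]
  push_cast
  field_simp

theorem divisorSum_psiCoeff (hl : 0 < l) {n : ℕ} (hnl : (n : ℝ) ≤ Real.exp (7 / 2 * l)) :
    divisorSum (psiCoeff l) n = if n = 1 then 1 else 0 := by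
  have h1 : ∀ d ∈ n.divisors, psiCoeff l d = ((μ d : ℤ) : ℝ) := by
    intro d hd
    have hd0 : (0 : ℝ) < d := by exact_mod_cast Nat.pos_of_mem_divisors hd
    have h2 : Real.log d ≤ 7 / 2 * l := by
      rw [← Real.log_exp (7 / 2 * l)]
      exact Real.log_le_log hd0 ((Nat.cast_le.2 (Nat.divisor_le hd)).trans hnl)
    rw [psiCoeff, selbergCoeff, selbergCoeff, max_eq_left (by linarith), max_eq_left (by linarith)]
    field_simp
    ring
  rw [divisorSum, Finset.sum_congr rfl h1]
  have h2 : (((∑ d ∈ n.divisors, μ d) : ℤ) : ℝ) = if n = 1 then 1 else 0 := by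
    rw [← coe_mul_zeta_apply, moebius_mul_coe_zeta, one_apply]
    split_ifs <;> simp
  rw [← h2]
  push_cast
  rfl

theorem abs_sum_thetaCoeff_le (hl : 0 < l) {N k : ℕ} (hN : Real.exp (l / 2) < N + 1)
    (hk : k ∈ Finset.Ioc 0 N) :
    |∑ d ∈ Finset.Ioc 0 N with k ∣ d, thetaCoeff l d * (d : ℝ) ^ (-1 : ℝ)| ≤
      2 / l * ((k : ℝ) ^ (-1 : ℝ) * sieveBound k) := by
  have h := abs_sum_selbergCoeff_mul_rpow_le le_rfl (by positivity) hN hk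
  simp only [add_zero, zero_mul, one_mul] at h
  simp_rw [thetaCoeff, mul_assoc, ← Finset.mul_sum]
  rw [abs_mul, abs_of_pos (by positivity)]
  gcongr

theorem abs_sum_psiCoeff_le (hl : 0 < l) {N k : ℕ} {ε : ℝ} (hε : 0 ≤ ε) (hN : Real.exp (5 * l) < N + 1)
    (hk : k ∈ Finset.Ioc 0 N) :
    |∑ d ∈ Finset.Ioc 0 N with k ∣ d, psiCoeff l d * (d : ℝ) ^ (-(1 + ε))| ≤
      2 / (3 * l) * (2 + ε * (17 / 2 * l)) * ((k : ℝ) ^ (-(1 + ε)) * sieveBound k) := by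
  have h := abs_sum_selbergCoeff_mul_rpow_le hε (by positivity) hN hk
  have h' := abs_sum_selbergCoeff_mul_rpow_le (Y := 7 / 2 * l) hε (by positivity)
    ((Real.exp_le_exp.2 (by linarith)).trans_lt hN) hk
  simp_rw [psiCoeff, mul_assoc, ← Finset.mul_sum, sub_mul, Finset.sum_sub_distrib]
  rw [abs_mul, abs_of_pos (by positivity)]
  refine mul_le_mul_of_nonneg_left ((abs_sub _ _).trans ((add_le_add h h').trans (le_of_eq ?_))) (by positivity)
  ring

theorem abs_sum_thetaCoeff_lcm_le (hl : 20 ≤ l) {N : ℕ} (hN : Real.exp (l / 2) < N + 1) :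
    |∑ d ∈ Finset.Ioc 0 N, ∑ e ∈ Finset.Ioc 0 N,
      thetaCoeff l d * thetaCoeff l e * (d.lcm e : ℝ) ^ (-1 : ℝ)| ≤ 99 / 5 / l := by
  have hl0 : 0 < l := by linarith
  refine (abs_sum_mul_lcm_rpow_le le_rfl (fun d ↦ thetaCoeff_of_not_squarefree)
    (fun d ↦ thetaCoeff_of_not_squarefree) (fun k hk _ ↦ abs_sum_thetaCoeff_le hl0 hN hk)
    (fun k hk _ ↦ abs_sum_thetaCoeff_le hl0 hN hk) (by positivity) (by positivity)
    (by positivity) fun d ↦ thetaCoeff_of_exp_lt).trans ?_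
  rw [le_div_iff₀ hl0]
  have e : 9 * (2 / l * (2 / l)) * (1 + l / 2) * l = 36 * (1 / l) + 18 := by field_simp; ring
  have : 1 / l ≤ 1 / 20 := one_div_le_one_div_of_le (by norm_num) hl
  rw [e]
  linarith

theorem abs_sum_thetaCoeff_psiCoeff_lcm_le (hl : 20 ≤ l) {N : ℕ} (hN : Real.exp (5 * l) < N + 1) :
    |∑ d ∈ Finset.Ioc 0 N, ∑ e ∈ Finset.Ioc 0 N,
      thetaCoeff l d * psiCoeff l e * (d.lcm e : ℝ) ^ (-1 : ℝ)| ≤ 66 / 5 / l := by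
  have hl0 : 0 < l := by linarith
  refine (abs_sum_mul_lcm_rpow_le le_rfl (fun d ↦ thetaCoeff_of_not_squarefree)
    (fun d ↦ psiCoeff_of_not_squarefree) (fun k hk _ ↦ abs_sum_thetaCoeff_le hl0
      ((Real.exp_le_exp.2 (by linarith)).trans_lt hN) hk)
    (fun k hk _ ↦ by simpa using abs_sum_psiCoeff_le hl0 le_rfl hN hk) (by positivity) (by positivity)
    (by positivity) fun d ↦ thetaCoeff_of_exp_lt).trans ?_
  rw [le_div_iff₀ hl0]
  have e : 9 * (2 / l * (2 / (3 * l) * 2)) * (1 + l / 2) * l = 24 * (1 / l) + 12 := by field_simp; ring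
  have : 1 / l ≤ 1 / 20 := one_div_le_one_div_of_le (by norm_num) hl
  rw [e]
  linarith

theorem sum_divisorSum_psiCoeff_sq_div_le (hl : 20 ≤ l) {N : ℕ} (hN : (N : ℝ) ≤ Real.exp (7 * l)) :
    ∑ n ∈ Finset.Ioc 0 N, divisorSum (psiCoeff l) n ^ 2 / n ≤ 4000 := by
  have hl0 : 0 < l := by linarith
  set D := ⌊Real.exp (5 * l)⌋₊
  have hD : Real.exp (5 * l) < D + 1 := Nat.lt_floor_add_one _
  have hc (d : ℕ) (hd : D < d) : psiCoeff l d = 0 :=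
    psiCoeff_of_exp_lt hl0 ((Nat.floor_lt (Real.exp_nonneg _)).1 hd)
  have h1 := abs_sum_mul_lcm_rpow_le (s := 1 + 1 / (7 * l)) (by simp; positivity)
    (fun d ↦ psiCoeff_of_not_squarefree) (fun d ↦ psiCoeff_of_not_squarefree)
    (fun k hk _ ↦ abs_sum_psiCoeff_le hl0 (by positivity) hD hk)
    (fun k hk _ ↦ abs_sum_psiCoeff_le hl0 (by positivity) hD hk) (by positivity) (by positivity)
    (by positivity) fun d ↦ psiCoeff_of_exp_lt hl0
  refine (sum_divisorSum_sq_div_le hc (by positivity) hN h1).trans ?_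
  have e : (1 + 7 * l) * (9 * (2 / (3 * l) * (2 + 1 / (7 * l) * (17 / 2 * l)) *
      (2 / (3 * l) * (2 + 1 / (7 * l) * (17 / 2 * l)))) * (1 + 5 * l)) =
      9 * (15 / 7) ^ 2 * ((1 / l + 7) * (1 / l + 5)) := by
    field_simp
    ring
  have h2 : 1 / l ≤ 1 / 20 := one_div_le_one_div_of_le (by norm_num) hl
  have h3 : 0 < 1 / l := by positivity
  rw [e]
  have h4 : (1 / l + 7) * (1 / l + 5) ≤ (1 / 20 + 7) * (1 / 20 + 5) := by gcongr
  have h5 := Real.exp_one_lt_d9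
  calc _ ≤ 2.7182818286 * (9 * (15 / 7) ^ 2 * ((1 / 20 + 7) * (1 / 20 + 5))) := by gcongr
    _ ≤ (4000 : ℝ) := by norm_num

end Coefficients

theorem norm_cpow_one_sub_sub_le {s : ℂ} (hs : 0 ≤ s.re) {M X : ℝ} (hM : 0 < M) (hMX : M ≤ X) :
    ‖(X : ℂ) ^ (1 - s) - (M : ℂ) ^ (1 - s)‖ ≤ ‖1 - s‖ * M ^ (-s.re) * (X - M) := by
  have h := (convex_Icc M X).norm_image_sub_le_of_norm_hasDerivWithin_le
    (f := fun u : ℝ ↦ (u : ℂ) ^ (1 - s)) (f' := fun u : ℝ ↦ (1 - s) * (u : ℂ) ^ (-s))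
    (C := ‖1 - s‖ * M ^ (-s.re)) (x := M) (y := X) ?_ ?_ (left_mem_Icc.2 hMX) (right_mem_Icc.2 hMX)
  · simpa [Real.norm_of_nonneg (sub_nonneg.2 hMX)] using h
  · intro u hu
    have hu0 : 0 < u := hM.trans_le hu.1
    have h1 := (hasDerivAt_id (u : ℂ)).cpow_const (c := 1 - s) (Or.inl (by simpa using hu0))
    refine (h1.comp_ofReal.congr_deriv ?_).hasDerivWithinAt
    simp
  · intro u hu
    have hu0 : 0 < u := hM.trans_le hu.1
    rw [norm_mul, Complex.norm_cpow_eq_rpow_re_of_pos hu0, neg_re]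
    gcongr ?_ * ?_
    exact Real.rpow_le_rpow_of_nonpos hM hu.1 (by linarith)

theorem norm_sum_cpow_sub_le {s : ℂ} (hs : 0 < s.re) (hs1 : s.re < 1) (hζ : riemannZeta s = 0) {X : ℝ}
    (hX : 1 ≤ X) :
    ‖∑ m ∈ Finset.Ioc 0 ⌊X⌋₊, (m : ℂ) ^ (-s) - (X : ℂ) ^ (1 - s) / (1 - s)‖ ≤
      2 * (‖s‖ * (1 + 1 / s.re) + 1) * X ^ (-s.re) := by
  have hs1' : s ≠ 1 := by rintro rfl; simp at hs1
  have hs2 : (1 : ℂ) - s ≠ 0 := sub_ne_zero.2 hs1'.symm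
  have hs3 : 0 < ‖1 - s‖ := norm_pos_iff.2 hs2
  set M := ⌊X⌋₊
  have hM1 : 1 ≤ M := Nat.le_floor (by simpa using hX)
  have hM1' : (1 : ℝ) ≤ M := by exact_mod_cast hM1
  have hMX : (M : ℝ) ≤ X := Nat.floor_le (by linarith)
  have hXM : X < M + 1 := Nat.lt_floor_add_one X
  have h1 := riemannZeta₁_eq hM1 hs
  have h2 := norm_tsum_zetaGap_le (N := M) (by omega) hs
  have h0 : riemannZeta₁ s = 0 := by
    have := riemannZeta_eq_inv_sub_mul hs1'
    rw [hζ] at this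
    have h3 : (s - 1)⁻¹ ≠ 0 := inv_ne_zero (sub_ne_zero.2 hs1')
    exact (mul_eq_zero.1 this.symm).resolve_left h3
  rw [h0] at h1
  set G := ∑' k, zetaGap (M + k) s
  have h3 := norm_cpow_one_sub_sub_le hs.le (show (0 : ℝ) < M by linarith) hMX
  have e : ∑ m ∈ Finset.Ioc 0 M, (m : ℂ) ^ (-s) - (X : ℂ) ^ (1 - s) / (1 - s) =
      (G - ((X : ℂ) ^ (1 - s) - ((M : ℝ) : ℂ) ^ (1 - s))) / (1 - s) := by
    change 0 = (s - 1) * ∑ m ∈ Finset.Ioc 0 M, (m : ℂ) ^ (-s) + (M : ℂ) ^ (1 - s) + G at h1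
    rw [eq_div_iff hs2, sub_mul, div_mul_cancel₀ _ hs2]
    push_cast
    linear_combination h1
  have h4 : (M : ℝ) ^ (-s.re) ≤ 2 * X ^ (-s.re) := by
    calc (M : ℝ) ^ (-s.re) ≤ (X / 2) ^ (-s.re) :=
          Real.rpow_le_rpow_of_nonpos (by linarith) (by linarith) (by linarith)
      _ = 2 ^ s.re * X ^ (-s.re) := by
          rw [Real.div_rpow (by linarith) (by norm_num), Real.rpow_neg (by norm_num : (0 : ℝ) ≤ 2), div_inv_eq_mul,
            mul_comm]
      _ ≤ 2 ^ (1 : ℝ) * X ^ (-s.re) := by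
          gcongr
          · norm_num
      _ = _ := by rw [Real.rpow_one]
  have h5 : 0 ≤ (M : ℝ) ^ (-s.re) := by positivity
  rw [e, norm_div, div_le_iff₀ hs3]
  refine (norm_sub_le _ _).trans ((add_le_add h2 h3).trans ?_)
  rw [norm_sub_rev s 1]
  calc _ ≤ ‖1 - s‖ * ‖s‖ * ((1 + 1 / s.re) * (M : ℝ) ^ (-s.re)) + ‖1 - s‖ * (M : ℝ) ^ (-s.re) * 1 := by
        gcongr
        linarith
    _ = ‖1 - s‖ * (‖s‖ * (1 + 1 / s.re) + 1) * (M : ℝ) ^ (-s.re) := by ring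
    _ ≤ ‖1 - s‖ * (‖s‖ * (1 + 1 / s.re) + 1) * (2 * X ^ (-s.re)) := by gcongr
    _ = _ := by ring

theorem sum_dvd_cpow_eq {D N : ℕ} (hD : 0 < D) (s : ℂ) :
    ∑ n ∈ Finset.Ioc 0 N, (if D ∣ n then (n : ℂ) ^ s else 0) =
      (D : ℂ) ^ s * ∑ m ∈ Finset.Ioc 0 (N / D), (m : ℂ) ^ s := by
  rw [← Finset.sum_filter, Finset.mul_sum]
  symm
  refine Finset.sum_bij (fun m _ ↦ D * m) ?_ ?_ ?_ ?_
  · intro m hm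
    rw [Finset.mem_Ioc] at hm
    rw [Finset.mem_filter, Finset.mem_Ioc]
    exact ⟨⟨Nat.mul_pos hD hm.1, by rw [mul_comm]; exact (Nat.le_div_iff_mul_le hD).1 hm.2⟩, dvd_mul_right _ _⟩
  · intro a _ b _ hab
    exact Nat.eq_of_mul_eq_mul_left hD hab
  · intro d hd
    rw [Finset.mem_filter, Finset.mem_Ioc] at hd
    obtain ⟨⟨h1, h2⟩, m, rfl⟩ := hd
    exact ⟨m, Finset.mem_Ioc.2 ⟨Nat.pos_of_mul_pos_left h1, (Nat.le_div_iff_mul_le hD).2 (by rwa [mul_comm])⟩, rfl⟩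
  · intro m _
    rw [Nat.cast_mul, Complex.natCast_mul_natCast_cpow]

theorem norm_sum_dvd_cpow_sub_le {s : ℂ} (hs : 0 < s.re) (hs1 : s.re < 1) (hζ : riemannZeta s = 0) {D : ℕ}
    (hD : 0 < D) {x : ℝ} (hDx : (D : ℝ) ≤ x) :
    ‖∑ n ∈ Finset.Ioc 0 ⌊x⌋₊, (if D ∣ n then (n : ℂ) ^ (-s) else 0) -
      (((D : ℝ) ^ (-1 : ℝ) : ℝ) : ℂ) * ((x : ℂ) ^ (1 - s) / (1 - s))‖ ≤
      2 * (‖s‖ * (1 + 1 / s.re) + 1) * x ^ (-s.re) := by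
  have hD0 : (0 : ℝ) < D := by exact_mod_cast hD
  have hDc : (D : ℂ) ≠ 0 := by exact_mod_cast hD.ne'
  have h := norm_sum_cpow_sub_le hs hs1 hζ (X := x / D) ((one_le_div hD0).2 hDx)
  rw [sum_dvd_cpow_eq hD, ← Nat.floor_div_natCast]
  have e : (((D : ℝ) ^ (-1 : ℝ) : ℝ) : ℂ) * ((x : ℂ) ^ (1 - s) / (1 - s)) =
      (D : ℂ) ^ (-s) * (((x / D : ℝ) : ℂ) ^ (1 - s) / (1 - s)) := by
    have h1 : (x : ℂ) = ((D : ℝ) : ℂ) * ((x / D : ℝ) : ℂ) := by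
      rw [← ofReal_mul, mul_div_cancel₀ _ hD0.ne']
    have h2 : (x : ℂ) ^ (1 - s) = (D : ℂ) ^ (1 - s) * ((x / D : ℝ) : ℂ) ^ (1 - s) := by
      conv_lhs => rw [h1]
      rw [Complex.mul_cpow_ofReal_nonneg hD0.le (div_nonneg (hD0.le.trans hDx) hD0.le), ofReal_natCast]
    rw [h2, sub_eq_add_neg, Complex.cpow_add _ _ hDc, Complex.cpow_one, Real.rpow_neg_one, ofReal_inv,
      ofReal_natCast]
    field_simp
  rw [e, ← mul_sub, norm_mul, Complex.norm_natCast_cpow_of_pos hD, neg_re]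
  calc _ ≤ (D : ℝ) ^ (-s.re) * (2 * (‖s‖ * (1 + 1 / s.re) + 1) * (x / D) ^ (-s.re)) := by gcongr
    _ = 2 * (‖s‖ * (1 + 1 / s.re) + 1) * ((D : ℝ) ^ (-s.re) * (x / D) ^ (-s.re)) := by ring
    _ = _ := by
        rw [← Real.mul_rpow hD0.le (div_nonneg (hD0.le.trans hDx) hD0.le), mul_div_cancel₀ _ hD0.ne']

theorem half_le_norm_sum_divisorSum {H l : ℝ} (hl : l = Real.log ((2 * H + 30) / 6)) (hl20 : 20 ≤ l)
    (hH : 0 ≤ H) {s : ℂ} (hζ : riemannZeta s = 0) (hs : 59 / 60 ≤ s.re) (hs1 : s.re < 1) (hsH : |s.im| ≤ H)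
    (hsG : 3 * Real.exp (7 * l * (1 - s.re)) ≤ |s.im|) :
    1 / 2 ≤ ‖∑ n ∈ Finset.Ioc 1 ⌊Real.exp (7 * l)⌋₊,
      ((divisorSum (thetaCoeff l) n * divisorSum (psiCoeff l) n : ℝ) : ℂ) * (n : ℂ) ^ (-s)‖ := by
  have hl0 : 0 < l := by linarith
  set x := Real.exp (7 * l) with hx
  set D := ⌊Real.exp (5 * l)⌋₊
  set D0 := ⌊Real.exp (l / 2)⌋₊
  have hx0 : 0 < x := Real.exp_pos _
  have hD : Real.exp (5 * l) < D + 1 := Nat.lt_floor_add_one _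
  have hDle : (D : ℝ) ≤ Real.exp (5 * l) := Nat.floor_le (Real.exp_nonneg _)
  have hD0le : (D0 : ℝ) ≤ Real.exp (l / 2) := Nat.floor_le (Real.exp_nonneg _)
  have hψ (d : ℕ) (hd : D < d) : psiCoeff l d = 0 :=
    psiCoeff_of_exp_lt hl0 ((Nat.floor_lt (Real.exp_nonneg _)).1 hd)
  have hθ0 (d : ℕ) (hd : D0 < d) : thetaCoeff l d = 0 :=
    thetaCoeff_of_exp_lt ((Nat.floor_lt (Real.exp_nonneg _)).1 hd)
  have hDD : D0 ≤ D := Nat.floor_le_floor (Real.exp_le_exp.2 (by linarith))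
  have hθ (d : ℕ) (hd : D < d) : thetaCoeff l d = 0 := hθ0 d (hDD.trans_lt hd)
  set P : ℂ := (x : ℂ) ^ (1 - s) / (1 - s) with hP
  set E : ℝ := 2 * (‖s‖ * (1 + 1 / s.re) + 1) * x ^ (-s.re) with hE
  have hs0 : 0 < s.re := by linarith
  have hE0 : 0 ≤ E := by positivity
  set f : ℕ → ℂ := fun n ↦ ((divisorSum (thetaCoeff l) n * divisorSum (psiCoeff l) n : ℝ) : ℂ) *
    (n : ℂ) ^ (-s) with hf
  have hsum : ∑ n ∈ Finset.Ioc 0 ⌊x⌋₊, f n = ∑ d ∈ Finset.Ioc 0 D, ∑ e ∈ Finset.Ioc 0 D,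
      ((thetaCoeff l d * psiCoeff l e : ℝ) : ℂ) *
        ∑ n ∈ Finset.Ioc 0 ⌊x⌋₊, (if d.lcm e ∣ n then (n : ℂ) ^ (-s) else 0) := by
    simp_rw [Finset.mul_sum]
    rw [Finset.sum_congr rfl fun d _ ↦ Finset.sum_comm, Finset.sum_comm]
    refine Finset.sum_congr rfl fun n hn ↦ ?_
    simp only [hf]
    rw [divisorSum_mul_divisorSum hθ hψ (Finset.mem_Ioc.1 hn).1.ne']
    push_cast
    simp_rw [Finset.sum_mul]
    refine Finset.sum_congr rfl fun d _ ↦ Finset.sum_congr rfl fun e _ ↦ ?_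
    split_ifs <;> simp
  set V : ℝ := ∑ d ∈ Finset.Ioc 0 D, ∑ e ∈ Finset.Ioc 0 D,
    thetaCoeff l d * psiCoeff l e * (d.lcm e : ℝ) ^ (-1 : ℝ) with hV
  have hVle : |V| ≤ 66 / 5 / l := abs_sum_thetaCoeff_psiCoeff_lcm_le hl20 hD
  have hdiff : ‖∑ n ∈ Finset.Ioc 0 ⌊x⌋₊, f n - (V : ℂ) * P‖ ≤ D0 * (D * E) := by
    have e1 : (V : ℂ) * P = ∑ d ∈ Finset.Ioc 0 D, ∑ e ∈ Finset.Ioc 0 D,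
        ((thetaCoeff l d * psiCoeff l e : ℝ) : ℂ) * ((((d.lcm e : ℝ) ^ (-1 : ℝ) : ℝ) : ℂ) * P) := by
      rw [hV]
      push_cast
      simp_rw [Finset.sum_mul, mul_assoc]
    rw [hsum, e1]
    simp_rw [← Finset.sum_sub_distrib, ← mul_sub]
    calc _ ≤ ∑ d ∈ Finset.Ioc 0 D, ∑ e ∈ Finset.Ioc 0 D, if d ≤ D0 then E else 0 := by
          refine norm_sum_le_of_le _ fun d hd ↦ norm_sum_le_of_le _ fun e he ↦ ?_
          rw [Finset.mem_Ioc] at hd he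
          split_ifs with h
          · have h1 : ((d.lcm e : ℕ) : ℝ) ≤ x := by
              calc ((d.lcm e : ℕ) : ℝ) ≤ (d : ℝ) * e := by exact_mod_cast Nat.lcm_le_mul hd.1 he.1
                _ ≤ Real.exp (l / 2) * Real.exp (5 * l) := by
                  gcongr
                  · exact (Nat.cast_le.2 h).trans hD0le
                  · exact (Nat.cast_le.2 he.2).trans hDle
                _ ≤ x := by
                  rw [← Real.exp_add]
                  exact Real.exp_le_exp.2 (by linarith)
            have h2 := norm_sum_dvd_cpow_sub_le hs0 hs1 hζ (Nat.lcm_pos hd.1 he.1) h1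
            have h3 : ‖((thetaCoeff l d * psiCoeff l e : ℝ) : ℂ)‖ ≤ 1 := by
              rw [Complex.norm_real, norm_mul]
              exact mul_le_one₀ (abs_thetaCoeff_le hl0 d) (norm_nonneg _) (abs_psiCoeff_le hl0 e)
            rw [norm_mul]
            calc _ ≤ 1 * E := by gcongr
              _ = E := one_mul E
          · rw [hθ0 d (not_le.1 h)]
            simp
      _ = D0 * (D * E) := by
          simp only [Finset.sum_const, Nat.card_Ioc, tsub_zero, nsmul_eq_mul, ← Finset.mul_sum]
          rw [← Finset.sum_filter]
          have : (Finset.Ioc 0 D).filter (· ≤ D0) = Finset.Ioc 0 D0 := by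
            ext d
            simp only [Finset.mem_filter, Finset.mem_Ioc]
            omega
          rw [this, Finset.sum_const, Nat.card_Ioc, nsmul_eq_mul]
          simp
          ring
  have hDDE : D0 * (D * E) ≤ 1 / 100 := by
    have hn : ‖s‖ ≤ 1 + H := (Complex.norm_le_abs_re_add_abs_im s).trans
      (add_le_add (by rw [abs_of_pos hs0]; exact hs1.le) hsH)
    have h1 : 1 / s.re ≤ 60 / 59 := by
      rw [div_le_div_iff₀ hs0 (by norm_num)]
      linarith
    have h2 : 2 * (‖s‖ * (1 + 1 / s.re) + 1) ≤ 15 * Real.exp l := by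
      have h3 : Real.exp l = (2 * H + 30) / 6 := by rw [hl, Real.exp_log (by positivity)]
      rw [h3]
      have : ‖s‖ * (1 + 1 / s.re) ≤ (1 + H) * (1 + 60 / 59) := by gcongr
      linarith
    have h3 : x ^ (-s.re) ≤ Real.exp (-(413 / 60 * l)) := by
      rw [hx, ← Real.exp_mul]
      refine Real.exp_le_exp.2 ?_
      nlinarith
    have h4 : E ≤ 15 * Real.exp l * Real.exp (-(413 / 60 * l)) := by
      rw [hE]
      gcongr
    calc D0 * (D * E) ≤ Real.exp (l / 2) * (Real.exp (5 * l) *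
          (15 * Real.exp l * Real.exp (-(413 / 60 * l)))) := by gcongr
      _ = 15 * Real.exp (-(23 / 60 * l)) := by
          rw [show -(23 / 60 * l) = l / 2 + (5 * l + (l + -(413 / 60 * l))) by ring, Real.exp_add, Real.exp_add,
            Real.exp_add]
          ring
      _ ≤ 15 * Real.exp (-(23 / 3)) := by
          gcongr
          linarith
      _ ≤ 1 / 100 := by
          rw [Real.exp_neg, ← div_eq_mul_inv, div_le_div_iff₀ (Real.exp_pos _) (by norm_num)]
          have h4 : (2.7182818283 : ℝ) ^ 23 ≤ Real.exp (23 / 3) ^ 3 := by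
            rw [← Real.exp_nat_mul]
            calc (2.7182818283 : ℝ) ^ 23 ≤ Real.exp 1 ^ 23 := by
                  gcongr
                  exact Real.exp_one_gt_d9.le
              _ = _ := by rw [← Real.exp_nat_mul]; norm_num
          by_contra! h5
          have : Real.exp (23 / 3) ^ 3 < 1500 ^ 3 := by gcongr; linarith
          norm_num at h4 this
          linarith
  have hVP : ‖(V : ℂ) * P‖ ≤ 11 / 50 := by
    have h1 : |s.im| ≤ ‖1 - s‖ := by
      have := Complex.abs_im_le_norm (1 - s)
      simpa using this
    have h2 : ‖(x : ℂ) ^ (1 - s)‖ = Real.exp (7 * l * (1 - s.re)) := by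
      rw [Complex.norm_cpow_eq_rpow_re_of_pos hx0, hx, ← Real.exp_mul]
      simp
    have h3 := Real.exp_pos (7 * l * (1 - s.re))
    have h4 : 0 < ‖1 - s‖ := by linarith
    rw [norm_mul, hP, norm_div, h2, Complex.norm_real]
    have h5 : |V| ≤ 66 / 100 := hVle.trans (by rw [div_le_iff₀ hl0]; linarith)
    have h6 : Real.exp (7 * l * (1 - s.re)) / ‖1 - s‖ ≤ 1 / 3 := by
      rw [div_le_div_iff₀ h4 (by norm_num)]
      linarith
    calc _ ≤ 66 / 100 * (1 / 3 : ℝ) := by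
          rw [Real.norm_eq_abs]
          gcongr
      _ = _ := by norm_num
  have h1x : 1 ≤ ⌊x⌋₊ := Nat.le_floor (by
    rw [Nat.cast_one, hx]
    exact Real.one_le_exp (by positivity))
  have hsplit : ∑ n ∈ Finset.Ioc 0 ⌊x⌋₊, f n = 1 + ∑ n ∈ Finset.Ioc 1 ⌊x⌋₊, f n := by
    have h1 : f 1 = 1 := by
      simp only [hf]
      rw [divisorSum_thetaCoeff_one hl0, divisorSum_psiCoeff hl0
        (by simpa using Real.one_le_exp (by positivity : 0 ≤ 7 / 2 * l))]
      simp
    rw [← h1, ← Finset.sum_Ioc_consecutive f zero_le_one h1x, show Finset.Ioc 0 1 = {1} from rfl,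
      Finset.sum_singleton]
  rw [hsplit] at hdiff
  have h1 := norm_sub_norm_le (1 : ℂ) (-(∑ n ∈ Finset.Ioc 1 ⌊x⌋₊, f n))
  rw [sub_neg_eq_add, norm_neg, norm_one] at h1
  have h2 := norm_sub_norm_le (1 + ∑ n ∈ Finset.Ioc 1 ⌊x⌋₊, f n) ((V : ℂ) * P)
  linarith

theorem hasDerivAt_max_sq (y : ℝ) : HasDerivAt (fun y : ℝ ↦ (max y 0) ^ 2) (2 * max y 0) y := by
  rcases lt_trichotomy y 0 with h | rfl | h
  · have : (fun y : ℝ ↦ (max y 0) ^ 2) =ᶠ[nhds y] fun _ ↦ 0 := by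
      filter_upwards [eventually_lt_nhds h] with z hz
      simp [max_eq_right hz.le]
    rw [max_eq_right h.le, mul_zero]
    exact (hasDerivAt_const y (0 : ℝ)).congr_of_eventuallyEq this
  · simp only [max_self, mul_zero]
    rw [hasDerivAt_iff_isLittleO_nhds_zero]
    simp only [zero_add, max_self, smul_zero, sub_zero, ne_eq, OfNat.ofNat_ne_zero, not_false_eq_true, zero_pow]
    refine (Asymptotics.IsBigO.of_bound 1 (Filter.Eventually.of_forall fun h ↦ ?_)).trans_isLittleO
      (Asymptotics.isLittleO_pow_id (n := 2) (by norm_num))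
    rw [norm_pow, norm_pow, one_mul]
    gcongr
    rw [Real.norm_eq_abs, Real.norm_eq_abs, abs_of_nonneg (le_max_right _ _)]
    exact max_le (le_abs_self h) (abs_nonneg h)
  · have : (fun y : ℝ ↦ (max y 0) ^ 2) =ᶠ[nhds y] fun y ↦ y ^ 2 := by
      filter_upwards [eventually_gt_nhds h] with z hz
      simp [max_eq_left hz.le]
    rw [max_eq_left h.le]
    exact ((hasDerivAt_pow 2 y).congr_of_eventuallyEq this).congr_deriv (by simp)

theorem norm_sum_sub_integral_le {g g' : ℝ → ℂ} {D : ℝ} (hD : 0 < D) {N : ℕ} (hN : 1 ≤ N)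
    (hg : ∀ u, 0 < u → HasDerivAt g (g' u) u) (hg' : ContinuousOn g' (Set.Ioi 0)) :
    ‖D * ∑ m ∈ Finset.Ioc 1 N, g (D * m) - ∫ u in D..(D * N), g u‖ ≤ D * ∫ u in D..(D * N), ‖g' u‖ := by
  have hint : ∀ a b : ℝ, 0 < a → 0 < b → IntervalIntegrable g MeasureTheory.volume a b := fun a b ha hb ↦
    ContinuousOn.intervalIntegrable fun u hu ↦
      (hg u ((lt_min ha hb).trans_le hu.1)).continuousAt.continuousWithinAt
  have hint' : ∀ a b : ℝ, 0 < a → 0 < b → IntervalIntegrable g' MeasureTheory.volume a b := fun a b ha hb ↦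
    (hg'.mono fun u hu ↦ (lt_min ha hb).trans_le hu.1).intervalIntegrable
  induction N, hN using Nat.le_induction with
  | base => simp
  | succ n hn ih =>
    have hn' : (1 : ℝ) ≤ n := by exact_mod_cast hn
    have p1 : 0 < D * n := by positivity
    have p2 : 0 < D * (n + 1 : ℕ) := by positivity
    have hle : D * n ≤ D * (n + 1 : ℕ) := by gcongr; simp
    rw [Finset.sum_Ioc_succ_top hn, ← intervalIntegral.integral_add_adjacent_intervals (hint D _ hD p1) (hint _ _ p1 p2),
      ← intervalIntegral.integral_add_adjacent_intervals (hint' D _ hD p1).norm (hint' _ _ p1 p2).norm]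
    have key : D * g (D * (n + 1 : ℕ)) - ∫ u in (D * n)..(D * (n + 1 : ℕ)), g u =
        ∫ u in (D * n)..(D * (n + 1 : ℕ)), ((u - D * n : ℝ) : ℂ) * g' u := by
      have := intervalIntegral.integral_mul_deriv_eq_deriv_mul (a := D * n) (b := D * (n + 1 : ℕ))
        (u := fun u : ℝ ↦ ((u - D * n : ℝ) : ℂ)) (u' := fun _ ↦ 1) (v := g) (v' := g')
        (fun x _ ↦ by
          have := ((hasDerivAt_id x).sub_const (D * n)).ofReal_comp
          simpa using this)
        (fun x hx ↦ hg x ((lt_min p1 p2).trans_le hx.1)) (by simp) (hint' _ _ p1 p2)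
      rw [this]
      push_cast
      simp only [sub_self, zero_mul, one_mul, sub_zero]
      ring
    have h2 : ‖∫ u in (D * n)..(D * (n + 1 : ℕ)), ((u - D * n : ℝ) : ℂ) * g' u‖ ≤
        D * ∫ u in (D * n)..(D * (n + 1 : ℕ)), ‖g' u‖ := by
      rw [← intervalIntegral.integral_const_mul]
      refine intervalIntegral.norm_integral_le_of_norm_le hle (Filter.Eventually.of_forall fun u hu ↦ ?_)
        ((hint' _ _ p1 p2).norm.const_mul D)
      rw [norm_mul, Complex.norm_real, Real.norm_eq_abs, abs_of_nonneg (by linarith [hu.1])]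
      have := hu.2
      push_cast at this
      gcongr
      linarith
    rw [← key] at h2
    calc _ = ‖(D * ∑ m ∈ Finset.Ioc 1 n, g (D * m) - ∫ u in D..(D * n), g u) +
        (D * g (D * (n + 1 : ℕ)) - ∫ u in (D * n)..(D * (n + 1 : ℕ)), g u)‖ := by
          congr 1
          ring
      _ ≤ _ := (norm_add_le _ _).trans (by rw [mul_add]; gcongr)

/-- A `C¹` bump, at least `1` on `[7 l / 2, 7 l]` and supported in `[3 l, 15 l / 2]`. -/
noncomputable def haloWeight (l u : ℝ) : ℝ :=
  (81 / 32) ^ 2 * (max (1 - ((u - 21 / 4 * l) / (9 / 4 * l)) ^ 2) 0) ^ 2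

noncomputable def haloWeightDeriv (l u : ℝ) : ℝ :=
  (81 / 32) ^ 2 * (2 * max (1 - ((u - 21 / 4 * l) / (9 / 4 * l)) ^ 2) 0 *
    (-(2 * ((u - 21 / 4 * l) / (9 / 4 * l)) * (1 / (9 / 4 * l)))))

section haloWeight

variable {l : ℝ}

theorem haloWeight_nonneg (u : ℝ) : 0 ≤ haloWeight l u := by
  unfold haloWeight
  positivity

theorem max_one_sub_sq_le (x : ℝ) : max (1 - x ^ 2) 0 ≤ 1 := max_le (by nlinarith [sq_nonneg x]) zero_le_one

theorem haloWeight_le (u : ℝ) : haloWeight l u ≤ 641 / 100 := by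
  unfold haloWeight
  have h1 := max_one_sub_sq_le ((u - 21 / 4 * l) / (9 / 4 * l))
  have h2 := pow_le_one₀ (n := 2) (le_max_right (1 - ((u - 21 / 4 * l) / (9 / 4 * l)) ^ 2) 0) h1
  linarith

theorem one_le_haloWeight (hl : 0 < l) {u : ℝ} (h1 : 7 / 2 * l ≤ u) (h2 : u ≤ 7 * l) : 1 ≤ haloWeight l u := by
  unfold haloWeight
  set x := (u - 21 / 4 * l) / (9 / 4 * l) with hx
  have h3 : |x| ≤ 7 / 9 := by
    rw [abs_le, hx, le_div_iff₀ (by positivity), div_le_iff₀ (by positivity)]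
    constructor <;> linarith
  have h4 : x ^ 2 ≤ (7 / 9) ^ 2 := sq_le_sq' (by linarith [(abs_le.1 h3).1]) (abs_le.1 h3).2
  have h5 : 32 / 81 ≤ max (1 - x ^ 2) 0 := le_max_of_le_left (by linarith)
  have h6 := pow_le_pow_left₀ (by norm_num) h5 2
  linarith

theorem max_one_sub_sq_eq_zero (hl : 0 < l) {u : ℝ} (h : u ≤ 3 * l ∨ 15 / 2 * l ≤ u) :
    max (1 - ((u - 21 / 4 * l) / (9 / 4 * l)) ^ 2) 0 = 0 := by
  refine max_eq_right ?_
  rw [div_pow, sub_nonpos, one_le_div (by positivity)]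
  rcases h with h | h <;> nlinarith

theorem max_one_sub_sq_eq (hl : 0 < l) {u : ℝ} (h1 : 3 * l ≤ u) (h2 : u ≤ 15 / 2 * l) :
    max (1 - ((u - 21 / 4 * l) / (9 / 4 * l)) ^ 2) 0 = 1 - ((u - 21 / 4 * l) / (9 / 4 * l)) ^ 2 := by
  refine max_eq_left ?_
  rw [div_pow, sub_nonneg, div_le_one (by positivity)]
  nlinarith

theorem haloWeight_eq_zero (hl : 0 < l) {u : ℝ} (h : u ≤ 3 * l ∨ 15 / 2 * l ≤ u) : haloWeight l u = 0 := by
  rw [haloWeight, max_one_sub_sq_eq_zero hl h]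
  norm_num

theorem haloWeightDeriv_eq_zero (hl : 0 < l) {u : ℝ} (h : u ≤ 3 * l ∨ 15 / 2 * l ≤ u) :
    haloWeightDeriv l u = 0 := by
  rw [haloWeightDeriv, max_one_sub_sq_eq_zero hl h]
  norm_num

theorem abs_haloWeightDeriv_le (hl : 0 < l) (u : ℝ) : |haloWeightDeriv l u| ≤ 12 / l := by
  unfold haloWeightDeriv
  set x := (u - 21 / 4 * l) / (9 / 4 * l)
  have h0 := le_max_right (1 - x ^ 2) 0
  have h1 := max_one_sub_sq_le x
  have h2 : max (1 - x ^ 2) 0 * |x| ≤ 1 := by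
    rcases le_total |x| 1 with h | h
    · exact mul_le_one₀ h1 (abs_nonneg _) h
    · rw [max_eq_right (by nlinarith [sq_abs x])]
      simp
  rw [abs_mul, abs_mul, abs_mul, abs_neg, abs_mul, abs_mul, abs_of_nonneg h0, abs_of_pos (by norm_num : (0 : ℝ) < 2),
    abs_of_pos (by positivity : 0 < 1 / (9 / 4 * l)), abs_of_pos (by norm_num : (0 : ℝ) < (81 / 32) ^ 2)]
  have e : (81 / 32 : ℝ) ^ 2 * (2 * max (1 - x ^ 2) 0 * (2 * |x| * (1 / (9 / 4 * l)))) =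
      (81 / 32) ^ 2 * (16 / 9) * (max (1 - x ^ 2) 0 * |x|) / l := by
    field_simp
    ring
  rw [e]
  gcongr
  linarith

theorem hasDerivAt_haloWeight (u : ℝ) : HasDerivAt (haloWeight l) (haloWeightDeriv l u) u := by
  have h1 : HasDerivAt (fun u ↦ (u - 21 / 4 * l) / (9 / 4 * l)) (1 / (9 / 4 * l)) u :=
    ((hasDerivAt_id u).sub_const _).div_const _
  have h2 : HasDerivAt (fun u ↦ 1 - ((u - 21 / 4 * l) / (9 / 4 * l)) ^ 2)
      (-(2 * ((u - 21 / 4 * l) / (9 / 4 * l)) * (1 / (9 / 4 * l)))) u := by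
    refine ((h1.pow 2).const_sub 1).congr_deriv ?_
    simp
  exact (((hasDerivAt_max_sq _).comp u h2).const_mul _)

theorem continuous_haloWeightDeriv : Continuous (haloWeightDeriv l) := by
  unfold haloWeightDeriv
  fun_prop

noncomputable def haloKernel (l : ℝ) (κ : ℂ) (u : ℝ) : ℂ := haloWeight l (Real.log u) * (u : ℂ) ^ (κ - 1)

noncomputable def haloKernelDeriv (l : ℝ) (κ : ℂ) (u : ℝ) : ℂ :=
  (haloWeightDeriv l (Real.log u) + haloWeight l (Real.log u) * (κ - 1)) * (u : ℂ) ^ (κ - 2)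

theorem ofReal_cpow_sub_one {u : ℝ} (hu : 0 < u) (κ : ℂ) : (u : ℂ) ^ (κ - 1) = u * (u : ℂ) ^ (κ - 2) := by
  rw [show κ - 1 = 1 + (κ - 2) by ring, Complex.cpow_add _ _ (by exact_mod_cast hu.ne'), Complex.cpow_one]

theorem hasDerivAt_ofReal_cpow_sub_one {u : ℝ} (hu : 0 < u) (κ : ℂ) :
    HasDerivAt (fun u : ℝ ↦ (u : ℂ) ^ (κ - 1)) ((κ - 1) * (u : ℂ) ^ (κ - 2)) u := by
  have h1 := (hasDerivAt_id (u : ℂ)).cpow_const (c := κ - 1) (Or.inl (by simpa using hu))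
  refine h1.comp_ofReal.congr_deriv ?_
  simp only [id, mul_one]
  rw [show κ - 1 - 1 = κ - 2 by ring]

theorem hasDerivAt_haloKernel (κ : ℂ) {u : ℝ} (hu : 0 < u) :
    HasDerivAt (haloKernel l κ) (haloKernelDeriv l κ u) u := by
  have h1 := ((hasDerivAt_haloWeight (l := l) (Real.log u)).comp u (Real.hasDerivAt_log hu.ne')).ofReal_comp
  refine (h1.mul (hasDerivAt_ofReal_cpow_sub_one hu κ)).congr_deriv ?_
  have hu' : (u : ℂ) ≠ 0 := by exact_mod_cast hu.ne'
  simp only [Function.comp_apply, haloKernelDeriv]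
  rw [ofReal_cpow_sub_one hu]
  push_cast
  field_simp

theorem continuousOn_haloKernelDeriv (κ : ℂ) : ContinuousOn (haloKernelDeriv l κ) (Set.Ioi 0) := by
  intro u hu
  have hu' : 0 < u := hu
  refine ContinuousAt.continuousWithinAt ?_
  have hlog : ContinuousAt Real.log u := Real.continuousAt_log hu'.ne'
  have h1 : ContinuousAt (fun u ↦ haloWeightDeriv l (Real.log u)) u :=
    continuous_haloWeightDeriv.continuousAt.comp hlog
  have h2 : ContinuousAt (fun u ↦ haloWeight l (Real.log u)) u :=
    (hasDerivAt_haloWeight _).continuousAt.comp hlog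
  have h3 : ContinuousAt (fun u : ℝ ↦ (u : ℂ) ^ (κ - 2)) u :=
    Complex.continuousAt_ofReal_cpow_const u _ (Or.inr hu'.ne')
  exact ((Complex.continuous_ofReal.continuousAt.comp h1).add
    ((Complex.continuous_ofReal.continuousAt.comp h2).mul continuousAt_const)).mul h3

theorem haloKernel_eq_zero (hl : 0 < l) (κ : ℂ) {u : ℝ} (hu : 0 < u)
    (h : u ≤ Real.exp (3 * l) ∨ Real.exp (15 / 2 * l) ≤ u) : haloKernel l κ u = 0 := by
  rw [haloKernel, haloWeight_eq_zero hl ?_, ofReal_zero, zero_mul]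
  exact h.imp (fun h ↦ (Real.log_le_iff_le_exp hu).2 h) (fun h ↦ (Real.le_log_iff_exp_le hu).2 h)

theorem haloKernelDeriv_eq_zero (hl : 0 < l) (κ : ℂ) {u : ℝ} (hu : 0 < u)
    (h : u ≤ Real.exp (3 * l) ∨ Real.exp (15 / 2 * l) ≤ u) : haloKernelDeriv l κ u = 0 := by
  have h' := h.imp (fun h ↦ (Real.log_le_iff_le_exp hu).2 h) (fun h ↦ (Real.le_log_iff_exp_le hu).2 h)
  rw [haloKernelDeriv, haloWeight_eq_zero hl h', haloWeightDeriv_eq_zero hl h']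
  simp

theorem rpow_le_exp_mul {κ u c : ℝ} (hκ : 0 ≤ κ) (hu : 0 < u) (h : u ≤ Real.exp c) :
    u ^ κ ≤ Real.exp (c * κ) := by
  rw [Real.exp_mul]
  gcongr

theorem norm_haloKernelDeriv_le (hl : 0 < l) {κ : ℂ} (hκ : 0 ≤ κ.re) {u : ℝ} (hu : 0 < u) :
    ‖haloKernelDeriv l κ u‖ ≤
      (12 / l + 7 * ‖κ - 1‖) * Real.exp (15 / 2 * l * κ.re) * u ^ (-2 : ℝ) := by
  rcases le_total (Real.exp (15 / 2 * l)) u with h | h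
  · rw [haloKernelDeriv_eq_zero hl κ hu (Or.inr h), norm_zero]
    positivity
  · rw [haloKernelDeriv, norm_mul, Complex.norm_cpow_eq_rpow_re_of_pos hu]
    have e : u ^ (κ - 2).re = u ^ κ.re * u ^ (-2 : ℝ) := by
      rw [← Real.rpow_add hu]
      simp [sub_eq_add_neg]
    rw [e, mul_assoc]
    have h1 := rpow_le_exp_mul hκ hu h
    gcongr
    refine (norm_add_le _ _).trans (add_le_add ?_ ?_)
    · rw [Complex.norm_real]
      exact abs_haloWeightDeriv_le hl _
    · rw [norm_mul, Complex.norm_real, Real.norm_of_nonneg (haloWeight_nonneg _)]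
      gcongr
      linarith [haloWeight_le (l := l) (Real.log u)]

theorem integral_norm_haloKernelDeriv_le (hl : 0 < l) {κ : ℂ} (hκ : 0 ≤ κ.re) {D X : ℝ} (hD : 0 < D)
    (hD' : D ≤ Real.exp (3 * l)) (hX : Real.exp (3 * l) ≤ X) :
    ∫ u in D..X, ‖haloKernelDeriv l κ u‖ ≤
      (12 / l + 7 * ‖κ - 1‖) * Real.exp (15 / 2 * l * κ.re) * Real.exp (-(3 * l)) := by
  set C := (12 / l + 7 * ‖κ - 1‖) * Real.exp (15 / 2 * l * κ.re)
  have hC : 0 ≤ C := by positivity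
  have he := Real.exp_pos (3 * l)
  have hint' : ∀ a b : ℝ, 0 < a → 0 < b →
      IntervalIntegrable (haloKernelDeriv l κ) MeasureTheory.volume a b := fun a b ha hb ↦
    ((continuousOn_haloKernelDeriv κ).mono fun u hu ↦ (lt_min ha hb).trans_le hu.1).intervalIntegrable
  rw [← intervalIntegral.integral_add_adjacent_intervals (hint' D _ hD he).norm
    (hint' _ _ he (he.trans_le hX)).norm]
  have h1 : ∫ u in D..Real.exp (3 * l), ‖haloKernelDeriv l κ u‖ = 0 := by
    rw [← intervalIntegral.integral_zero (a := D) (b := Real.exp (3 * l))]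
    refine intervalIntegral.integral_congr fun u hu ↦ ?_
    rw [uIcc_of_le hD'] at hu
    simp [haloKernelDeriv_eq_zero hl κ (hD.trans_le hu.1) (Or.inl hu.2)]
  rw [h1, zero_add]
  have h0 : (0 : ℝ) ∉ uIcc (Real.exp (3 * l)) X := by
    rw [uIcc_of_le hX]
    exact fun h ↦ absurd h.1 (not_le.2 he)
  have h2 : ∫ u in Real.exp (3 * l)..X, ‖haloKernelDeriv l κ u‖ ≤ ∫ u in Real.exp (3 * l)..X, C * u ^ (-2 : ℝ) := by
    refine intervalIntegral.integral_mono_on hX (hint' _ _ he (he.trans_le hX)).norm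
      ((intervalIntegral.intervalIntegrable_rpow (Or.inr h0)).const_mul C) fun u hu ↦ ?_
    exact norm_haloKernelDeriv_le hl hκ (he.trans_le hu.1)
  refine h2.trans ?_
  rw [intervalIntegral.integral_const_mul, integral_rpow (Or.inr ⟨by norm_num, h0⟩)]
  gcongr
  rw [show (-2 : ℝ) + 1 = -1 by norm_num, Real.rpow_neg_one, Real.rpow_neg_one, Real.exp_neg]
  have : 0 ≤ X⁻¹ := inv_nonneg.2 (he.le.trans hX)
  linarith

noncomputable def haloIntegral (l : ℝ) (κ : ℂ) : ℂ :=
  ∫ u in Real.exp (3 * l)..Real.exp (15 / 2 * l), haloKernel l κ u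

theorem integral_haloKernel_eq (hl : 0 < l) (κ : ℂ) {D X : ℝ} (hD : 0 < D)
    (hD' : D ≤ Real.exp (3 * l)) (hX : Real.exp (15 / 2 * l) ≤ X) :
    ∫ u in D..X, haloKernel l κ u = haloIntegral l κ := by
  have he := Real.exp_pos (3 * l)
  have he' := Real.exp_pos (15 / 2 * l)
  have hint : ∀ a b : ℝ, 0 < a → 0 < b →
      IntervalIntegrable (haloKernel l κ) MeasureTheory.volume a b := fun a b ha hb ↦
    ContinuousOn.intervalIntegrable fun u hu ↦
      (hasDerivAt_haloKernel κ ((lt_min ha hb).trans_le hu.1)).continuousAt.continuousWithinAt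
  rw [← intervalIntegral.integral_add_adjacent_intervals (hint D _ hD he) (hint _ _ he (he'.trans_le hX)),
    ← intervalIntegral.integral_add_adjacent_intervals (hint _ _ he he') (hint _ _ he' (he'.trans_le hX))]
  have h1 : ∫ u in D..Real.exp (3 * l), haloKernel l κ u = 0 := by
    rw [← intervalIntegral.integral_zero (a := D) (b := Real.exp (3 * l))]
    refine intervalIntegral.integral_congr fun u hu ↦ ?_
    rw [uIcc_of_le hD'] at hu
    exact haloKernel_eq_zero hl κ (hD.trans_le hu.1) (Or.inl hu.2)
  have h2 : ∫ u in Real.exp (15 / 2 * l)..X, haloKernel l κ u = 0 := by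
    rw [← intervalIntegral.integral_zero (a := Real.exp (15 / 2 * l)) (b := X)]
    refine intervalIntegral.integral_congr fun u hu ↦ ?_
    rw [uIcc_of_le hX] at hu
    exact haloKernel_eq_zero hl κ (he'.trans_le hu.1) (Or.inr hu.1)
  rw [h1, h2, zero_add, add_zero, haloIntegral]

theorem norm_integral_log_mul_cpow_le {F : ℝ → ℂ} {a b C : ℝ} (hab : a ≤ b) {κ : ℂ} (hκ : 0 ≤ κ.re)
    (hF : ∀ v, a ≤ v → v ≤ b → ‖F v‖ ≤ C) :
    ‖∫ u in Real.exp a..Real.exp b, F (Real.log u) * (u : ℂ) ^ (κ - 1)‖ ≤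
      C * Real.exp (b * κ.re) * (b - a) := by
  have ha := Real.exp_pos a
  have hC : 0 ≤ C := (norm_nonneg _).trans (hF a le_rfl hab)
  have h0 : (0 : ℝ) ∉ uIcc (Real.exp a) (Real.exp b) := by
    rw [uIcc_of_le (Real.exp_le_exp.2 hab)]
    exact fun h ↦ absurd h.1 (not_le.2 ha)
  have e : C * Real.exp (b * κ.re) * (b - a) =
      ∫ u in Real.exp a..Real.exp b, C * Real.exp (b * κ.re) * u⁻¹ := by
    rw [intervalIntegral.integral_const_mul, integral_inv h0, ← Real.exp_sub, Real.log_exp]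
  rw [e]
  refine intervalIntegral.norm_integral_le_of_norm_le (Real.exp_le_exp.2 hab)
    (Filter.Eventually.of_forall fun u hu ↦ ?_)
    ((intervalIntegral.intervalIntegrable_inv (fun u hu h ↦ h0 (h ▸ hu)) continuousOn_id).const_mul _)
  have hu0 : 0 < u := ha.trans hu.1
  rw [norm_mul, Complex.norm_cpow_eq_rpow_re_of_pos hu0, sub_re, one_re, Real.rpow_sub_one hu0.ne', div_eq_mul_inv,
    mul_assoc]
  have h1 := rpow_le_exp_mul hκ hu0 hu.2
  have h2 := hF (Real.log u) ((Real.le_log_iff_exp_le hu0).2 hu.1.le) ((Real.log_le_iff_le_exp hu0).2 hu.2)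
  gcongr

theorem haloIntegral_mul_sq (hl : 0 < l) (κ : ℂ) :
    κ ^ 2 * haloIntegral l κ = ∫ u in Real.exp (3 * l)..Real.exp (15 / 2 * l),
      (((81 / 32) ^ 2 * (4 * (1 / (9 / 4 * l)) ^ 2 *
        (3 * ((Real.log u - 21 / 4 * l) / (9 / 4 * l)) ^ 2 - 1)) : ℝ) : ℂ) * (u : ℂ) ^ (κ - 1) := by
  set α := 1 / (9 / 4 * l) with hα
  set x : ℝ → ℝ := fun v ↦ (v - 21 / 4 * l) / (9 / 4 * l) with hx
  have hle : Real.exp (3 * l) ≤ Real.exp (15 / 2 * l) := Real.exp_le_exp.2 (by linarith)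
  have hpos : ∀ u ∈ uIcc (Real.exp (3 * l)) (Real.exp (15 / 2 * l)), 0 < u := fun u hu ↦ by
    rw [uIcc_of_le hle] at hu
    exact (Real.exp_pos _).trans_le hu.1
  have hxd : ∀ u, 0 < u → HasDerivAt (fun u ↦ x (Real.log u)) (α * u⁻¹) u := fun u hu ↦ by
    refine (((Real.hasDerivAt_log hu.ne').sub_const (21 / 4 * l)).div_const (9 / 4 * l)).congr_deriv ?_
    rw [hα]
    ring
  set W : ℝ → ℝ := fun y ↦ (81 / 32) ^ 2 * (1 - y ^ 2) ^ 2 with hW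
  set W1 : ℝ → ℝ := fun y ↦ (81 / 32) ^ 2 * (2 * (1 - y ^ 2) * (-(2 * y * α))) with hW1
  set W2 : ℝ → ℝ := fun y ↦ (81 / 32) ^ 2 * (4 * α ^ 2 * (3 * y ^ 2 - 1)) with hW2
  have hWd : ∀ u, 0 < u → HasDerivAt (fun u ↦ W (x (Real.log u))) (W1 (x (Real.log u)) * u⁻¹) u := fun u hu ↦ by
    refine ((((hxd u hu).pow 2).const_sub 1).pow 2 |>.const_mul _).congr_deriv ?_
    simp only [hW1, Nat.cast_ofNat, Pi.pow_apply]
    ring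
  have hW1d : ∀ u, 0 < u → HasDerivAt (fun u ↦ W1 (x (Real.log u))) (W2 (x (Real.log u)) * u⁻¹) u := fun u hu ↦ by
    have h1 := (((hxd u hu).pow 2).const_sub 1).const_mul 2
    have h2 := (((hxd u hu).const_mul 2).mul_const α).neg
    refine ((h1.mul h2).const_mul ((81 / 32) ^ 2)).congr_deriv ?_
    simp only [hW2, Nat.cast_ofNat, Pi.pow_apply, Pi.neg_apply]
    ring
  have hI : haloIntegral l κ =
      ∫ u in Real.exp (3 * l)..Real.exp (15 / 2 * l), (W (x (Real.log u)) : ℂ) * (u : ℂ) ^ (κ - 1) := by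
    refine intervalIntegral.integral_congr fun u hu ↦ ?_
    have hu0 := hpos u hu
    rw [uIcc_of_le hle] at hu
    simp only [haloKernel, haloWeight, hW, hx]
    rw [max_one_sub_sq_eq hl ((Real.le_log_iff_exp_le hu0).2 hu.1) ((Real.log_le_iff_le_exp hu0).2 hu.2)]
  have hcont : ∀ F : ℝ → ℝ, Continuous F → ContinuousOn (fun u : ℝ ↦ (F (x (Real.log u)) : ℂ) * (u : ℂ) ^ (κ - 1))
      (uIcc (Real.exp (3 * l)) (Real.exp (15 / 2 * l))) := fun F hF u hu ↦ by
    have hu0 := hpos u hu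
    exact ((Complex.continuous_ofReal.continuousAt.comp (hF.continuousAt.comp (hxd u hu0).continuousAt)).mul
      (Complex.continuousAt_ofReal_cpow_const u _ (Or.inr hu0.ne'))).continuousWithinAt
  have c1 : Continuous W := by fun_prop
  have c2 : Continuous W2 := by fun_prop
  have key := intervalIntegral.integral_eq_sub_of_hasDerivAt
    (f := fun u : ℝ ↦ (κ * W (x (Real.log u)) - W1 (x (Real.log u)) : ℂ) * (u : ℂ) ^ κ)
    (f' := fun u : ℝ ↦ κ ^ 2 * ((W (x (Real.log u)) : ℂ) * (u : ℂ) ^ (κ - 1)) -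
      (W2 (x (Real.log u)) : ℂ) * (u : ℂ) ^ (κ - 1)) (a := Real.exp (3 * l)) (b := Real.exp (15 / 2 * l))
    (fun u hu ↦ by
      have hu0 := hpos u hu
      have hu' : (u : ℂ) ≠ 0 := by exact_mod_cast hu0.ne'
      have h1 := (((hWd u hu0).ofReal_comp).const_mul κ).sub (hW1d u hu0).ofReal_comp
      have h2 := ((hasDerivAt_id (u : ℂ)).cpow_const (c := κ) (Or.inl (by simpa using hu0))).comp_ofReal
      refine (h1.mul h2).congr_deriv ?_
      have h3 : (u : ℂ) ^ κ = u * (u : ℂ) ^ (κ - 1) := by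
        have := ofReal_cpow_sub_one hu0 (κ + 1)
        rwa [add_sub_cancel_right, show κ + 1 - 2 = κ - 1 by ring] at this
      simp only [id, mul_one, Pi.sub_apply]
      rw [h3]
      push_cast
      field_simp
      ring)
    (((hcont W c1).intervalIntegrable.const_mul _).sub (hcont W2 c2).intervalIntegrable)
  rw [intervalIntegral.integral_sub ((hcont W c1).intervalIntegrable.const_mul _) (hcont W2 c2).intervalIntegrable,
    intervalIntegral.integral_const_mul, ← hI] at key
  have hx1 : x (3 * l) = -1 := by
    simp only [hx]
    field_simp
    ring
  have hx2 : x (15 / 2 * l) = 1 := by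
    simp only [hx]
    field_simp
    ring
  have hend : (κ * W (x (Real.log (Real.exp (15 / 2 * l)))) - W1 (x (Real.log (Real.exp (15 / 2 * l)))) : ℂ) *
      (Real.exp (15 / 2 * l) : ℂ) ^ κ - (κ * W (x (Real.log (Real.exp (3 * l)))) -
        W1 (x (Real.log (Real.exp (3 * l)))) : ℂ) * (Real.exp (3 * l) : ℂ) ^ κ = 0 := by
    rw [Real.log_exp, Real.log_exp, hx1, hx2]
    simp [hW, hW1]
  exact sub_eq_zero.1 (key.trans hend)

theorem norm_haloIntegral_mul_le (hl : 0 < l) {κ : ℂ} (hκ : 0 ≤ κ.re) :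
    ‖haloIntegral l κ‖ * (158 / 100 / l ^ 2 + ‖κ‖ ^ 2) ≤ 92 / l * Real.exp (15 / 2 * l * κ.re) := by
  have hE := Real.exp_pos (15 / 2 * l * κ.re)
  have h1 : ‖haloIntegral l κ‖ ≤ 641 / 100 * Real.exp (15 / 2 * l * κ.re) * (15 / 2 * l - 3 * l) :=
    norm_integral_log_mul_cpow_le (F := fun v ↦ (haloWeight l v : ℂ)) (by linarith) hκ fun v _ _ ↦ by
      rw [Complex.norm_real, Real.norm_of_nonneg (haloWeight_nonneg _)]
      exact haloWeight_le v
  have h2 : ‖κ‖ ^ 2 * ‖haloIntegral l κ‖ ≤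
      1014 / 100 / l ^ 2 * Real.exp (15 / 2 * l * κ.re) * (15 / 2 * l - 3 * l) := by
    rw [← norm_pow, ← norm_mul, haloIntegral_mul_sq hl]
    refine norm_integral_log_mul_cpow_le (F := fun v ↦ (((81 / 32) ^ 2 * (4 * (1 / (9 / 4 * l)) ^ 2 *
        (3 * ((v - 21 / 4 * l) / (9 / 4 * l)) ^ 2 - 1)) : ℝ) : ℂ)) (by linarith) hκ fun v hv1 hv2 ↦ ?_
    rw [Complex.norm_real, Real.norm_eq_abs]
    set y := (v - 21 / 4 * l) / (9 / 4 * l) with hy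
    have hy1 : y ^ 2 ≤ 1 := by
      rw [hy, div_pow, div_le_one (by positivity)]
      nlinarith
    have hy2 : |3 * y ^ 2 - 1| ≤ 2 := abs_le.2 ⟨by nlinarith [sq_nonneg y], by linarith⟩
    rw [abs_mul, abs_mul, abs_of_pos (by norm_num : (0 : ℝ) < (81 / 32) ^ 2),
      abs_of_pos (by positivity : 0 < 4 * (1 / (9 / 4 * l)) ^ 2)]
    calc (81 / 32 : ℝ) ^ 2 * (4 * (1 / (9 / 4 * l)) ^ 2 * |3 * y ^ 2 - 1|) ≤
          (81 / 32 : ℝ) ^ 2 * (4 * (1 / (9 / 4 * l)) ^ 2 * 2) := by gcongr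
      _ = (81 / 32 : ℝ) ^ 2 * 8 * 16 / 81 / l ^ 2 := by
          field_simp
          ring
      _ ≤ _ := by
          refine div_le_div_of_nonneg_right ?_ (by positivity)
          norm_num
  calc _ = 158 / 100 / l ^ 2 * ‖haloIntegral l κ‖ + ‖κ‖ ^ 2 * ‖haloIntegral l κ‖ := by ring
    _ ≤ 158 / 100 / l ^ 2 * (641 / 100 * Real.exp (15 / 2 * l * κ.re) * (15 / 2 * l - 3 * l)) +
        1014 / 100 / l ^ 2 * Real.exp (15 / 2 * l * κ.re) * (15 / 2 * l - 3 * l) := by gcongr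
    _ = (158 / 100 * (641 / 100) + 1014 / 100) * (9 / 2) / l * Real.exp (15 / 2 * l * κ.re) := by
        field_simp
        ring
    _ ≤ _ := by
        gcongr
        norm_num

end haloWeight

theorem sum_dvd_eq_sum_mul {D N : ℕ} (hD : 0 < D) {g : ℕ → ℂ} (hg : ∀ n, N < n → g n = 0) :
    ∑ n ∈ Finset.Ioc 0 N, (if D ∣ n then g n else 0) = ∑ m ∈ Finset.Ioc 0 N, g (D * m) := by
  have h : ∑ m ∈ Finset.Ioc 0 N, g (D * m) = ∑ m ∈ Finset.Ioc 0 (N / D), g (D * m) := by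
    refine (Finset.sum_subset (Finset.Ioc_subset_Ioc_right (Nat.div_le_self N D)) fun m hm hm' ↦ hg _ ?_).symm
    rw [Finset.mem_Ioc] at hm hm'
    by_contra! h
    exact hm' ⟨hm.1, (Nat.le_div_iff_mul_le hD).2 (by rwa [mul_comm])⟩
  rw [h, ← Finset.sum_filter]
  symm
  refine Finset.sum_bij (fun m _ ↦ D * m) ?_ ?_ ?_ fun _ _ ↦ rfl
  · intro m hm
    rw [Finset.mem_Ioc] at hm
    rw [Finset.mem_filter, Finset.mem_Ioc]
    exact ⟨⟨Nat.mul_pos hD hm.1, by rw [mul_comm]; exact (Nat.le_div_iff_mul_le hD).1 hm.2⟩, dvd_mul_right _ _⟩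
  · intro a _ b _ hab
    exact Nat.eq_of_mul_eq_mul_left hD hab
  · intro d hd
    rw [Finset.mem_filter, Finset.mem_Ioc] at hd
    obtain ⟨⟨h1, h2⟩, m, rfl⟩ := hd
    exact ⟨m, Finset.mem_Ioc.2 ⟨Nat.pos_of_mul_pos_left h1, (Nat.le_div_iff_mul_le hD).2 (by rwa [mul_comm])⟩, rfl⟩

/-- `∑ w(log n) θ(n)² n ^ (κ - 1)` with `θ` the Selberg divisor sum. -/
noncomputable def haloSum (l : ℝ) (κ : ℂ) : ℂ :=
  ∑ n ∈ Finset.Ioc 0 ⌈Real.exp (15 / 2 * l)⌉₊,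
    ((divisorSum (thetaCoeff l) n * divisorSum (thetaCoeff l) n : ℝ) : ℂ) * haloKernel l κ n

theorem norm_sum_dvd_haloKernel_sub_le {l : ℝ} (hl : 0 < l) {κ : ℂ} (hκ : 0 ≤ κ.re) {q : ℕ} (hq : 0 < q)
    (hq' : (q : ℝ) ≤ Real.exp (3 * l)) :
    ‖∑ n ∈ Finset.Ioc 0 ⌈Real.exp (15 / 2 * l)⌉₊, (if q ∣ n then haloKernel l κ n else 0) -
      (((q : ℝ) ^ (-1 : ℝ) : ℝ) : ℂ) * haloIntegral l κ‖ ≤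
      (12 / l + 7 * ‖κ - 1‖) * Real.exp (15 / 2 * l * κ.re) * Real.exp (-(3 * l)) := by
  set N := ⌈Real.exp (15 / 2 * l)⌉₊
  have hN : Real.exp (15 / 2 * l) ≤ N := Nat.le_ceil _
  have hN1 : 1 ≤ N := Nat.ceil_pos.2 (Real.exp_pos _)
  have hq0 : (0 : ℝ) < q := by exact_mod_cast hq
  have hq1 : (1 : ℝ) ≤ q := by exact_mod_cast hq
  have hqN : Real.exp (15 / 2 * l) ≤ q * N := hN.trans (le_mul_of_one_le_left (by positivity) hq1)
  rw [sum_dvd_eq_sum_mul hq fun n hn ↦ haloKernel_eq_zero hl κ (by exact_mod_cast (by omega : 0 < n))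
    (Or.inr (hN.trans (by exact_mod_cast hn.le)))]
  have h1 := norm_sum_sub_integral_le hq0 hN1 (fun u hu ↦ hasDerivAt_haloKernel (l := l) κ hu)
    (continuousOn_haloKernelDeriv κ)
  rw [integral_haloKernel_eq hl κ hq0 hq' hqN] at h1
  have h2 := integral_norm_haloKernelDeriv_le hl hκ hq0 hq'
    ((Real.exp_le_exp.2 (by linarith : 3 * l ≤ 15 / 2 * l)).trans hqN)
  have h3 : ∑ m ∈ Finset.Ioc 0 N, haloKernel l κ ((q * m : ℕ) : ℝ) =
      ∑ m ∈ Finset.Ioc 1 N, haloKernel l κ (q * m) := by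
    rw [← Finset.sum_Ioc_consecutive _ zero_le_one hN1, show Finset.Ioc 0 1 = {1} from rfl,
      Finset.sum_singleton, mul_one, haloKernel_eq_zero hl κ hq0 (Or.inl hq'), zero_add]
    simp
  rw [h3]
  have h4 : (q : ℝ) * ‖∑ m ∈ Finset.Ioc 1 N, haloKernel l κ (q * m) -
      (((q : ℝ) ^ (-1 : ℝ) : ℝ) : ℂ) * haloIntegral l κ‖ =
      ‖((q : ℝ) : ℂ) * ∑ m ∈ Finset.Ioc 1 N, haloKernel l κ (q * m) - haloIntegral l κ‖ := by
    have hq2 : (q : ℂ) ≠ 0 := by exact_mod_cast hq0.ne'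
    rw [← Real.norm_of_nonneg hq0.le, ← Complex.norm_real, ← norm_mul, Complex.norm_real, Real.norm_of_nonneg hq0.le]
    congr 1
    rw [Real.rpow_neg_one]
    push_cast
    field_simp
  rw [← h4] at h1
  exact (le_of_mul_le_mul_left h1 hq0).trans h2

theorem norm_haloSum_sub_le {l : ℝ} (hl : 20 ≤ l) {κ : ℂ} (hκ : 0 ≤ κ.re) :
    ‖haloSum l κ‖ ≤ 99 / 5 / l * ‖haloIntegral l κ‖ +
      (12 / l + 7 * ‖κ - 1‖) * Real.exp (15 / 2 * l * κ.re) * Real.exp (-(2 * l)) := by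
  have hl0 : 0 < l := by linarith
  set D := ⌊Real.exp (l / 2)⌋₊
  have hDle : (D : ℝ) ≤ Real.exp (l / 2) := Nat.floor_le (Real.exp_pos _).le
  have hD : Real.exp (l / 2) < D + 1 := Nat.lt_floor_add_one _
  have hθ0 : ∀ d, D < d → thetaCoeff l d = 0 := fun d hd ↦
    thetaCoeff_of_exp_lt (hD.trans_le (by exact_mod_cast hd))
  set E := (12 / l + 7 * ‖κ - 1‖) * Real.exp (15 / 2 * l * κ.re) * Real.exp (-(3 * l)) with hE
  set N := ⌈Real.exp (15 / 2 * l)⌉₊ with hN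
  set V : ℝ := ∑ d ∈ Finset.Ioc 0 D, ∑ e ∈ Finset.Ioc 0 D,
    thetaCoeff l d * thetaCoeff l e * (d.lcm e : ℝ) ^ (-1 : ℝ) with hV
  have hVle : |V| ≤ 99 / 5 / l := abs_sum_thetaCoeff_lcm_le hl hD
  have hsum : haloSum l κ = ∑ d ∈ Finset.Ioc 0 D, ∑ e ∈ Finset.Ioc 0 D,
      ((thetaCoeff l d * thetaCoeff l e : ℝ) : ℂ) *
        ∑ n ∈ Finset.Ioc 0 N, (if d.lcm e ∣ n then haloKernel l κ n else 0) := by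
    rw [haloSum, ← hN]
    simp_rw [Finset.mul_sum]
    rw [Finset.sum_congr rfl fun d _ ↦ Finset.sum_comm, Finset.sum_comm]
    refine Finset.sum_congr rfl fun n hn ↦ ?_
    rw [Finset.mem_Ioc] at hn
    rw [divisorSum_mul_divisorSum hθ0 hθ0 (by omega)]
    push_cast
    simp_rw [Finset.sum_mul]
    refine Finset.sum_congr rfl fun d _ ↦ Finset.sum_congr rfl fun e _ ↦ ?_
    split_ifs <;> simp
  have e1 : (V : ℂ) * haloIntegral l κ = ∑ d ∈ Finset.Ioc 0 D, ∑ e ∈ Finset.Ioc 0 D,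
      ((thetaCoeff l d * thetaCoeff l e : ℝ) : ℂ) * ((((d.lcm e : ℝ) ^ (-1 : ℝ) : ℝ) : ℂ) * haloIntegral l κ) := by
    rw [hV]
    push_cast
    simp_rw [Finset.sum_mul, mul_assoc]
  have hdiff : ‖haloSum l κ - (V : ℂ) * haloIntegral l κ‖ ≤ D * (D * E) := by
    rw [hsum, e1]
    simp_rw [← Finset.sum_sub_distrib, ← mul_sub]
    calc _ ≤ ∑ d ∈ Finset.Ioc 0 D, ∑ e ∈ Finset.Ioc 0 D, E := by
          refine norm_sum_le_of_le _ fun d hd ↦ norm_sum_le_of_le _ fun e he ↦ ?_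
          rw [Finset.mem_Ioc] at hd he
          have h1 : ((d.lcm e : ℕ) : ℝ) ≤ Real.exp (3 * l) := by
            calc ((d.lcm e : ℕ) : ℝ) ≤ (d : ℝ) * e := by exact_mod_cast Nat.lcm_le_mul hd.1 he.1
              _ ≤ Real.exp (l / 2) * Real.exp (l / 2) := by
                gcongr
                · exact (Nat.cast_le.2 hd.2).trans hDle
                · exact (Nat.cast_le.2 he.2).trans hDle
              _ ≤ _ := by
                rw [← Real.exp_add]
                exact Real.exp_le_exp.2 (by linarith)
          have h2 := norm_sum_dvd_haloKernel_sub_le hl0 hκ (Nat.lcm_pos hd.1 he.1) h1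
          have h3 : ‖((thetaCoeff l d * thetaCoeff l e : ℝ) : ℂ)‖ ≤ 1 := by
            rw [Complex.norm_real, norm_mul]
            exact mul_le_one₀ (abs_thetaCoeff_le hl0 d) (norm_nonneg _) (abs_thetaCoeff_le hl0 e)
          rw [norm_mul]
          calc _ ≤ 1 * E := by gcongr
            _ = E := one_mul E
      _ = D * (D * E) := by
          simp only [Finset.sum_const, Nat.card_Ioc, tsub_zero, nsmul_eq_mul]
  have hDDE : D * (D * E) ≤ (12 / l + 7 * ‖κ - 1‖) * Real.exp (15 / 2 * l * κ.re) * Real.exp (-(2 * l)) := by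
    calc D * (D * E) ≤ Real.exp (l / 2) * (Real.exp (l / 2) * E) := by gcongr
      _ = _ := by
        rw [hE, show -(2 * l) = l / 2 + (l / 2 + -(3 * l)) by ring, Real.exp_add, Real.exp_add]
        ring
  have hVI : ‖(V : ℂ) * haloIntegral l κ‖ ≤ 99 / 5 / l * ‖haloIntegral l κ‖ := by
    rw [norm_mul, Complex.norm_real, Real.norm_eq_abs]
    gcongr
  have := norm_sub_norm_le (haloSum l κ) ((V : ℂ) * haloIntegral l κ)
  linarith

theorem neg_reLSeriesVonMangoldt_le {σ : ℝ} (hσ : 1 < σ) (t : ℝ) :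
    -reLSeriesVonMangoldt σ t ≤ reLSeriesVonMangoldt σ 0 := by
  have h := (hasSum_reLSeriesVonMangoldt hσ 0).add (hasSum_reLSeriesVonMangoldt hσ t)
  have := h.nonneg fun n ↦ by
    have : 0 ≤ Λ n := vonMangoldt_nonneg
    have h2 : 0 ≤ Real.cos (0 * Real.log n) + Real.cos (t * Real.log n) := by
      rw [zero_mul, Real.cos_zero]
      linarith [Real.neg_one_le_cos (t * Real.log n)]
    rw [← mul_add]
    positivity
  linarith

theorem ofReal_sum_norm_sq_eq {α : Type*} (J : Finset α) (s ε : α → ℂ) (l : ℝ) :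
    ((∑ n ∈ Finset.Ioc 0 ⌈Real.exp (15 / 2 * l)⌉₊, haloWeight l (Real.log n) * divisorSum (thetaCoeff l) n ^ 2 *
      (n * ‖∑ j ∈ J, ε j * (n : ℂ) ^ (-s j)‖ ^ 2) : ℝ) : ℂ) =
      ∑ j ∈ J, ∑ k ∈ J, ε j * starRingEnd ℂ (ε k) * haloSum l (2 - s j - starRingEnd ℂ (s k)) := by
  simp_rw [haloSum, Finset.mul_sum]
  rw [Finset.sum_congr rfl fun d _ ↦ Finset.sum_comm, Finset.sum_comm]
  push_cast
  refine Finset.sum_congr rfl fun n hn ↦ ?_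
  rw [Finset.mem_Ioc] at hn
  have hn0 : (n : ℂ) ≠ 0 := by exact_mod_cast hn.1.ne'
  rw [← Complex.mul_conj', map_sum, Finset.sum_mul_sum]
  simp_rw [Finset.mul_sum]
  refine Finset.sum_congr rfl fun j _ ↦ Finset.sum_congr rfl fun k _ ↦ ?_
  have h1 : starRingEnd ℂ ((n : ℂ) ^ (-s k)) = (n : ℂ) ^ (-starRingEnd ℂ (s k)) := by
    rw [← map_neg, Complex.cpow_conj _ _ (by rw [natCast_arg]; exact Real.pi_pos.ne), conj_natCast]
  rw [map_mul, h1, haloKernel, show 2 - s j - starRingEnd ℂ (s k) - 1 = 1 + (-s j + -starRingEnd ℂ (s k)) by ring,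
    Complex.ofReal_natCast, Complex.cpow_add _ _ hn0, Complex.cpow_add _ _ hn0, Complex.cpow_one]
  ring

theorem card_sq_le_sum_haloSum {α : Type*} {l : ℝ} (hl : 20 ≤ l) (J : Finset α) (s : α → ℂ)
    (hs : ∀ j ∈ J, 1 / 2 ≤ ‖∑ n ∈ Finset.Ioc 1 ⌊Real.exp (7 * l)⌋₊,
      ((divisorSum (thetaCoeff l) n * divisorSum (psiCoeff l) n : ℝ) : ℂ) * (n : ℂ) ^ (-s j)‖) :
    (J.card : ℝ) ^ 2 ≤ 16000 * ∑ j ∈ J, ∑ k ∈ J, ‖haloSum l (2 - s j - starRingEnd ℂ (s k))‖ := by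
  have hl0 : 0 < l := by linarith
  set N := ⌊Real.exp (7 * l)⌋₊ with hN
  set a : α → ℂ := fun j ↦ ∑ n ∈ Finset.Ioc 1 N,
    ((divisorSum (thetaCoeff l) n * divisorSum (psiCoeff l) n : ℝ) : ℂ) * (n : ℂ) ^ (-s j) with ha
  have hε : ∀ z : ℂ, ∃ w : ℂ, ‖w‖ ≤ 1 ∧ w * z = ‖z‖ := fun z ↦ by
    rcases eq_or_ne z 0 with rfl | hz
    · exact ⟨0, by simp⟩
    · have hz' : (‖z‖ : ℂ) ≠ 0 := by simpa using hz
      refine ⟨starRingEnd ℂ z / ‖z‖, ?_, ?_⟩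
      · rw [norm_div, RCLike.norm_conj, Complex.norm_real, norm_norm, div_self (by simpa using hz)]
      · rw [div_mul_eq_mul_div, mul_comm, Complex.mul_conj', sq, mul_div_cancel_right₀ _ hz']
  choose ε hε1 hε2 using fun j ↦ hε (a j)
  set A : ℕ → ℂ := fun n ↦ ∑ j ∈ J, ε j * (n : ℂ) ^ (-s j) with hA
  set θ : ℕ → ℝ := divisorSum (thetaCoeff l) with hθ
  set ψ : ℕ → ℝ := divisorSum (psiCoeff l) with hψ
  have h1 : (J.card : ℝ) / 2 ≤ ∑ n ∈ Finset.Ioc 1 N, |θ n * ψ n| * ‖A n‖ := by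
    calc (J.card : ℝ) / 2 = ∑ j ∈ J, (1 / 2 : ℝ) := by
          rw [Finset.sum_const, nsmul_eq_mul]
          ring
      _ ≤ ∑ j ∈ J, ‖a j‖ := Finset.sum_le_sum hs
      _ = ‖∑ j ∈ J, ε j * a j‖ := by
          simp_rw [hε2]
          rw [← ofReal_sum, Complex.norm_real, Real.norm_of_nonneg (Finset.sum_nonneg fun _ _ ↦ norm_nonneg _)]
      _ = ‖∑ n ∈ Finset.Ioc 1 N, ((θ n * ψ n : ℝ) : ℂ) * A n‖ := by
          simp_rw [ha, hA, Finset.mul_sum]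
          rw [Finset.sum_comm]
          congr 1
          refine Finset.sum_congr rfl fun n _ ↦ Finset.sum_congr rfl fun j _ ↦ ?_
          ring
      _ ≤ _ := by
          refine norm_sum_le_of_le _ fun n _ ↦ ?_
          rw [norm_mul, Complex.norm_real, Real.norm_eq_abs]
  set f : ℕ → ℝ := fun n ↦ |ψ n| / √n with hf
  set g : ℕ → ℝ := fun n ↦ if ψ n = 0 then 0 else |θ n| * ‖A n‖ * √n with hg
  have h2 : ∑ n ∈ Finset.Ioc 1 N, |θ n * ψ n| * ‖A n‖ = ∑ n ∈ Finset.Ioc 1 N, f n * g n := by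
    refine Finset.sum_congr rfl fun n hn ↦ ?_
    rw [Finset.mem_Ioc] at hn
    have : 0 < √(n : ℝ) := Real.sqrt_pos.2 (by exact_mod_cast (by omega : 0 < n))
    simp only [hf, hg]
    split_ifs with h
    · simp [h]
    · rw [abs_mul]
      field_simp
  have h3 : ∑ n ∈ Finset.Ioc 1 N, f n ^ 2 ≤ 4000 := by
    refine le_trans ?_ (sum_divisorSum_psiCoeff_sq_div_le hl (N := N) (Nat.floor_le (Real.exp_pos _).le))
    refine (Finset.sum_le_sum_of_subset_of_nonneg (Finset.Ioc_subset_Ioc_left zero_le_one)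
      fun _ _ _ ↦ sq_nonneg _).trans (le_of_eq (Finset.sum_congr rfl fun n _ ↦ ?_))
    simp only [hf]
    rw [div_pow, sq_abs, Real.sq_sqrt (Nat.cast_nonneg n)]
  have hNle : N ≤ ⌈Real.exp (15 / 2 * l)⌉₊ :=
    (Nat.floor_le_ceil _).trans (Nat.ceil_mono (Real.exp_le_exp.2 (by linarith)))
  have h4 : ∑ n ∈ Finset.Ioc 1 N, g n ^ 2 ≤ ∑ n ∈ Finset.Ioc 0 ⌈Real.exp (15 / 2 * l)⌉₊,
      haloWeight l (Real.log n) * θ n ^ 2 * (n * ‖A n‖ ^ 2) := by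
    refine (Finset.sum_le_sum fun n hn ↦ ?_).trans (Finset.sum_le_sum_of_subset_of_nonneg
      (Finset.Ioc_subset_Ioc zero_le_one hNle) fun n _ _ ↦ ?_)
    · rw [Finset.mem_Ioc] at hn
      have hn0 : (0 : ℝ) < n := by exact_mod_cast (by omega : 0 < n)
      have hw := haloWeight_nonneg (l := l) (Real.log n)
      simp only [hg]
      split_ifs with h
      · rw [zero_pow two_ne_zero]
        positivity
      · have h5 : ¬ (n : ℝ) ≤ Real.exp (7 / 2 * l) := fun h5 ↦ h (by
          rw [hψ, divisorSum_psiCoeff hl0 h5, if_neg (by omega)])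
        have h6 : 1 ≤ haloWeight l (Real.log n) :=
          one_le_haloWeight hl0 ((Real.le_log_iff_exp_le hn0).2 (not_le.1 h5).le)
            ((Real.log_le_iff_le_exp hn0).2 ((Nat.le_floor_iff (Real.exp_pos _).le).1 hn.2))
        rw [mul_pow, mul_pow, sq_abs, Real.sq_sqrt hn0.le]
        calc _ = 1 * θ n ^ 2 * (n * ‖A n‖ ^ 2) := by ring
          _ ≤ _ := by gcongr
    · have hw := haloWeight_nonneg (l := l) (Real.log n)
      positivity
  have h5 : ∑ n ∈ Finset.Ioc 0 ⌈Real.exp (15 / 2 * l)⌉₊,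
      haloWeight l (Real.log n) * θ n ^ 2 * (n * ‖A n‖ ^ 2) ≤
      ∑ j ∈ J, ∑ k ∈ J, ‖haloSum l (2 - s j - starRingEnd ℂ (s k))‖ := by
    refine (le_abs_self _).trans ?_
    rw [← Real.norm_eq_abs, ← Complex.norm_real, ofReal_sum_norm_sq_eq]
    refine norm_sum_le_of_le _ fun j _ ↦ norm_sum_le_of_le _ fun k _ ↦ ?_
    rw [norm_mul, norm_mul, RCLike.norm_conj]
    have := mul_le_one₀ (hε1 j) (norm_nonneg _) (hε1 k)
    exact mul_le_of_le_one_left (norm_nonneg _) this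
  have h6 := Finset.sum_mul_sq_le_sq_mul_sq (Finset.Ioc 1 N) f g
  rw [← h2] at h6
  have h7 : ((J.card : ℝ) / 2) ^ 2 ≤ (∑ n ∈ Finset.Ioc 1 N, |θ n * ψ n| * ‖A n‖) ^ 2 := by gcongr
  have h8 : (∑ n ∈ Finset.Ioc 1 N, f n ^ 2) * ∑ n ∈ Finset.Ioc 1 N, g n ^ 2 ≤
      4000 * ∑ j ∈ J, ∑ k ∈ J, ‖haloSum l (2 - s j - starRingEnd ℂ (s k))‖ :=
    mul_le_mul h3 (h4.trans h5) (Finset.sum_nonneg fun _ _ ↦ sq_nonneg _) (by norm_num)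
  linarith

namespace ZetaZeros
variable {K ε : ℝ} (Z : ZetaZeros K ε)

theorem sumRe_le (hε : ε ≤ 1 / 100) {l t : ℝ} (hl : 20 ≤ l) (ht : 3 ≤ |t|) (htK : |t| + 2 < K)
    (htl : Real.log ((|t| + 30) / 6) ≤ l) : Z.sumRe (1 + 1 / l) t ≤ 151 / 100 * l := by
  have hl0 : 0 < l := by linarith
  have hη0 : 0 < 1 / l := by positivity
  have hη1 : 1 / l ≤ 1 / 20 := one_div_le_one_div_of_le (by norm_num) hl
  have h1 := Z.sumRe_add_le hε (t := t) hη0 (by linarith) htK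
  have h2 := Z.sumRe_add_le_zero hε hη0 (by linarith) (by linarith)
  have h3 := neg_reLSeriesVonMangoldt_le (σ := 1 + 1 / l) (by linarith) t
  have h4 := Z.sumRe_nonneg (σ := 1 + 1 / l) (by linarith) 0
  have h5 : 1 / l / ((1 / l) ^ 2 + t ^ 2) ≤ 1 / 10 := by
    rw [div_le_iff₀ (by positivity)]
    have : 9 ≤ t ^ 2 := by nlinarith [sq_abs t]
    nlinarith [sq_nonneg (1 / l)]
  rw [one_div_one_div] at h2
  linarith

private theorem one_div_le_aux {l b τ P : ℝ} (hl : 0 < l) (hb : 0 < b) (hP : b ^ 2 + τ ^ 2 ≤ P) :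
    1 / (158 / 100 / l ^ 2 + P) ≤ 5 / 3 * l * ((1 / l + b) / ((1 / l + b) ^ 2 + τ ^ 2)) := by
  obtain ⟨η, hη⟩ : ∃ η, η = 1 / l := ⟨_, rfl⟩
  have hη0 : 0 < η := by rw [hη]; positivity
  have e2 : 158 / 100 / l ^ 2 = 158 / 100 * η ^ 2 := by rw [hη]; field_simp
  have hlη : l * η = 1 := by rw [hη]; field_simp
  have hP0 : 0 < P := lt_of_lt_of_le (by positivity) hP
  rw [e2, ← hη, ← mul_div_assoc, div_le_div_iff₀ (by positivity) (by positivity)]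
  have h6 : 1 ≤ l * (η + b) := by
    have := mul_pos hl hb
    linarith
  have h7 : (η + b) ^ 2 + τ ^ 2 ≤ 5 / 3 * (158 / 100 * η ^ 2 + P) := by
    nlinarith [sq_nonneg (3 * η - 2 * b), sq_nonneg τ]
  have h8 : 0 ≤ 5 / 3 * (158 / 100 * η ^ 2 + P) := by positivity
  have h9 := mul_le_mul_of_nonneg_right h6 h8
  linarith

private theorem mul_norm_le_aux {l X g P b τ : ℝ} (hl : 0 < l) (hb : 0 < b) (hX : 0 ≤ X) (hP : b ^ 2 + τ ^ 2 ≤ P)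
    (hg : g * (158 / 100 / l ^ 2 + P) ≤ 92 / l * X) :
    99 / 5 / l * g ≤ 3037 / l * X * ((1 / l + b) / ((1 / l + b) ^ 2 + τ ^ 2)) := by
  have hP0 : 0 < P := lt_of_lt_of_le (by positivity) hP
  have h1 := one_div_le_aux hl hb hP
  have h2 : g ≤ 92 / l * X * (1 / (158 / 100 / l ^ 2 + P)) := by
    rwa [mul_one_div, le_div_iff₀ (by positivity)]
  obtain ⟨R, hR⟩ : ∃ R, R = (1 / l + b) / ((1 / l + b) ^ 2 + τ ^ 2) := ⟨_, rfl⟩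
  have hR0 : 0 ≤ R := by rw [hR]; positivity
  rw [← hR] at h1 ⊢
  have h3 : g ≤ 92 / l * X * (5 / 3 * l * R) := h2.trans (mul_le_mul_of_nonneg_left h1 (by positivity))
  have h4 : 0 ≤ 1 / l * X * R := by positivity
  calc 99 / 5 / l * g ≤ 99 / 5 / l * (92 / l * X * (5 / 3 * l * R)) := mul_le_mul_of_nonneg_left h3 (by positivity)
    _ = 3036 * (1 / l * X * R) := by
      field_simp
      ring
    _ ≤ 3037 * (1 / l * X * R) := by linarith
    _ = _ := by ring

theorem norm_haloSum_le {H l : ℝ} (hl : l = Real.log ((2 * H + 30) / 6)) (hl20 : 20 ≤ l) (hH : 0 ≤ H)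
    {lam : ℝ} (hlam1 : lam ≤ l / 60) {j k : Z.ι}
    (hj : |(Z.ρ j).im| ≤ H ∧ 1 - (Z.ρ j).re ≤ lam / l) (hk : |(Z.ρ k).im| ≤ H ∧ 1 - (Z.ρ k).re ≤ lam / l) :
    ‖haloSum l (2 - Z.ρ j - starRingEnd ℂ (Z.ρ k))‖ ≤
      3037 / l * Real.exp (15 * lam) * ((1 + 1 / l - (Z.ρ k).re) /
        ((1 + 1 / l - (Z.ρ k).re) ^ 2 + ((Z.ρ j).im - (Z.ρ k).im) ^ 2)) +
      42 * Real.exp (-l) * Real.exp (15 * lam) := by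
  have hl0 : 0 < l := by linarith
  have hel : Real.exp l = (2 * H + 30) / 6 := by rw [hl, Real.exp_log (by positivity)]
  clear hl
  obtain ⟨hj1, hj2⟩ := hj
  obtain ⟨hk1, hk2⟩ := hk
  have hbj := Z.re_lt_one j
  have hbk := Z.re_lt_one k
  set κ := 2 - Z.ρ j - starRingEnd ℂ (Z.ρ k) with hκ
  set τ := (Z.ρ j).im - (Z.ρ k).im with hτ
  set b := 1 - (Z.ρ k).re with hb
  have hre : κ.re = (1 - (Z.ρ j).re) + b := by
    rw [hκ, hb]
    simp
    ring
  have him : κ.im = -τ := by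
    rw [hκ, hτ]
    simp
    ring
  have hκ0 : 0 ≤ κ.re := by rw [hre]; linarith
  have hκle : κ.re ≤ 2 * lam / l := by
    rw [hre, mul_div_assoc]
    linarith
  have hlaml : lam / l ≤ 1 / 60 := by
    rw [div_le_iff₀ hl0]
    linarith
  have hX : Real.exp (15 / 2 * l * κ.re) ≤ Real.exp (15 * lam) := by
    refine Real.exp_le_exp.2 ?_
    calc 15 / 2 * l * κ.re ≤ 15 / 2 * l * (2 * lam / l) := by gcongr
      _ = _ := by field_simp
  have hτ1 : |τ| ≤ 2 * H := by
    rw [hτ]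
    exact (abs_sub _ _).trans (by linarith)
  have hκ1 : ‖κ - 1‖ ≤ 1 + 2 * H := by
    refine (Complex.norm_le_abs_re_add_abs_im _).trans (add_le_add ?_ ?_)
    · rw [sub_re, one_re, abs_le]
      constructor <;> linarith [mul_div_assoc 2 lam l]
    · simpa [him] using hτ1
  have hκ2 : b ^ 2 + τ ^ 2 ≤ ‖κ‖ ^ 2 := by
    rw [← Complex.normSq_eq_norm_sq, Complex.normSq_apply, him, hre]
    nlinarith
  have h1 := norm_haloSum_sub_le hl20 hκ0
  have h2 := norm_haloIntegral_mul_le hl0 hκ0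
  have h3 : (12 / l + 7 * ‖κ - 1‖) * Real.exp (15 / 2 * l * κ.re) * Real.exp (-(2 * l)) ≤
      42 * Real.exp (-l) * Real.exp (15 * lam) := by
    have h4 : 12 / l ≤ 1 := by
      rw [div_le_one hl0]
      linarith
    calc _ ≤ 42 * Real.exp l * Real.exp (15 * lam) * Real.exp (-(2 * l)) := by
          gcongr
          rw [hel]
          linarith
      _ = _ := by
          rw [show -l = l + -(2 * l) by ring, Real.exp_add]
          ring
  have h9 := mul_norm_le_aux hl0 (b := b) (by rw [hb]; linarith) (Real.exp_nonneg (15 * lam)) hκ2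
    (h2.trans (mul_le_mul_of_nonneg_left hX (by positivity)))
  rw [show 1 + 1 / l - (Z.ρ k).re = 1 / l + b by rw [hb]; ring]
  linarith

theorem sum_norm_haloSum_le (hε : ε ≤ 1 / 100) {H l : ℝ} (hl : l = Real.log ((2 * H + 30) / 6)) (hl20 : 20 ≤ l)
    (hH : 0 ≤ H) (hK : H + 2 < K) {lam : ℝ} (hlam1 : lam ≤ l / 60) (J : Finset Z.ι)
    (hJ : ∀ i ∈ J, 3 ≤ |(Z.ρ i).im| ∧ |(Z.ρ i).im| ≤ H ∧ 1 - (Z.ρ i).re ≤ lam / l) {j : Z.ι} (hj : j ∈ J) :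
    ∑ k ∈ J, ‖haloSum l (2 - Z.ρ j - starRingEnd ℂ (Z.ρ k))‖ ≤
      (4600 + 42 * Real.exp (-l) * J.card) * Real.exp (15 * lam) := by
  have hl0 : 0 < l := by linarith
  refine (Finset.sum_le_sum fun k hk ↦ Z.norm_haloSum_le hl hl20 hH hlam1 (hJ j hj).2 (hJ k hk).2).trans ?_
  rw [Finset.sum_add_distrib, ← Finset.mul_sum, Finset.sum_const, nsmul_eq_mul]
  obtain ⟨hj3, hjH, -⟩ := hJ j hj
  have h1 := Z.sum_le_sumRe (σ := 1 + 1 / l) (by linarith [one_div_pos.2 hl0]) (Z.ρ j).im J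
  have h2 := Z.sumRe_le hε hl20 hj3 (by linarith) (by
    rw [hl]
    refine Real.log_le_log (by positivity) ?_
    linarith)
  have h3 : 3037 / l * Real.exp (15 * lam) * ∑ k ∈ J, ((1 + 1 / l - (Z.ρ k).re) /
        ((1 + 1 / l - (Z.ρ k).re) ^ 2 + ((Z.ρ j).im - (Z.ρ k).im) ^ 2)) ≤
      3037 / l * Real.exp (15 * lam) * (151 / 100 * l) := by
    gcongr
    exact h1.trans h2
  have h4 : 3037 / l * Real.exp (15 * lam) * (151 / 100 * l) = 3037 * 151 / 100 * Real.exp (15 * lam) := by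
    field_simp
  have := Real.exp_pos (15 * lam)
  linarith

theorem card_large_le (hε : ε ≤ 1 / 100) {H l : ℝ} (hl : l = Real.log ((2 * H + 30) / 6)) (hl20 : 20 ≤ l)
    (hH : 0 ≤ H) (hK : H + 2 < K) {lam : ℝ} (hlam : 0 ≤ lam) (hlam1 : lam ≤ l / 60) (J : Finset Z.ι)
    (hJ : ∀ i ∈ J, 3 * Real.exp (7 * lam) ≤ |(Z.ρ i).im| ∧ |(Z.ρ i).im| ≤ H ∧ 1 - (Z.ρ i).re ≤ lam / l) :
    (J.card : ℝ) ≤ 10 ^ 8 * Real.exp (15 * lam) := by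
  have hl0 : 0 < l := by linarith
  have hlaml : lam / l ≤ 1 / 60 := by
    rw [div_le_iff₀ hl0]
    linarith
  have h1 := card_sq_le_sum_haloSum hl20 J Z.ρ fun i hi ↦ by
    obtain ⟨h1, h2, h3⟩ := hJ i hi
    refine half_le_norm_sum_divisorSum hl hl20 hH (Z.zeta_eq_zero i) (by linarith) (Z.re_lt_one i) h2
      (le_trans ?_ h1)
    gcongr 3 * Real.exp ?_
    rw [mul_assoc]
    gcongr
    rwa [← le_div_iff₀' hl0]
  have h2 : ∑ j ∈ J, ∑ k ∈ J, ‖haloSum l (2 - Z.ρ j - starRingEnd ℂ (Z.ρ k))‖ ≤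
      J.card * ((4600 + 42 * Real.exp (-l) * J.card) * Real.exp (15 * lam)) := by
    refine (Finset.sum_le_card_nsmul _ _ _ fun j hj ↦ Z.sum_norm_haloSum_le hε hl hl20 hH hK hlam1 J
      (fun i hi ↦ ?_) hj).trans (nsmul_eq_mul _ _).le
    obtain ⟨h1, h2, h3⟩ := hJ i hi
    exact ⟨by linarith [Real.one_le_exp (by positivity : 0 ≤ 7 * lam)], h2, h3⟩
  have h3 : Real.exp (-l) * Real.exp (15 * lam) ≤ Real.exp (-15) := by
    rw [← Real.exp_add]
    exact Real.exp_le_exp.2 (by linarith)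
  have h4 : 16000 * 42 * Real.exp (-15) ≤ 1 / 4 := by
    rw [Real.exp_neg, ← div_eq_mul_inv, div_le_div_iff₀ (Real.exp_pos _) (by norm_num)]
    have : (2.7182818283 : ℝ) ^ 15 ≤ Real.exp 15 := by
      rw [show (15 : ℝ) = (15 : ℕ) * 1 by norm_num, Real.exp_nat_mul]
      gcongr
      exact Real.exp_one_gt_d9.le
    norm_num at this
    linarith
  rcases J.eq_empty_or_nonempty with rfl | hne
  · simp only [Finset.card_empty, Nat.cast_zero]
    positivity
  have hc : (0 : ℝ) < J.card := by exact_mod_cast hne.card_pos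
  set c : ℝ := (J.card : ℝ)
  set X := Real.exp (15 * lam) with hX
  have hX0 : 0 < X := Real.exp_pos _
  have h5 : c * c ≤ c * (16000 * ((4600 + 42 * Real.exp (-l) * c) * X)) := by nlinarith
  have h6 := le_of_mul_le_mul_left h5 hc
  have h7 : 16000 * 42 * (Real.exp (-l) * X) * c ≤ 1 / 4 * c := by
    gcongr
    linarith
  linarith

theorem card_small_le (hε : ε ≤ 1 / 100) (hK : 2 < K) {G : ℝ} (J : Finset Z.ι)
    (hJ : ∀ i ∈ J, |(Z.ρ i).im| ≤ G) : (J.card : ℝ) ≤ 2 + G ^ 2 := by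
  have h1 := Z.sumRe_add_le_zero hε (η := 1) one_pos le_rfl hK
  have h2 := Z.sum_le_sumRe (σ := 1 + 1) (by norm_num) 0 J
  have h3 := le_reLSeriesVonMangoldt_two
  rw [show (2 : ℝ) = 1 + 1 by norm_num] at h3
  have h4 : ∑ i ∈ J, 1 / (2 + G ^ 2) ≤ ∑ i ∈ J, (1 + 1 - (Z.ρ i).re) /
      ((1 + 1 - (Z.ρ i).re) ^ 2 + (0 - (Z.ρ i).im) ^ 2) := by
    refine Finset.sum_le_sum fun i hi ↦ ?_
    have h5 := Z.re_lt_one i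
    have h6 := Z.re_pos i
    have h7 : (Z.ρ i).im ^ 2 ≤ G ^ 2 := sq_le_sq' (by linarith [(abs_le.1 (hJ i hi)).1]) (abs_le.1 (hJ i hi)).2
    rw [div_le_div_iff₀ (by positivity) (by nlinarith)]
    nlinarith [sq_nonneg (Z.ρ i).im]
  rw [Finset.sum_const, nsmul_eq_mul, mul_one_div] at h4
  have h5 : (J.card : ℝ) / (2 + G ^ 2) ≤ 1 := by linarith
  rwa [div_le_one (by positivity)] at h5

/-- A log-free zero density estimate near the line `Re s = 1`. -/
theorem card_le (hε : ε ≤ 1 / 100) {H l : ℝ} (hl : l = Real.log ((2 * H + 30) / 6)) (hl20 : 20 ≤ l)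
    (hH : 0 ≤ H) (hK : H + 2 < K) {lam : ℝ} (hlam : 0 ≤ lam) (hlam1 : lam ≤ l / 60) (J : Finset Z.ι)
    (hJ : ∀ i ∈ J, |(Z.ρ i).im| ≤ H ∧ 1 - (Z.ρ i).re ≤ lam / l) :
    (J.card : ℝ) ≤ (10 ^ 8 + 11) * Real.exp (15 * lam) := by
  have h1 := Z.card_large_le hε hl hl20 hH hK hlam hlam1 (J.filter fun i ↦ 3 * Real.exp (7 * lam) ≤ |(Z.ρ i).im|)
    fun i hi ↦ by
      rw [Finset.mem_filter] at hi
      exact ⟨hi.2, hJ i hi.1⟩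
  have h2 := Z.card_small_le hε (by linarith) (G := 3 * Real.exp (7 * lam))
    (J.filter fun i ↦ ¬ 3 * Real.exp (7 * lam) ≤ |(Z.ρ i).im|) fun i hi ↦ by
      rw [Finset.mem_filter] at hi
      exact (not_le.1 hi.2).le
  have h3 : (3 * Real.exp (7 * lam)) ^ 2 ≤ 9 * Real.exp (15 * lam) := by
    rw [mul_pow, ← Real.exp_nat_mul]
    norm_num
    linarith
  have h4 : 1 ≤ Real.exp (15 * lam) := Real.one_le_exp (by positivity)
  rw [← Finset.card_filter_add_card_filter_not (s := J) (fun i ↦ 3 * Real.exp (7 * lam) ≤ |(Z.ρ i).im|)]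
  push_cast
  linarith

end ZetaZeros

namespace ZetaZeros
variable {K ε : ℝ} (Z : ZetaZeros K ε)

theorem sum_re_one_div_le {D : ℝ} (hD : 1 < D) (hDK : D < K) :
    ∑ i, (D - (Z.ρ i).re) / ((D - (Z.ρ i).re) ^ 2 + (Z.ρ i).im ^ 2) ≤
      1 / (D - 1) + (Real.log ((D + 2) / (2 * Real.pi)) / 2 + 1 / D) + ε := by
  have hD0 : 0 < D := by linarith
  have h1 := Z.sum_add_re_LSeries_le (s := (D : ℂ)) (by simpa) (by rwa [norm_real, Real.norm_of_nonneg hD0.le])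
  have h2 := re_digamma_half_le (s := (D : ℂ)) (by simpa)
  have h3 : ‖(D : ℂ) + 2‖ = D + 2 := by
    rw [show (D : ℂ) + 2 = ((D + 2 : ℝ) : ℂ) by push_cast; rfl, norm_real, Real.norm_of_nonneg (by positivity)]
  have h4 : (1 / ((D : ℂ) - 1)).re = 1 / (D - 1) := by
    rw [show 1 / ((D : ℂ) - 1) = ((1 / (D - 1) : ℝ) : ℂ) by push_cast; rfl, ofReal_re]
  have h5 : 0 ≤ (LSeries (fun n ↦ (Λ n : ℂ)) (D : ℂ)).re := by
    have := hasSum_re_LSeries_vonMangoldt hD 0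
    simp only [ofReal_zero, zero_mul, add_zero, Real.cos_zero, mul_one] at this
    exact this.nonneg fun n ↦ mul_nonneg vonMangoldt_nonneg (by positivity)
  rw [h3, ofReal_re, ofReal_im, abs_zero, zero_add] at h2
  rw [h4] at h1
  simp only [Z.re_one_div_sub, ofReal_re, ofReal_im, zero_sub, neg_sq] at h1
  linarith

theorem sum_one_div_one_add_le {D : ℝ} (hD : 1 < D) (hDK : D < K) :
    ∑ i, 1 / (1 + (Z.ρ i).im ^ 2 / D ^ 2) ≤
      D ^ 2 / (D - 1) * (1 / (D - 1) + (Real.log ((D + 2) / (2 * Real.pi)) / 2 + 1 / D) + ε) := by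
  have hD0 : 0 < D := by linarith
  refine le_trans ?_ (mul_le_mul_of_nonneg_left (Z.sum_re_one_div_le hD hDK) (div_nonneg (by positivity) (by linarith)))
  rw [Finset.mul_sum]
  refine Finset.sum_le_sum fun i _ ↦ ?_
  have h1 := Z.re_pos i
  have h2 := Z.re_lt_one i
  generalize (Z.ρ i).im = γ
  obtain ⟨r, hr⟩ : ∃ r, r = D - (Z.ρ i).re := ⟨_, rfl⟩
  rw [← hr]
  have hr0 : 0 < r := by linarith
  have h3 : D ^ 2 * ((D - 1) * (r ^ 2 + γ ^ 2)) ≤ D ^ 2 * (r * (D ^ 2 + γ ^ 2)) := by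
    refine mul_le_mul_of_nonneg_left ?_ (by positivity)
    refine mul_le_mul (by linarith) ?_ (by positivity) hr0.le
    nlinarith
  have h4 : 0 < D - 1 := by linarith
  calc 1 / (1 + γ ^ 2 / D ^ 2) = D ^ 2 / (D ^ 2 + γ ^ 2) := by field_simp
    _ ≤ (D ^ 2 * r) / ((D - 1) * (r ^ 2 + γ ^ 2)) := by
      rw [div_le_div_iff₀ (by positivity) (by positivity)]
      linarith
    _ = _ := by
      field_simp

/-- The number of zeros up to height of order `T = exp u`, in a smooth form. -/
theorem sum_one_div_one_add_exp_le (hε : ε ≤ 1 / 100) {u : ℝ} (hu : 2 ≤ u) (hK : 4 * Real.exp u + 3 < K) :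
    ∑ i, 1 / (1 + (Z.ρ i).im ^ 2 / (4 * Real.exp u + 3) ^ 2) ≤ 23 / 10 * Real.exp u * u := by
  have hT : (7.38 : ℝ) ≤ Real.exp u := by
    refine le_trans ?_ (Real.exp_le_exp.2 hu)
    rw [show (2 : ℝ) = (2 : ℕ) * 1 by norm_num, Real.exp_nat_mul]
    have := Real.exp_one_gt_d9
    nlinarith
  refine (Z.sum_one_div_one_add_le (by linarith) hK).trans ?_
  have hlog : Real.log ((4 * Real.exp u + 3 + 2) / (2 * Real.pi)) ≤ u - 25 / 100 := by
    have hpi := Real.pi_gt_d2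
    rw [Real.log_le_iff_le_exp (by positivity), Real.exp_sub, div_le_div_iff₀ (by positivity) (Real.exp_pos _)]
    have h1 : Real.exp (25 / 100) ≤ 1.29 := by
      have := Real.exp_bound_div_one_sub_of_interval (x := 25 / 100) (by norm_num) (by norm_num)
      have h2 : Real.exp (25 / 100) ^ 4 ≤ 1.29 ^ 4 := by
        rw [← Real.exp_nat_mul]
        norm_num
        exact Real.exp_one_lt_d9.le.trans (by norm_num)
      exact le_of_pow_le_pow_left₀ (by norm_num) (by norm_num) h2
    nlinarith
  generalize Real.exp u = T at *
  have h1 : 1 / (4 * T + 3 - 1) ≤ 318 / 10000 := by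
    rw [div_le_div_iff₀ (by linarith) (by norm_num)]
    linarith
  have h2 : 1 / (4 * T + 3) ≤ 308 / 10000 := by
    rw [div_le_div_iff₀ (by linarith) (by norm_num)]
    linarith
  have h3 : (4 * T + 3) ^ 2 / (4 * T + 3 - 1) ≤ 455 / 100 * T := by
    rw [div_le_iff₀ (by linarith)]
    nlinarith
  have h4 : 0 ≤ (4 * T + 3) ^ 2 / (4 * T + 3 - 1) := div_nonneg (by positivity) (by linarith)
  have h5 : 1 / (4 * T + 3 - 1) + (Real.log ((4 * T + 3 + 2) / (2 * Real.pi)) / 2 + 1 / (4 * T + 3)) + ε ≤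
      u / 2 - 425 / 10000 := by linarith
  have h6 := mul_le_mul_of_nonneg_left h5 h4
  have h7 := mul_le_mul_of_nonneg_right h3 (by linarith : 0 ≤ u / 2 - 425 / 10000)
  have h8 : 455 / 100 * T * (u / 2 - 425 / 10000) ≤ 23 / 10 * T * u := by nlinarith
  linarith

end ZetaZeros

theorem exp_le_one_add_pow {x : ℝ} (hx : 0 ≤ x) (n : ℕ) : Real.exp (n * (2 * x / (x + 2))) ≤ (1 + x) ^ n := by
  rw [Real.exp_nat_mul]
  refine pow_le_pow_left₀ (Real.exp_nonneg _) ?_ n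
  rw [← Real.le_log_iff_exp_le (by positivity)]
  exact Real.le_log_one_add_of_nonneg hx

/-- The dependence of the zero weights on the height. -/
noncomputable def heightDecay (m : ℕ) (v : ℝ) : ℝ := (1 + v / 5) / (1 + v / (8 * m)) ^ (4 * m)

theorem one_add_div_le_pow {m : ℕ} (hm : 1 ≤ m) {v : ℝ} (hv : 0 ≤ v) :
    (1 + v / 8) ^ 4 ≤ (1 + v / (8 * m)) ^ (4 * m) := by
  have hm0 : (0 : ℝ) < m := by exact_mod_cast hm
  have h0 : 0 ≤ v / (8 * m) := by positivity
  have h := one_add_mul_le_pow (a := v / (8 * m)) (by linarith) m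
  rw [mul_comm 4 m, pow_mul]
  refine pow_le_pow_left₀ (by positivity) (le_trans (le_of_eq ?_) h) 4
  field_simp

theorem heightDecay_le_one {m : ℕ} (hm : 1 ≤ m) {v : ℝ} (hv : 0 ≤ v) : heightDecay m v ≤ 1 := by
  have h := one_add_div_le_pow hm hv
  rw [heightDecay, div_le_one (by positivity)]
  refine le_trans ?_ h
  nlinarith [pow_nonneg hv 2, pow_nonneg hv 3, pow_nonneg hv 4]

theorem heightDecay_le_two_div {m : ℕ} (hm : 1 ≤ m) {v : ℝ} (hv : 0 ≤ v) : heightDecay m v ≤ 2 / (1 + v) := by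
  have h := one_add_div_le_pow hm hv
  rw [heightDecay, div_le_div_iff₀ (by positivity) (by positivity)]
  refine le_trans ?_ (mul_le_mul_of_nonneg_left h (by norm_num))
  nlinarith [pow_nonneg hv 2, pow_nonneg hv 3, pow_nonneg hv 4, sq_nonneg (v - 4), mul_nonneg hv (sq_nonneg (v - 4))]

theorem heightDecay_le_of_le {m : ℕ} {v₀ v : ℝ} (hv0 : 26 ≤ v₀) (hm : v₀ ≤ m) (hv : v₀ ≤ v) :
    heightDecay m v ≤ (1 + v₀) * (1 + v₀ / 5) * Real.exp (v₀ ^ 2 / (32 * m) - v₀ / 2) / (1 + v) := by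
  have hm0 : (0 : ℝ) < m := by linarith
  obtain ⟨g, hg⟩ : ∃ g, g = v₀ / (8 * m) := ⟨_, rfl⟩
  obtain ⟨h, hh⟩ : ∃ h, h = (v - v₀) / (8 * m) / (1 + g) := ⟨_, rfl⟩
  have hg0 : 0 ≤ g := by rw [hg]; positivity
  have hg1 : g ≤ 1 := by
    rw [hg, div_le_one (by positivity)]
    linarith
  have hh0 : 0 ≤ h := by
    rw [hh]
    exact div_nonneg (div_nonneg (by linarith) (by positivity)) (by linarith)
  have e1 : 1 + v / (8 * m) = (1 + g) * (1 + h) := by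
    rw [hh, mul_add, mul_div_cancel₀ _ (by positivity), hg]
    field_simp
    ring
  have e2 : v = v₀ + 8 * m * (1 + g) * h := by
    rw [hh]
    field_simp
    ring
  have h1 : Real.exp (v₀ / 2 - v₀ ^ 2 / (32 * m)) ≤ (1 + g) ^ (4 * m) := by
    refine le_trans (Real.exp_le_exp.2 ?_) (exp_le_one_add_pow hg0 (4 * m))
    have e3 : v₀ = 8 * m * g := by
      rw [hg]
      field_simp
    have e4 : v₀ / 2 - v₀ ^ 2 / (32 * m) = 4 * m * (g * (1 - g / 2)) := by
      rw [e3]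
      field_simp
      ring
    rw [e4]
    push_cast
    refine mul_le_mul_of_nonneg_left ?_ (by positivity)
    rw [le_div_iff₀ (by positivity)]
    nlinarith [mul_nonneg hg0 (sq_nonneg g)]
  have h2 : 1 + m * h ≤ (1 + h) ^ m := one_add_mul_le_pow (by linarith) m
  have hmh : 0 ≤ m * h := by positivity
  have h3 : (1 + m * h) ^ 2 ≤ (1 + h) ^ (4 * m) := by
    calc (1 + m * h) ^ 2 ≤ (1 + m * h) ^ 4 := pow_le_pow_right₀ (by linarith) (by norm_num)
      _ ≤ ((1 + h) ^ m) ^ 4 := pow_le_pow_left₀ (by positivity) h2 4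
      _ = _ := by rw [← pow_mul, mul_comm]
  have h4 : (1 + v / 5) * (1 + v) ≤ (1 + v₀) * (1 + v₀ / 5) * (1 + m * h) ^ 2 := by
    have h5 : v - v₀ ≤ 16 * (m * h) := by
      rw [e2]
      nlinarith
    have h6 : 1 + v ≤ (1 + v₀) * (1 + m * h) := by nlinarith
    have h7 : 1 + v / 5 ≤ (1 + v₀ / 5) * (1 + m * h) := by nlinarith
    calc (1 + v / 5) * (1 + v) ≤ ((1 + v₀ / 5) * (1 + m * h)) * ((1 + v₀) * (1 + m * h)) :=
          mul_le_mul h7 h6 (by linarith) (by positivity)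
      _ = _ := by ring
  have hE := Real.exp_pos (v₀ / 2 - v₀ ^ 2 / (32 * m))
  rw [heightDecay, e1, mul_pow, div_le_div_iff₀ (by positivity) (by linarith)]
  have e5 : Real.exp (v₀ ^ 2 / (32 * m) - v₀ / 2) * Real.exp (v₀ / 2 - v₀ ^ 2 / (32 * m)) = 1 := by
    rw [← Real.exp_add, ← Real.exp_zero]
    ring_nf
  calc _ ≤ (1 + v₀) * (1 + v₀ / 5) * (1 + m * h) ^ 2 := h4
    _ = (1 + v₀) * (1 + v₀ / 5) * Real.exp (v₀ ^ 2 / (32 * m) - v₀ / 2) *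
        (Real.exp (v₀ / 2 - v₀ ^ 2 / (32 * m)) * (1 + m * h) ^ 2) := by
      linear_combination (-(1 + v₀) * (1 + v₀ / 5) * (1 + m * h) ^ 2) * e5
    _ ≤ _ := by
      refine mul_le_mul_of_nonneg_left ?_ (by positivity)
      exact mul_le_mul h1 h3 (by positivity) (by positivity)

theorem div_add_pow_le_exp {M b L : ℝ} (hM : 0 < M) (hb : 0 ≤ b) (n : ℕ) (hL : L * (2 * M + b) ≤ 2 * n) :
    (M / (M + b)) ^ n ≤ Real.exp (-(L * b)) := by
  have h1 := exp_le_one_add_pow (x := b / M) (by positivity) n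
  have e1 : (M / (M + b)) ^ n = ((1 + b / M) ^ n)⁻¹ := by
    rw [← inv_pow]
    congr 1
    field_simp
  rw [e1, Real.exp_neg]
  refine inv_anti₀ (Real.exp_pos _) (le_trans (Real.exp_le_exp.2 ?_) h1)
  have e2 : n * (2 * (b / M) / (b / M + 2)) = 2 * n * b / (2 * M + b) := by
    field_simp
    ring
  rw [e2, le_div_iff₀ (by positivity)]
  nlinarith

theorem zeroWeight_le {M : ℝ} (hM : 0 < M) {m : ℕ} (hmM : 200 * m ≤ M ^ 2) {ρ : ℂ} (h0 : 0 < ρ.re)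
    (h1 : ρ.re < 1) :
    (M / ‖(1 + M : ℂ) - ρ‖) ^ (8 * m) * (5 / 4 + 8 * m / 4 * (‖1 - ρ‖ / ‖(1 + M : ℂ) - ρ‖) ^ 2) ≤
      126 / 100 * ((M / (M + (1 - ρ.re))) ^ (8 * m) * heightDecay m (8 * m * ρ.im ^ 2 / (M + (1 - ρ.re)) ^ 2)) := by
  obtain ⟨b, hb⟩ : ∃ b, b = 1 - ρ.re := ⟨_, rfl⟩
  have hb0 : 0 < b := by linarith
  rw [← hb]
  have e1 : ‖(1 + M : ℂ) - ρ‖ ^ 2 = (M + b) ^ 2 + ρ.im ^ 2 := by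
    rw [← Complex.normSq_eq_norm_sq, Complex.normSq_apply, hb]
    simp
    ring
  have e2 : ‖1 - ρ‖ ^ 2 = b ^ 2 + ρ.im ^ 2 := by
    rw [← Complex.normSq_eq_norm_sq, Complex.normSq_apply, hb]
    simp
    ring
  rw [show 8 * m = 2 * (4 * m) by ring, pow_mul (M / ‖(1 + M : ℂ) - ρ‖), div_pow M, div_pow ‖1 - ρ‖, e1, e2]
  generalize ρ.im = γ
  obtain ⟨g, hg⟩ : ∃ g, g = γ ^ 2 / (M + b) ^ 2 := ⟨_, rfl⟩
  have hg0 : 0 ≤ g := by rw [hg]; positivity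
  have hMb : 0 < M + b := by positivity
  have e3 : (M + b) ^ 2 + γ ^ 2 = (M + b) ^ 2 * (1 + g) := by
    rw [hg]
    field_simp
  have hm0 : (0 : ℝ) ≤ m := m.cast_nonneg
  have h3 : 5 / 4 + 8 * m / 4 * ((b ^ 2 + γ ^ 2) / ((M + b) ^ 2 + γ ^ 2)) ≤ 126 / 100 * (1 + 8 * m * g / 5) := by
    have h4 : (b ^ 2 + γ ^ 2) / ((M + b) ^ 2 + γ ^ 2) ≤ 1 / M ^ 2 + g := by
      calc (b ^ 2 + γ ^ 2) / ((M + b) ^ 2 + γ ^ 2) ≤ (1 + γ ^ 2) / (M + b) ^ 2 := by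
            gcongr
            · nlinarith
            · nlinarith [sq_nonneg γ]
        _ = 1 / (M + b) ^ 2 + g := by rw [hg, add_div]
        _ ≤ _ := by gcongr; linarith
    have h5 : 2 * m * (1 / M ^ 2) ≤ 1 / 100 := by
      rw [mul_one_div, div_le_div_iff₀ (by positivity) (by norm_num)]
      linarith
    have h6 := mul_le_mul_of_nonneg_left h4 (by positivity : 0 ≤ 2 * (m : ℝ))
    have h7 : 0 ≤ m * g := by positivity
    linarith
  have e4 : (M ^ 2 / ((M + b) ^ 2 + γ ^ 2)) ^ (4 * m) = (M / (M + b)) ^ (2 * (4 * m)) / (1 + g) ^ (4 * m) := by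
    rw [e3, pow_mul (M / (M + b)), ← div_pow]
    congr 1
    field_simp
  rw [e4, heightDecay]
  have e5 : 1 + 8 * m * γ ^ 2 / (M + b) ^ 2 / 5 = 1 + 8 * m * g / 5 := by
    rw [hg]
    ring
  rcases Nat.eq_zero_or_pos m with rfl | hmp
  · norm_num
  have hmp' : (0 : ℝ) < m := by exact_mod_cast hmp
  have e6 : 1 + 8 * m * γ ^ 2 / (M + b) ^ 2 / (8 * m) = 1 + g := by
    rw [hg]
    field_simp
  rw [e5, e6]
  refine (mul_le_mul_of_nonneg_left h3 (by positivity)).trans (le_of_eq ?_)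
  ring

theorem exp_neg_le_inv_pow {a : ℝ} (n : ℕ) (h : (n : ℝ) ≤ a) : Real.exp (-a) ≤ (1 / 2) ^ n := by
  have h2 : Real.exp (-1) ≤ 1 / 2 := by
    rw [Real.exp_neg, inv_le_comm₀ (Real.exp_pos _) (by norm_num)]
    linarith [Real.exp_one_gt_d9]
  calc Real.exp (-a) ≤ Real.exp (n * (-1)) := Real.exp_le_exp.2 (by linarith)
    _ = Real.exp (-1) ^ n := Real.exp_nat_mul _ _
    _ ≤ _ := pow_le_pow_left₀ (Real.exp_nonneg _) h2 n

set_option maxHeartbeats 1000000 in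
/-- The parameters of the window functional used for the interval `[x, x + x / T]`, `T = x ^ (1 / 106)`. -/
theorem exists_window_parameters {x L T : ℝ} (hx : 0 < x) (hL : L = Real.log x) (hL212 : 212 ≤ L)
    (hT : T = Real.exp (L / 106)) :
    ∃ (m : ℕ) (M : ℝ), 0 < M ∧ 100 * L ^ 2 ≤ m ∧ 200 * m ≤ M ^ 2 ∧
      M * L ≤ 8 * m - 2 * √(8 * m) ∧ 8 * m + 2 * √(8 * m) ≤ M * Real.log (x * (1 + 1 / T)) ∧
      (M + 1) ^ 2 ≤ 8 * m * (4 * T + 3) ^ 2 ∧ L * (2 * M + 1) ≤ 2 * (8 * m) ∧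
      M * (M + 6) * (8 * m + 2) * (M / (M + 2)) ^ (8 * m - 1) ≤ 1 / 1000 ∧
      M / x * (2 * √(x * (1 + 1 / T)) * Real.log (x * (1 + 1 / T))) ≤ 1 / 1000 := by
  have hT7 : 7 ≤ T := by
    have h1 : Real.exp 2 ≤ T := by
      rw [hT]
      exact Real.exp_le_exp.2 (by linarith)
    have h2 : Real.exp 2 = Real.exp 1 ^ 2 := by
      rw [← Real.exp_nat_mul]
      norm_num
    nlinarith [Real.exp_one_gt_d9]
  obtain ⟨D, hD⟩ : ∃ D, D = 4 * T + 2 := ⟨_, rfl⟩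
  have hD30 : 30 ≤ D := by linarith
  have hD5 : D ≤ 5 * T := by linarith
  obtain ⟨u, hu⟩ : ∃ u, u = L + 2 / D := ⟨_, rfl⟩
  have hD2 : 0 < 2 / D := by positivity
  have huD : (u - L) * D = 2 := by rw [hu]; field_simp; ring
  have huL : L < u := by linarith
  have hu2 : u ≤ 2 * L := by
    have : 2 / D ≤ 2 / 30 := by gcongr
    linarith
  have hu0 : 0 < u := by linarith
  obtain ⟨m, hm⟩ : ∃ m : ℕ, m = ⌈(u * D) ^ 2 / 8⌉₊ := ⟨_, rfl⟩
  obtain ⟨n, hn⟩ : ∃ n : ℝ, n = 8 * m := ⟨_, rfl⟩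
  have hn1 : (u * D) ^ 2 ≤ n := by
    have := Nat.le_ceil ((u * D) ^ 2 / 8)
    rw [← hm] at this
    linarith
  have hn2 : n ≤ (u * D) ^ 2 + 8 := by
    have := (Nat.ceil_lt_add_one (by positivity : 0 ≤ (u * D) ^ 2 / 8)).le
    rw [← hm] at this
    linarith
  have huD1 : 1000 ≤ u * D := le_trans (by norm_num) (mul_le_mul (hL212.trans huL.le) hD30 (by norm_num) hu0.le)
  have huD2 : (1000 : ℝ) ^ 2 ≤ (u * D) ^ 2 := pow_le_pow_left₀ (by norm_num) huD1 2
  have hn0 : 0 < n := by linarith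
  have hn3 : n ≤ 2 * (u * D) ^ 2 := by linarith
  have hsq : u * D ≤ √n := Real.le_sqrt_of_sq_le hn1
  have hsq2 : √n * √n = n := Real.mul_self_sqrt hn0.le
  obtain ⟨M, hM⟩ : ∃ M, M = n / u := ⟨_, rfl⟩
  have hMu : M * u = n := by rw [hM]; field_simp
  have hM0 : 0 < M := by rw [hM]; positivity
  have hMD : u * D ^ 2 ≤ M := by
    rw [hM, le_div_iff₀ hu0]
    linarith
  have hMD2 : M ≤ 2 * u * D ^ 2 := by
    rw [hM, div_le_iff₀ hu0]
    linarith
  -- the gain `M (u - L)` compared with `√n`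
  have hgain : 2 * √n ≤ M * (2 / D) := by
    rw [← mul_div_assoc, le_div_iff₀ (by positivity)]
    have h1 : √n * (u * D) ≤ √n * √n := mul_le_mul_of_nonneg_left hsq (Real.sqrt_nonneg n)
    have h2 : √n * D * u ≤ M * u := by linarith
    have := le_of_mul_le_mul_right h2 hu0
    linarith
  have hMuL : M * L = n - M * (2 / D) := by
    rw [← hMu, hu]
    ring
  have hLuD : L ≤ u * D := huL.le.trans (le_mul_of_one_le_right hu0.le (by linarith))
  have hLM : L * (2 * M + 2) ≤ 2 * n := by linarith
  have hlogT : 4 / D ≤ Real.log (1 + 1 / T) := by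
    refine le_trans (le_of_eq ?_) (Real.le_log_one_add_of_nonneg (by positivity))
    rw [hD]
    have : T ≠ 0 := by positivity
    field_simp
    ring
  have hlogy : Real.log (x * (1 + 1 / T)) = L + Real.log (1 + 1 / T) := by
    rw [Real.log_mul hx.ne' (by positivity), hL]
  have hTinv : 1 / T ≤ 1 := by
    rw [div_le_one (by linarith)]
    linarith
  have hlogy2 : Real.log (x * (1 + 1 / T)) ≤ 2 * L := by
    have := Real.log_le_sub_one_of_pos (by positivity : 0 < 1 + 1 / T)
    rw [hlogy]
    linarith
  have hLexp : L ≤ 10 * Real.exp (L / 10) := by linarith [Real.add_one_le_exp (L / 10)]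
  have hD6 : D ^ 2 ≤ 25 * Real.exp (L / 53) := by
    rw [show L / 53 = (2 : ℕ) * (L / 106) by push_cast; ring, Real.exp_nat_mul, ← hT]
    have := pow_le_pow_left₀ (by linarith) hD5 2
    linarith
  have huexp : u ≤ 20 * Real.exp (L / 10) := by linarith
  have hE1 := Real.exp_pos (L / 10)
  have hE2 := Real.exp_pos (L / 53)
  have hMexp : M ≤ 1000 * Real.exp (L / 8) := by
    calc M ≤ 2 * u * D ^ 2 := hMD2
      _ ≤ 2 * (20 * Real.exp (L / 10)) * (25 * Real.exp (L / 53)) := by gcongr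
      _ = 1000 * Real.exp (L / 10 + L / 53) := by rw [Real.exp_add]; ring
      _ ≤ _ := by
        gcongr
        linarith
  have hL1 : 1 ≤ Real.exp (L / 8) := Real.one_le_exp (by linarith)
  have hnexp : n ≤ 20000 * Real.exp (L / 4) := by
    calc n = M * u := hMu.symm
      _ ≤ 1000 * Real.exp (L / 8) * (20 * Real.exp (L / 10)) := by gcongr
      _ = 20000 * Real.exp (L / 8 + L / 10) := by rw [Real.exp_add]; ring
      _ ≤ _ := by
        gcongr
        linarith
  have hbase : (M / (M + 2)) ^ (8 * m - 1) ≤ 2 * Real.exp (-(2 * L)) := by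
    have h1 := div_add_pow_le_exp (b := 2) (L := L) hM0 (by norm_num) (8 * m) (by
      push_cast
      rw [← hn]
      linarith)
    have h2 : 0 < 8 * m := by
      have : (0 : ℝ) < 8 * m := by linarith
      exact_mod_cast this
    have h3 : (M / (M + 2)) ^ (8 * m) = (M / (M + 2)) ^ (8 * m - 1) * (M / (M + 2)) := by
      rw [← pow_succ]
      congr 1
      omega
    have h4 : 1 / 2 ≤ M / (M + 2) := by
      have h6 : 1 * D ^ 2 ≤ u * D ^ 2 := by
        gcongr
        linarith
      have h7 : (30 : ℝ) ^ 2 ≤ D ^ 2 := pow_le_pow_left₀ (by norm_num) hD30 2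
      rw [div_le_div_iff₀ (by norm_num) (by positivity)]
      linarith
    have h5 : 0 ≤ (M / (M + 2)) ^ (8 * m - 1) := by positivity
    have h6 := mul_le_mul_of_nonneg_left h4 h5
    rw [mul_comm 2 L]
    linarith
  refine ⟨m, M, hM0, ?_, ?_, ?_, ?_, ?_, ?_, ?_, ?_⟩
  · have h1 : L * 30 ≤ u * D := mul_le_mul huL.le hD30 (by norm_num) hu0.le
    have h2 : (L * 30) ^ 2 ≤ (u * D) ^ 2 := pow_le_pow_left₀ (by linarith) h1 2
    linarith [sq_nonneg L]
  · have h1 : 25 * u ^ 2 ≤ n := by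
      have : 30 ^ 2 * u ^ 2 ≤ (u * D) ^ 2 := by
        rw [mul_pow, mul_comm]
        gcongr
      linarith [sq_nonneg u]
    refine le_of_mul_le_mul_right ?_ (by positivity : 0 < u ^ 2)
    rw [← mul_pow, hMu]
    have := mul_le_mul_of_nonneg_left h1 hn0.le
    rw [show 200 * (m : ℝ) = 25 * n by rw [hn]; ring]
    linarith
  · rw [← hn]
    linarith
  · rw [← hn, hlogy]
    have : M * (4 / D) ≤ M * Real.log (1 + 1 / T) := by gcongr
    have e : M * (4 / D) = M * (2 / D) + M * (2 / D) := by ring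
    linarith
  · rw [← hn, show 4 * T + 3 = D + 1 by linarith]
    refine le_of_mul_le_mul_right ?_ (by positivity : 0 < u ^ 2)
    rw [← mul_pow, add_mul, hMu]
    have h1 : n * n ≤ n * ((u * D) ^ 2 + 8) := by gcongr
    have h2 : 0 ≤ n * u ^ 2 * (2 * D + 1 - 61) := by
      have : 0 ≤ 2 * D + 1 - 61 := by linarith
      positivity
    have h3 : 0 ≤ n * (u * (u - 212)) := by
      have : 0 ≤ u - 212 := by linarith
      positivity
    have h4 : u ^ 2 ≤ n * u ^ 2 := le_mul_of_one_le_left (by positivity) (by linarith)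
    have h5 : 8 * n ≤ n * u ^ 2 := by
      rw [mul_comm 8 n]
      gcongr
      have : (212 : ℝ) ^ 2 ≤ u ^ 2 := pow_le_pow_left₀ (by norm_num) (by linarith) 2
      linarith
    have h6 : 0 ≤ n * u ^ 2 := by positivity
    linarith
  · rw [← hn]
    linarith
  · rw [← hn]
    have h1 : M + 6 ≤ 1006 * Real.exp (L / 8) := by linarith
    have h2 : n + 2 ≤ 20002 * Real.exp (L / 4) := by
      have : 1 ≤ Real.exp (L / 4) := Real.one_le_exp (by linarith)
      linarith
    calc _ ≤ 1000 * Real.exp (L / 8) * (1006 * Real.exp (L / 8)) * (20002 * Real.exp (L / 4)) * (2 * Real.exp (-(2 * L))) := by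
          gcongr
      _ = 1000 * 1006 * 20002 * 2 * Real.exp (-(3 / 2 * L)) := by
        rw [show -(3 / 2 * L) = L / 8 + L / 8 + L / 4 + -(2 * L) by ring, Real.exp_add, Real.exp_add, Real.exp_add]
        ring
      _ ≤ 1000 * 1006 * 20002 * 2 * (1 / 2) ^ 200 := by
        gcongr
        exact exp_neg_le_inv_pow 200 (by push_cast; linarith)
      _ ≤ _ := by norm_num
  · have hxe : x = Real.exp (L / 2) * Real.exp (L / 2) := by
      rw [← Real.exp_add, hL, add_halves, Real.exp_log hx]
    have h1 : √(x * (1 + 1 / T)) ≤ 2 * Real.exp (L / 2) := by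
      refine Real.sqrt_le_iff.2 ⟨by positivity, ?_⟩
      rw [hxe]
      have h2 : 0 < Real.exp (L / 2) * Real.exp (L / 2) := by positivity
      have h3 := mul_le_mul_of_nonneg_left (by linarith : 1 + 1 / T ≤ 4) h2.le
      linarith
    calc _ ≤ 1000 * Real.exp (L / 8) / x * (2 * (2 * Real.exp (L / 2)) * (2 * (10 * Real.exp (L / 10)))) := by
          have h2 : Real.log (x * (1 + 1 / T)) ≤ 2 * (10 * Real.exp (L / 10)) := by linarith
          have h3 : 0 ≤ Real.log (x * (1 + 1 / T)) := by
            rw [hlogy]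
            have := Real.log_nonneg (by linarith [one_div_pos.2 (by linarith : 0 < T)] : 1 ≤ 1 + 1 / T)
            linarith
          gcongr
      _ = 80000 * Real.exp (-(11 / 40 * L)) := by
        have e : Real.exp (-(11 / 40 * L)) = Real.exp (L / 8) * Real.exp (L / 10) / Real.exp (L / 2) := by
          rw [← Real.exp_add, ← Real.exp_sub]
          congr 1
          ring
        rw [e, hxe]
        field_simp
        norm_num
      _ ≤ 80000 * (1 / 2) ^ 50 := by
        gcongr
        exact exp_neg_le_inv_pow 50 (by push_cast; linarith)
      _ ≤ _ := by norm_num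

section Layers
variable {ι : Type*} {f : ι → ℝ} {R : ℝ}

theorem sum_exp_neg_mul_le_card (hR : 0 ≤ R) {c : ℝ} {J : Finset ι} (hJ : ∀ i ∈ J, c ≤ f i) :
    ∑ i ∈ J, Real.exp (-(R * f i)) ≤ J.card * Real.exp (-(R * c)) := by
  refine (Finset.sum_le_card_nsmul _ _ _ fun i hi ↦ Real.exp_le_exp.2 ?_).trans (nsmul_eq_mul _ _).le
  exact neg_le_neg (mul_le_mul_of_nonneg_left (hJ i hi) hR)

theorem sum_exp_neg_mul_le_add_card (hR : 0 ≤ R) (c : ℝ) (J : Finset ι) :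
    ∑ i ∈ J, Real.exp (-(R * f i)) ≤ ∑ i ∈ J with f i ≤ c, Real.exp (-(R * f i)) +
      ((J.card : ℝ) - (J.filter fun i ↦ f i ≤ c).card) * Real.exp (-(R * c)) := by
  rw [← Finset.sum_filter_add_sum_filter_not J (fun i ↦ f i ≤ c), ← Finset.card_filter_add_card_filter_not (s := J) (fun i ↦ f i ≤ c)]
  push_cast
  rw [add_sub_cancel_left]
  refine add_le_add le_rfl (sum_exp_neg_mul_le_card hR fun i hi ↦ ?_)
  rw [Finset.mem_filter] at hi
  exact (not_le.1 hi.2).le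

theorem sum_exp_neg_mul_le_of_card_le (hR : 0 ≤ R) {J : Finset ι} (h0 : ∀ i ∈ J, 1 / 20 ≤ f i)
    (h1 : ((J.filter fun i ↦ f i ≤ 1 / 10).card : ℝ) ≤ 4) (h2 : ((J.filter fun i ↦ f i ≤ 1 / 5).card : ℝ) ≤ 16)
    (h3 : (J.card : ℝ) ≤ 217) :
    ∑ i ∈ J, Real.exp (-(R * f i)) ≤
      4 * Real.exp (-(R * (1 / 20))) + 12 * Real.exp (-(R * (1 / 10))) + 201 * Real.exp (-(R * (1 / 5))) := by
  have s1 := sum_exp_neg_mul_le_add_card (f := f) hR (1 / 5) J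
  have s2 := sum_exp_neg_mul_le_add_card (f := f) hR (1 / 10) (J.filter fun i ↦ f i ≤ 1 / 5)
  have e : (J.filter fun i ↦ f i ≤ 1 / 5).filter (fun i ↦ f i ≤ 1 / 10) = J.filter fun i ↦ f i ≤ 1 / 10 := by
    ext i
    simp only [Finset.mem_filter]
    exact ⟨fun h ↦ ⟨h.1.1, h.2⟩, fun h ↦ ⟨⟨h.1, by linarith [h.2]⟩, h.2⟩⟩
  rw [e] at s2
  have s3 := sum_exp_neg_mul_le_card (f := f) hR (c := 1 / 20) (J := J.filter fun i ↦ f i ≤ 1 / 10)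
    fun i hi ↦ h0 i (Finset.mem_filter.1 hi).1
  have m1 : Real.exp (-(R * (1 / 10))) ≤ Real.exp (-(R * (1 / 20))) := Real.exp_le_exp.2 (by linarith)
  have m2 : Real.exp (-(R * (1 / 5))) ≤ Real.exp (-(R * (1 / 10))) := Real.exp_le_exp.2 (by linarith)
  have m3 := Real.exp_pos (-(R * (1 / 5)))
  have t1 := mul_le_mul_of_nonneg_right h1 (sub_nonneg.2 m1)
  have t2 := mul_le_mul_of_nonneg_right h2 (sub_nonneg.2 m2)
  have t3 := mul_le_mul_of_nonneg_right h3 m3.le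
  linarith

/-- Summing over layers of width `1 / 50` when the counting function grows like `exp (15 t)`. -/
theorem sum_exp_neg_mul_le_of_card_le_exp (hR : 90 ≤ R) {J : Finset ι} {c C : ℝ} (hC : 0 ≤ C)
    (h0 : ∀ i ∈ J, c ≤ f i)
    (h1 : ∀ t, c ≤ t → ((J.filter fun i ↦ f i ≤ t).card : ℝ) ≤ C * Real.exp (15 * t)) :
    ∑ i ∈ J, Real.exp (-(R * f i)) ≤ 13 / 10 * (C * Real.exp (15 * (c + 1 / 50) - R * c)) := by
  obtain ⟨r, hr⟩ : ∃ r, r = Real.exp ((15 - R) / 50) := ⟨_, rfl⟩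
  have hr0 : 0 < r := hr ▸ Real.exp_pos _
  have hr1 : r ≤ 3 / 13 := by
    have h2 : r ≤ Real.exp (-1) * Real.exp (-(1 / 2)) := by
      rw [hr, ← Real.exp_add]
      exact Real.exp_le_exp.2 (by linarith)
    have h3 : Real.exp (-1) ≤ 10 / 27 := by
      rw [Real.exp_neg, inv_le_comm₀ (Real.exp_pos _) (by norm_num)]
      linarith [Real.exp_one_gt_d9]
    have h4 : Real.exp (-(1 / 2)) ≤ 61 / 100 := by
      refine le_of_pow_le_pow_left₀ two_ne_zero (by norm_num) ?_
      rw [← Real.exp_nat_mul]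
      norm_num
      linarith
    have := mul_le_mul h3 h4 (Real.exp_nonneg _) (by norm_num)
    linarith
  obtain ⟨j, hj⟩ : ∃ j : ι → ℕ, j = fun i ↦ ⌊(f i - c) * 50⌋₊ := ⟨_, rfl⟩
  obtain ⟨N, hN⟩ : ∃ N : ℕ, ∀ i ∈ J, j i < N :=
    ⟨J.sup j + 1, fun i hi ↦ Nat.lt_succ_of_le (Finset.le_sup hi)⟩
  rw [← Finset.sum_fiberwise_of_maps_to (t := Finset.range N) (g := j) fun i hi ↦ Finset.mem_range.2 (hN i hi)]
  have hterm : ∀ k ∈ Finset.range N, ∑ i ∈ J with j i = k, Real.exp (-(R * f i)) ≤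
      C * Real.exp (15 * (c + 1 / 50) - R * c) * r ^ k := by
    intro k _
    have hlow : ∀ i ∈ J.filter (fun i ↦ j i = k), c + k / 50 ≤ f i := by
      intro i hi
      rw [Finset.mem_filter] at hi
      have h2 := Nat.floor_le (a := (f i - c) * 50) (by linarith [h0 i hi.1])
      rw [← hi.2, hj]
      linarith
    have hsub : J.filter (fun i ↦ j i = k) ⊆ J.filter fun i ↦ f i ≤ c + (k + 1) / 50 := by
      intro i hi
      rw [Finset.mem_filter] at hi ⊢
      refine ⟨hi.1, ?_⟩
      have h2 := Nat.lt_floor_add_one ((f i - c) * 50)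
      rw [← hi.2, hj]
      linarith
    have hcard : ((J.filter fun i ↦ j i = k).card : ℝ) ≤ C * Real.exp (15 * (c + (k + 1) / 50)) :=
      le_trans (by exact_mod_cast Finset.card_le_card hsub) (h1 _ (by
        have : 0 ≤ ((k : ℝ) + 1) / 50 := by positivity
        linarith))
    refine (sum_exp_neg_mul_le_card (by linarith) hlow).trans
      ((mul_le_mul_of_nonneg_right hcard (Real.exp_nonneg _)).trans (le_of_eq ?_))
    rw [hr, ← Real.exp_nat_mul, mul_assoc, mul_assoc, ← Real.exp_add, ← Real.exp_add]
    congr 2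
    ring
  refine (Finset.sum_le_sum hterm).trans ?_
  rw [← Finset.mul_sum]
  have hgeom : ∑ k ∈ Finset.range N, r ^ k ≤ 13 / 10 := by
    refine (Summable.sum_le_tsum _ (fun k _ ↦ by positivity) (summable_geometric_of_lt_one hr0.le (by linarith))).trans ?_
    rw [tsum_geometric_of_lt_one hr0.le (by linarith), inv_le_comm₀ (by linarith) (by norm_num)]
    norm_num
    linarith
  have := mul_le_mul_of_nonneg_left hgeom (by positivity : 0 ≤ C * Real.exp (15 * (c + 1 / 50) - R * c))
  linarith

end Layers

namespace ZetaZeros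
variable {K ε : ℝ} (Z : ZetaZeros K ε)

theorem sum_exp_near_le (hε : ε ≤ 1 / 100) {H l : ℝ} (hl : l = Real.log ((2 * H + 30) / 6)) (hl4 : 4 ≤ l)
    (hK : 3 * H + 3 < K) {R : ℝ} (hR : 0 ≤ R) (J : Finset Z.ι)
    (hJ : ∀ i ∈ J, |(Z.ρ i).im| ≤ H ∧ (1 - (Z.ρ i).re) * l ≤ 27 / 100) :
    ∑ i ∈ J, Real.exp (-(R * ((1 - (Z.ρ i).re) * l))) ≤
      4 * Real.exp (-(R * (1 / 20))) + 12 * Real.exp (-(R * (1 / 10))) + 201 * Real.exp (-(R * (1 / 5))) := by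
  have hl0 : 0 < l := by linarith
  have key : ∀ {lam : ℝ} (J' : Finset Z.ι), (∀ i ∈ J', i ∈ J ∧ (1 - (Z.ρ i).re) * l ≤ lam) →
      ∀ i ∈ J', |(Z.ρ i).im| ≤ H ∧ 1 - (Z.ρ i).re ≤ lam / l := fun J' h i hi ↦
    ⟨(hJ i (h i hi).1).1, (le_div_iff₀ hl0).2 (h i hi).2⟩
  have h1 := Z.card_near_one_le hε hl hl4 hK (a := 1 / 5) (lam := 1 / 10) (by norm_num) (by norm_num) (by norm_num)
    (by norm_num) (by norm_num) (by norm_num) (J.filter fun i ↦ (1 - (Z.ρ i).re) * l ≤ 1 / 10)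
    (key _ fun i hi ↦ Finset.mem_filter.1 hi)
  have h2 := Z.card_near_one_le hε hl hl4 hK (a := 1 / 5) (lam := 1 / 5) (by norm_num) (by norm_num) (by norm_num)
    (by norm_num) (by norm_num) (by norm_num) (J.filter fun i ↦ (1 - (Z.ρ i).re) * l ≤ 1 / 5)
    (key _ fun i hi ↦ Finset.mem_filter.1 hi)
  have h3 := Z.card_near_one_le hε hl hl4 hK (a := 3 / 20) (lam := 27 / 100) (by norm_num) (by norm_num)
    (by norm_num) (by norm_num) (by norm_num) (by norm_num) J (key _ fun i hi ↦ ⟨hi, (hJ i hi).2⟩)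
  refine sum_exp_neg_mul_le_of_card_le hR (fun i hi ↦ ?_) ?_ ?_ ?_
  · have := Z.zero_free hε hl hl4 hK i (hJ i hi).1
    rw [div_le_iff₀ (by positivity)] at this
    linarith
  · have : (J.filter fun i ↦ (1 - (Z.ρ i).re) * l ≤ 1 / 10).card < 5 := by
      rify
      linarith
    exact_mod_cast Nat.lt_succ_iff.1 this
  · have : (J.filter fun i ↦ (1 - (Z.ρ i).re) * l ≤ 1 / 5).card < 17 := by
      rify
      linarith
    exact_mod_cast Nat.lt_succ_iff.1 this
  · have : J.card < 218 := by
      rify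
      linarith
    exact_mod_cast Nat.lt_succ_iff.1 this

theorem sum_exp_far_le (hε : ε ≤ 1 / 100) {H l : ℝ} (hl : l = Real.log ((2 * H + 30) / 6)) (hl20 : 20 ≤ l)
    (hH : 0 ≤ H) (hK : H + 2 < K) {R : ℝ} (hR : 90 ≤ R) (J : Finset Z.ι)
    (hJ : ∀ i ∈ J, |(Z.ρ i).im| ≤ H ∧ 27 / 100 ≤ (1 - (Z.ρ i).re) * l ∧ 1 - (Z.ρ i).re ≤ 1 / 60) :
    ∑ i ∈ J, Real.exp (-(R * ((1 - (Z.ρ i).re) * l))) ≤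
      13 / 10 * ((10 ^ 8 + 11) * Real.exp (15 * (27 / 100 + 1 / 50) - R * (27 / 100))) := by
  have hl0 : 0 < l := by linarith
  refine sum_exp_neg_mul_le_of_card_le_exp hR (by norm_num) (fun i hi ↦ (hJ i hi).2.1) fun t ht ↦ ?_
  refine (Z.card_le hε hl hl20 hH hK (lam := min t (l / 60)) (le_min (by linarith) (by positivity))
    (min_le_right _ _) _ fun i hi ↦ ?_).trans ?_
  · rw [Finset.mem_filter] at hi
    refine ⟨(hJ i hi.1).1, (le_div_iff₀ hl0).2 (le_min hi.2 ?_)⟩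
    have := mul_le_mul_of_nonneg_right (hJ i hi.1).2.2 hl0.le
    linarith
  · gcongr
    exact min_le_left _ _

end ZetaZeros

theorem exp_neg_natCast_le (n : ℕ) : Real.exp (-n) ≤ (10000 / 27182) ^ n := by
  rw [show -(n : ℝ) = n * (-1) by ring, Real.exp_nat_mul]
  refine pow_le_pow_left₀ (Real.exp_nonneg _) ?_ n
  rw [Real.exp_neg, inv_le_comm₀ (Real.exp_pos _) (by norm_num)]
  linarith [Real.exp_one_gt_d9]

theorem le_exp_of_two_le {u : ℝ} (hu : 2 ≤ u) : (738 / 100 : ℝ) ≤ Real.exp u := by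
  refine le_trans ?_ (Real.exp_le_exp.2 hu)
  rw [show (2 : ℝ) = (2 : ℕ) * 1 by norm_num, Real.exp_nat_mul]
  have := Real.exp_one_gt_d9
  nlinarith

theorem four_le_logHeight {u l : ℝ} (hu : 2 ≤ u)
    (hl : l = Real.log ((2 * ((4 * Real.exp u + 3) * (11 / 2 + u / 6)) + 30) / 6)) : 4 ≤ l := by
  have hT := le_exp_of_two_le hu
  rw [hl, Real.le_log_iff_exp_le (by positivity)]
  have h1 : Real.exp 4 ≤ 56 := by
    rw [show (4 : ℝ) = (4 : ℕ) * 1 by norm_num, Real.exp_nat_mul]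
    exact (pow_le_pow_left₀ (Real.exp_nonneg 1) Real.exp_one_lt_d9.le 4).trans (by norm_num)
  nlinarith

theorem logHeight_le {u l : ℝ} (hu : 2 ≤ u)
    (hl : l = Real.log ((2 * ((4 * Real.exp u + 3) * (11 / 2 + u / 6)) + 30) / 6)) : l ≤ 10223 / 10000 * u + 2195 / 1000 := by
  have hT := le_exp_of_two_le hu
  rw [hl, Real.log_le_iff_le_exp (by positivity)]
  have h1 : (1102 / 100 : ℝ) ≤ Real.exp (24 / 10) := by
    refine le_of_pow_le_pow_left₀ (n := 5) (by norm_num) (Real.exp_nonneg _) ?_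
    rw [← Real.exp_nat_mul, show ((5 : ℕ) : ℝ) * (24 / 10) = (12 : ℕ) * 1 by norm_num, Real.exp_nat_mul]
    exact le_trans (by norm_num) (pow_le_pow_left₀ (by norm_num) Real.exp_one_gt_d9.le 12)
  have h2 := Real.add_one_le_exp (223 / 10000 * u - 205 / 1000)
  have h3 : 1102 / 100 * (223 / 10000 * u - 205 / 1000 + 1) ≤ Real.exp (24 / 10) * Real.exp (223 / 10000 * u - 205 / 1000) :=
    mul_le_mul h1 h2 (by linarith) (Real.exp_nonneg _)
  rw [show 10223 / 10000 * u + 2195 / 1000 = u + (24 / 10 + (223 / 10000 * u - 205 / 1000)) by ring, Real.exp_add,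
    Real.exp_add (24 / 10)]
  refine le_trans ?_ (mul_le_mul_of_nonneg_left h3 (Real.exp_nonneg u))
  nlinarith

theorem twenty_le_logHeight {u l : ℝ} (hu : 2 ≤ u)
    (hl : l = Real.log ((2 * ((4 * Real.exp u + 3) * (11 / 2 + u / 6)) + 30) / 6)) (hu18 : 18 ≤ u) : 20 ≤ l := by
  rw [hl, Real.le_log_iff_exp_le (by positivity)]
  have h1 : Real.exp 20 ≤ 9 * Real.exp u := by
    have h2 : Real.exp 2 ≤ 9 := by
      rw [show (2 : ℝ) = (2 : ℕ) * 1 by norm_num, Real.exp_nat_mul]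
      exact (pow_le_pow_left₀ (Real.exp_nonneg 1) Real.exp_one_lt_d9.le 2).trans (by norm_num)
    rw [show (20 : ℝ) = 2 + 18 by norm_num, Real.exp_add]
    exact mul_le_mul h2 (Real.exp_le_exp.2 hu18) (Real.exp_nonneg _) (by norm_num)
  have := Real.exp_pos u
  nlinarith

theorem fifty_le_div_logHeight {u l : ℝ} (hu : 2 ≤ u)
    (hl : l = Real.log ((2 * ((4 * Real.exp u + 3) * (11 / 2 + u / 6)) + 30) / 6)) : 50 ≤ 106 * u / l := by
  rw [le_div_iff₀ (by linarith [four_le_logHeight hu hl])]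
  linarith [logHeight_le hu hl]

theorem ninetyTwo_le_div_logHeight {u l : ℝ} (hu : 2 ≤ u)
    (hl : l = Real.log ((2 * ((4 * Real.exp u + 3) * (11 / 2 + u / 6)) + 30) / 6)) (hu18 : 18 ≤ u) : 92 ≤ 106 * u / l := by
  rw [le_div_iff₀ (by linarith [four_le_logHeight hu hl])]
  linarith [logHeight_le hu hl]

theorem exp_mul_exp_neg_le {u l : ℝ} (hu : 2 ≤ u)
    (hl : l = Real.log ((2 * ((4 * Real.exp u + 3) * (11 / 2 + u / 6)) + 30) / 6)) (hu18 : u ≤ 18) :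
    Real.exp u * u * Real.exp (-(106 * u / l * (27 / 100))) ≤ 17 / 1000 := by
  have hl4 := four_le_logHeight hu hl
  have h1 : u + 7 ≤ 106 * u / l * (27 / 100) := by
    rw [div_mul_eq_mul_div, le_div_iff₀ (by linarith)]
    have := mul_le_mul_of_nonneg_left (logHeight_le hu hl) (by linarith : 0 ≤ u + 7)
    nlinarith
  have h2 : Real.exp (-(106 * u / l * (27 / 100))) ≤ Real.exp (-u) * Real.exp (-(7 : ℕ)) := by
    rw [← Real.exp_add]
    refine Real.exp_le_exp.2 ?_
    push_cast
    linarith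
  have h3 := exp_neg_natCast_le 7
  have e : Real.exp u * Real.exp (-u) = 1 := by rw [← Real.exp_add, add_neg_cancel, Real.exp_zero]
  calc _ ≤ Real.exp u * u * (Real.exp (-u) * Real.exp (-(7 : ℕ))) := by gcongr
    _ = u * Real.exp (-(7 : ℕ)) := by linear_combination (u * Real.exp (-(7 : ℕ))) * e
    _ ≤ 18 * (10000 / 27182) ^ 7 := by gcongr
    _ ≤ _ := by norm_num

theorem exp_mul_exp_neg_div_le {u : ℝ} (hu : 18 ≤ u) : Real.exp u * u * Real.exp (-(106 * u * (1 / 60))) ≤ 1 / 1000 := by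
  have h1 : u ≤ 4 * Real.exp (u / 4) := by linarith [Real.add_one_le_exp (u / 4)]
  have h2 := exp_neg_natCast_le 9
  calc _ ≤ Real.exp u * (4 * Real.exp (u / 4)) * Real.exp (-(106 * u * (1 / 60))) := by gcongr
    _ = 4 * Real.exp (u + u / 4 - 106 * u * (1 / 60)) := by
      rw [Real.exp_sub, Real.exp_add, Real.exp_neg]
      ring
    _ ≤ 4 * Real.exp (-(9 : ℕ)) := by
      gcongr
      push_cast
      linarith
    _ ≤ 4 * (10000 / 27182) ^ 9 := by gcongr
    _ ≤ _ := by norm_num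

theorem tail_height_le {u : ℝ} (hu : 2 ≤ u) {m : ℝ} (hm : 100 * (106 * u) ^ 2 ≤ m) :
    (1 + (12 / 5 * u + 26)) * (1 + (12 / 5 * u + 26) / 5) *
      Real.exp ((12 / 5 * u + 26) ^ 2 / (32 * m) - (12 / 5 * u + 26) / 2) * (23 / 10 * Real.exp u * u) ≤ 1 / 50 := by
  have hm0 : 0 < m := lt_of_lt_of_le (by positivity) hm
  have h1 : (12 / 5 * u + 26) ^ 2 / (32 * m) ≤ 1 / 100 := by
    rw [div_le_div_iff₀ (by positivity) (by norm_num)]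
    nlinarith
  have h2 : Real.exp ((12 / 5 * u + 26) ^ 2 / (32 * m) - (12 / 5 * u + 26) / 2) ≤
      Real.exp (1 / 100) * Real.exp (-(13 : ℕ)) * Real.exp (-u) * Real.exp (-(u / 5)) := by
    rw [← Real.exp_add, ← Real.exp_add, ← Real.exp_add]
    refine Real.exp_le_exp.2 ?_
    push_cast
    linarith
  have h3 : Real.exp (1 / 100) ≤ 102 / 100 := by
    have := Real.exp_bound_div_one_sub_of_interval (x := 1 / 100) (by norm_num) (by norm_num)
    linarith
  have h4 := exp_neg_natCast_le 13
  have h5 : (1 + u / 20) ^ 4 ≤ Real.exp (u / 5) := by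
    rw [show u / 5 = (4 : ℕ) * (u / 20) by push_cast; ring, Real.exp_nat_mul]
    refine pow_le_pow_left₀ (by positivity) ?_ 4
    linarith [Real.add_one_le_exp (u / 20)]
  have e : Real.exp (-u) * Real.exp u = 1 := by rw [← Real.exp_add, neg_add_cancel, Real.exp_zero]
  have e2 : Real.exp (-(u / 5)) = (Real.exp (u / 5))⁻¹ := Real.exp_neg _
  calc _ ≤ (1 + (12 / 5 * u + 26)) * (1 + (12 / 5 * u + 26) / 5) *
        (102 / 100 * (10000 / 27182) ^ 13 * Real.exp (-u) * Real.exp (-(u / 5))) * (23 / 10 * Real.exp u * u) := by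
        gcongr
        refine h2.trans ?_
        gcongr
    _ = (102 / 100 * (10000 / 27182) ^ 13 * (23 / 10)) * ((1 + (12 / 5 * u + 26)) * (1 + (12 / 5 * u + 26) / 5) * u) /
        Real.exp (u / 5) := by
      rw [e2]
      linear_combination (102 / 100 * (10000 / 27182) ^ 13 * (23 / 10) * ((1 + (12 / 5 * u + 26)) *
        (1 + (12 / 5 * u + 26) / 5) * u) * (Real.exp (u / 5))⁻¹) * e
    _ ≤ _ := by
      rw [div_le_iff₀ (Real.exp_pos _)]
      have h6 : (102 / 100 * (10000 / 27182) ^ 13 * (23 / 10) : ℝ) ≤ 531 / 10 ^ 8 := by norm_num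
      have h7 := mul_le_mul_of_nonneg_right h6 (by positivity :
        0 ≤ (1 + (12 / 5 * u + 26)) * (1 + (12 / 5 * u + 26) / 5) * u)
      have h8 : 0 ≤ u ^ 2 := by positivity
      have h9 : 0 ≤ u ^ 3 := by positivity
      have h10 : 0 ≤ u ^ 4 := by positivity
      nlinarith

theorem near_le_of_fifty_le {R : ℝ} (hR : 50 ≤ R) :
    4 * Real.exp (-(R * (1 / 20))) + 12 * Real.exp (-(R * (1 / 10))) + 201 * Real.exp (-(R * (1 / 5))) ≤ 42 / 100 := by
  have h1 : Real.exp (-(R * (1 / 20))) ≤ 821 / 10000 := by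
    refine (Real.exp_le_exp.2 (by linarith : -(R * (1 / 20)) ≤ -(5 / 2))).trans ?_
    refine le_of_pow_le_pow_left₀ two_ne_zero (by norm_num) ?_
    rw [← Real.exp_nat_mul, show ((2 : ℕ) : ℝ) * (-(5 / 2)) = -(5 : ℕ) by norm_num]
    exact (exp_neg_natCast_le 5).trans (by norm_num)
  have h2 : Real.exp (-(R * (1 / 10))) ≤ (10000 / 27182) ^ 5 :=
    (Real.exp_le_exp.2 (by push_cast; linarith)).trans (exp_neg_natCast_le 5)
  have h3 : Real.exp (-(R * (1 / 5))) ≤ (10000 / 27182) ^ 10 :=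
    (Real.exp_le_exp.2 (by push_cast; linarith)).trans (exp_neg_natCast_le 10)
  norm_num at h2 h3
  linarith

theorem near_add_far_le {R : ℝ} (hR : 92 ≤ R) :
    4 * Real.exp (-(R * (1 / 20))) + 12 * Real.exp (-(R * (1 / 10))) + 201 * Real.exp (-(R * (1 / 5))) +
      13 / 10 * ((10 ^ 8 + 11) * Real.exp (15 * (27 / 100 + 1 / 50) - R * (27 / 100))) ≤ 505 / 1000 := by
  have h1 : Real.exp (-(R * (1 / 20))) ≤ (10000 / 27182) ^ 4 :=
    (Real.exp_le_exp.2 (by push_cast; linarith)).trans (exp_neg_natCast_le 4)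
  have h2 : Real.exp (-(R * (1 / 10))) ≤ (10000 / 27182) ^ 9 :=
    (Real.exp_le_exp.2 (by push_cast; linarith)).trans (exp_neg_natCast_le 9)
  have h3 : Real.exp (-(R * (1 / 5))) ≤ (10000 / 27182) ^ 10 :=
    (Real.exp_le_exp.2 (by push_cast; linarith)).trans (exp_neg_natCast_le 10)
  have h4 : Real.exp (15 * (27 / 100 + 1 / 50) - R * (27 / 100)) ≤ (10000 / 27182) ^ 20 :=
    (Real.exp_le_exp.2 (by push_cast; linarith)).trans (exp_neg_natCast_le 20)
  norm_num at h1 h2 h3 h4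
  linarith

theorem heightDecay_le_mul_one_div {m : ℕ} {u D γ v H : ℝ} (hu : 2 ≤ u) (hD : 0 < D)
    (hH : H = D * (11 / 2 + u / 6)) (hm : 100 * (106 * u) ^ 2 ≤ m) (hv : γ ^ 2 / D ^ 2 ≤ v) (hγ : H < |γ|) :
    heightDecay m v ≤ (1 + (12 / 5 * u + 26)) * (1 + (12 / 5 * u + 26) / 5) *
      Real.exp ((12 / 5 * u + 26) ^ 2 / (32 * m) - (12 / 5 * u + 26) / 2) * (1 / (1 + γ ^ 2 / D ^ 2)) := by
  have h1 : (11 / 2 + u / 6) ^ 2 ≤ γ ^ 2 / D ^ 2 := by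
    rw [le_div_iff₀ (by positivity), ← mul_pow, ← sq_abs γ, mul_comm _ D, ← hH]
    exact pow_le_pow_left₀ (by rw [hH]; positivity) hγ.le 2
  have h2 : 12 / 5 * u + 26 ≤ γ ^ 2 / D ^ 2 := le_trans (by nlinarith [sq_nonneg (u - 17)]) h1
  refine (heightDecay_le_of_le (v₀ := 12 / 5 * u + 26) (by linarith) ?_ (h2.trans hv)).trans ?_
  · nlinarith
  · rw [mul_one_div]
    gcongr

namespace ZetaZeros
variable {K ε : ℝ} (Z : ZetaZeros K ε)

theorem sum_weights_le (hε : ε ≤ 1 / 100) {u H : ℝ} (hu : 2 ≤ u)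
    (hH : H = (4 * Real.exp u + 3) * (11 / 2 + u / 6)) (hK : 3 * H + 3 < K) {m : ℕ}
    (hm : 100 * (106 * u) ^ 2 ≤ m) (v : Z.ι → ℝ)
    (hv : ∀ i, (Z.ρ i).im ^ 2 / (4 * Real.exp u + 3) ^ 2 ≤ v i) :
    ∑ i, Real.exp (-(106 * u * (1 - (Z.ρ i).re))) * heightDecay m (v i) ≤ 57 / 100 := by
  obtain ⟨D, hD⟩ : ∃ D, D = 4 * Real.exp u + 3 := ⟨_, rfl⟩
  obtain ⟨l, hl⟩ : ∃ l, l = Real.log ((2 * H + 30) / 6) := ⟨_, rfl⟩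
  obtain ⟨R, hR⟩ : ∃ R, R = 106 * u / l := ⟨_, rfl⟩
  have hl' : l = Real.log ((2 * ((4 * Real.exp u + 3) * (11 / 2 + u / 6)) + 30) / 6) := by rw [hl, hH]
  have hl4 := four_le_logHeight hu hl'
  have hl0 : 0 < l := by linarith
  have hR50 := fifty_le_div_logHeight hu hl'
  have hRl : R * l = 106 * u := by rw [hR]; field_simp
  have hD0 : 0 < D := by rw [hD]; positivity
  have hDH : D ≤ H := by
    rw [hH, ← hD]
    nlinarith
  have hS := Z.sum_one_div_one_add_exp_le hε hu (by linarith : 4 * Real.exp u + 3 < K)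
  have htail := tail_height_le hu hm
  obtain ⟨C, hC⟩ : ∃ C, C = (1 + (12 / 5 * u + 26)) * (1 + (12 / 5 * u + 26) / 5) *
      Real.exp ((12 / 5 * u + 26) ^ 2 / (32 * m) - (12 / 5 * u + 26) / 2) := ⟨_, rfl⟩
  rw [← hD] at hS hv hH
  rw [← hC] at htail
  have hC0 : 0 ≤ C := by rw [hC]; positivity
  rw [← hR] at hR50
  have hm1 : 1 ≤ m := by
    have : (1 : ℝ) ≤ m := by nlinarith
    exact_mod_cast this
  have hv0 : ∀ i, 0 ≤ v i := fun i ↦ le_trans (by positivity) (hv i)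
  have ew : ∀ i, Real.exp (-(106 * u * (1 - (Z.ρ i).re))) = Real.exp (-(R * ((1 - (Z.ρ i).re) * l))) := fun i ↦ by
    rw [← hRl]
    ring_nf
  have hs0 : ∀ i, 0 ≤ 1 / (1 + (Z.ρ i).im ^ 2 / D ^ 2) := fun i ↦ by positivity
  have hfar : ∀ i, H < |(Z.ρ i).im| → Real.exp (-(106 * u * (1 - (Z.ρ i).re))) * heightDecay m (v i) ≤
      C * (1 / (1 + (Z.ρ i).im ^ 2 / D ^ 2)) := fun i hi ↦ by
    have h1 := heightDecay_le_mul_one_div hu hD0 hH hm (hv i) hi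
    rw [← hC] at h1
    have h2 : Real.exp (-(106 * u * (1 - (Z.ρ i).re))) ≤ 1 := by
      rw [Real.exp_le_one_iff]
      have := Z.re_lt_one i
      have : 0 ≤ 106 * u * (1 - (Z.ρ i).re) := by
        apply mul_nonneg <;> linarith
      linarith
    calc _ ≤ Real.exp (-(106 * u * (1 - (Z.ρ i).re))) * (C * (1 / (1 + (Z.ρ i).im ^ 2 / D ^ 2))) :=
          mul_le_mul_of_nonneg_left h1 (Real.exp_nonneg _)
      _ ≤ 1 * (C * (1 / (1 + (Z.ρ i).im ^ 2 / D ^ 2))) :=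
          mul_le_mul_of_nonneg_right h2 (mul_nonneg hC0 (hs0 i))
      _ = _ := one_mul _
  have hone : ∀ i, Real.exp (-(106 * u * (1 - (Z.ρ i).re))) * heightDecay m (v i) ≤
      Real.exp (-(R * ((1 - (Z.ρ i).re) * l))) := fun i ↦ by
    rw [ew]
    exact mul_le_of_le_one_right (Real.exp_nonneg _) (heightDecay_le_one hm1 (hv0 i))
  have hmid : ∀ i {c : ℝ}, Real.exp (-(106 * u * (1 - (Z.ρ i).re))) ≤ c →
      Real.exp (-(106 * u * (1 - (Z.ρ i).re))) * heightDecay m (v i) ≤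
        2 * c * (1 / (1 + (Z.ρ i).im ^ 2 / D ^ 2)) := fun i c hc ↦ by
    have h1 : heightDecay m (v i) ≤ 2 * (1 / (1 + (Z.ρ i).im ^ 2 / D ^ 2)) := by
      refine (heightDecay_le_two_div hm1 (hv0 i)).trans ?_
      rw [mul_one_div]
      refine div_le_div_of_nonneg_left (by norm_num) (by positivity) ?_
      linarith [hv i]
    calc _ ≤ Real.exp (-(106 * u * (1 - (Z.ρ i).re))) * (2 * (1 / (1 + (Z.ρ i).im ^ 2 / D ^ 2))) :=
          mul_le_mul_of_nonneg_left h1 (Real.exp_nonneg _)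
      _ ≤ c * (2 * (1 / (1 + (Z.ρ i).im ^ 2 / D ^ 2))) :=
          mul_le_mul_of_nonneg_right hc (mul_nonneg zero_le_two (hs0 i))
      _ = _ := by ring
  have hnear := Z.sum_exp_near_le hε hl hl4 hK (by linarith : 0 ≤ R)
    (Finset.univ.filter fun i ↦ |(Z.ρ i).im| ≤ H ∧ (1 - (Z.ρ i).re) * l ≤ 27 / 100)
    (fun i hi ↦ (Finset.mem_filter.1 hi).2)
  rw [Finset.sum_filter] at hnear
  rcases le_total u 18 with h18 | h18
  · have hc := exp_mul_exp_neg_le hu hl' h18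
    rw [← hR] at hc
    obtain ⟨c, hcd⟩ : ∃ c, c = Real.exp (-(R * (27 / 100))) := ⟨_, rfl⟩
    rw [← hcd] at hc
    have hc0 : 0 ≤ c := by rw [hcd]; positivity
    have hp : ∀ i, Real.exp (-(106 * u * (1 - (Z.ρ i).re))) * heightDecay m (v i) ≤
        (if |(Z.ρ i).im| ≤ H ∧ (1 - (Z.ρ i).re) * l ≤ 27 / 100 then
          Real.exp (-(R * ((1 - (Z.ρ i).re) * l))) else 0) + (C + 2 * c) * (1 / (1 + (Z.ρ i).im ^ 2 / D ^ 2)) := by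
      intro i
      have hs := hs0 i
      have hCs := mul_nonneg hC0 hs
      have hcs := mul_nonneg hc0 hs
      split_ifs with hi
      · linarith [hone i]
      · rcases lt_or_ge H |(Z.ρ i).im| with h | h
        · linarith [hfar i h]
        · have : 27 / 100 ≤ (1 - (Z.ρ i).re) * l := by
            by_contra hcon
            exact hi ⟨h, (not_le.1 hcon).le⟩
          have h2 : Real.exp (-(106 * u * (1 - (Z.ρ i).re))) ≤ c := by
            rw [ew, hcd]
            refine Real.exp_le_exp.2 (neg_le_neg (mul_le_mul_of_nonneg_left this (by linarith)))
          linarith [hmid i h2]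
    have h1 := Finset.sum_le_sum fun i (_ : i ∈ Finset.univ) ↦ hp i
    rw [Finset.sum_add_distrib, ← Finset.mul_sum] at h1
    have h2 := mul_le_mul_of_nonneg_left hS (by linarith : 0 ≤ C + 2 * c)
    have h3 := near_le_of_fifty_le hR50
    have h4 : (C + 2 * c) * (23 / 10 * Real.exp u * u) = C * (23 / 10 * Real.exp u * u) +
      46 / 10 * (Real.exp u * u * c) := by ring
    linarith
  · have hc := exp_mul_exp_neg_div_le h18
    have hl20 := twenty_le_logHeight hu hl' h18
    have hR92 := ninetyTwo_le_div_logHeight hu hl' h18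
    rw [← hR] at hR92
    have hfarsum := Z.sum_exp_far_le hε hl hl20 (by linarith) (by linarith) (by linarith : 90 ≤ R)
      (Finset.univ.filter fun i ↦ |(Z.ρ i).im| ≤ H ∧ 27 / 100 ≤ (1 - (Z.ρ i).re) * l ∧ 1 - (Z.ρ i).re ≤ 1 / 60)
      (fun i hi ↦ (Finset.mem_filter.1 hi).2)
    rw [Finset.sum_filter] at hfarsum
    obtain ⟨c, hcd⟩ : ∃ c, c = Real.exp (-(106 * u * (1 / 60))) := ⟨_, rfl⟩
    rw [← hcd] at hc
    have hc0 : 0 ≤ c := by rw [hcd]; positivity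
    have hp : ∀ i, Real.exp (-(106 * u * (1 - (Z.ρ i).re))) * heightDecay m (v i) ≤
        (if |(Z.ρ i).im| ≤ H ∧ (1 - (Z.ρ i).re) * l ≤ 27 / 100 then
          Real.exp (-(R * ((1 - (Z.ρ i).re) * l))) else 0) +
        (if |(Z.ρ i).im| ≤ H ∧ 27 / 100 ≤ (1 - (Z.ρ i).re) * l ∧ 1 - (Z.ρ i).re ≤ 1 / 60 then
          Real.exp (-(R * ((1 - (Z.ρ i).re) * l))) else 0) +
        (C + 2 * c) * (1 / (1 + (Z.ρ i).im ^ 2 / D ^ 2)) := by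
      intro i
      have hs := hs0 i
      have hCs := mul_nonneg hC0 hs
      have hcs := mul_nonneg hc0 hs
      have he := (Real.exp_pos (-(R * ((1 - (Z.ρ i).re) * l)))).le
      split_ifs with hi hj hj
      · linarith [hone i]
      · linarith [hone i]
      · linarith [hone i]
      · rcases lt_or_ge H |(Z.ρ i).im| with h | h
        · linarith [hfar i h]
        · have : 27 / 100 ≤ (1 - (Z.ρ i).re) * l := by
            by_contra hcon
            exact hi ⟨h, (not_le.1 hcon).le⟩
          have h3 : 1 / 60 ≤ 1 - (Z.ρ i).re := by
            by_contra hcon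
            exact hj ⟨h, this, (not_le.1 hcon).le⟩
          have h2 : Real.exp (-(106 * u * (1 - (Z.ρ i).re))) ≤ c := by
            rw [hcd]
            refine Real.exp_le_exp.2 (neg_le_neg (mul_le_mul_of_nonneg_left h3 (by linarith)))
          linarith [hmid i h2]
    have h1 := Finset.sum_le_sum fun i (_ : i ∈ Finset.univ) ↦ hp i
    rw [Finset.sum_add_distrib, Finset.sum_add_distrib, ← Finset.mul_sum] at h1
    have h2 := mul_le_mul_of_nonneg_left hS (by linarith : 0 ≤ C + 2 * c)
    have h3 := near_add_far_le hR92
    have h4 : (C + 2 * c) * (23 / 10 * Real.exp u * u) = C * (23 / 10 * Real.exp u * u) +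
      46 / 10 * (Real.exp u * u * c) := by ring
    linarith

end ZetaZeros

namespace ZetaZeros
variable {K ε : ℝ} (Z : ZetaZeros K ε)

theorem sum_zeroWeight_le (hε : ε ≤ 1 / 100) {L T M H : ℝ} (hL212 : 212 ≤ L) (hT : T = Real.exp (L / 106))
    (hM : 0 < M) {m : ℕ} (hm : 100 * L ^ 2 ≤ m) (hmM : 200 * m ≤ M ^ 2)
    (hMT : (M + 1) ^ 2 ≤ 8 * m * (4 * T + 3) ^ 2) (hLM : L * (2 * M + 1) ≤ 2 * (8 * m))
    (hH : H = (4 * T + 3) * (11 / 2 + L / 106 / 6)) (hK : 3 * H + 3 < K) :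
    ∑ i, (M / ‖(1 + M : ℂ) - Z.ρ i‖) ^ (8 * m) *
        (5 / 4 + 8 * m / 4 * (‖1 - Z.ρ i‖ / ‖(1 + M : ℂ) - Z.ρ i‖) ^ 2) ≤ 126 / 100 * (57 / 100) := by
  have hm1 : 1 ≤ m := by
    have : (1 : ℝ) ≤ m := by nlinarith
    exact_mod_cast this
  have hT0 : 0 < T := by rw [hT]; exact Real.exp_pos _
  have h := Z.sum_weights_le hε (u := L / 106) (by linarith) (by rw [hH, hT]) hK (m := m)
    (by rwa [mul_div_cancel₀ L (by norm_num : (106 : ℝ) ≠ 0)])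
    (fun i ↦ 8 * m * (Z.ρ i).im ^ 2 / (M + (1 - (Z.ρ i).re)) ^ 2) fun i ↦ by
      have h0 := Z.re_pos i
      have h1 := Z.re_lt_one i
      rw [← hT, div_le_div_iff₀ (by positivity) (by nlinarith)]
      have h2 : (M + (1 - (Z.ρ i).re)) ^ 2 ≤ (M + 1) ^ 2 := pow_le_pow_left₀ (by linarith) (by linarith) 2
      calc _ ≤ (Z.ρ i).im ^ 2 * (8 * m * (4 * T + 3) ^ 2) :=
            mul_le_mul_of_nonneg_left (h2.trans hMT) (sq_nonneg _)
        _ = _ := by ring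
  rw [mul_div_cancel₀ L (by norm_num : (106 : ℝ) ≠ 0)] at h
  refine le_trans ?_ (mul_le_mul_of_nonneg_left h (by norm_num))
  rw [Finset.mul_sum]
  refine Finset.sum_le_sum fun i _ ↦ ?_
  have h0 := Z.re_pos i
  have h1 := Z.re_lt_one i
  refine (zeroWeight_le hM hmM h0 h1).trans (mul_le_mul_of_nonneg_left ?_ (by norm_num))
  refine mul_le_mul_of_nonneg_right (div_add_pow_le_exp hM (by linarith) _ ?_) ?_
  · push_cast
    refine le_trans (mul_le_mul_of_nonneg_left ?_ (by linarith)) hLM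
    linarith
  · rw [heightDecay]
    positivity

end ZetaZeros

theorem exists_prime_of_le_log {x : ℝ} (hx : 1 ≤ x) (hL : 212 ≤ Real.log x) :
    ∃ p : ℕ, p.Prime ∧ x ≤ p ∧ (p : ℝ) ≤ x + x ^ (1 - 1 / 106 : ℝ) := by
  have hx0 : 0 < x := by linarith
  obtain ⟨L, hLd⟩ : ∃ L, L = Real.log x := ⟨_, rfl⟩
  obtain ⟨T, hT⟩ : ∃ T, T = Real.exp (L / 106) := ⟨_, rfl⟩
  have hT0 : 0 < T := by rw [hT]; exact Real.exp_pos _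
  rw [← hLd] at hL
  have hy : x + x ^ (1 - 1 / 106 : ℝ) = x * (1 + 1 / T) := by
    rw [Real.rpow_def_of_pos hx0, ← hLd, mul_sub, mul_one, Real.exp_sub, hLd, Real.exp_log hx0, ← hLd,
      mul_one_div, ← hT]
    ring
  obtain ⟨m, M, hM, hm, hmM, hMx, hMy, hMT, hLM, h1, h2⟩ := exists_window_parameters hx0 hLd hL hT
  by_contra! hcon
  obtain ⟨H, hH⟩ : ∃ H, H = (4 * T + 3) * (11 / 2 + L / 106 / 6) := ⟨_, rfl⟩
  have hH0 : 0 ≤ H := by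
    rw [hH]
    positivity
  obtain ⟨Z⟩ := ZetaZeros.nonempty (ε := 1 / 100) (K := 2 * M + 3 * H + 4) (by norm_num) (by linarith)
  have hm0 : (1 : ℝ) ≤ m := by nlinarith
  have hm1 : 1 ≤ m := by exact_mod_cast hm0
  obtain ⟨k, hk⟩ : ∃ k, 8 * m = k + 1 := ⟨8 * m - 1, by omega⟩
  have hk' : (k : ℝ) + 1 = 8 * m := by exact_mod_cast hk.symm
  have hk1 : 8 * m - 1 = k := by omega
  have h3 := Z.three_quarters_le le_rfl hM (by linarith) k hx (y := x * (1 + 1 / T))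
    (by
      rw [← hy]
      linarith [Real.rpow_nonneg hx0.le (1 - 1 / 106 : ℝ)])
    (by rwa [hk', ← hLd]) (by rwa [hk']) (fun p hp hxp ↦ by
      rw [← hy]
      exact not_le.2 (hcon p hp hxp))
  have h4 := Z.sum_zeroWeight_le le_rfl hL hT hM hm hmM hMT hLM hH (by linarith)
  rw [hk'] at h3
  rw [hk1, show (8 * m + 2 : ℝ) = k + 3 by linarith] at h1
  rw [hk] at h4
  linarith

/-- `iterSq p a n` is congruent to `a ^ 2 ^ n` modulo `p`. -/
def iterSq (p a : ℕ) : ℕ → ℕ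
  | 0 => a
  | n + 1 => Nat.mod (Nat.pow (iterSq p a n) 2) p

theorem iterSq_modEq (p a n : ℕ) : iterSq p a n ≡ a ^ 2 ^ n [MOD p] := by
  induction n with
  | zero => simp [iterSq, Nat.ModEq.refl]
  | succ n ih =>
    have h : iterSq p a (n + 1) = iterSq p a n ^ 2 % p := rfl
    rw [h, pow_succ 2 n, pow_mul]
    exact (Nat.mod_modEq _ _).trans (ih.pow 2)

/-- **Proth's theorem.** -/
theorem Nat.prime_of_pow_modEq {k n a : ℕ} (hk : 0 < k) (hkn : k < 2 ^ (n + 1))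
    (h : (a ^ k) ^ 2 ^ n ≡ k * 2 ^ (n + 1) [MOD k * 2 ^ (n + 1) + 1]) : (k * 2 ^ (n + 1) + 1).Prime := by
  obtain ⟨p, hp⟩ : ∃ p, p = k * 2 ^ (n + 1) + 1 := ⟨_, rfl⟩
  rw [← hp] at h ⊢
  have hp1 : 1 < p := by
    rw [hp]
    have := Nat.mul_pos hk (Nat.two_pow_pos (n + 1))
    omega
  by_contra hnp
  obtain ⟨q, hq, hqp, hqsq⟩ : ∃ q, q.Prime ∧ q ∣ p ∧ q ^ 2 ≤ p :=
    ⟨p.minFac, Nat.minFac_prime hp1.ne', Nat.minFac_dvd p, Nat.minFac_sq_le_self (by omega) hnp⟩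
  have : Fact q.Prime := ⟨hq⟩
  have hq2 : 2 < q := by
    refine lt_of_le_of_ne hq.two_le fun h2 ↦ ?_
    rw [← h2, hp, pow_succ, ← mul_assoc] at hqp
    omega
  have : Fact (2 < q) := ⟨hq2⟩
  have h1 : ((a : ZMod q) ^ k) ^ 2 ^ n = -1 := by
    have h2 := (ZMod.natCast_eq_natCast_iff _ _ _).2 (h.of_dvd hqp)
    have h3 := (ZMod.natCast_eq_zero_iff _ _).2 hqp
    have h4 : (p : ZMod q) = (k * 2 ^ (n + 1) : ℕ) + 1 := by
      rw [hp]
      push_cast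
      ring
    rw [← h2, h3] at h4
    push_cast at h4
    linear_combination -h4
  have h2 : orderOf ((a : ZMod q) ^ k) = 2 ^ (n + 1) := by
    refine orderOf_eq_prime_pow ?_ ?_
    · rw [h1]
      exact ZMod.neg_one_ne_one
    · rw [pow_succ 2 n, pow_mul, h1]
      norm_num
  have h3 : orderOf ((a : ZMod q) ^ k) ∣ q - 1 :=
    ZMod.orderOf_dvd_card_sub_one fun h0 ↦ by
      rw [h0, zero_pow (by positivity)] at h1
      exact one_ne_zero (neg_eq_zero.1 h1.symm)
  rw [h2] at h3
  have h4 : 2 ^ (n + 1) + 1 ≤ q := by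
    have := Nat.le_of_dvd (by omega) h3
    omega
  have h5 : p < 2 ^ (n + 1) * 2 ^ (n + 1) + 1 := by
    rw [hp]
    gcongr
  nlinarith

/-- Every real number in `[1, N]` has a prime at most `x ^ (1 - 1 / 106)` above it. -/
def PrimeGapsUpTo (N : ℕ) : Prop :=
  ∀ x : ℝ, 1 ≤ x → x ≤ N → ∃ p : ℕ, p.Prime ∧ x ≤ p ∧ (p : ℝ) ≤ x + x ^ (1 - 1 / 106 : ℝ)

theorem PrimeGapsUpTo.step {p q : ℕ} (h : PrimeGapsUpTo p) (hp : 1 ≤ p) (hq : q.Prime)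
    (hpq : (q - p) ^ 106 ≤ p ^ 105) : PrimeGapsUpTo q := by
  intro x hx hxq
  rcases le_or_gt x p with hxp | hxp
  · exact h x hx hxp
  refine ⟨q, hq, hxq, ?_⟩
  have hp1 : (1 : ℝ) ≤ p := by exact_mod_cast hp
  have h1 : ((q - p : ℕ) : ℝ) ≤ (p : ℝ) ^ (1 - 1 / 106 : ℝ) := by
    refine le_of_pow_le_pow_left₀ (n := 106) (by norm_num) (by positivity) ?_
    rw [← Real.rpow_natCast ((p : ℝ) ^ (1 - 1 / 106 : ℝ)), ← Real.rpow_mul (by positivity),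
      show (1 - 1 / 106 : ℝ) * (106 : ℕ) = (105 : ℕ) by norm_num, Real.rpow_natCast]
    exact_mod_cast hpq
  have h2 : (p : ℝ) ^ (1 - 1 / 106 : ℝ) ≤ x ^ (1 - 1 / 106 : ℝ) :=
    Real.rpow_le_rpow (by positivity) hxp.le (by norm_num)
  have h3 : (q : ℝ) ≤ (q - p : ℕ) + p := by
    exact_mod_cast (by omega : q ≤ q - p + p)
  linarith

theorem primeGapsUpTo_two : PrimeGapsUpTo 2 := fun x hx hx2 ↦
  ⟨2, Nat.prime_two, hx2, by
    have := Real.one_le_rpow hx (by norm_num : (0 : ℝ) ≤ 1 - 1 / 106)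
    push_cast
    linarith⟩

/-- Checks that the numbers `k * 2 ^ (n + 1) + 1` for `(k, n)` in the list are primes which, starting from `p`,
increase in sufficiently small steps to a number that is at least `N`. -/
def prothChain (N : ℕ) : ℕ → List (ℕ × ℕ) → Bool
  | p, [] => Nat.ble N p
  | p, (k, n) :: l =>
    Nat.blt 0 k && Nat.blt k (2 ^ (n + 1)) &&
      Nat.beq (iterSq (k * 2 ^ (n + 1) + 1) (3 ^ k) n) (k * 2 ^ (n + 1)) &&
      Nat.ble ((k * 2 ^ (n + 1) + 1 - p) ^ 106) (p ^ 105) && prothChain N (k * 2 ^ (n + 1) + 1) l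

theorem PrimeGapsUpTo.of_prothChain {N p : ℕ} (h : PrimeGapsUpTo p) (hp : 1 ≤ p) {l : List (ℕ × ℕ)}
    (hl : prothChain N p l = true) : PrimeGapsUpTo N := by
  induction l generalizing p with
  | nil =>
    have hN : N ≤ p := Nat.le_of_ble_eq_true hl
    exact fun x hx hxN ↦ h x hx (hxN.trans (by exact_mod_cast hN))
  | cons e l ih =>
    obtain ⟨k, n⟩ := e
    simp only [prothChain, Bool.and_eq_true] at hl
    obtain ⟨⟨⟨⟨h1, h2⟩, h3⟩, h4⟩, h5⟩ := hl
    refine ih (h.step hp (Nat.prime_of_pow_modEq (a := 3) ?_ ?_ ?_) (Nat.le_of_ble_eq_true h4)) (by omega) h5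
    · simpa [Nat.blt_eq] using h1
    · simpa [Nat.blt_eq] using h2
    · have := iterSq_modEq (k * 2 ^ (n + 1) + 1) (3 ^ k) n
      rw [Nat.eq_of_beq_eq_true h3] at this
      exact this.symm

/-- Exponent data of Proth primes whose successive ratios stay below `1 + p ^ (-1 / 106)` up to `2 ^ 306`. -/
def prothTable : List (ℕ × ℕ) :=
  [(1, 7), (7, 5), (5, 6), (19, 5), (25, 5), (43, 5), (35, 6), (31, 7), (55, 7), (25, 9), (181, 7),
   (85, 9), (5, 14), (289, 9), (17, 14), (497, 10), (233, 12), (1745, 10), (403, 13), (1493, 12),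
   (2771, 12), (5129, 12), (4717, 13), (8689, 13), (15955, 13), (7303, 15), (13321, 15), (3035, 18),
   (11035, 17), (10007, 18), (4511, 20), (16285, 19), (7303, 21), (13003, 21), (5815, 23), (10381, 23),
   (9221, 24), (8185, 25), (14527, 25), (3209, 28), (11317, 27), (623, 32), (2191, 31), (1919, 32),
   (13427, 30), (2923, 33), (10181, 32), (8785, 33), (15223, 33), (13175, 34), (5681, 36), (2441, 38),
   (2095, 39), (14323, 37), (12251, 38), (10423, 39), (8885, 40), (15089, 40), (1601, 44), (10835, 42),
   (565, 47), (15253, 43), (6409, 45), (10759, 45), (4513, 47), (15035, 46), (6263, 48), (5215, 49),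
   (8683, 49), (7175, 50), (11897, 50), (9841, 51), (16225, 51), (6667, 53), (1361, 56), (4393, 55),
   (899, 58), (11761, 55), (4795, 57), (15641, 56), (12643, 57), (5131, 59), (8323, 59), (13153, 59),
   (5305, 61), (529, 65), (6797, 62), (10925, 62), (8653, 63), (13867, 63), (5545, 65), (8857, 65),
   (13975, 65), (11081, 66), (4385, 68), (6923, 68), (683, 72), (8629, 69), (13585, 69), (5335, 71),
   (8275, 71), (6503, 72), (10145, 72), (15881, 72), (12373, 73), (4753, 75), (14801, 74), (5729, 76),
   (4459, 77), (6913, 77), (5315, 78), (4117, 79), (3185, 80), (9691, 79), (7451, 80), (713, 84),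
   (8689, 81), (13147, 81), (5041, 83), (15347, 82), (5849, 84), (8843, 84), (13379, 84), (9787, 85),
   (7415, 86), (701, 90), (8497, 87), (12853, 87), (9629, 88), (14429, 88), (1361, 92), (8177, 90),
   (12275, 90), (9205, 91), (3457, 93), (10313, 92), (15269, 92), (2815, 95), (8315, 94), (12407, 94),
   (4571, 96), (13573, 95), (10043, 96), (14825, 96), (10825, 97), (16003, 97), (5905, 99), (8713, 99),
   (1607, 102), (4729, 101), (6877, 101), (10015, 101), (14659, 101), (671, 106), (15575, 102),
   (11305, 103), (4027, 105), (1465, 107), (8455, 105), (6125, 106), (8837, 106), (6433, 107), (9277, 107),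
   (13345, 107), (4747, 109), (13763, 108), (9937, 109), (889, 113), (635, 114), (7303, 111), (2593, 113),
   (14887, 111), (10679, 112), (7675, 113), (10987, 113), (3937, 115), (11, 124), (15845, 114),
   (11293, 115), (15931, 115), (11, 126), (16055, 116), (11365, 117), (8057, 118), (11417, 118),
   (16127, 118), (11425, 119), (16165, 119), (5659, 121), (15929, 120), (5495, 122), (7679, 122),
   (677, 126), (15071, 122), (5243, 124), (1835, 126), (9899, 124), (13889, 124), (4811, 126),
   (13303, 125), (9305, 126), (13019, 126), (9073, 127), (12625, 127), (8789, 128), (3059, 130),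
   (8395, 129), (11017, 129), (15283, 129), (5245, 131), (1813, 133), (9991, 131), (13585, 131),
   (9209, 132), (1591, 135), (2197, 135), (12139, 133), (1039, 137), (5545, 135), (15275, 134),
   (1301, 138), (14215, 135), (593, 140), (3239, 138), (8857, 137), (6047, 138), (4057, 139), (11087, 138),
   (15059, 138), (10243, 139), (13945, 139), (9455, 140), (1603, 143), (8287, 141), (11227, 141),
   (15187, 141), (10241, 142), (13901, 142), (4685, 144), (12673, 143), (4129, 145), (695, 148),
   (15035, 144), (9937, 145), (13405, 145), (8981, 146), (11945, 146), (8047, 147), (5375, 148),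
   (1811, 150), (9503, 148), (12551, 148), (1055, 152), (2827, 151), (7589, 150), (2465, 152), (3245, 152),
   (8521, 151), (5639, 152), (1877, 154), (10043, 152), (13241, 152), (8455, 153), (1409, 156),
   (15007, 153), (1243, 157), (3305, 156), (8767, 155), (11665, 155), (15481, 155), (1261, 159),
   (13355, 156), (2197, 159), (5735, 158), (7589, 158), (10001, 158), (13211, 158), (8605, 159),
   (703, 163), (7433, 160), (611, 164), (3185, 162), (4157, 162), (10819, 161), (14215, 161), (9119, 162),
   (11855, 162), (7723, 163), (5063, 164), (13255, 163), (8573, 164), (1405, 167), (14645, 164),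
   (2395, 167), (12493, 165), (4051, 167), (10529, 166), (6841, 167), (1109, 170), (11485, 167),
   (14851, 167), (9659, 168), (12521, 168), (2017, 171), (10465, 169), (3331, 171), (8645, 170),
   (2789, 172), (7105, 171), (4493, 172), (2893, 173), (14827, 171), (9611, 172), (6199, 173),
   (15995, 172), (2521, 175), (6467, 174), (4141, 175), (10619, 174), (13691, 174), (8653, 175),
   (11041, 175), (14221, 175), (4579, 177), (5713, 177), (14705, 176), (9349, 177), (11905, 177),
   (15295, 177), (4891, 179), (12431, 178), (3959, 180), (10111, 179), (6455, 180), (8219, 180),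
   (2615, 182), (6649, 181), (8197, 181), (5135, 182), (6431, 182), (4087, 183), (5203, 183), (6643, 183),
   (8293, 183), (10393, 183), (6581, 184), (8375, 184), (5329, 185), (6757, 185), (133, 191), (10579, 185),
   (13399, 185), (8477, 186), (10535, 186), (13301, 186), (4169, 188), (163, 193), (13195, 187),
   (8333, 188), (5179, 189), (6553, 189), (8239, 189), (10285, 189), (1625, 192), (8015, 190), (4915, 191),
   (3101, 192), (481, 195), (4715, 192), (5795, 192), (907, 195), (1141, 195), (11183, 192), (13841, 192),
   (8707, 193), (5477, 194), (1721, 196), (8597, 194), (1345, 197), (13511, 194), (8335, 195), (5183, 196),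
   (6371, 196), (7973, 196), (9923, 196), (1537, 199), (3821, 198), (9553, 197), (5879, 198), (7331, 198),
   (1099, 201), (10919, 198), (6745, 199), (4151, 200), (2569, 201), (12757, 199), (1985, 202),
   (4795, 201), (5923, 201), (7225, 201), (8803, 201), (10945, 201), (13435, 201), (4075, 203),
   (9737, 202), (12077, 202), (7501, 203), (4631, 204), (11317, 203), (13945, 203), (2147, 206),
   (2639, 206), (12965, 204), (1981, 207), (9613, 205), (11893, 205), (7355, 206), (4447, 207),
   (5437, 207), (6721, 207), (127, 213), (9631, 207), (11857, 207), (14383, 207), (4315, 209), (5293, 209),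
   (12935, 208), (3947, 210), (9709, 209), (11569, 209), (1769, 212), (8231, 210), (9917, 210),
   (1519, 213), (7351, 211), (4475, 212), (2749, 213), (6755, 212), (4069, 213), (9119, 212), (5437, 213),
   (6517, 213), (15905, 212), (2347, 215), (5747, 214), (3511, 215), (8417, 214), (10061, 214),
   (5701, 215), (3485, 216), (8485, 215), (10351, 215), (395, 220), (15115, 215), (8969, 216),
   (10889, 216), (6619, 217), (2017, 219), (9673, 217), (5777, 218), (13987, 217), (8375, 218),
   (9935, 218), (3023, 220), (7333, 219), (4385, 220), (329, 224), (6233, 220), (7343, 220), (8723, 220),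
   (5239, 221), (12671, 220), (953, 224), (281, 226), (10837, 221), (13147, 221), (15943, 221),
   (9665, 222), (11255, 222), (3395, 224), (8053, 223), (9703, 223), (11755, 223), (14197, 223),
   (8591, 224), (5179, 225), (6157, 225), (14525, 224), (2125, 227), (10219, 225), (1535, 228),
   (14677, 225), (4105, 227), (9779, 226), (5587, 227), (1669, 229), (4019, 228), (9667, 227),
   (11281, 227), (1697, 230), (16261, 227), (9695, 228), (5707, 229), (13673, 228), (2017, 231),
   (9475, 229), (1421, 232), (6785, 230), (4003, 231), (4753, 231), (11345, 230), (3371, 232), (1007, 234),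
   (2413, 233), (11545, 231), (13801, 231), (3859, 233), (2309, 234), (11069, 232), (6385, 233),
   (15311, 232), (8995, 233), (10747, 233), (6389, 234), (7475, 234), (8891, 234), (5233, 235), (767, 238),
   (7315, 235), (8605, 235), (10207, 235), (3037, 237), (3613, 237), (4255, 237), (9959, 236),
   (11819, 236), (14003, 236), (7915, 237), (9433, 237), (5519, 238), (3283, 239), (3775, 239),
   (4483, 239), (10517, 238), (5941, 239), (14087, 238), (517, 243), (4781, 240), (691, 243), (13135, 239),
   (15523, 239), (9185, 240), (167, 246), (12425, 240), (14225, 240), (4097, 242), (2287, 243),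
   (10789, 241), (12727, 241), (467, 246), (8801, 242), (10409, 242), (3065, 244), (14429, 242),
   (8533, 243), (10093, 243), (11965, 243), (3517, 245), (8291, 244), (4897, 245), (11579, 244),
   (6799, 245), (16043, 244), (37, 253), (11137, 245), (6287, 246), (14749, 245), (8681, 246), (2543, 248),
   (11969, 246), (7063, 247), (8101, 247), (2359, 249), (5495, 248), (12973, 247), (7523, 248),
   (4297, 249), (10103, 248), (5809, 249), (3401, 250), (1993, 251), (8779, 249), (10189, 249),
   (11899, 249), (13993, 249), (3985, 251), (1129, 253), (659, 254), (12359, 250), (3611, 252),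
   (4241, 252), (607, 255), (11377, 251), (1661, 254), (485, 256), (8663, 252), (5065, 253), (11825, 252),
   (13859, 252), (15659, 252), (2245, 255), (637, 257), (11887, 253), (13597, 253), (7967, 254),
   (8639, 254), (10025, 254), (11699, 254), (6745, 255), (7855, 255), (1115, 258), (9907, 255),
   (11173, 255), (13081, 255), (7601, 256), (8873, 256), (5167, 257), (5875, 257), (1711, 259),
   (3917, 258), (9025, 257), (5027, 258), (1421, 260), (13057, 257), (14983, 257), (4273, 259), (611, 262),
   (2753, 260), (25, 267), (14561, 258), (2113, 261), (9457, 259), (10975, 259), (6389, 260), (14503, 259),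
   (8279, 260), (9455, 260), (5509, 261), (6397, 261), (3707, 262), (8635, 261), (299, 266), (11113, 261),
   (3235, 263), (14953, 261), (4333, 263), (5023, 263), (11189, 262), (6511, 263), (3779, 264),
   (8437, 263), (9637, 263), (697, 267), (3067, 265), (14101, 263), (7979, 264), (9149, 264), (2651, 266),
   (6097, 265), (13571, 264), (3935, 266), (9139, 265), (10609, 265), (11845, 265), (13729, 265),
   (15745, 265), (4351, 267), (9899, 266), (11351, 266), (13055, 266), (3689, 268), (4223, 268),
   (9427, 267), (10855, 267), (12571, 267), (7163, 268), (4099, 269), (1177, 271), (10313, 268),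
   (5953, 269), (13673, 268), (15779, 268), (8947, 269), (10225, 269), (11785, 269), (13429, 269),
   (3853, 271), (4423, 271), (1273, 273), (5845, 271), (1633, 273), (15065, 270), (8605, 271), (2365, 273),
   (10291, 271), (2953, 273), (3289, 273), (7445, 272), (8129, 272), (2291, 274), (5059, 273),
   (11441, 272), (12959, 272), (14759, 272), (257, 278), (2317, 275), (2671, 275), (5729, 274),
   (13069, 273), (14977, 273), (8399, 274), (9419, 274), (10685, 274), (11699, 274), (3359, 276),
   (14921, 274), (8155, 275), (9325, 275), (10693, 275), (6143, 276), (3529, 277), (16237, 275),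
   (8999, 276), (1273, 279), (11633, 276), (13151, 276), (3581, 278), (4019, 278), (8995, 277),
   (10207, 277), (175, 283), (3187, 279), (3625, 279), (8069, 278), (2213, 280), (5041, 279), (11447, 278),
   (13091, 278), (7447, 279), (8437, 279), (4805, 280), (10561, 279), (1499, 282), (6755, 280),
   (15373, 279), (8609, 280), (4873, 281), (10919, 280), (6049, 281), (427, 285), (15605, 280),
   (8869, 281), (9955, 281), (11329, 281), (12859, 281), (455, 286), (2081, 284), (9155, 282),
   (10385, 282), (5851, 283), (13307, 282), (59, 290), (1079, 286), (1187, 286), (2707, 285), (6149, 284),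
   (6941, 284), (15781, 283), (8783, 284), (1207, 287), (10811, 284), (6013, 285), (13631, 284),
   (3749, 286), (4259, 286), (9379, 285), (655, 289), (2965, 287), (13447, 285), (14989, 285), (2135, 288),
   (605, 290), (5467, 287), (12407, 286), (13931, 286), (7855, 287), (4451, 288), (2533, 289), (5639, 288),
   (12523, 287), (14005, 287), (15643, 287), (2207, 290), (4759, 289), (10109, 288), (5677, 289),
   (191, 294), (6769, 289), (15401, 288), (8539, 289), (9655, 289), (335, 294), (2911, 291), (13195, 289),
   (14899, 289), (2111, 292), (9059, 290), (10157, 290), (1423, 293), (12665, 290), (3479, 292),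
   (7867, 291), (1085, 294), (9745, 291), (5453, 292), (6173, 292), (13741, 291), (15547, 291),
   (2195, 294)]

theorem prothChain_prothTable : prothChain (2 ^ 306) 157 prothTable = true := by
  decide +kernel

theorem primeGapsUpTo_two_pow : PrimeGapsUpTo (2 ^ 306) := by
  have h3 := primeGapsUpTo_two.step (q := 3) (by norm_num) (by norm_num) (by norm_num)
  have h5 := h3.step (q := 5) (by norm_num) (by norm_num) (by norm_num)
  have h7 := h5.step (q := 7) (by norm_num) (by norm_num) (by norm_num)
  have h13 := h7.step (q := 13) (by norm_num) (by norm_num) (by norm_num)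
  have h23 := h13.step (q := 23) (by norm_num) (by norm_num) (by norm_num)
  have h43 := h23.step (q := 43) (by norm_num) (by norm_num) (by norm_num)
  have h83 := h43.step (q := 83) (by norm_num) (by norm_num) (by norm_num)
  have h157 := h83.step (q := 157) (by norm_num) (by norm_num) (by norm_num)
  exact h157.of_prothChain (by norm_num) prothChain_prothTable

theorem exists_prime_le_add_rpow {x : ℝ} (hx : 1 ≤ x) :
    ∃ p : ℕ, p.Prime ∧ x ≤ p ∧ (p : ℝ) ≤ x + x ^ (1 - 1 / 106 : ℝ) := by
  rcases le_total 212 (Real.log x) with h | h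
  · exact exists_prime_of_le_log hx h
  · refine primeGapsUpTo_two_pow x hx ?_
    rw [Nat.cast_pow, Nat.cast_ofNat, ← Real.log_le_log_iff (by linarith) (by positivity), Real.log_pow,
      Nat.cast_ofNat]
    linarith [Real.log_two_gt_d9]

end

/-- For every real `n ≥ 106` and every real `x ≥ 1`, the interval `[x, x + x^(1 - 1/n)]`
contains at least one prime. In particular this holds for `n = 250` (Heilbronn) and
`n = 33000` (Hoheisel). -/
theorem primes_in_short_intervals_effective (n x : ℝ) (hn : 106 ≤ n) (hx : 1 ≤ x) :
    ∃ p : ℕ, Nat.Prime p ∧ x ≤ (p : ℝ) ∧ (p : ℝ) ≤ x + x ^ (1 - 1 / n) := by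
  obtain ⟨p, hp, hxp, hpx⟩ := exists_prime_le_add_rpow hx
  refine ⟨p, hp, hxp, hpx.trans ?_⟩
  gcongr
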